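/- For every integer n ≥ 0, writing N_i = N(i,11,11n+1) and M_i = M(i,11,11n+1), the following hold: N_0 + 4N_2 + N_4 + M_0 ≥ 2N_1 + 3N_3 + N_5 + M_2; N_0 + 3N_1 + 6N_3 + M_0 ≥ 4N_2 + 6N_4 + M_2; 2N_1 + 6N_4 ≥ N_2 + 3N_3 + 4N_5; N_1 + 2N_2 + 3N_5 + 3M_2 ≥ N_0 + N_3 + 4N_4 + 2M_0 + M_1; and 3N_2 + 2N_3 + N_4 + 3M_2 ≥ N_0 + N_1 + 4N_5 + 2M_0 + M_1. -/

import Mathlib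

/-- `p n`: the number of partitions of `n`. -/
def partitionCount (n : ℕ) : ℕ := Fintype.card (Nat.Partition n)

/-- The rank of a partition: its largest part minus its number of parts
(the empty partition has rank 0). -/
def partitionRank {n : ℕ} (π : Nat.Partition n) : ℤ :=
  (π.parts.sup : ℤ) - (Multiset.card π.parts : ℤ)

/-- The crank of a partition `π`: if `π` has no parts equal to 1, it is the largest part;
otherwise it is (number of parts larger than the number of ones) − (number of ones). -/
def partitionCrank {n : ℕ} (π : Nat.Partition n) : ℤ :=
  if π.parts.count 1 = 0 then (π.parts.sup : ℤ)
  else ((π.parts.filter fun x => π.parts.count 1 < x).card : ℤ) - (π.parts.count 1 : ℤ)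

/-- `rankCount a r n` = `N(a,r,n)`: the number of partitions of `n` whose rank is
congruent to `a` modulo `r`. -/
def rankCount (a r : ℤ) (n : ℕ) : ℕ :=
  (Finset.univ.filter fun π : Nat.Partition n => partitionRank π % r = a % r).card

/-- `crankCount a n` = `M(a,11,n)`: for `n ≠ 1`, the number of partitions of `n` whose crank
is congruent to `a` modulo 11; at `n = 1` the standard convention `M(0,11,1) = −1`,
`M(1,11,1) = M(10,11,1) = 1`, and `M(a,11,1) = 0` otherwise. -/
def crankCount (a : ℤ) (n : ℕ) : ℤ :=
  if n = 1 then
    if a % 11 = 0 then -1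
    else if a % 11 = 1 ∨ a % 11 = 10 then 1
    else 0
  else ((Finset.univ.filter fun π : Nat.Partition n => partitionCrank π % 11 = a % 11).card : ℤ)

namespace RankCrank
open Filter Topology

/-- Gaussian sums over the integers converge absolutely. -/
theorem summable_norm_gauss {R w : ℂ} (hR0 : R ≠ 0) (hR : ‖R‖ < 1) (hw : w ≠ 0) :
    Summable fun n : ℤ => ‖R ^ (n * n) * w ^ n‖ := by
  have key : ∀ t : ℝ, 0 < t → Summable fun n : ℕ => ‖R‖ ^ (n * n) * t ^ n := by
    intro t ht
    have hr : 0 < ‖R‖ := norm_pos_iff.mpr hR0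
    refine summable_of_ratio_test_tendsto_lt_one (l := 0) one_pos
      (Eventually.of_forall fun n => by positivity) ?_
    have h1 : Tendsto (fun n : ℕ => ‖R‖ * t * (‖R‖ ^ 2) ^ n) atTop (𝓝 (‖R‖ * t * 0)) :=
      (tendsto_pow_atTop_nhds_zero_of_lt_one (by positivity) (by nlinarith)).const_mul _
    rw [mul_zero] at h1
    refine h1.congr fun n => ?_
    have h2 : ‖R‖ ^ ((n + 1) * (n + 1)) * t ^ (n + 1)
        = (‖R‖ ^ (n * n) * t ^ n) * (‖R‖ * t * (‖R‖ ^ 2) ^ n) := by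
      rw [← pow_mul]; ring
    rw [Real.norm_of_nonneg (by positivity), Real.norm_of_nonneg (by positivity), h2]
    field_simp
  refine Summable.of_nat_of_neg ?_ ?_
  · refine (key ‖w‖ (norm_pos_iff.mpr hw)).congr fun n => ?_
    rw [norm_mul, norm_zpow, norm_zpow, ← Int.natCast_mul, zpow_natCast, zpow_natCast]
  · refine (key ‖w‖⁻¹ (inv_pos.mpr (norm_pos_iff.mpr hw))).congr fun n => ?_
    rw [norm_mul, norm_zpow, norm_zpow, neg_mul_neg, ← Int.natCast_mul, zpow_natCast, zpow_neg,
      zpow_natCast, inv_pow]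

theorem summable_norm_gauss_quadratic {R w : ℂ} (hR0 : R ≠ 0) (hR : ‖R‖ < 1) (hw : w ≠ 0)
    {a : ℤ} (ha : 0 < a) (b : ℤ) :
    Summable fun n : ℤ => ‖R ^ (a * (n * n) + b * n) * w ^ n‖ := by
  have h : ‖R ^ a‖ < 1 := by
    lift a to ℕ using ha.le
    rw [zpow_natCast, norm_pow]
    exact pow_lt_one₀ (norm_nonneg _) hR (by rintro rfl; simp at ha)
  refine (summable_norm_gauss (zpow_ne_zero a hR0) h
    (mul_ne_zero (zpow_ne_zero b hR0) hw)).congr fun n => ?_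
  rw [mul_zpow, ← zpow_mul, ← zpow_mul, zpow_add₀ hR0, mul_assoc]

theorem summable_norm_gauss_linear {R w : ℂ} (hR0 : R ≠ 0) (hR : ‖R‖ < 1) (hw : w ≠ 0)
    {a : ℤ} (ha : 0 < a) (b : ℤ) :
    Summable fun n : ℤ => ‖(n : ℂ) * (R ^ (a * (n * n) + b * n) * w ^ n)‖ := by
  have h1 := summable_norm_gauss_quadratic hR0 hR (mul_ne_zero hw two_ne_zero) ha b
  have h2 := summable_norm_gauss_quadratic hR0 hR (mul_ne_zero hw (inv_ne_zero two_ne_zero)) ha b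
  refine Summable.of_nonneg_of_le (fun n => norm_nonneg _) (fun n => ?_) (h1.add h2)
  have hn : ‖(n : ℂ)‖ ≤ ‖(2 : ℂ) ^ n‖ + ‖((2 : ℂ)⁻¹) ^ n‖ := by
    simp only [norm_zpow, norm_inv, Complex.norm_ofNat, Complex.norm_intCast]
    have hp : ∀ k : ℕ, (k : ℝ) ≤ 2 ^ k := fun k => by exact_mod_cast Nat.lt_two_pow_self.le
    obtain ⟨k, rfl | rfl⟩ := n.eq_nat_or_neg
    · have := hp k
      have h3 : (0 : ℝ) ≤ (2⁻¹ : ℝ) ^ (k : ℤ) := by positivity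
      simp only [Int.cast_natCast, Nat.abs_cast, zpow_natCast] at *
      linarith
    · have := hp k
      have h3 : (0 : ℝ) ≤ ((2 : ℝ) ^ k)⁻¹ := by positivity
      rw [inv_zpow, zpow_neg, inv_inv]
      simp only [Int.cast_neg, Int.cast_natCast, abs_neg, Nat.abs_cast, zpow_natCast] at *
      linarith
  have hA := norm_nonneg (R ^ (a * (n * n) + b * n) * w ^ n)
  calc _ = ‖(n : ℂ)‖ * ‖R ^ (a * (n * n) + b * n) * w ^ n‖ := norm_mul _ _
    _ ≤ (‖(2 : ℂ) ^ n‖ + ‖((2 : ℂ)⁻¹) ^ n‖) * ‖R ^ (a * (n * n) + b * n) * w ^ n‖ := by gcongr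
    _ = _ := by
      simp only [mul_zpow, norm_mul]
      ring

/-- The theta function `∑ (-1)ⁿ R^{n(n-1)} wⁿ`, with nome `R ^ 2`. -/
noncomputable def th (R w : ℂ) : ℂ := ∑' n : ℤ, (-1) ^ n * R ^ (n * (n - 1)) * w ^ n

/-- The logarithmic-type derivative `w · d/dw` of `th`. -/
noncomputable def thDeriv (R w : ℂ) : ℂ :=
  ∑' n : ℤ, (n : ℂ) * ((-1) ^ n * R ^ (n * (n - 1)) * w ^ n)

theorem norm_neg_one_zpow (n : ℤ) : ‖(-1 : ℂ) ^ n‖ = 1 := by simp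

theorem summable_norm_th {R w : ℂ} (hR0 : R ≠ 0) (hR : ‖R‖ < 1) (hw : w ≠ 0) :
    Summable fun n : ℤ => ‖(-1) ^ n * R ^ (n * (n - 1)) * w ^ n‖ := by
  refine (summable_norm_gauss_quadratic hR0 hR hw one_pos (-1)).congr fun n => ?_
  rw [mul_assoc, norm_mul ((-1 : ℂ) ^ n), norm_neg_one_zpow,
    show n * (n - 1) = 1 * (n * n) + -1 * n by ring, one_mul, one_mul]

theorem summable_norm_thDeriv {R w : ℂ} (hR0 : R ≠ 0) (hR : ‖R‖ < 1) (hw : w ≠ 0) :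
    Summable fun n : ℤ => ‖(n : ℂ) * ((-1) ^ n * R ^ (n * (n - 1)) * w ^ n)‖ := by
  refine (summable_norm_gauss_linear hR0 hR hw one_pos (-1)).congr fun n => ?_
  rw [norm_mul (n : ℂ), norm_mul (n : ℂ), mul_assoc ((-1 : ℂ) ^ n), norm_mul ((-1 : ℂ) ^ n),
    norm_neg_one_zpow, show n * (n - 1) = 1 * (n * n) + -1 * n by ring, one_mul, one_mul]

theorem neg_one_zpow_add_one (n : ℤ) : (-1 : ℂ) ^ (n + 1) = -(-1) ^ n := by
  rw [zpow_add_one₀ (by norm_num)]; ring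

theorem neg_one_zpow_neg (n : ℤ) : (-1 : ℂ) ^ (-n) = (-1) ^ n := by
  rw [zpow_neg, ← inv_zpow]; norm_num

theorem neg_one_zpow_mul_self (n : ℤ) : (-1 : ℂ) ^ n * (-1) ^ n = 1 := by
  rw [← mul_zpow]; norm_num

/-- Quasi-periodicity of `th`. -/
theorem th_mul_sq {R w : ℂ} (hR0 : R ≠ 0) (hw : w ≠ 0) : th R (R ^ 2 * w) = -w⁻¹ * th R w := by
  unfold th
  rw [← (Equiv.subRight (1 : ℤ)).tsum_eq, ← tsum_mul_left]
  refine tsum_congr fun n => ?_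
  have h1 : (R ^ 2 * w) ^ (n - 1) = R ^ (2 * (n - 1)) * w ^ n * w⁻¹ := by
    rw [mul_zpow, zpow_sub_one₀ hw, zpow_mul, mul_assoc]; norm_cast
  have h2 : R ^ (n * (n - 1)) = R ^ ((n - 1) * (n - 1 - 1)) * R ^ (2 * (n - 1)) := by
    rw [← zpow_add₀ hR0]; congr 1; ring
  have h3 : (-1 : ℂ) ^ n = -(-1) ^ (n - 1) := by
    rw [← neg_one_zpow_add_one]; congr 1; ring
  simp only [Equiv.subRight_apply]
  rw [h1, h2, h3]; ring

theorem th_inv {R w : ℂ} (hw : w ≠ 0) : th R w⁻¹ = -w⁻¹ * th R w := by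
  unfold th
  rw [← (Equiv.subLeft (1 : ℤ)).tsum_eq, ← tsum_mul_left]
  refine tsum_congr fun n => ?_
  have h1 : (w⁻¹) ^ (1 - n) = w ^ n * w⁻¹ := by
    rw [inv_zpow, ← zpow_neg, neg_sub, zpow_sub_one₀ hw]
  have h3 : (-1 : ℂ) ^ (1 - n) = -(-1) ^ n := by
    rw [← neg_one_zpow_neg n, ← neg_one_zpow_add_one]; congr 1; ring
  simp only [Equiv.subLeft_apply]
  rw [h1, h3, show (1 - n) * (1 - n - 1) = n * (n - 1) by ring]; ring

theorem th_one (R : ℂ) : th R 1 = 0 := by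
  have h := th_inv (R := R) one_ne_zero
  rw [inv_one] at h
  linear_combination h / 2

theorem thDeriv_inv {R w : ℂ} (hR0 : R ≠ 0) (hR : ‖R‖ < 1) (hw : w ≠ 0) :
    thDeriv R w⁻¹ = w⁻¹ * (thDeriv R w - th R w) := by
  unfold th thDeriv
  rw [← (summable_norm_thDeriv hR0 hR hw).of_norm.tsum_sub (summable_norm_th hR0 hR hw).of_norm,
    ← (Equiv.subLeft (1 : ℤ)).tsum_eq, ← tsum_mul_left]
  refine tsum_congr fun n => ?_
  have h1 : (w⁻¹) ^ (1 - n) = w ^ n * w⁻¹ := by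
    rw [inv_zpow, ← zpow_neg, neg_sub, zpow_sub_one₀ hw]
  have h3 : (-1 : ℂ) ^ (1 - n) = -(-1) ^ n := by
    rw [← neg_one_zpow_neg n, ← neg_one_zpow_add_one]; congr 1; ring
  simp only [Equiv.subLeft_apply]
  rw [h1, h3, show (1 - n) * (1 - n - 1) = n * (n - 1) by ring]; push_cast; ring

theorem thDeriv_mul_sq {R w : ℂ} (hR0 : R ≠ 0) (hR : ‖R‖ < 1) (hw : w ≠ 0) :
    thDeriv R (R ^ 2 * w) = -w⁻¹ * (thDeriv R w - th R w) := by
  unfold th thDeriv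
  rw [← (summable_norm_thDeriv hR0 hR hw).of_norm.tsum_sub (summable_norm_th hR0 hR hw).of_norm,
    ← (Equiv.subRight (1 : ℤ)).tsum_eq, ← tsum_mul_left]
  refine tsum_congr fun n => ?_
  have h1 : (R ^ 2 * w) ^ (n - 1) = R ^ (2 * (n - 1)) * w ^ n * w⁻¹ := by
    rw [mul_zpow, zpow_sub_one₀ hw, zpow_mul, mul_assoc]; norm_cast
  have h2 : R ^ (n * (n - 1)) = R ^ ((n - 1) * (n - 1 - 1)) * R ^ (2 * (n - 1)) := by
    rw [← zpow_add₀ hR0]; congr 1; ring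
  have h3 : (-1 : ℂ) ^ n = -(-1) ^ (n - 1) := by
    rw [← neg_one_zpow_add_one]; congr 1; ring
  simp only [Equiv.subRight_apply]
  rw [h1, h2, h3]; push_cast; ring

/-- Splitting a double sum over the integers according to the parity of `n + m`. -/
theorem tsum_int_prod_parity {f : ℤ × ℤ → ℂ} (hf : Summable f) :
    ∑' p, f p = ∑' p : ℤ × ℤ, f (p.1 + p.2, p.1 - p.2)
      + ∑' p : ℤ × ℤ, f (p.1 + p.2 + 1, p.1 - p.2) := by
  let e : (ℤ × ℤ) ⊕ (ℤ × ℤ) → ℤ × ℤ :=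
    Sum.elim (fun p => (p.1 + p.2, p.1 - p.2)) (fun p => (p.1 + p.2 + 1, p.1 - p.2))
  have he : Function.Bijective e := by
    constructor
    · rintro (⟨a, b⟩ | ⟨a, b⟩) (⟨c, d⟩ | ⟨c, d⟩) h <;>
        simp only [e, Sum.elim_inl, Sum.elim_inr, Prod.mk.injEq] at h <;>
        obtain ⟨h1, h2⟩ := h
      · obtain rfl : a = c := by omega
        obtain rfl : b = d := by omega
        rfl
      · omega
      · omega
      · obtain rfl : a = c := by omega
        obtain rfl : b = d := by omega
        rfl
    · rintro ⟨n, m⟩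
      rcases Int.even_or_odd' (n + m) with ⟨k, h | h⟩
      · exact ⟨Sum.inl (k, n - k), by simp only [e, Sum.elim_inl, Prod.mk.injEq]; omega⟩
      · exact ⟨Sum.inr (k, n - k - 1), by simp only [e, Sum.elim_inr, Prod.mk.injEq]; omega⟩
  have hs : Summable (f ∘ e) := hf.comp_injective he.1
  have h := (Equiv.ofBijective e he).tsum_eq f
  rw [← h]
  exact Summable.tsum_sum (f := f ∘ e) (hs.comp_injective Sum.inl_injective)
    (hs.comp_injective Sum.inr_injective)

noncomputable def thOdd (R a : ℂ) : ℂ := ∑' i : ℤ, R ^ (2 * (i * i) - 2 * i) * a ^ (2 * i - 1)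
noncomputable def thEven (R a : ℂ) : ℂ := ∑' i : ℤ, R ^ (2 * (i * i)) * a ^ (2 * i)
noncomputable def thOddDeriv (R a : ℂ) : ℂ :=
  ∑' i : ℤ, (2 * i - 1 : ℂ) * (R ^ (2 * (i * i) - 2 * i) * a ^ (2 * i - 1))
noncomputable def thEvenDeriv (R a : ℂ) : ℂ :=
  ∑' i : ℤ, (2 * i : ℂ) * (R ^ (2 * (i * i)) * a ^ (2 * i))

theorem sq_zpow (a : ℂ) (i : ℤ) : (a ^ 2) ^ i = a ^ (2 * i) := by rw [zpow_mul]; norm_cast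

section
variable {R a b : ℂ} (hR0 : R ≠ 0) (hR : ‖R‖ < 1) (ha : a ≠ 0)
include hR0 hR ha

theorem summable_norm_thOdd :
    Summable fun i : ℤ => ‖R ^ (2 * (i * i) - 2 * i) * a ^ (2 * i - 1)‖ := by
  refine ((summable_norm_gauss_quadratic hR0 hR (pow_ne_zero 2 ha) two_pos (-2)).mul_right
    ‖a⁻¹‖).congr fun i => ?_
  rw [← norm_mul, zpow_sub_one₀ ha, sq_zpow, show 2 * (i * i) + -2 * i = 2 * (i * i) - 2 * i by ring,
    mul_assoc]

theorem summable_norm_thOdd_shift :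
    Summable fun i : ℤ =>
      ‖R ^ (2 * ((i + 1) * (i + 1)) - 2 * (i + 1)) * a ^ (2 * (i + 1) - 1)‖ :=
  (summable_norm_thOdd hR0 hR ha).comp_injective (add_left_injective (1 : ℤ))

omit hR0 hR ha in
theorem thOdd_eq_shift : thOdd R a =
    ∑' i : ℤ, R ^ (2 * ((i + 1) * (i + 1)) - 2 * (i + 1)) * a ^ (2 * (i + 1) - 1) :=
  ((Equiv.addRight (1 : ℤ)).tsum_eq
    (fun i : ℤ => R ^ (2 * (i * i) - 2 * i) * a ^ (2 * i - 1))).symm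

theorem summable_norm_thEven :
    Summable fun i : ℤ => ‖R ^ (2 * (i * i)) * a ^ (2 * i)‖ := by
  refine (summable_norm_gauss_quadratic hR0 hR (pow_ne_zero 2 ha) two_pos 0).congr fun i => ?_
  rw [zpow_mul a, zero_mul, add_zero]
  norm_cast

theorem summable_norm_thEvenDeriv :
    Summable fun i : ℤ => ‖(2 * i : ℂ) * (R ^ (2 * (i * i)) * a ^ (2 * i))‖ := by
  refine ((summable_norm_gauss_linear hR0 hR (pow_ne_zero 2 ha) two_pos 0).mul_left
    ‖(2 : ℂ)‖).congr fun i => ?_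
  rw [← norm_mul, zpow_mul a, zero_mul, add_zero, mul_assoc (2 : ℂ)]
  norm_cast

theorem summable_norm_thOddDeriv :
    Summable fun i : ℤ =>
      ‖(2 * i - 1 : ℂ) * (R ^ (2 * (i * i) - 2 * i) * a ^ (2 * i - 1))‖ := by
  have h1 := ((summable_norm_gauss_linear hR0 hR (pow_ne_zero 2 ha) two_pos (-2)).mul_left
    ‖(2 : ℂ) * a⁻¹‖)
  have h2 := summable_norm_thOdd hR0 hR ha
  refine Summable.of_nonneg_of_le (fun _ => norm_nonneg _) (fun i => ?_) (h1.add h2)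
  rw [← norm_mul]
  refine (norm_sub_le _ _).trans_eq' ?_
  congr 1
  rw [zpow_sub_one₀ ha, sq_zpow, show 2 * (i * i) + -2 * i = 2 * (i * i) - 2 * i by ring]
  ring

end

/-- The basic odd function of two variables underlying the Weierstrass three-term relation. -/
noncomputable def wf (R a b : ℂ) : ℂ := a⁻¹ * (th R (a * b) * th R (a / b))

section
variable {R a b : ℂ} (hR0 : R ≠ 0) (hR : ‖R‖ < 1) (ha : a ≠ 0) (hb : b ≠ 0)
include hR0 hR ha hb

omit hR in
theorem parity_even (i j : ℤ) :
    ((-1) ^ (i + j) * R ^ ((i + j) * (i + j - 1)) * (a * b) ^ (i + j)) *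
      ((-1) ^ (i - j) * R ^ ((i - j) * (i - j - 1)) * (a / b) ^ (i - j))
    = a * ((R ^ (2 * (i * i) - 2 * i) * a ^ (2 * i - 1)) * (R ^ (2 * (j * j)) * b ^ (2 * j))) := by
  have h1 : (-1 : ℂ) ^ (i + j) * (-1) ^ (i - j) = 1 := by
    rw [← zpow_add₀ (by norm_num), show i + j + (i - j) = i + i by ring,
      zpow_add₀ (by norm_num), neg_one_zpow_mul_self]
  have h2 : R ^ ((i + j) * (i + j - 1)) * R ^ ((i - j) * (i - j - 1))
      = R ^ (2 * (i * i) - 2 * i) * R ^ (2 * (j * j)) := by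
    rw [← zpow_add₀ hR0, ← zpow_add₀ hR0]; congr 1; ring
  have h3 : (a * b) ^ (i + j) * (a / b) ^ (i - j) = a * (a ^ (2 * i - 1) * b ^ (2 * j)) := by
    have e1 : a ^ (2 * i - 1) = a ^ (i + j) * a ^ (i - j) * a⁻¹ := by
      rw [← zpow_add₀ ha, ← zpow_sub_one₀ ha]; congr 1; ring
    have e2 : b ^ (2 * j) = b ^ (i + j) * (b ^ (i - j))⁻¹ := by
      rw [← zpow_neg, ← zpow_add₀ hb]; congr 1; ring
    rw [div_zpow, mul_zpow, e1, e2]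
    generalize a ^ (i + j) = A, b ^ (i + j) = B, a ^ (i - j) = C, b ^ (i - j) = D
    field_simp
  linear_combination (R ^ ((i + j) * (i + j - 1)) * R ^ ((i - j) * (i - j - 1)) * (a * b) ^ (i + j)
    * (a / b) ^ (i - j)) * h1 + (a * b) ^ (i + j) * (a / b) ^ (i - j) * h2 +
    R ^ (2 * (i * i) - 2 * i) * R ^ (2 * (j * j)) * h3

omit hR in
theorem parity_odd (i j : ℤ) :
    ((-1) ^ (i + j + 1) * R ^ ((i + j + 1) * (i + j + 1 - 1)) * (a * b) ^ (i + j + 1)) *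
      ((-1) ^ (i - j) * R ^ ((i - j) * (i - j - 1)) * (a / b) ^ (i - j))
    = -(a * ((R ^ (2 * (i * i)) * a ^ (2 * i)) *
        (R ^ (2 * ((j + 1) * (j + 1)) - 2 * (j + 1)) * b ^ (2 * (j + 1) - 1)))) := by
  have h1 : (-1 : ℂ) ^ (i + j + 1) * (-1) ^ (i - j) = -1 := by
    rw [← zpow_add₀ (by norm_num), show i + j + 1 + (i - j) = i + i + 1 by ring,
      zpow_add_one₀ (by norm_num), zpow_add₀ (by norm_num), neg_one_zpow_mul_self, one_mul]
  have h2 : R ^ ((i + j + 1) * (i + j + 1 - 1)) * R ^ ((i - j) * (i - j - 1))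
      = R ^ (2 * (i * i)) * R ^ (2 * ((j + 1) * (j + 1)) - 2 * (j + 1)) := by
    rw [← zpow_add₀ hR0, ← zpow_add₀ hR0]; congr 1; ring
  have h3 : (a * b) ^ (i + j + 1) * (a / b) ^ (i - j)
      = a * (a ^ (2 * i) * b ^ (2 * (j + 1) - 1)) := by
    have e1 : a ^ (2 * i) = a ^ (i + j + 1) * a ^ (i - j) * a⁻¹ := by
      rw [← zpow_add₀ ha, ← zpow_sub_one₀ ha]; congr 1; ring
    have e2 : b ^ (2 * (j + 1) - 1) = b ^ (i + j + 1) * (b ^ (i - j))⁻¹ := by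
      rw [← zpow_neg, ← zpow_add₀ hb]; congr 1; ring
    rw [div_zpow, mul_zpow, e1, e2]
    generalize a ^ (i + j + 1) = A, b ^ (i + j + 1) = B, a ^ (i - j) = C, b ^ (i - j) = D
    field_simp
  linear_combination (R ^ ((i + j + 1) * (i + j + 1 - 1)) * R ^ ((i - j) * (i - j - 1))
    * (a * b) ^ (i + j + 1) * (a / b) ^ (i - j)) * h1
    - (a * b) ^ (i + j + 1) * (a / b) ^ (i - j) * h2 -
    R ^ (2 * (i * i)) * R ^ (2 * ((j + 1) * (j + 1)) - 2 * (j + 1)) * h3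

theorem wf_eq : wf R a b = thOdd R a * thEven R b - thEven R a * thOdd R b := by
  have hab := mul_ne_zero ha hb
  have hab' := div_ne_zero ha hb
  have e1 : th R (a * b) * th R (a / b) =
      a * (thOdd R a * thEven R b) - a * (thEven R a * thOdd R b) := by
    unfold th
    rw [tsum_mul_tsum_of_summable_norm (summable_norm_th hR0 hR hab) (summable_norm_th hR0 hR hab'),
      tsum_int_prod_parity (summable_mul_of_summable_norm (summable_norm_th hR0 hR hab)
        (summable_norm_th hR0 hR hab'))]
    simp only [parity_even hR0 ha hb, parity_odd hR0 ha hb]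
    rw [tsum_neg, tsum_mul_left, tsum_mul_left, sub_eq_add_neg]
    congr 3
    · unfold thOdd thEven
      rw [tsum_mul_tsum_of_summable_norm (summable_norm_thOdd hR0 hR ha)
        (summable_norm_thEven hR0 hR hb)]
    · rw [thOdd_eq_shift, thEven, tsum_mul_tsum_of_summable_norm (summable_norm_thEven hR0 hR ha)
        (summable_norm_thOdd_shift hR0 hR hb)]
  rw [wf, e1]; field_simp

theorem wf_deriv_eq :
    a⁻¹ * (thDeriv R (a * b) * th R (a / b) + th R (a * b) * thDeriv R (a / b)
      - th R (a * b) * th R (a / b)) =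
    thOddDeriv R a * thEven R b - thEvenDeriv R a * thOdd R b := by
  have hab := mul_ne_zero ha hb
  have hab' := div_ne_zero ha hb
  have s1 := summable_norm_th hR0 hR hab
  have s2 := summable_norm_th hR0 hR hab'
  have s3 := summable_norm_thDeriv hR0 hR hab
  have s4 := summable_norm_thDeriv hR0 hR hab'
  have e1 : thDeriv R (a * b) * th R (a / b) + th R (a * b) * thDeriv R (a / b)
      - th R (a * b) * th R (a / b) =
      a * (thOddDeriv R a * thEven R b) - a * (thEvenDeriv R a * thOdd R b) := by
    unfold th thDeriv
    rw [tsum_mul_tsum_of_summable_norm s3 s2, tsum_mul_tsum_of_summable_norm s1 s4,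
      tsum_mul_tsum_of_summable_norm s1 s2,
      ← (summable_mul_of_summable_norm s3 s2).tsum_add (summable_mul_of_summable_norm s1 s4),
      ← ((summable_mul_of_summable_norm s3 s2).add (summable_mul_of_summable_norm s1 s4)).tsum_sub
        (summable_mul_of_summable_norm s1 s2),
      tsum_int_prod_parity (((summable_mul_of_summable_norm s3 s2).add
        (summable_mul_of_summable_norm s1 s4)).sub (summable_mul_of_summable_norm s1 s2))]
    have he : ∀ A B C D : ℂ, A * C * D + C * (B * D) - C * D = (A + B - 1) * (C * D) := by
      intros; ring
    have he' : ∀ n m : ℤ, (n : ℂ) * ((-1) ^ n * R ^ (n * (n - 1)) * (a * b) ^ n) *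
          ((-1) ^ m * R ^ (m * (m - 1)) * (a / b) ^ m) +
        ((-1) ^ n * R ^ (n * (n - 1)) * (a * b) ^ n) *
          ((m : ℂ) * ((-1) ^ m * R ^ (m * (m - 1)) * (a / b) ^ m)) -
        ((-1) ^ n * R ^ (n * (n - 1)) * (a * b) ^ n) *
          ((-1) ^ m * R ^ (m * (m - 1)) * (a / b) ^ m) =
        ((n : ℂ) + m - 1) * (((-1) ^ n * R ^ (n * (n - 1)) * (a * b) ^ n) *
          ((-1) ^ m * R ^ (m * (m - 1)) * (a / b) ^ m)) := fun n m => he _ _ _ _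
    simp only [he']
    simp only [parity_even hR0 ha hb, parity_odd hR0 ha hb]
    have hE : ∀ i j : ℤ, (((i + j : ℤ) : ℂ) + ((i - j : ℤ) : ℂ) - 1) *
        (a * ((R ^ (2 * (i * i) - 2 * i) * a ^ (2 * i - 1)) * (R ^ (2 * (j * j)) * b ^ (2 * j))))
        = a * (((2 * i - 1 : ℂ) * (R ^ (2 * (i * i) - 2 * i) * a ^ (2 * i - 1)))
          * (R ^ (2 * (j * j)) * b ^ (2 * j))) := by
      intro i j; push_cast; ring
    have hO : ∀ i j : ℤ, (((i + j + 1 : ℤ) : ℂ) + ((i - j : ℤ) : ℂ) - 1) *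
        -(a * ((R ^ (2 * (i * i)) * a ^ (2 * i)) *
        (R ^ (2 * ((j + 1) * (j + 1)) - 2 * (j + 1)) * b ^ (2 * (j + 1) - 1))))
        = -(a * (((2 * i : ℂ) * (R ^ (2 * (i * i)) * a ^ (2 * i)))
          * (R ^ (2 * ((j + 1) * (j + 1)) - 2 * (j + 1)) * b ^ (2 * (j + 1) - 1)))) := by
      intro i j; push_cast; ring
    simp only [hE, hO]
    rw [tsum_neg, tsum_mul_left, tsum_mul_left, sub_eq_add_neg]
    congr 3
    · unfold thOddDeriv thEven
      rw [tsum_mul_tsum_of_summable_norm (summable_norm_thOddDeriv hR0 hR ha)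
        (summable_norm_thEven hR0 hR hb)]
    · rw [thOdd_eq_shift, thEvenDeriv,
        tsum_mul_tsum_of_summable_norm (summable_norm_thEvenDeriv hR0 hR ha)
        (summable_norm_thOdd_shift hR0 hR hb)]
  rw [e1]; field_simp
end

/-- Weierstrass' three-term relation. -/
theorem wf_plucker {R a b c d : ℂ} (hR0 : R ≠ 0) (hR : ‖R‖ < 1) (ha : a ≠ 0) (hb : b ≠ 0)
    (hc : c ≠ 0) (hd : d ≠ 0) :
    wf R a b * wf R c d - wf R a c * wf R b d + wf R a d * wf R b c = 0 := by
  simp only [wf_eq hR0 hR, ne_eq, ha, hb, hc, hd, not_false_eq_true]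
  ring

/-- The logarithmic derivative `w θ'(w) / θ(w)`. -/
noncomputable def thLog (R w : ℂ) : ℂ := thDeriv R w / th R w

/-- A parallelogram combination of logarithmic derivatives is a theta quotient. -/
theorem thLog_parallelogram {R s t u : ℂ} (hR0 : R ≠ 0) (hR : ‖R‖ < 1) (hs : s ≠ 0) (ht : t ≠ 0)
    (hu : u ≠ 0) (h1 : th R (s * t) ≠ 0) (h2 : th R (s / t) ≠ 0) (h3 : th R (s * u) ≠ 0)
    (h4 : th R (s / u) ≠ 0) :
    (thLog R (s * t) + thLog R (s / t) - thLog R (s * u) - thLog R (s / u)) *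
      (wf R s t * wf R s u) = - thDeriv R 1 * s⁻¹ * th R (s * s) * wf R u t := by
  have k1 := wf_deriv_eq hR0 hR hs ht
  have k2 := wf_deriv_eq hR0 hR hs hu
  have k3 := wf_deriv_eq hR0 hR hs hs
  rw [div_self hs, th_one] at k3
  have l1 : (thLog R (s * t) + thLog R (s / t) - 1) * wf R s t
      = thOddDeriv R s * thEven R t - thEvenDeriv R s * thOdd R t := by
    rw [← k1, wf, thLog, thLog]; field_simp
  have l2 : (thLog R (s * u) + thLog R (s / u) - 1) * wf R s u
      = thOddDeriv R s * thEven R u - thEvenDeriv R s * thOdd R u := by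
    rw [← k2, wf, thLog, thLog]; field_simp
  have w1 := wf_eq hR0 hR hs ht
  have w2 := wf_eq hR0 hR hs hu
  have w3 := wf_eq hR0 hR hu ht
  have : (thLog R (s * t) + thLog R (s / t) - thLog R (s * u) - thLog R (s / u)) *
      (wf R s t * wf R s u) = (thOddDeriv R s * thEven R t - thEvenDeriv R s * thOdd R t) * wf R s u
       - (thOddDeriv R s * thEven R u - thEvenDeriv R s * thOdd R u) * wf R s t := by
    rw [← l1, ← l2]; ring
  rw [this, w1, w2, w3]
  linear_combination (thOdd R u * thEven R t - thEven R u * thOdd R t) * k3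

/-- The infinite product `∏ (1 - x Qⁱ)`. -/
noncomputable def qp (Q x : ℂ) : ℂ := ∏' i : ℕ, (1 - x * Q ^ i)

section
variable {Q : ℂ} (hQ : ‖Q‖ < 1)
include hQ

theorem summable_norm_mul_pow (x : ℂ) : Summable fun i : ℕ => ‖-(x * Q ^ i)‖ := by
  simp only [norm_neg, norm_mul, norm_pow]
  exact (summable_geometric_of_lt_one (norm_nonneg _) hQ).mul_left _

theorem qp_multipliable (x : ℂ) : Multipliable fun i : ℕ => 1 - x * Q ^ i := by
  simpa only [sub_eq_add_neg] using multipliable_one_add_of_summable (summable_norm_mul_pow hQ x)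

theorem qp_tendsto (x : ℂ) :
    Tendsto (fun n => ∏ i ∈ Finset.range n, (1 - x * Q ^ i)) atTop (𝓝 (qp Q x)) :=
  (qp_multipliable hQ x).hasProd.tendsto_prod_nat

theorem qp_ne_zero {x : ℂ} (hx : ∀ i : ℕ, x * Q ^ i ≠ 1) : qp Q x ≠ 0 := by
  unfold qp
  simp only [sub_eq_add_neg]
  refine tprod_one_add_ne_zero_of_summable (fun i => ?_) (summable_norm_mul_pow hQ x)
  rw [← sub_eq_add_neg, sub_ne_zero]
  exact (hx i).symm

theorem qp_ne_zero_of_norm_lt {x : ℂ} (hx : ‖x‖ < 1) : qp Q x ≠ 0 := by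
  refine qp_ne_zero hQ fun i h => ?_
  have h1 : ‖x * Q ^ i‖ < 1 := by
    rw [norm_mul, norm_pow]
    exact mul_lt_one_of_nonneg_of_lt_one_left (norm_nonneg _) hx
      (pow_le_one₀ (norm_nonneg _) hQ.le)
  rw [h, norm_one] at h1
  exact lt_irrefl _ h1

theorem qp_eq (x : ℂ) : qp Q x = (1 - x) * qp Q (x * Q) := by
  have h1 := (qp_tendsto hQ x).comp (tendsto_add_atTop_nat 1)
  refine tendsto_nhds_unique h1 (((qp_tendsto hQ (x * Q)).const_mul (1 - x)).congr fun n => ?_)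
  simp only [Function.comp_apply, Finset.prod_range_succ', pow_zero, mul_one, pow_succ', mul_assoc]
  ring

theorem qp_continuous : Continuous (qp Q) := by
  rw [continuous_iff_continuousAt]
  intro x
  have h := Summable.hasProdUniformlyOn_nat_one_add (f := fun i x => -(x * Q ^ i))
    (isCompact_closedBall x 1)
    ((summable_geometric_of_lt_one (norm_nonneg _) hQ).mul_left (‖x‖ + 1))
    (Eventually.of_forall fun i z hz => ?_) (fun i => by fun_prop)
  · have h2 : ContinuousOn (fun z => ∏' i : ℕ, (1 + -(z * Q ^ i))) (Metric.closedBall x 1) := by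
      rw [hasProdUniformlyOn_iff_tendstoUniformlyOn] at h
      exact h.continuousOn (Frequently.of_forall fun s => by fun_prop)
    simp only [← sub_eq_add_neg] at h2
    exact h2.continuousAt (Metric.closedBall_mem_nhds x one_pos)
  · rw [norm_neg, norm_mul, norm_pow]
    gcongr
    have h3 := norm_sub_norm_le z x
    rw [Metric.mem_closedBall, dist_eq_norm] at hz
    linarith

end

/-- `1 / (Q; Q)_n`, extended by zero to negative `n`. -/
noncomputable def invPoch (Q : ℂ) (n : ℤ) : ℂ :=
  if n < 0 then 0 else (∏ i ∈ Finset.range n.toNat, (1 - Q * Q ^ i))⁻¹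

section
variable {R : ℂ} (hR0 : R ≠ 0) (hR : ‖R‖ < 1)

theorem one_sub_mul_pow_ne_zero {Q : ℂ} (hQ : ‖Q‖ < 1) (i : ℕ) : 1 - Q * Q ^ i ≠ 0 := by
  rw [sub_ne_zero, ← pow_succ']
  intro h
  have h1 : ‖Q ^ (i + 1)‖ < 1 := by
    rw [norm_pow]; exact pow_lt_one₀ (norm_nonneg _) hQ (by simp)
  rw [← h, norm_one] at h1
  exact lt_irrefl _ h1

theorem invPoch_sub_one {Q : ℂ} (hQ : ‖Q‖ < 1) (n : ℤ) :
    invPoch Q (n - 1) = (1 - Q ^ n) * invPoch Q n := by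
  rcases lt_trichotomy n 0 with h | rfl | h
  · rw [invPoch, invPoch, if_pos h, if_pos (by omega), mul_zero]
  · simp [invPoch]
  · obtain ⟨k, rfl⟩ : ∃ k : ℕ, n = k + 1 := ⟨(n - 1).toNat, by omega⟩
    rw [invPoch, invPoch, if_neg (by omega), if_neg (by omega), add_sub_cancel_right,
      Int.toNat_natCast, show ((k : ℤ) + 1).toNat = k + 1 by omega, Finset.prod_range_succ,
      show Q ^ ((k : ℤ) + 1) = Q * Q ^ k by rw [← pow_succ']; norm_cast]
    have := one_sub_mul_pow_ne_zero hQ k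
    field_simp

include hR0 hR

/-- A finite form of the Jacobi triple product. -/
theorem finite_triple_product {w : ℂ} (hw : w ≠ 0) (N : ℕ) :
    HasSum (fun m : ℤ => ((-1) ^ m * R ^ (m * (m - 1)) * w ^ m) *
      ((∏ i ∈ Finset.range (2 * N), (1 - R ^ 2 * (R ^ 2) ^ i)) *
        (invPoch (R ^ 2) (N + m) * invPoch (R ^ 2) (N - m))))
      ((∏ i ∈ Finset.range N, (1 - w * (R ^ 2) ^ i)) *
        ∏ i ∈ Finset.range N, (1 - R ^ 2 / w * (R ^ 2) ^ i)) := by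
  have hQ : ‖R ^ 2‖ < 1 := by rw [norm_pow]; exact pow_lt_one₀ (norm_nonneg _) hR two_ne_zero
  induction N with
  | zero =>
    convert hasSum_single (0 : ℤ) ?_ using 1
    · simp [invPoch]
    · intro m hm
      rcases lt_or_gt_of_ne hm with h | h
      · simp [invPoch, h]
      · simp [invPoch, h]
  | succ N ih =>
    have h1 := ih.mul_left (1 + (R ^ 2) ^ (2 * N + 1))
    have h2 := ((Equiv.subRight (1 : ℤ)).hasSum_iff.mpr ih).mul_left (w * (R ^ 2) ^ N)
    have h3 := ((Equiv.addRight (1 : ℤ)).hasSum_iff.mpr ih).mul_left (R ^ 2 / w * (R ^ 2) ^ N)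
    have hv : (∏ i ∈ Finset.range (N + 1), (1 - w * (R ^ 2) ^ i)) *
        ∏ i ∈ Finset.range (N + 1), (1 - R ^ 2 / w * (R ^ 2) ^ i) =
        (1 + (R ^ 2) ^ (2 * N + 1)) * ((∏ i ∈ Finset.range N, (1 - w * (R ^ 2) ^ i)) *
          ∏ i ∈ Finset.range N, (1 - R ^ 2 / w * (R ^ 2) ^ i)) -
        w * (R ^ 2) ^ N * ((∏ i ∈ Finset.range N, (1 - w * (R ^ 2) ^ i)) *
          ∏ i ∈ Finset.range N, (1 - R ^ 2 / w * (R ^ 2) ^ i)) -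
        R ^ 2 / w * (R ^ 2) ^ N * ((∏ i ∈ Finset.range N, (1 - w * (R ^ 2) ^ i)) *
          ∏ i ∈ Finset.range N, (1 - R ^ 2 / w * (R ^ 2) ^ i)) := by
      rw [Finset.prod_range_succ, Finset.prod_range_succ]
      field_simp
      ring
    rw [hv]
    refine (congrArg (fun f => HasSum f _) (funext fun m => ?_)).mpr ((h1.sub h2).sub h3)
    · simp only [Function.comp_apply, Equiv.subRight_apply, Equiv.coe_addRight]
      have e1 : invPoch (R ^ 2) (N + m) =
          (1 - R ^ (2 * N + 2 + 2 * m)) * invPoch (R ^ 2) ((N + 1 : ℕ) + m) := by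
        rw [show (N : ℤ) + m = ((N + 1 : ℕ) + m) - 1 by push_cast; ring, invPoch_sub_one hQ,
          sq_zpow]
        congr 3; push_cast; ring
      have e2 : invPoch (R ^ 2) (N - m) =
          (1 - R ^ (2 * N + 2 - 2 * m)) * invPoch (R ^ 2) ((N + 1 : ℕ) - m) := by
        rw [show (N : ℤ) - m = ((N + 1 : ℕ) - m) - 1 by push_cast; ring, invPoch_sub_one hQ,
          sq_zpow]
        congr 3; push_cast; ring
      have e3 : invPoch (R ^ 2) (N + (m - 1)) = (1 - R ^ (2 * N + 2 * m)) *
          ((1 - R ^ (2 * N + 2 + 2 * m)) * invPoch (R ^ 2) ((N + 1 : ℕ) + m)) := by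
        rw [← e1, show (N : ℤ) + (m - 1) = (N + m) - 1 by ring, invPoch_sub_one hQ, sq_zpow]
        congr 3; ring
      have e4 : invPoch (R ^ 2) (N - (m + 1)) = (1 - R ^ (2 * N - 2 * m)) *
          ((1 - R ^ (2 * N + 2 - 2 * m)) * invPoch (R ^ 2) ((N + 1 : ℕ) - m)) := by
        rw [← e2, show (N : ℤ) - (m + 1) = (N - m) - 1 by ring, invPoch_sub_one hQ, sq_zpow]
        congr 3; ring
      have e5 : invPoch (R ^ 2) (N + (m + 1)) = invPoch (R ^ 2) ((N + 1 : ℕ) + m) := by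
        congr 1; push_cast; ring
      have e6 : invPoch (R ^ 2) (N - (m - 1)) = invPoch (R ^ 2) ((N + 1 : ℕ) - m) := by
        congr 1; push_cast; ring
      rw [e3, e4, e5, e6, e1, e2]
      generalize invPoch (R ^ 2) ((N + 1 : ℕ) + m) = a
      generalize invPoch (R ^ 2) ((N + 1 : ℕ) - m) = b
      rw [show 2 * (N + 1) = 2 * N + 1 + 1 by ring, Finset.prod_range_succ, Finset.prod_range_succ]
      generalize ∏ i ∈ Finset.range (2 * N), (1 - R ^ 2 * (R ^ 2) ^ i) = P
      have f1 : R ^ ((m - 1) * (m - 1 - 1)) = R ^ (m * (m - 1)) * (R ^ m)⁻¹ ^ 2 * R ^ 2 := by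
        rw [← zpow_neg, ← zpow_natCast, ← zpow_mul, ← zpow_natCast R, ← zpow_add₀ hR0,
          ← zpow_add₀ hR0]; congr 1; push_cast; ring
      have f2 : R ^ ((m + 1) * (m + 1 - 1)) = R ^ (m * (m - 1)) * (R ^ m) ^ 2 := by
        rw [← zpow_natCast (R ^ m), ← zpow_mul, ← zpow_add₀ hR0]; congr 1; push_cast; ring
      have f3 : (-1 : ℂ) ^ (m - 1) = -(-1) ^ m := by
        have := neg_one_zpow_add_one (m - 1)
        rw [sub_add_cancel] at this; rw [this, neg_neg]
      have g1 : R ^ (2 * N + 2 + 2 * m) = (R ^ N) ^ 2 * R ^ 2 * (R ^ m) ^ 2 := by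
        rw [← zpow_natCast (R ^ m), ← zpow_natCast R 2, ← zpow_natCast R N, ← zpow_natCast,
          ← zpow_mul, ← zpow_mul, ← zpow_add₀ hR0, ← zpow_add₀ hR0]; congr 1; push_cast; ring
      have g2 : R ^ (2 * N + 2 - 2 * m) = (R ^ N) ^ 2 * R ^ 2 * (R ^ m)⁻¹ ^ 2 := by
        rw [← zpow_neg, ← zpow_natCast (R ^ (-m)), ← zpow_natCast R 2, ← zpow_natCast R N,
          ← zpow_natCast,
          ← zpow_mul, ← zpow_mul, ← zpow_add₀ hR0, ← zpow_add₀ hR0]; congr 1; push_cast; ring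
      have g3 : R ^ (2 * N + 2 * m) = (R ^ N) ^ 2 * (R ^ m) ^ 2 := by
        rw [← zpow_natCast (R ^ m), ← zpow_natCast R N, ← zpow_natCast,
          ← zpow_mul, ← zpow_mul, ← zpow_add₀ hR0]; congr 1; push_cast; ring
      have g4 : R ^ (2 * N - 2 * m) = (R ^ N) ^ 2 * (R ^ m)⁻¹ ^ 2 := by
        rw [← zpow_neg, ← zpow_natCast (R ^ (-m)), ← zpow_natCast R N, ← zpow_natCast,
          ← zpow_mul, ← zpow_mul, ← zpow_add₀ hR0]; congr 1; push_cast; ring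
      rw [f1, f2, f3, neg_one_zpow_add_one, g1, g2, g3, g4, zpow_sub_one₀ hw, zpow_add_one₀ hw]
      have hm : R ^ m ≠ 0 := zpow_ne_zero _ hR0
      have r1 : (R ^ 2) ^ (2 * N + 1) = (R ^ N) ^ 4 * R ^ 2 := by ring
      have r2 : (R ^ 2) ^ (2 * N) = (R ^ N) ^ 4 := by ring
      have r3 : (R ^ 2) ^ N = (R ^ N) ^ 2 := by ring
      rw [r1, r2, r3]
      generalize R ^ m = X at *
      generalize R ^ N = Y
      field_simp
      ring

end

theorem norm_sq_lt_one {R : ℂ} (hR : ‖R‖ < 1) : ‖R ^ 2‖ < 1 := by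
  rw [norm_pow]; exact pow_lt_one₀ (norm_nonneg _) hR two_ne_zero

theorem invPoch_bounded {Q : ℂ} (hQ : ‖Q‖ < 1) : ∃ C, ∀ n, ‖invPoch Q n‖ ≤ C := by
  have h := ((qp_tendsto hQ Q).inv₀ (qp_ne_zero_of_norm_lt hQ hQ)).norm
  obtain ⟨C, hC⟩ := h.bddAbove_range
  refine ⟨max C 0, fun n => ?_⟩
  unfold invPoch
  split_ifs
  · simp
  · exact (hC ⟨n.toNat, rfl⟩).trans (le_max_left _ _)

theorem invPoch_tendsto {Q : ℂ} (hQ : ‖Q‖ < 1) {f : ℕ → ℤ} (hf : Tendsto f atTop atTop) :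
    Tendsto (fun n => invPoch Q (f n)) atTop (𝓝 (qp Q Q)⁻¹) := by
  have h := ((qp_tendsto hQ Q).inv₀ (qp_ne_zero_of_norm_lt hQ hQ))
  have h2 : Tendsto (fun n => (f n).toNat) atTop atTop :=
    tendsto_atTop.mpr fun b => by
      filter_upwards [hf.eventually_ge_atTop (b : ℤ)] with n hn
      omega
  refine (h.comp h2).congr' ?_
  filter_upwards [hf.eventually_ge_atTop 0] with n hn
  rw [invPoch, if_neg (by omega)]
  rfl

section
variable {R : ℂ} (hR0 : R ≠ 0) (hR : ‖R‖ < 1)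
include hR0 hR

/-- The Jacobi triple product identity. -/
theorem th_eq_prod {w : ℂ} (hw : w ≠ 0) :
    th R w = qp (R ^ 2) (R ^ 2) * (qp (R ^ 2) w * qp (R ^ 2) (R ^ 2 / w)) := by
  have hQ := norm_sq_lt_one hR
  obtain ⟨C, hC⟩ := invPoch_bounded hQ
  obtain ⟨D, hD⟩ := (qp_tendsto hQ (R ^ 2)).norm.bddAbove_range
  have hJ := qp_ne_zero_of_norm_lt hQ hQ
  have h1 : Tendsto (fun N : ℕ => ∑' m : ℤ, ((-1) ^ m * R ^ (m * (m - 1)) * w ^ m) *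
      ((∏ i ∈ Finset.range (2 * N), (1 - R ^ 2 * (R ^ 2) ^ i)) *
        (invPoch (R ^ 2) (N + m) * invPoch (R ^ 2) (N - m)))) atTop
      (𝓝 (∑' m : ℤ, ((-1) ^ m * R ^ (m * (m - 1)) * w ^ m) *
        (qp (R ^ 2) (R ^ 2) * ((qp (R ^ 2) (R ^ 2))⁻¹ * (qp (R ^ 2) (R ^ 2))⁻¹)))) := by
    refine tendsto_tsum_of_dominated_convergence
      ((summable_norm_th hR0 hR hw).mul_right (D * (C * C))) (fun m => ?_)
      (Eventually.of_forall fun N m => ?_)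
    · refine Tendsto.const_mul _ (Tendsto.mul ?_ (Tendsto.mul ?_ ?_))
      · exact (qp_tendsto hQ (R ^ 2)).comp (tendsto_id.const_mul_atTop' two_pos)
      · exact invPoch_tendsto hQ (tendsto_atTop_add_const_right _ _ tendsto_natCast_atTop_atTop)
      · exact invPoch_tendsto hQ (tendsto_atTop_add_const_right _ _ tendsto_natCast_atTop_atTop)
    · rw [norm_mul, norm_mul (∏ i ∈ _, _), norm_mul (invPoch _ _)]
      gcongr
      · exact (norm_nonneg _).trans (hD ⟨0, rfl⟩)
      · exact hD ⟨2 * N, rfl⟩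
      · exact (norm_nonneg _).trans (hC 0)
      · exact hC _
      · exact hC _
  have h2 := (qp_tendsto hQ w).mul (qp_tendsto hQ (R ^ 2 / w))
  have h3 := tendsto_nhds_unique h2
    (h1.congr fun N => (finite_triple_product hR0 hR hw N).tsum_eq)
  rw [h3, tsum_mul_right, th]
  field_simp

theorem th_ne_zero {w : ℂ} (hw : w ≠ 0) (h : ∀ n : ℤ, w * (R ^ 2) ^ n ≠ 1) : th R w ≠ 0 := by
  have hQ := norm_sq_lt_one hR
  rw [th_eq_prod hR0 hR hw]
  refine mul_ne_zero (qp_ne_zero_of_norm_lt hQ hQ) (mul_ne_zero (qp_ne_zero hQ fun i => ?_)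
    (qp_ne_zero hQ fun i hi => h (-(i + 1)) ?_))
  · exact_mod_cast h i
  · have h1 : w = R ^ 2 * (R ^ 2) ^ i := by field_simp at hi; exact hi.symm
    have h2 : (R ^ 2) ^ (i + 1) ≠ 0 := by positivity
    rw [zpow_neg, h1, ← pow_succ', show ((i : ℤ) + 1) = ((i + 1 : ℕ) : ℤ) by push_cast; rfl,
      zpow_natCast, mul_inv_cancel₀ h2]

/-- Differentiation of the theta series. -/
theorem th_hasDerivAt {w : ℂ} (hw : w ≠ 0) : HasDerivAt (th R) (w⁻¹ * thDeriv R w) w := by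
  have hw' := norm_pos_iff.mpr hw
  have hb : ∀ (n : ℤ) (z : ℂ), z ∈ {z : ℂ | ‖w‖ / 2 < ‖z‖ ∧ ‖z‖ < 2 * ‖w‖} →
      ‖(-1) ^ n * R ^ (n * (n - 1)) * z ^ n‖ ≤ ‖(-1) ^ n * R ^ (n * (n - 1)) * (w / 2) ^ n‖ +
        ‖(-1) ^ n * R ^ (n * (n - 1)) * (2 * w) ^ n‖ := by
    intro n z ⟨h1, h2⟩
    rw [norm_mul, norm_mul _ ((w / 2) ^ n), norm_mul _ ((2 * w) ^ n), ← mul_add]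
    gcongr
    rw [norm_zpow, norm_zpow, norm_zpow, norm_div, norm_mul, Complex.norm_ofNat]
    rcases le_total 0 n with hn | hn
    · have : ‖z‖ ^ n ≤ (2 * ‖w‖) ^ n := zpow_le_zpow_left₀ hn (norm_nonneg _) h2.le
      have h3 : 0 ≤ (‖w‖ / 2) ^ n := by positivity
      linarith
    · have : ‖z‖ ^ n ≤ (‖w‖ / 2) ^ n := by
        obtain ⟨k, rfl⟩ : ∃ k : ℕ, n = -k := ⟨n.natAbs, by omega⟩
        rw [zpow_neg, zpow_neg, zpow_natCast, zpow_natCast]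
        gcongr
      have h3 : 0 ≤ (2 * ‖w‖) ^ n := by positivity
      linarith
  have ho : IsOpen {z : ℂ | ‖w‖ / 2 < ‖z‖ ∧ ‖z‖ < 2 * ‖w‖} :=
    (isOpen_lt continuous_const continuous_norm).inter (isOpen_lt continuous_norm continuous_const)
  have hmem : w ∈ {z : ℂ | ‖w‖ / 2 < ‖z‖ ∧ ‖z‖ < 2 * ‖w‖} := by constructor <;> linarith
  have hs := (summable_norm_th hR0 hR (div_ne_zero hw two_ne_zero)).add
    (summable_norm_th hR0 hR (mul_ne_zero two_ne_zero hw))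
  have hdn : ∀ (n : ℤ) (z : ℂ), z ≠ 0 → HasDerivAt (fun z => (-1) ^ n * R ^ (n * (n - 1)) * z ^ n)
      ((-1) ^ n * R ^ (n * (n - 1)) * (n * z ^ (n - 1))) z := fun n z hz =>
    (hasDerivAt_zpow n z (Or.inl hz)).const_mul _
  have hd : ∀ n : ℤ, DifferentiableOn ℂ (fun z => (-1) ^ n * R ^ (n * (n - 1)) * z ^ n)
      {z : ℂ | ‖w‖ / 2 < ‖z‖ ∧ ‖z‖ < 2 * ‖w‖} := fun n z hz =>
    (hdn n z (norm_pos_iff.mp (by have := hz.1; linarith))).differentiableAt.differentiableWithinAt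
  have h1 := Complex.differentiableOn_tsum_of_summable_norm hs hd ho hb
  have h2 := Complex.hasSum_deriv_of_summable_norm hs hd ho hb hmem
  have h3 := (h1.differentiableAt (ho.mem_nhds hmem)).hasDerivAt
  rw [← h2.tsum_eq] at h3
  refine HasDerivAt.congr_deriv (f' := _) (show HasDerivAt (th R) _ w from h3) ?_
  symm
  rw [thDeriv, ← tsum_mul_left]
  refine tsum_congr fun n => ?_
  rw [(hdn n w hw).deriv, zpow_sub_one₀ hw]
  ring

theorem thDeriv_one : thDeriv R 1 = -(qp (R ^ 2) (R ^ 2)) ^ 3 := by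
  have hQ := norm_sq_lt_one hR
  have h1 := th_hasDerivAt hR0 hR one_ne_zero
  rw [inv_one, one_mul, hasDerivAt_iff_tendsto_slope] at h1
  have h2 : ContinuousAt (fun w => -(qp (R ^ 2) (R ^ 2) *
      (qp (R ^ 2) (w * R ^ 2) * qp (R ^ 2) (R ^ 2 / w)))) 1 := by
    have hc := qp_continuous hQ
    have : ContinuousAt (fun w : ℂ => R ^ 2 / w) 1 := by fun_prop (disch := norm_num)
    have h3 : ContinuousAt (fun w : ℂ => qp (R ^ 2) (R ^ 2 / w)) 1 := hc.continuousAt.comp this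
    have h4 : ContinuousAt (fun w : ℂ => qp (R ^ 2) (w * R ^ 2)) 1 := by fun_prop
    exact ((h4.mul h3).const_mul _).neg
  have h3 := h2.tendsto.mono_left (nhdsWithin_le_nhds (s := {1}ᶜ))
  have h4 := tendsto_nhds_unique (h1.congr' ?_) h3
  · rw [h4]; simp only [one_mul, div_one]; ring
  · have hne : ∀ᶠ w : ℂ in 𝓝[≠] 1, w ≠ 0 :=
      (continuousAt_id.eventually_ne one_ne_zero).filter_mono nhdsWithin_le_nhds
    filter_upwards [hne, self_mem_nhdsWithin] with w hw hw1
    rw [slope_def_field, th_one, th_eq_prod hR0 hR hw, qp_eq hQ w]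
    have : w - 1 ≠ 0 := sub_ne_zero.mpr hw1
    field_simp
    ring

/-- Euler's pentagonal number theorem, in terms of theta functions. -/
theorem th_cube_sq : th (R ^ 3) (R ^ 2) = qp (R ^ 2) (R ^ 2) := by
  have hQ := norm_sq_lt_one hR
  have hR3 : ‖R ^ 3‖ < 1 := by rw [norm_pow]; exact pow_lt_one₀ (norm_nonneg _) hR (by norm_num)
  have hQ3 := norm_sq_lt_one hR3
  rw [th_eq_prod (pow_ne_zero 3 hR0) hR3 (pow_ne_zero 2 hR0),
    show (R ^ 3) ^ 2 / R ^ 2 = R ^ 4 by field_simp]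
  have h1 := ((qp_tendsto hQ3 ((R ^ 3) ^ 2)).mul ((qp_tendsto hQ3 (R ^ 2)).mul
    (qp_tendsto hQ3 (R ^ 4))))
  have h2 := (qp_tendsto hQ (R ^ 2)).comp (tendsto_id.const_mul_atTop' three_pos)
  refine tendsto_nhds_unique h1 (h2.congr fun n => ?_)
  simp only [Function.comp_apply, id]
  induction n with
  | zero => simp
  | succ n ih =>
    rw [show 3 * (n + 1) = 3 * n + 1 + 1 + 1 by ring]
    simp only [Finset.prod_range_succ]
    rw [ih]
    ring

/-- The duplication formula. -/
theorem th_duplication {a : ℂ} (ha : a ≠ 0) :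
    th R a * th R (-a) * th R (a * R) * th R (-a * R) =
      qp (R ^ 2) (R ^ 2) ^ 3 * th R (a ^ 2) := by
  have hQ := norm_sq_lt_one hR
  have key : ∀ b : ℂ, qp (R ^ 2) b * qp (R ^ 2) (-b) * qp (R ^ 2) (b * R) * qp (R ^ 2) (-b * R)
      = qp (R ^ 2) (b ^ 2) := by
    intro b
    have h1 := (((qp_tendsto hQ b).mul (qp_tendsto hQ (-b))).mul (qp_tendsto hQ (b * R))).mul
      (qp_tendsto hQ (-b * R))
    have h2 := (qp_tendsto hQ (b ^ 2)).comp (tendsto_id.const_mul_atTop' two_pos)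
    refine tendsto_nhds_unique h1 (h2.congr fun n => ?_)
    simp only [Function.comp_apply, id]
    induction n with
    | zero => simp
    | succ n ih =>
      rw [show 2 * (n + 1) = 2 * n + 1 + 1 by ring]
      simp only [Finset.prod_range_succ]
      rw [ih]
      ring
  have k1 := key a
  have k2 := key (R / a)
  rw [th_eq_prod hR0 hR ha, th_eq_prod hR0 hR (neg_ne_zero.mpr ha),
    th_eq_prod hR0 hR (mul_ne_zero ha hR0), th_eq_prod hR0 hR (mul_ne_zero (neg_ne_zero.mpr ha) hR0),
    th_eq_prod hR0 hR (pow_ne_zero 2 ha)]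
  rw [show R ^ 2 / a ^ 2 = (R / a) ^ 2 by ring, ← k1, ← k2,
    show R / a * R = R ^ 2 / a by ring, show -(R / a) * R = R ^ 2 / -a by field_simp,
    show R ^ 2 / (a * R) = R / a by field_simp, show R ^ 2 / (-a * R) = -(R / a) by field_simp]
  ring
end

theorem neg_one_zpow_two_mul (i : ℤ) : (-1 : ℂ) ^ (2 * i) = 1 := by
  rw [two_mul, zpow_add₀ (by norm_num), neg_one_zpow_mul_self]

theorem neg_one_zpow_two_mul_add_one (i : ℤ) : (-1 : ℂ) ^ (2 * i + 1) = -1 := by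
  rw [neg_one_zpow_add_one, neg_one_zpow_two_mul]

theorem norm_cube_lt_one {R : ℂ} (hR : ‖R‖ < 1) : ‖R ^ 3‖ < 1 := by
  rw [norm_pow]; exact pow_lt_one₀ (norm_nonneg _) hR three_ne_zero

section
variable {R w : ℂ} (hR0 : R ≠ 0) (hR : ‖R‖ < 1) (hw : w ≠ 0)
include hR0

theorem th_cube_term (c : ℕ) (k : ℕ) (n : ℤ) :
    (-1) ^ n * (R ^ 3) ^ (n * (n - 1)) * (R ^ c * w ^ k) ^ n =
      (-1) ^ n * R ^ (3 * (n * (n - 1)) + c * n) * w ^ (k * n) := by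
  rw [zpow_add₀ hR0, mul_zpow]
  simp only [zpow_mul, zpow_natCast]
  norm_cast
  ring

include hw

theorem quintuple_term (u : ℤ) (c k : ℕ) (m n : ℤ) :
    w ^ u * (((-1) ^ m * R ^ (m * (m - 1)) * w ^ m) *
      ((-1) ^ n * (R ^ 3) ^ (n * (n - 1)) * (R ^ c * w ^ k) ^ n)) =
    (-1) ^ (m + n) * R ^ (m * (m - 1) + (3 * (n * (n - 1)) + c * n)) * w ^ (u + m + k * n) := by
  rw [th_cube_term hR0, zpow_add₀ hR0 (m * (m - 1)), zpow_add₀ hw (u + m), zpow_add₀ hw u,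
    zpow_add₀ (show (-1 : ℂ) ≠ 0 by norm_num) m]
  ring

include hR

theorem summable_quintuple_term (u : ℤ) (c k : ℕ) : Summable fun p : ℤ × ℤ =>
    (-1) ^ (p.1 + p.2) * R ^ (p.1 * (p.1 - 1) + (3 * (p.2 * (p.2 - 1)) + c * p.2)) *
      w ^ (u + p.1 + k * p.2) := by
  refine ((summable_mul_of_summable_norm (summable_norm_th hR0 hR hw)
    (summable_norm_th (pow_ne_zero 3 hR0) (norm_cube_lt_one hR)
      (mul_ne_zero (pow_ne_zero c hR0) (pow_ne_zero k hw)))).mul_left (w ^ u)).congr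
      fun p => ?_
  exact quintuple_term hR0 hw u c k p.1 p.2

theorem th_mul_th_cube (u : ℤ) (c k : ℕ) :
    w ^ u * (th R w * th (R ^ 3) (R ^ c * w ^ k)) =
    ∑' p : ℤ × ℤ, (-1) ^ (p.1 + p.2) *
      R ^ (p.1 * (p.1 - 1) + (3 * (p.2 * (p.2 - 1)) + c * p.2)) * w ^ (u + p.1 + k * p.2) := by
  unfold th
  rw [tsum_mul_tsum_of_summable_norm (summable_norm_th hR0 hR hw)
    (summable_norm_th (pow_ne_zero 3 hR0) (norm_cube_lt_one hR)
      (mul_ne_zero (pow_ne_zero c hR0) (pow_ne_zero k hw))), ← tsum_mul_left]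
  exact tsum_congr fun p => quintuple_term hR0 hw u c k p.1 p.2

/-- The quintuple product identity. -/
theorem quintuple :
    th (R ^ 3) (R ^ 2) * th R (w ^ 2) =
      th R w * (w * th (R ^ 3) (R ^ 4 * w ^ 3) + th (R ^ 3) (R ^ 2 * w ^ 3)) := by
  have e1 := th_mul_th_cube hR0 hR hw 1 4 3
  have e2 := th_mul_th_cube hR0 hR hw 0 2 3
  have e3 := th_mul_th_cube hR0 hR (pow_ne_zero 2 hw) 0 2 0
  rw [tsum_int_prod_parity (summable_quintuple_term hR0 hR hw 1 4 3)] at e1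
  rw [tsum_int_prod_parity (summable_quintuple_term hR0 hR hw 0 2 3)] at e2
  rw [tsum_int_prod_parity (summable_quintuple_term hR0 hR (pow_ne_zero 2 hw) 0 2 0)] at e3
  rw [zpow_one] at e1
  rw [zpow_zero, one_mul] at e2
  rw [zpow_zero, one_mul, pow_zero, mul_one] at e3
  rw [mul_add, mul_comm (th (R ^ 3) (R ^ 2)), show th R w * (w * th (R ^ 3) (R ^ 4 * w ^ 3)) =
    w * (th R w * th (R ^ 3) (R ^ 4 * w ^ 3)) by ring, e1, e2, e3]
  clear e1 e2 e3
  let eA : ℤ × ℤ ≃ ℤ × ℤ := ⟨fun p => (p.1 - p.2, -p.2), fun p => (p.1 - p.2, -p.2),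
      fun p => by ext <;> simp, fun p => by ext <;> simp⟩
  let eB : ℤ × ℤ ≃ ℤ × ℤ := ⟨fun p => (p.1, p.1 - p.2), fun p => (p.1, p.1 - p.2),
      fun p => by ext <;> simp, fun p => by ext <;> simp⟩
  let eC : ℤ × ℤ ≃ ℤ × ℤ := ⟨fun p => (p.1 - p.2, p.1), fun p => (p.2, p.2 - p.1),
      fun p => by ext <;> simp, fun p => by ext <;> simp⟩
  have A : ∀ f g : ℤ × ℤ → ℂ, (∀ i j, g (i - j, -j) = -f (i, j)) →
      ∑' p, f p + ∑' p, g p = 0 := by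
    intro f g h
    have h2 : (fun p => g (eA p)) = fun p => -f p := funext fun p => h p.1 p.2
    rw [← eA.tsum_eq g, h2, tsum_neg, add_neg_cancel]
  have B : ∀ f g : ℤ × ℤ → ℂ, (∀ i j, g (i, i - j) = f (i, j)) → ∑' p, f p = ∑' p, g p := by
    intro f g h
    rw [← eB.tsum_eq g]
    exact tsum_congr fun p => (h p.1 p.2).symm
  have C : ∀ f g : ℤ × ℤ → ℂ, (∀ i j, g (i - j, i) = f (i, j)) → ∑' p, f p = ∑' p, g p := by
    intro f g h
    rw [← eC.tsum_eq g]
    exact tsum_congr fun p => (h p.1 p.2).symm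
  have close : ∀ {a b c d a0 b0 c0 d0 : ℂ}, a + b0 = 0 → a0 = c → b = d → 
      c + d = a + b + (a0 + b0) := by
    intro a b c d a0 b0 c0 d0 h1 h2 h3
    rw [← h2, ← h3]; linear_combination -h1
  refine close (c0 := 0) (d0 := 0) (A _ _ fun i j => ?_) (B _ _ fun i j => ?_) (C _ _ fun i j => ?_)
  · dsimp only
    rw [show i + j + (i - j) = 2 * i by ring,
      show i - j + -j + 1 + (i - j - -j) = 2 * (i - j) + 1 by ring, neg_one_zpow_two_mul,
      neg_one_zpow_two_mul_add_one]
    rw [neg_one_mul, one_mul, neg_mul]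
    congr 3 <;> push_cast <;> ring
  · dsimp only
    rw [sq_zpow, show i + (i - j) + (i - (i - j)) = 2 * i by ring,
      show i + j + (i - j) = 2 * i by ring]
    congr 2 
    · congr 1; push_cast; ring
    · push_cast; ring
  · dsimp only
    rw [sq_zpow, show i - j + i + 1 + (i - j - i) = 2 * (i - j) + 1 by ring,
      show i + j + 1 + (i - j) = 2 * i + 1 by ring, neg_one_zpow_two_mul_add_one,
      neg_one_zpow_two_mul_add_one]
    congr 2 
    · congr 1; push_cast; ring
    · push_cast; ring
end

/-- `th R X / (1 - X)`, with the singularity at `1` removed. -/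
noncomputable def thQuot (R X : ℂ) : ℂ := -dslope (th R) 1 X

/-- `th R X / (1 - X R ^ (2 n))`, with the singularity removed. -/
noncomputable def thQuotShift (R : ℂ) (n : ℤ) (X : ℂ) : ℂ :=
  (-1) ^ n * X ^ n * R ^ (n * (n - 1)) * thQuot R (X * (R ^ 2) ^ n)

/-- The level-three Appell-type series multiplied by `th R X`. -/
noncomputable def appell (R c X : ℂ) : ℂ :=
  ∑' n : ℤ, (-1) ^ n * (R ^ 3) ^ (n * (n - 1)) * c ^ n * thQuotShift R n X

section
variable {R : ℂ} (hR0 : R ≠ 0) (hR : ‖R‖ < 1)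
include hR0

theorem th_mul_zpow {w : ℂ} (hw : w ≠ 0) (n : ℤ) :
    (-1) ^ n * w ^ n * R ^ (n * (n - 1)) * th R (w * (R ^ 2) ^ n) = th R w := by
  have hQ : (R ^ 2) ^ n ≠ 0 := zpow_ne_zero _ (pow_ne_zero 2 hR0)
  unfold th
  rw [← (Equiv.addRight n).tsum_eq (fun k : ℤ => (-1) ^ k * R ^ (k * (k - 1)) * w ^ k),
    ← tsum_mul_left]
  refine tsum_congr fun k => ?_
  simp only [Equiv.coe_addRight]
  rw [mul_zpow, sq_zpow, ← zpow_mul, zpow_add₀ (by norm_num), zpow_add₀ hw,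
    show (k + n) * (k + n - 1) = k * (k - 1) + n * (n - 1) + 2 * n * k by ring,
    zpow_add₀ hR0, zpow_add₀ hR0]
  ring

include hR

theorem th_differentiableOn : DifferentiableOn ℂ (th R) {0}ᶜ := fun _ hw =>
  (th_hasDerivAt hR0 hR hw).differentiableAt.differentiableWithinAt

theorem thQuot_differentiableOn : DifferentiableOn ℂ (thQuot R) {0}ᶜ :=
  ((Complex.differentiableOn_dslope (isOpen_compl_singleton.mem_nhds (by simp))).mpr
    (th_differentiableOn hR0 hR)).neg

omit hR0 hR in
theorem one_sub_mul_thQuot (X : ℂ) : (1 - X) * thQuot R X = th R X := by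
  have := sub_smul_dslope (th R) 1 X
  rw [th_one, sub_zero, smul_eq_mul] at this
  rw [thQuot, ← this]; ring

theorem thQuot_one : thQuot R 1 = -thDeriv R 1 := by
  rw [thQuot, dslope_same, (th_hasDerivAt hR0 hR one_ne_zero).deriv, inv_one, one_mul]

omit hR in
theorem one_sub_mul_thQuotShift {X : ℂ} (hX : X ≠ 0) (n : ℤ) :
    (1 - X * (R ^ 2) ^ n) * thQuotShift R n X = th R X := by
  rw [thQuotShift, ← th_mul_zpow hR0 hX n, ← one_sub_mul_thQuot (X * (R ^ 2) ^ n)]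
  ring

theorem thQuotShift_differentiableOn (n : ℤ) :
    DifferentiableOn ℂ (thQuotShift R n) {0}ᶜ := by
  have hQ : (R ^ 2) ^ n ≠ 0 := zpow_ne_zero _ (pow_ne_zero 2 hR0)
  have h1 : DifferentiableOn ℂ (fun X => thQuot R (X * (R ^ 2) ^ n)) {0}ᶜ :=
    (thQuot_differentiableOn hR0 hR).comp (by fun_prop) fun X hX => mul_ne_zero hX hQ
  have h2 : DifferentiableOn ℂ (fun X : ℂ => X ^ n) {0}ᶜ := fun X hX =>
    (differentiableAt_zpow.mpr (Or.inl hX)).differentiableWithinAt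
  exact ((h2.const_mul _).mul_const _).mul h1

omit hR0 hR in
theorem thQuotShift_zero (X : ℂ) : thQuotShift R 0 X = thQuot R X := by simp [thQuotShift]

omit hR in
theorem thQuotShift_succ {X : ℂ} (hX : X ≠ 0) (n : ℤ) :
    thQuotShift R n (R ^ 2 * X) = -X⁻¹ * thQuotShift R (n + 1) X := by
  have hQ : R ^ 2 ≠ 0 := pow_ne_zero 2 hR0
  rw [thQuotShift, thQuotShift, mul_zpow, zpow_add_one₀ hQ, zpow_add_one₀ hX,
    neg_one_zpow_add_one, sq_zpow, show (n + 1) * (n + 1 - 1) = 2 * n + n * (n - 1) by ring,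
    zpow_add₀ hR0, show R ^ 2 * X * R ^ (2 * n) = X * (R ^ (2 * n) * R ^ 2) by ring]
  field_simp

theorem thQuotShift_bounded {c₁ c₂ : ℝ} (hc₁ : 0 < c₁) :
    ∃ B, ∀ n X, c₁ ≤ ‖X‖ → ‖X‖ ≤ c₂ → ‖thQuotShift R n X‖ ≤ B := by
  set K : Set ℂ := Metric.closedBall 0 c₂ ∩ {X | c₁ ≤ ‖X‖} with hK
  have hKc : IsCompact K := (isCompact_closedBall _ _).inter_right
    (isClosed_le continuous_const continuous_norm)
  have hK0 : K ⊆ {0}ᶜ := fun X hX => norm_pos_iff.mp (hc₁.trans_le hX.2)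
  have key : ∀ {f : ℂ → ℂ}, DifferentiableOn ℂ f {0}ᶜ → ∃ B, 0 ≤ B ∧ ∀ X ∈ K, ‖f X‖ ≤ B := by
    intro f hf
    obtain ⟨B, hB⟩ := hKc.exists_bound_of_continuousOn (hf.continuousOn.mono hK0)
    exact ⟨max B 0, le_max_right _ _, fun X hX => (hB X hX).trans (le_max_left _ _)⟩
  obtain ⟨M, hM0, hM⟩ := key (th_differentiableOn hR0 hR)
  choose B hB0 hB using fun n => key (thQuotShift_differentiableOn hR0 hR n)
  have hQ := norm_sq_lt_one hR
  have hQ0 : 0 < ‖R ^ 2‖ := norm_pos_iff.mpr (pow_ne_zero 2 hR0)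
  have ht := tendsto_pow_atTop_nhds_zero_of_lt_one hQ0.le hQ
  obtain ⟨N, hN1, hN2⟩ := ((Tendsto.eventually_le_const (u := (1 / 2 : ℝ)) (v := 0 * c₂) (by norm_num)
    (ht.mul_const c₂)).and (Tendsto.eventually_le_const (u := c₁ / 2)
    (by positivity) ht)).exists
  refine ⟨2 * M + ∑ n ∈ Finset.Ioo (-N : ℤ) N, B n, fun n X h1 h2 => ?_⟩
  have hX : X ∈ K := ⟨by simpa using h2, h1⟩
  have hX0 := hK0 hX
  have hs : 0 ≤ ∑ n ∈ Finset.Ioo (-N : ℤ) N, B n := Finset.sum_nonneg fun n _ => hB0 n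
  by_cases hn : n ∈ Finset.Ioo (-N : ℤ) N
  · have := Finset.single_le_sum (f := B) (fun n _ => hB0 n) hn
    linarith [hB n X hX]
  · have hle : 1 / 2 ≤ ‖1 - X * (R ^ 2) ^ n‖ := by
      rw [Finset.mem_Ioo, not_and_or, not_lt, not_lt] at hn
      rcases hn with hn | hn
      · have h3 : 2 ≤ ‖X * (R ^ 2) ^ n‖ := by
          rw [norm_mul, norm_zpow]
          have h4 : (‖R ^ 2‖ ^ N)⁻¹ ≤ ‖R ^ 2‖ ^ n := by
            rw [← zpow_natCast, ← zpow_neg]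
            exact zpow_le_zpow_right_of_le_one₀ hQ0 hQ.le hn
          have h5 : 2 ≤ c₁ * (‖R ^ 2‖ ^ N)⁻¹ := by
            rw [← div_eq_mul_inv, le_div_iff₀ (by positivity)]; linarith
          calc 2 ≤ c₁ * (‖R ^ 2‖ ^ N)⁻¹ := h5
            _ ≤ ‖X‖ * ‖R ^ 2‖ ^ n := by gcongr
        have h6 := norm_sub_norm_le (X * (R ^ 2) ^ n) 1
        rw [norm_one, norm_sub_rev] at h6
        linarith
      · have h3 : ‖X * (R ^ 2) ^ n‖ ≤ 1 / 2 := by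
          rw [norm_mul, norm_zpow]
          have h4 : ‖R ^ 2‖ ^ n ≤ ‖R ^ 2‖ ^ N := by
            rw [← zpow_natCast]
            exact zpow_le_zpow_right_of_le_one₀ hQ0 hQ.le hn
          calc ‖X‖ * ‖R ^ 2‖ ^ n ≤ c₂ * ‖R ^ 2‖ ^ N := by
                gcongr
                exact hc₁.le.trans (h1.trans h2)
            _ ≤ 1 / 2 := by linarith
        have h6 := norm_sub_norm_le 1 (X * (R ^ 2) ^ n)
        rw [norm_one] at h6
        linarith
    have h7 := congrArg norm (one_sub_mul_thQuotShift hR0 hX0 n)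
    rw [norm_mul] at h7
    have h8 := hM X hX
    nlinarith [norm_nonneg (thQuotShift R n X)]
end

section
variable {R : ℂ} (hR0 : R ≠ 0) (hR : ‖R‖ < 1)
include hR0 hR

theorem appell_term_bound {c z : ℂ} (hc : c ≠ 0) (hz : z ≠ 0) : ∃ u : ℤ → ℝ, Summable u ∧
    ∀ n, ∀ X ∈ {X : ℂ | ‖z‖ / 2 < ‖X‖ ∧ ‖X‖ < 2 * ‖z‖},
      ‖(-1) ^ n * (R ^ 3) ^ (n * (n - 1)) * c ^ n * thQuotShift R n X‖ ≤ u n := by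
  have hz' := norm_pos_iff.mpr hz
  obtain ⟨B, hB⟩ := thQuotShift_bounded (c₁ := ‖z‖ / 2) (c₂ := 2 * ‖z‖) hR0 hR (by positivity)
  refine ⟨_, (summable_norm_th (pow_ne_zero 3 hR0) (norm_cube_lt_one hR) hc).mul_right B,
    fun n X hX => ?_⟩
  rw [norm_mul]
  exact mul_le_mul_of_nonneg_left (hB n X hX.1.le hX.2.le) (norm_nonneg _)

omit hR0 hR in
theorem isOpen_annulus (z : ℂ) : IsOpen {X : ℂ | ‖z‖ / 2 < ‖X‖ ∧ ‖X‖ < 2 * ‖z‖} :=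
  (isOpen_lt continuous_const continuous_norm).inter (isOpen_lt continuous_norm continuous_const)

omit hR0 hR in
theorem self_mem_annulus {z : ℂ} (hz : z ≠ 0) : z ∈ {X : ℂ | ‖z‖ / 2 < ‖X‖ ∧ ‖X‖ < 2 * ‖z‖} := by
  have hz' := norm_pos_iff.mpr hz
  constructor <;> linarith

theorem appell_term_differentiableOn (c z : ℂ) (n : ℤ) : DifferentiableOn ℂ
    (fun X => (-1) ^ n * (R ^ 3) ^ (n * (n - 1)) * c ^ n * thQuotShift R n X)
    {X : ℂ | ‖z‖ / 2 < ‖X‖ ∧ ‖X‖ < 2 * ‖z‖} :=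
  ((thQuotShift_differentiableOn hR0 hR n).mono fun X hX => norm_pos_iff.mp
    (lt_of_le_of_lt (by positivity) hX.1)).const_mul _

theorem appell_summable {c X : ℂ} (hc : c ≠ 0) (hX : X ≠ 0) : Summable fun n : ℤ =>
    (-1) ^ n * (R ^ 3) ^ (n * (n - 1)) * c ^ n * thQuotShift R n X := by
  obtain ⟨u, hu, hb⟩ := appell_term_bound hR0 hR hc hX
  exact Summable.of_norm_bounded hu fun n => hb n X (self_mem_annulus hX)

theorem appell_differentiableAt {c X : ℂ} (hc : c ≠ 0) (hX : X ≠ 0) :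
    DifferentiableAt ℂ (appell R c) X := by
  obtain ⟨u, hu, hb⟩ := appell_term_bound hR0 hR hc hX
  exact (Complex.differentiableOn_tsum_of_summable_norm hu
    (appell_term_differentiableOn hR0 hR c X) (isOpen_annulus X) hb).differentiableAt
    ((isOpen_annulus X).mem_nhds (self_mem_annulus hX))

omit hR in
theorem appell_eq {c X : ℂ} (hX : X ≠ 0) (h : ∀ n : ℤ, X * (R ^ 2) ^ n ≠ 1) : appell R c X =
    th R X * ∑' n : ℤ, (-1) ^ n * (R ^ 3) ^ (n * (n - 1)) * c ^ n / (1 - X * (R ^ 2) ^ n) := by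
  rw [appell, ← tsum_mul_left]
  refine tsum_congr fun n => ?_
  have h1 : 1 - X * (R ^ 2) ^ n ≠ 0 := sub_ne_zero.mpr (h n).symm
  rw [← one_sub_mul_thQuotShift hR0 hX n]
  field_simp

omit hR0 in
theorem sq_zpow_ne_one {n : ℤ} (hn : n ≠ 0) : (R ^ 2) ^ n ≠ 1 := by
  intro h
  have h1 := congrArg norm h
  rw [norm_zpow, norm_one] at h1
  exact (zpow_eq_one_iff_right₀ (norm_nonneg _)
    (norm_sq_lt_one hR).ne).not.mpr hn h1

theorem thQuotShift_one (n : ℤ) : thQuotShift R n 1 = if n = 0 then -thDeriv R 1 else 0 := by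
  split_ifs with hn
  · rw [hn, thQuotShift_zero, thQuot_one hR0 hR]
  · have h := one_sub_mul_thQuotShift hR0 one_ne_zero n
    rw [th_one, one_mul] at h
    exact (mul_eq_zero.mp h).resolve_left (sub_ne_zero.mpr (sq_zpow_ne_one hR hn).symm)

theorem appell_one (c : ℂ) : appell R c 1 = -thDeriv R 1 := by
  rw [appell, tsum_eq_single 0 fun n hn => by rw [thQuotShift_one hR0 hR, if_neg hn, mul_zero],
    thQuotShift_one hR0 hR]
  simp

omit hR0 hR in
theorem thQuot_inv {X : ℂ} (hX : X ≠ 0) : thQuot R X⁻¹ = thQuot R X := by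
  by_cases h : X = 1
  · rw [h, inv_one]
  have h1 : (1 : ℂ) - X ≠ 0 := sub_ne_zero.mpr (Ne.symm h)
  have h2 := one_sub_mul_thQuot (R := R) X⁻¹
  rw [th_inv hX, ← one_sub_mul_thQuot X] at h2
  apply mul_left_cancel₀ h1
  linear_combination -X * h2 - (thQuot R X⁻¹ - (1 - X) * thQuot R X) * mul_inv_cancel₀ hX

theorem thQuot_deriv_one : deriv (thQuot R) 1 = 0 := by
  have hd : HasDerivAt (thQuot R) (deriv (thQuot R) 1) 1 :=
    ((thQuot_differentiableOn hR0 hR).differentiableAt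
      (isOpen_compl_singleton.mem_nhds (by simp))).hasDerivAt
  have hi : HasDerivAt (fun X : ℂ => X⁻¹) (-1) 1 := by simpa using hasDerivAt_inv (one_ne_zero (α := ℂ))
  have h1 : HasDerivAt (fun X => thQuot R X⁻¹) (deriv (thQuot R) 1 * -1) 1 :=
    HasDerivAt.comp (h₂ := thQuot R) (1 : ℂ) (by simpa using hd) hi
  have h2 : HasDerivAt (thQuot R) (deriv (thQuot R) 1 * -1) 1 :=
    h1.congr_of_eventuallyEq ((isOpen_compl_singleton (x := (0:ℂ))).mem_nhds (by simp) |>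
      Filter.mem_of_superset <| fun X hX => (thQuot_inv hX).symm)
  have := hd.unique h2
  linear_combination this / 2

theorem thQuotShift_deriv_one (n : ℤ) : deriv (thQuotShift R n) 1 =
    if n = 0 then 0 else thDeriv R 1 / (1 - (R ^ 2) ^ n) := by
  split_ifs with hn
  · rw [hn, show thQuotShift R 0 = thQuot R from funext thQuotShift_zero, thQuot_deriv_one hR0 hR]
  · have h1 : 1 - (R ^ 2) ^ n ≠ 0 := sub_ne_zero.mpr (sq_zpow_ne_one hR hn).symm
    have hd : HasDerivAt (thQuotShift R n) (deriv (thQuotShift R n) 1) 1 :=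
      ((thQuotShift_differentiableOn hR0 hR n).differentiableAt
        (isOpen_compl_singleton.mem_nhds (by simp))).hasDerivAt
    have hl : HasDerivAt (fun X : ℂ => 1 - X * (R ^ 2) ^ n) (-(1 * (R ^ 2) ^ n)) 1 :=
      ((hasDerivAt_id (1 : ℂ)).mul_const _).const_sub 1
    have h2 := hl.mul hd
    rw [thQuotShift_one hR0 hR, if_neg hn, mul_zero, zero_add, one_mul] at h2
    have h3 := th_hasDerivAt hR0 hR one_ne_zero
    have h4 := h2.congr_of_eventuallyEq (f₁ := th R)
      ((isOpen_compl_singleton (x := (0:ℂ))).mem_nhds (by simp) |>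
      Filter.mem_of_superset <| fun X hX => (one_sub_mul_thQuotShift hR0 hX n).symm)
    have h5 := h3.unique h4
    rw [inv_one, one_mul] at h5
    rw [h5, mul_div_cancel_left₀ _ h1]

theorem appell_hasDerivAt_one {c : ℂ} (hc : c ≠ 0) : HasDerivAt (appell R c)
    (thDeriv R 1 * ∑' n : ℤ, if n = 0 then 0 else
      (-1) ^ n * (R ^ 3) ^ (n * (n - 1)) * c ^ n / (1 - (R ^ 2) ^ n)) 1 := by
  obtain ⟨u, hu, hb⟩ := appell_term_bound hR0 hR hc one_ne_zero
  have h := Complex.hasSum_deriv_of_summable_norm hu (appell_term_differentiableOn hR0 hR c 1)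
    (isOpen_annulus 1) hb (self_mem_annulus one_ne_zero)
  refine HasDerivAt.congr_deriv (appell_differentiableAt hR0 hR hc one_ne_zero).hasDerivAt ?_
  rw [show appell R c = fun X => ∑' n : ℤ, (-1) ^ n * (R ^ 3) ^ (n * (n - 1)) * c ^ n *
    thQuotShift R n X from rfl, ← h.tsum_eq, ← tsum_mul_left]
  refine tsum_congr fun n => ?_
  rw [deriv_const_mul_field, thQuotShift_deriv_one hR0 hR]
  split_ifs
  · simp
  · ring

theorem appell_mul_sq {c X : ℂ} (hc : c ≠ 0) (hX : X ≠ 0) : appell R c (R ^ 2 * X) =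
    c⁻¹ * R ^ 6 * (X ^ 2 * appell R c X + th R X * (X * th (R ^ 3) (c / R ^ 2) +
      th (R ^ 3) (c / R ^ 4) + X⁻¹ * th (R ^ 3) (c / R ^ 6))) := by
  have hs : ∀ k : ℕ, HasSum (fun n : ℤ => (-1) ^ n * (R ^ 3) ^ (n * (n - 1)) * (c / R ^ k) ^ n)
      (th (R ^ 3) (c / R ^ k)) := fun k =>
    (summable_norm_th (pow_ne_zero 3 hR0) (norm_cube_lt_one hR)
      (div_ne_zero hc (pow_ne_zero k hR0))).of_norm.hasSum
  have h0 := (appell_summable hR0 hR hc hX).hasSum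
  have h1 := ((h0.mul_left (X ^ 2)).add (((((hs 2).mul_left X).add (hs 4)).add
    ((hs 6).mul_left X⁻¹)).mul_left (th R X))).mul_left (c⁻¹ * R ^ 6)
  rw [appell, ← (Equiv.subRight (1 : ℤ)).tsum_eq]
  refine Eq.trans (tsum_congr fun n => ?_) h1.tsum_eq
  have hQ : R ^ (2 * n) ≠ 0 := zpow_ne_zero _ hR0
  have e : ∀ k : ℕ, (c / R ^ (2 * k)) ^ n = c ^ n * (R ^ (2 * n))⁻¹ ^ k := by
    intro k
    rw [div_zpow, div_eq_mul_inv, ← zpow_natCast R, ← zpow_mul, ← zpow_neg, ← zpow_natCast,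
      ← zpow_neg, ← zpow_mul]
    congr 2; push_cast; ring
  rw [show (R ^ 2 : ℂ) = R ^ (2 * 1) by norm_num, show (R ^ 4 : ℂ) = R ^ (2 * 2) by norm_num,
    show c / R ^ 6 = c / R ^ (2 * 3) by norm_num, e, e, e, mul_one]
  simp only [Equiv.subRight_apply]
  rw [thQuotShift_succ hR0 hX, sub_add_cancel, ← one_sub_mul_thQuotShift hR0 hX n,
    sq_zpow, show (-1 : ℂ) ^ (n - 1) = -(-1) ^ n by
      rw [← neg_eq_iff_eq_neg, ← neg_one_zpow_add_one]; congr 1; ring,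
    show (n - 1) * (n - 1 - 1) = n * (n - 1) + (-2 * n + 2) by ring,
    zpow_add₀ (pow_ne_zero 3 hR0), zpow_sub_one₀ hc]
  have e2 : (R ^ 3) ^ (-2 * n + 2) = R ^ 6 * (R ^ (2 * n))⁻¹ ^ 3 := by
    rw [← zpow_natCast, ← zpow_natCast, ← zpow_natCast, ← zpow_mul, ← zpow_neg, ← zpow_mul,
      ← zpow_add₀ hR0]
    congr 1; push_cast; ring
  rw [e2]
  field_simp
  ring
end

/-- A holomorphic function on `ℂ \ {0}` invariant under multiplication by `Q` is constant. -/
theorem eq_of_mul_invariant {f : ℂ → ℂ} {Q : ℂ} (hQ0 : Q ≠ 0) (hQ : ‖Q‖ < 1)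
    (hf : ∀ z ≠ 0, DifferentiableAt ℂ f z) (h : ∀ z ≠ 0, f (Q * z) = f z) {z w : ℂ}
    (hz : z ≠ 0) (hw : w ≠ 0) : f z = f w := by
  have hQ' : 0 < ‖Q‖ := norm_pos_iff.mpr hQ0
  have hn : ∀ (n : ℕ) (z : ℂ), z ≠ 0 → f (Q ^ n * z) = f z := by
    intro n
    induction n with
    | zero => intro z _; simp
    | succ n ih =>
      intro z hz
      rw [pow_succ', mul_assoc, h _ (mul_ne_zero (pow_ne_zero n hQ0) hz), ih z hz]
  have hg : Differentiable ℂ (f ∘ Complex.exp) := fun s =>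
    (hf _ (Complex.exp_ne_zero s)).comp s Complex.differentiableAt_exp
  set K : Set ℂ := Metric.closedBall 0 1 ∩ {X | ‖Q‖ ≤ ‖X‖} with hK
  have hKc : IsCompact K := (isCompact_closedBall _ _).inter_right
    (isClosed_le continuous_const continuous_norm)
  have hK0 : K ⊆ {0}ᶜ := fun X hX => norm_pos_iff.mp (hQ'.trans_le hX.2)
  obtain ⟨B, hB⟩ := hKc.exists_bound_of_continuousOn (f := f) fun X hX =>
    (hf X (hK0 hX)).continuousAt.continuousWithinAt
  have hb : Bornology.IsBounded (Set.range (f ∘ Complex.exp)) := by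
    refine isBounded_iff_forall_norm_le.mpr ⟨B, ?_⟩
    rintro _ ⟨s, rfl⟩
    set z := Complex.exp s with hzs
    have hz : z ≠ 0 := Complex.exp_ne_zero s
    have hz' : 0 < ‖z‖ := norm_pos_iff.mpr hz
    obtain ⟨n, hn1, hn2⟩ := exists_mem_Ioc_zpow hz' (one_lt_inv₀ hQ' |>.mpr hQ)
    have hmem : Q ^ (n + 1) * z ∈ K := by
      have e : ‖Q ^ (n + 1) * z‖ = ‖z‖ / (‖Q‖⁻¹) ^ (n + 1) := by
        rw [norm_mul, norm_zpow, inv_zpow, div_inv_eq_mul, mul_comm]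
      have hp : 0 < ‖Q‖⁻¹ ^ (n + 1) := zpow_pos (inv_pos.mpr hQ') _
      refine ⟨?_, ?_⟩
      · rw [mem_closedBall_zero_iff, e, div_le_one hp]; exact hn2
      · show ‖Q‖ ≤ _
        rw [e, le_div_iff₀ hp, zpow_add_one₀ (inv_pos.mpr hQ').ne']
        rw [show ‖Q‖ * (‖Q‖⁻¹ ^ n * ‖Q‖⁻¹) = ‖Q‖⁻¹ ^ n * (‖Q‖ * ‖Q‖⁻¹) by ring,
          mul_inv_cancel₀ hQ'.ne', mul_one]
        exact hn1.le
    show ‖f z‖ ≤ B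
    obtain ⟨m, hm | hm⟩ := (n + 1).eq_nat_or_neg
    · rw [hm, zpow_natCast] at hmem
      rw [← hn m z hz]; exact hB _ hmem
    · have : f z = f (Q ^ (n + 1) * z) := by
        rw [← hn m (Q ^ (n + 1) * z) (mul_ne_zero (zpow_ne_zero _ hQ0) hz), hm, zpow_neg,
          zpow_natCast, mul_inv_cancel_left₀ (pow_ne_zero m hQ0)]
      rw [this]; exact hB _ hmem
  have key := hg.apply_eq_apply_of_bounded hb (Complex.log z) (Complex.log w)
  simpa [Complex.exp_log hz, Complex.exp_log hw] using key

section
variable {R : ℂ} (hR0 : R ≠ 0) (hR : ‖R‖ < 1)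
include hR0 

theorem th_sq_mul_inv {X : ℂ} (hX : X ≠ 0) : th R (R ^ 2 * X⁻¹) = th R X := by
  rw [th_mul_sq hR0 (inv_ne_zero hX), th_inv hX, inv_inv]
  field_simp

include hR

/-- The elliptic combination of Appell series whose poles cancel. -/
noncomputable def appellComb (R κ w z : ℂ) : ℂ :=
  th R z * th R (z * w) * appell R (R ^ 6 * (w ^ 3)⁻¹) (z / w) +
    w ^ 3 * (th R z * th R (z / w) * appell R (R ^ 6 * w ^ 3) (z * w)) -
    κ * (th R (z / w) * th R (z * w) * appell R (R ^ 6) z)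

theorem appellComb_mul_sq {κ w z : ℂ} (hw : w ≠ 0) (hz : z ≠ 0) (hθ : th R w ≠ 0)
    (hκ : κ * th R w = w * th R (w ^ 2)) :
    appellComb R κ w (R ^ 2 * z) = appellComb R κ w z := by
  have hR3 : R ^ 3 ≠ 0 := pow_ne_zero 3 hR0
  have hw3 : w ^ 3 ≠ 0 := pow_ne_zero 3 hw
  have hc1 : R ^ 6 * (w ^ 3)⁻¹ ≠ 0 := mul_ne_zero (pow_ne_zero 6 hR0) (inv_ne_zero hw3)
  have hc2 : R ^ 6 * w ^ 3 ≠ 0 := mul_ne_zero (pow_ne_zero 6 hR0) hw3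
  have r : ∀ {X : ℂ}, X ≠ 0 → th (R ^ 3) (R ^ 6 * X⁻¹) = th (R ^ 3) X := by
    intro X hX
    rw [← th_sq_mul_inv hR3 hX]; congr 1; ring
  have e1 : R ^ 6 * (w ^ 3)⁻¹ / R ^ 2 = R ^ 6 * (R ^ 2 * w ^ 3)⁻¹ := by field_simp
  have e2 : R ^ 6 * (w ^ 3)⁻¹ / R ^ 4 = R ^ 6 * (R ^ 4 * w ^ 3)⁻¹ := by field_simp
  have e3 : R ^ 6 * (w ^ 3)⁻¹ / R ^ 6 = (w ^ 3)⁻¹ := by field_simp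
  have e4 : R ^ 6 * w ^ 3 / R ^ 2 = R ^ 4 * w ^ 3 := by field_simp
  have e5 : R ^ 6 * w ^ 3 / R ^ 4 = R ^ 2 * w ^ 3 := by field_simp
  have e6 : R ^ 6 * w ^ 3 / R ^ 6 = w ^ 3 := by field_simp
  have e7 : R ^ 6 / R ^ 2 = R ^ 6 * (R ^ 2)⁻¹ := by field_simp
  have e8 : R ^ 6 / R ^ 4 = R ^ 2 := by field_simp
  have e9 : R ^ 6 / R ^ 6 = 1 := by field_simp
  have hq := quintuple hR0 hR hw
  have hκ2 : κ * th (R ^ 3) (R ^ 2) =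
      w * (w * th (R ^ 3) (R ^ 4 * w ^ 3) + th (R ^ 3) (R ^ 2 * w ^ 3)) := by
    apply mul_right_cancel₀ hθ
    linear_combination th (R ^ 3) (R ^ 2) * hκ + w * hq
  unfold appellComb
  rw [mul_assoc (R ^ 2), mul_div_assoc (R ^ 2), appell_mul_sq hR0 hR hc1 (div_ne_zero hz hw),
    appell_mul_sq hR0 hR hc2 (mul_ne_zero hz hw), appell_mul_sq hR0 hR (pow_ne_zero 6 hR0) hz,
    th_mul_sq hR0 hz, th_mul_sq hR0 (mul_ne_zero hz hw), th_mul_sq hR0 (div_ne_zero hz hw),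
    e1, e2, e3, e4, e5, e6, e7, e8, e9, th_one, th_inv hw3,
    r (mul_ne_zero (pow_ne_zero 2 hR0) hw3), r (mul_ne_zero (pow_ne_zero 4 hR0) hw3),
    r (pow_ne_zero 2 hR0)]
  generalize th (R ^ 3) (R ^ 4 * w ^ 3) = a at *
  generalize th (R ^ 3) (R ^ 2 * w ^ 3) = b at *
  generalize th (R ^ 3) (w ^ 3) = d at *
  generalize th (R ^ 3) (R ^ 2) = J at *
  clear hq hκ
  field_simp
  linear_combination (-(z ^ 2 + z) * (th R z * th R (z * w) * th R (z / w))) * hκ2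

theorem appellComb_differentiableAt {κ w z : ℂ} (hw : w ≠ 0) (hz : z ≠ 0) :
    DifferentiableAt ℂ (appellComb R κ w) z := by
  have hR6 : R ^ 6 ≠ 0 := pow_ne_zero 6 hR0
  have hw3 : w ^ 3 ≠ 0 := pow_ne_zero 3 hw
  have t1 := (th_hasDerivAt hR0 hR hz).differentiableAt
  have t2 : DifferentiableAt ℂ (fun z => th R (z * w)) z :=
    (th_hasDerivAt hR0 hR (mul_ne_zero hz hw)).differentiableAt.comp z
      (f := fun z => z * w) (by fun_prop)
  have t3 : DifferentiableAt ℂ (fun z => th R (z / w)) z :=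
    (th_hasDerivAt hR0 hR (div_ne_zero hz hw)).differentiableAt.comp z
      (f := fun z => z / w) (by fun_prop)
  have s1 := appell_differentiableAt hR0 hR hR6 hz
  have s2 : DifferentiableAt ℂ (fun z => appell R (R ^ 6 * w ^ 3) (z * w)) z :=
    (appell_differentiableAt hR0 hR (mul_ne_zero hR6 hw3) (mul_ne_zero hz hw)).comp z
      (f := fun z => z * w) (by fun_prop)
  have s3 : DifferentiableAt ℂ (fun z => appell R (R ^ 6 * (w ^ 3)⁻¹) (z / w)) z :=
    (appell_differentiableAt hR0 hR (mul_ne_zero hR6 (inv_ne_zero hw3)) (div_ne_zero hz hw)).comp z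
      (f := fun z => z / w) (by fun_prop)
  exact (((t1.mul t2).mul s3).add (((t1.mul t3).mul s2).const_mul _)).sub
    (((t3.mul t2).mul s1).const_mul _)

theorem appellComb_eq {κ w z : ℂ} (hw : w ≠ 0) (hz : z ≠ 0) (hθ : th R w ≠ 0)
    (hκ : κ * th R w = w * th R (w ^ 2)) :
    appellComb R κ w z = -thDeriv R 1 * (th R w * th R (w ^ 2)) := by
  rw [eq_of_mul_invariant (pow_ne_zero 2 hR0) (norm_sq_lt_one hR)
    (fun z hz => appellComb_differentiableAt hR0 hR hw hz)
    (fun z hz => appellComb_mul_sq hR0 hR hw hz hθ hκ) hz hw, appellComb, div_self hw, th_one,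
    appell_one hR0 hR]
  ring_nf

/-- The coefficient sequence of the level-three Appell series. -/
noncomputable def cubeCoeff (R c : ℂ) (n : ℤ) : ℂ := (-1) ^ n * (R ^ 3) ^ (n * (n - 1)) * c ^ n

/-- Atkin and Swinnerton-Dyer's three-term identity. -/
theorem appell_sum_eq {κ w z : ℂ} (hw : w ≠ 0) (hz : z ≠ 0) (hθ : th R w ≠ 0)
    (hκ : κ * th R w = w * th R (w ^ 2)) (h1 : ∀ n : ℤ, z * (R ^ 2) ^ n ≠ 1)
    (h2 : ∀ n : ℤ, z / w * (R ^ 2) ^ n ≠ 1) (h3 : ∀ n : ℤ, z * w * (R ^ 2) ^ n ≠ 1) :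
    ∑' n : ℤ, cubeCoeff R (R ^ 6 * (w ^ 3)⁻¹) n / (1 - z / w * (R ^ 2) ^ n) +
      w ^ 3 * ∑' n : ℤ, cubeCoeff R (R ^ 6 * w ^ 3) n / (1 - z * w * (R ^ 2) ^ n) -
      κ * ∑' n : ℤ, cubeCoeff R (R ^ 6) n / (1 - z * (R ^ 2) ^ n) =
    -thDeriv R 1 * (th R w * th R (w ^ 2)) / (th R z * th R (z / w) * th R (z * w)) := by
  have h := appellComb_eq hR0 hR hw hz hθ hκ
  have g1 := th_ne_zero hR0 hR hz h1
  have g2 := th_ne_zero hR0 hR (div_ne_zero hz hw) h2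
  have g3 := th_ne_zero hR0 hR (mul_ne_zero hz hw) h3
  rw [appellComb, appell_eq hR0 hz h1, appell_eq hR0 (div_ne_zero hz hw) h2,
    appell_eq hR0 (mul_ne_zero hz hw) h3] at h
  rw [eq_div_iff (mul_ne_zero (mul_ne_zero g1 g2) g3), ← h]
  unfold cubeCoeff
  ring

/-- The limiting case of the three-term identity. -/
theorem appell_sum_eq_limit {κ w : ℂ} (hw : w ≠ 0) (hθ : th R w ≠ 0) (hd : thDeriv R 1 ≠ 0)
    (hκ : κ * th R w = w * th R (w ^ 2)) (h1 : ∀ n : ℤ, w * (R ^ 2) ^ n ≠ 1)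
    (h2 : ∀ n : ℤ, w * w * (R ^ 2) ^ n ≠ 1) :
    (∑' n : ℤ, if n = 0 then 0 else cubeCoeff R (R ^ 6 * (w ^ 3)⁻¹) n / (1 - (R ^ 2) ^ n)) +
      w ^ 3 * ∑' n : ℤ, cubeCoeff R (R ^ 6 * w ^ 3) n / (1 - w * w * (R ^ 2) ^ n) -
      κ * ∑' n : ℤ, cubeCoeff R (R ^ 6) n / (1 - w * (R ^ 2) ^ n) =
    thLog R w + thLog R (w * w) := by
  have hR6 : R ^ 6 ≠ 0 := pow_ne_zero 6 hR0
  have hw3 : w ^ 3 ≠ 0 := pow_ne_zero 3 hw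
  have hww := mul_ne_zero hw hw
  have g1 := th_ne_zero hR0 hR hw h1
  have g2 := th_ne_zero hR0 hR hww h2
  have t1 := th_hasDerivAt hR0 hR hw
  have t2 : HasDerivAt (fun z => th R (z * w)) ((w * w)⁻¹ * thDeriv R (w * w) * (1 * w)) w :=
    HasDerivAt.comp (h₂ := th R) w (th_hasDerivAt hR0 hR hww) ((hasDerivAt_id w).mul_const w)
  have t3 : HasDerivAt (fun z => th R (z / w)) (thDeriv R 1 * (1 / w)) w :=
    HasDerivAt.comp (h₂ := th R) w (by
      simpa [div_self hw] using th_hasDerivAt hR0 hR one_ne_zero) ((hasDerivAt_id w).div_const w)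
  have s1 := (appell_differentiableAt hR0 hR hR6 hw).hasDerivAt
  have s2 : HasDerivAt (fun z => appell R (R ^ 6 * w ^ 3) (z * w))
      (deriv (appell R (R ^ 6 * w ^ 3)) (w * w) * (1 * w)) w :=
    HasDerivAt.comp (h₂ := appell R (R ^ 6 * w ^ 3)) w
      (appell_differentiableAt hR0 hR (mul_ne_zero hR6 hw3) hww).hasDerivAt
      ((hasDerivAt_id w).mul_const w)
  have hs := appell_hasDerivAt_one hR0 hR (mul_ne_zero hR6 (inv_ne_zero hw3))
  unfold cubeCoeff
  generalize (∑' n : ℤ, if n = 0 then (0 : ℂ) else _) = A at *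
  have s3 : HasDerivAt (fun z => appell R (R ^ 6 * (w ^ 3)⁻¹) (z / w))
      (thDeriv R 1 * A * (1 / w)) w :=
    HasDerivAt.comp (h₂ := appell R (R ^ 6 * (w ^ 3)⁻¹)) w (by
      show HasDerivAt _ _ (w / w)
      rw [div_self hw]
      exact hs) ((hasDerivAt_id w).div_const w)
  have H := (((t1.mul t2).mul s3).add (((t1.mul t3).mul s2).const_mul (w ^ 3))).sub
    (((t3.mul t2).mul s1).const_mul κ)
  have H0 := (hasDerivAt_const w (-thDeriv R 1 * (th R w * th R (w ^ 2)))).congr_of_eventuallyEq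
    (f₁ := appellComb R κ w) ((isOpen_compl_singleton (x := (0:ℂ))).mem_nhds hw |>
      Filter.mem_of_superset <| fun z hz => appellComb_eq hR0 hR hw hz hθ hκ)
  have h := H0.unique H
  simp only [div_self hw, th_one, appell_one hR0 hR, mul_zero, zero_mul, add_zero, Pi.mul_apply] at h
  rw [appell_eq hR0 hw h1, appell_eq hR0 hww h2] at h
  unfold thLog
  generalize (∑' n : ℤ, _ / (1 - w * w * (R ^ 2) ^ n)) = B at *
  generalize (∑' n : ℤ, _ / (1 - w * (R ^ 2) ^ n)) = C at *
  rw [← sq] at g2 ⊢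
  field_simp at h ⊢
  apply mul_left_cancel₀ hd
  linear_combination -h
end

theorem tsum_int_eq_sum_residues {f : ℤ → ℂ} (hf : Summable f) (c : ℤ) :
    ∑' n, f n = ∑ i ∈ Finset.range 11, ∑' N : ℤ, f (11 * N + (i + c)) := by
  obtain ⟨e, he⟩ : ∃ e : Fin 11 × ℤ ≃ ℤ, ∀ p, e p = 11 * p.2 + (((p.1 : ℕ) : ℤ) + c) :=
    ⟨((Equiv.prodComm _ _).trans (Int.divModEquiv 11).symm).trans (Equiv.addRight c), fun p => by
      show p.2 * ((11 : ℕ) : ℤ) + ((p.1 : ℕ) : ℤ) + c = _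
      push_cast; ring⟩
  have hs := e.summable_iff.mpr hf
  rw [← e.tsum_eq f, ← Fin.sum_univ_eq_sum_range (fun i => ∑' N : ℤ, f (11 * N + (i + c)))]
  have h2 : f ∘ e = fun p => f (11 * p.2 + (((p.1 : ℕ) : ℤ) + c)) := by
    funext p; exact congrArg f (he p)
  rw [h2] at hs
  simp only [he]
  rw [hs.tsum_prod, tsum_fintype]

/-- The theta constants attached to the residue `k` modulo `11`, normalized to be odd in `k`. -/
noncomputable def thx (ρ : ℂ) (k : ℤ) : ℂ := ρ ^ (k * (k - 11)) * th (ρ ^ 121) ((ρ ^ 22) ^ k)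

/-- Logarithmic derivatives of the theta function at the points `ρ ^ (22 k)`. -/
noncomputable def lam (ρ : ℂ) (k : ℤ) : ℂ := thLog (ρ ^ 121) ((ρ ^ 22) ^ k)

section
variable {ρ : ℂ} (h0 : ρ ≠ 0) (h1 : ‖ρ‖ < 1)
include h0

omit h0 in
theorem sq_pow_eq (n : ℤ) : ((ρ ^ 121) ^ 2) ^ n = (ρ ^ 22) ^ (11 * n) := by
  rw [← pow_mul, ← zpow_natCast, ← zpow_natCast, ← zpow_mul, ← zpow_mul]
  congr 1; push_cast; ring

theorem thx_neg (k : ℤ) : thx ρ (-k) = -thx ρ k := by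
  have hy : (ρ ^ 22) ^ k ≠ 0 := zpow_ne_zero _ (pow_ne_zero _ h0)
  unfold thx
  rw [zpow_neg, th_inv hy, show -k * (-k - 11) = k * (k - 11) + 22 * k by ring, zpow_add₀ h0,
    zpow_mul ρ 22]
  rw [show ρ ^ (22 : ℤ) = ρ ^ 22 by norm_cast]
  field_simp

theorem thx_add_eleven (k : ℤ) : thx ρ (k + 11) = -thx ρ k := by
  have hy : (ρ ^ 22) ^ k ≠ 0 := zpow_ne_zero _ (pow_ne_zero _ h0)
  unfold thx
  rw [show (ρ ^ 22) ^ (k + 11) = (ρ ^ 121) ^ 2 * (ρ ^ 22) ^ k by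
    rw [zpow_add₀ (pow_ne_zero _ h0), mul_comm]; congr 1; norm_cast; ring,
    th_mul_sq (pow_ne_zero _ h0) hy, show (k + 11) * (k + 11 - 11) = k * (k - 11) + 22 * k by ring,
    zpow_add₀ h0, zpow_mul ρ 22]
  rw [show ρ ^ (22 : ℤ) = ρ ^ 22 by norm_cast]
  field_simp

theorem thx_eleven_sub (k : ℤ) : thx ρ (11 - k) = thx ρ k := by
  rw [show 11 - k = -k + 11 by ring, thx_add_eleven h0, thx_neg h0, neg_neg]

theorem thx_mul_eq_wf (a b : ℤ) : thx ρ (a + b) * thx ρ (a - b) =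
    ρ ^ (2 * (a * a) + 2 * (b * b)) * wf (ρ ^ 121) ((ρ ^ 22) ^ a) ((ρ ^ 22) ^ b) := by
  have hy : ρ ^ 22 ≠ 0 := pow_ne_zero _ h0
  unfold thx wf
  rw [zpow_add₀ hy, zpow_sub₀ hy]
  have e : ρ ^ ((a + b) * (a + b - 11)) * ρ ^ ((a - b) * (a - b - 11)) =
      ρ ^ (2 * (a * a) + 2 * (b * b)) * ((ρ ^ 22) ^ a)⁻¹ := by
    rw [← zpow_add₀ h0, ← zpow_neg, ← zpow_natCast, ← zpow_mul, ← zpow_add₀ h0]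
    congr 1; push_cast; ring
  linear_combination (th (ρ ^ 121) ((ρ ^ 22) ^ a * (ρ ^ 22) ^ b) *
    th (ρ ^ 121) ((ρ ^ 22) ^ a / (ρ ^ 22) ^ b)) * e

include h1

omit h0 in
theorem norm_pow_lt_one {n : ℕ} (hn : n ≠ 0) : ‖ρ ^ n‖ < 1 := by
  rw [norm_pow]; exact pow_lt_one₀ (norm_nonneg _) h1 hn

theorem thx_plucker (a b c d : ℤ) :
    thx ρ (a + b) * thx ρ (a - b) * (thx ρ (c + d) * thx ρ (c - d)) -
    thx ρ (a + c) * thx ρ (a - c) * (thx ρ (b + d) * thx ρ (b - d)) +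
    thx ρ (a + d) * thx ρ (a - d) * (thx ρ (b + c) * thx ρ (b - c)) = 0 := by
  have hy : ∀ k : ℤ, (ρ ^ 22) ^ k ≠ 0 := fun k => zpow_ne_zero _ (pow_ne_zero _ h0)
  have h := wf_plucker (pow_ne_zero 121 h0) (norm_pow_lt_one h1 (by norm_num)) (hy a) (hy b)
    (hy c) (hy d)
  simp only [thx_mul_eq_wf h0, zpow_add₀ h0]
  linear_combination (ρ ^ (2 * (a * a)) * ρ ^ (2 * (b * b)) * ρ ^ (2 * (c * c)) *
    ρ ^ (2 * (d * d))) * h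

theorem zpow_mul_sq_zpow_ne_one {k : ℤ} (hk : k % 11 ≠ 0) (n : ℤ) :
    (ρ ^ 22) ^ k * ((ρ ^ 121) ^ 2) ^ n ≠ 1 := by
  rw [sq_pow_eq, ← zpow_add₀ (pow_ne_zero _ h0)]
  intro h
  have h2 := congrArg norm h
  rw [norm_zpow, norm_one, zpow_eq_one_iff_right₀ (norm_nonneg _)
    (norm_pow_lt_one h1 (by norm_num)).ne] at h2
  omega

theorem thx_ne_zero {k : ℤ} (hk : k % 11 ≠ 0) : thx ρ k ≠ 0 :=
  mul_ne_zero (zpow_ne_zero _ h0) (th_ne_zero (pow_ne_zero _ h0) (norm_pow_lt_one h1 (by norm_num))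
    (zpow_ne_zero _ (pow_ne_zero _ h0)) (zpow_mul_sq_zpow_ne_one h0 h1 hk))

theorem lam_parallelogram {A C D : ℤ} (h₁ : (A + D) % 11 ≠ 0) (h₂ : (A - D) % 11 ≠ 0)
    (h₃ : (A + C) % 11 ≠ 0) (h₄ : (A - C) % 11 ≠ 0) :
    (lam ρ (A + D) + lam ρ (A - D) - lam ρ (A + C) - lam ρ (A - C)) *
      (thx ρ (A + D) * thx ρ (A - D) * (thx ρ (A + C) * thx ρ (A - C))) =
    -thDeriv (ρ ^ 121) 1 * thx ρ (2 * A) * (thx ρ (C + D) * thx ρ (C - D)) := by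
  have hy : ∀ k : ℤ, (ρ ^ 22) ^ k ≠ 0 := fun k => zpow_ne_zero _ (pow_ne_zero _ h0)
  have hth : ∀ k : ℤ, k % 11 ≠ 0 → th (ρ ^ 121) ((ρ ^ 22) ^ k) ≠ 0 := fun k hk =>
    th_ne_zero (pow_ne_zero _ h0) (norm_pow_lt_one h1 (by norm_num)) (hy k)
      (zpow_mul_sq_zpow_ne_one h0 h1 hk)
  have hy1 : ρ ^ 22 ≠ 0 := pow_ne_zero _ h0
  have h := thLog_parallelogram (pow_ne_zero 121 h0) (norm_pow_lt_one h1 (by norm_num)) (hy A)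
    (hy D) (hy C) (by rw [← zpow_add₀ hy1]; exact hth _ h₁)
    (by rw [← zpow_sub₀ hy1]; exact hth _ h₂)
    (by rw [← zpow_add₀ hy1]; exact hth _ h₃) (by rw [← zpow_sub₀ hy1]; exact hth _ h₄)
  rw [← zpow_add₀ hy1, ← zpow_sub₀ hy1, ← zpow_add₀ hy1, ← zpow_sub₀ hy1, ← zpow_add₀ hy1] at h
  simp only [thx_mul_eq_wf h0]
  have e : thx ρ (2 * A) = ρ ^ (4 * (A * A)) * (((ρ ^ 22) ^ A)⁻¹ * th (ρ ^ 121) ((ρ ^ 22) ^ (A + A))) := by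
    unfold thx
    rw [← two_mul, ← mul_assoc]
    congr 1
    rw [← zpow_neg, ← zpow_natCast, ← zpow_mul, ← zpow_add₀ h0]
    congr 1; push_cast; ring
  rw [e]
  simp only [zpow_add₀ h0]
  rw [show 4 * (A * A) = 2 * (A * A) + 2 * (A * A) by ring, zpow_add₀ h0]
  unfold lam
  linear_combination (ρ ^ (2 * (A * A)) * ρ ^ (2 * (A * A)) * ρ ^ (2 * (C * C)) *
    ρ ^ (2 * (D * D))) * h

theorem lam_neg {k : ℤ} (hk : k % 11 ≠ 0) : lam ρ (-k) = 1 - lam ρ k := by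
  have hy : (ρ ^ 22) ^ k ≠ 0 := zpow_ne_zero _ (pow_ne_zero _ h0)
  have hR := pow_ne_zero 121 h0
  have hR1 : ‖ρ ^ 121‖ < 1 := norm_pow_lt_one h1 (by norm_num)
  have ht := th_ne_zero hR hR1 hy (zpow_mul_sq_zpow_ne_one h0 h1 hk)
  unfold lam thLog
  rw [zpow_neg, th_inv hy, thDeriv_inv hR hR1 hy]
  field_simp
  ring

theorem lam_add_eleven {k : ℤ} (hk : k % 11 ≠ 0) : lam ρ (k + 11) = lam ρ k - 1 := by
  have hy : (ρ ^ 22) ^ k ≠ 0 := zpow_ne_zero _ (pow_ne_zero _ h0)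
  have hR := pow_ne_zero 121 h0
  have hR1 : ‖ρ ^ 121‖ < 1 := norm_pow_lt_one h1 (by norm_num)
  have ht := th_ne_zero hR hR1 hy (zpow_mul_sq_zpow_ne_one h0 h1 hk)
  unfold lam thLog
  rw [show (ρ ^ 22) ^ (k + 11) = (ρ ^ 121) ^ 2 * (ρ ^ 22) ^ k by
    rw [zpow_add₀ (pow_ne_zero _ h0), mul_comm]; congr 1; norm_cast; ring,
    th_mul_sq hR hy, thDeriv_mul_sq hR hR1 hy]
  field_simp

end

theorem neg_one_zpow_eleven_mul_add (N m : ℤ) : (-1 : ℂ) ^ (11 * N + m) = (-1) ^ N * (-1) ^ m := by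
  rw [show 11 * N + m = 2 * (5 * N) + (N + m) by ring, zpow_add₀ (by norm_num), zpow_mul,
    zpow_add₀ (by norm_num)]
  norm_num

theorem tsum_int_eq_sum_pairs {f : ℤ → ℂ} (hf : Summable f) {g : ℤ → ℂ} (m : ℤ)
    (hg : ∀ l, ∑' N : ℤ, f (11 * N + (m + l)) = g l) :
    ∑' n, f n = g 0 + (g 1 + g (-1)) + (g 2 + g (-2)) + (g 3 + g (-3)) + (g 4 + g (-4)) +
      (g 5 + g (-5)) := by
  have hi : ∀ i : ℕ, (i : ℤ) + (m - 5) = m + ((i : ℤ) - 5) := fun i => by ring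
  rw [tsum_int_eq_sum_residues hf (m - 5)]
  simp only [hi, hg, Finset.sum_range_succ, Finset.sum_range_zero]
  norm_num
  ring

section
variable {ρ : ℂ} (h0 : ρ ≠ 0) (h1 : ‖ρ‖ < 1)
include h0

theorem pentagonal_term (l N : ℤ) : (-1 : ℂ) ^ (11 * N + (2 + l)) * (ρ ^ 3) ^ ((11 * N + (2 + l)) *
    (11 * N + (2 + l) - 1)) * (ρ ^ 2) ^ (11 * N + (2 + l)) =
    (-1) ^ l * ρ ^ (10 + 11 * l + 3 * (l * l)) * ((-1) ^ N * ((ρ ^ 121) ^ 3) ^ (N * (N - 1)) *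
      ((ρ ^ 121) ^ 4 * ((ρ ^ 22) ^ l) ^ 3) ^ N) := by
  have e : (ρ ^ 3) ^ ((11 * N + (2 + l)) * (11 * N + (2 + l) - 1)) * (ρ ^ 2) ^ (11 * N + (2 + l)) =
      ρ ^ (10 + 11 * l + 3 * (l * l)) * (((ρ ^ 121) ^ 3) ^ (N * (N - 1)) *
      ((ρ ^ 121) ^ 4 * ((ρ ^ 22) ^ l) ^ 3) ^ N) := by
    rw [mul_zpow]
    simp only [← zpow_natCast, ← zpow_mul, ← zpow_add₀ h0]
    congr 1; push_cast; ring
  rw [neg_one_zpow_eleven_mul_add, zpow_add₀ (by norm_num) 2 l]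
  linear_combination ((-1) ^ N * (-1) ^ l) * e

theorem lambert_term (a l N : ℤ) : (-1 : ℂ) ^ (11 * N + (a + l)) *
    ρ ^ (3 * ((11 * N + (a + l)) * (11 * N + (a + l))) + (33 - 6 * a) * (11 * N + (a + l))) /
      (1 - (ρ ^ 22) ^ (11 * N + (a + l))) =
    (-1) ^ (a + l) * ρ ^ (3 * (l * l) - 3 * (a * a) + 33 * (a + l)) *
      (cubeCoeff (ρ ^ 121) ((ρ ^ 121) ^ 6 * ((ρ ^ 22) ^ l) ^ 3) N /
        (1 - (ρ ^ 22) ^ (a + l) * ((ρ ^ 121) ^ 2) ^ N)) := by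
  have e : ρ ^ (3 * ((11 * N + (a + l)) * (11 * N + (a + l))) +
      (33 - 6 * a) * (11 * N + (a + l))) = ρ ^ (3 * (l * l) - 3 * (a * a) + 33 * (a + l)) *
      (((ρ ^ 121) ^ 3) ^ (N * (N - 1)) * ((ρ ^ 121) ^ 6 * ((ρ ^ 22) ^ l) ^ 3) ^ N) := by
    rw [mul_zpow]
    simp only [← zpow_natCast, ← zpow_mul, ← zpow_add₀ h0]
    congr 1; push_cast; ring
  rw [neg_one_zpow_eleven_mul_add, sq_pow_eq, ← zpow_add₀ (pow_ne_zero _ h0), add_comm (a + l),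
    e, cubeCoeff]
  ring

include h1

/-- The contribution of the residues `2 ± k` to the pentagonal number series. -/
theorem pentagonal_pair {k : ℤ} (hk : k % 11 ≠ 0) :
    (-1) ^ k * ρ ^ (10 + 11 * k + 3 * (k * k)) *
      th ((ρ ^ 121) ^ 3) ((ρ ^ 121) ^ 4 * ((ρ ^ 22) ^ k) ^ 3) +
    (-1) ^ (-k) * ρ ^ (10 + 11 * -k + 3 * (-k * -k)) *
      th ((ρ ^ 121) ^ 3) ((ρ ^ 121) ^ 4 * ((ρ ^ 22) ^ (-k)) ^ 3) =
    ρ ^ 10 * th ((ρ ^ 121) ^ 3) ((ρ ^ 121) ^ 2) * ((-1) ^ k * thx ρ (2 * k) / thx ρ k) := by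
  have hR := pow_ne_zero 121 h0
  have hR1 : ‖ρ ^ 121‖ < 1 := norm_pow_lt_one h1 (by norm_num)
  have hy : (ρ ^ 22) ^ k ≠ 0 := zpow_ne_zero _ (pow_ne_zero _ h0)
  have ht := th_ne_zero hR hR1 hy (zpow_mul_sq_zpow_ne_one h0 h1 hk)
  have h2 := th_sq_mul_inv (R := (ρ ^ 121) ^ 3) (pow_ne_zero _ hR)
    (mul_ne_zero (pow_ne_zero 2 hR) (pow_ne_zero 3 hy))
  have hq := quintuple hR hR1 hy
  rw [show (ρ ^ 121) ^ 4 * ((ρ ^ 22) ^ (-k)) ^ 3 =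
    ((ρ ^ 121) ^ 3) ^ 2 * ((ρ ^ 121) ^ 2 * ((ρ ^ 22) ^ k) ^ 3)⁻¹ by
      rw [zpow_neg]; field_simp, h2, neg_one_zpow_neg]
  have e1 : ρ ^ (10 + 11 * k + 3 * (k * k)) =
      ρ ^ (10 + 11 * -k + 3 * (-k * -k)) * (ρ ^ 22) ^ k := by
    simp only [← zpow_natCast, ← zpow_mul, ← zpow_add₀ h0]
    congr 1; push_cast; ring
  have e2 : ρ ^ (2 * k * (2 * k - 11)) * ρ ^ 10 =
      ρ ^ (10 + 11 * -k + 3 * (-k * -k)) * ρ ^ (k * (k - 11)) := by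
    simp only [← zpow_natCast, ← zpow_add₀ h0]
    congr 1; push_cast; ring
  have hx := zpow_ne_zero (k * (k - 11)) h0
  unfold thx
  rw [mul_div_assoc', eq_div_iff (mul_ne_zero hx ht), e1,
    show (ρ ^ 22) ^ (2 * k) = ((ρ ^ 22) ^ k) ^ 2 by
      rw [mul_comm, zpow_mul]; norm_cast]
  linear_combination (-th ((ρ ^ 121) ^ 3) ((ρ ^ 121) ^ 2) * (-1) ^ k *
    th (ρ ^ 121) (((ρ ^ 22) ^ k) ^ 2)) * e2 -
    (-1) ^ k * ρ ^ (10 + 11 * -k + 3 * (-k * -k)) * ρ ^ (k * (k - 11)) * hq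

/-- The eleven-dissection factor of Euler's product. -/
noncomputable def pentFactor (ρ : ℂ) : ℂ :=
  1 - thx ρ 2 / thx ρ 1 + thx ρ 4 / thx ρ 2 - thx ρ 6 / thx ρ 3 + thx ρ 8 / thx ρ 4 -
    thx ρ 10 / thx ρ 5

theorem pentagonal_dissection : th (ρ ^ 3) (ρ ^ 2) =
    ρ ^ 10 * th ((ρ ^ 121) ^ 3) ((ρ ^ 121) ^ 2) * pentFactor ρ := by
  have hs := (summable_norm_th (pow_ne_zero 3 h0) (norm_pow_lt_one h1 (by norm_num))
    (pow_ne_zero 2 h0)).of_norm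
  have key : ∀ l : ℤ, ∑' N : ℤ, (-1 : ℂ) ^ (11 * N + (2 + l)) * (ρ ^ 3) ^ ((11 * N + (2 + l)) *
    (11 * N + (2 + l) - 1)) * (ρ ^ 2) ^ (11 * N + (2 + l)) =
    (-1) ^ l * ρ ^ (10 + 11 * l + 3 * (l * l)) *
      th ((ρ ^ 121) ^ 3) ((ρ ^ 121) ^ 4 * ((ρ ^ 22) ^ l) ^ 3) := fun l => by
    rw [th, ← tsum_mul_left]
    exact tsum_congr fun N => pentagonal_term h0 l N
  rw [th, tsum_int_eq_sum_pairs hs 2 key]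
  have p1 := pentagonal_pair h0 h1 (k := 1) (by norm_num)
  have p2 := pentagonal_pair h0 h1 (k := 2) (by norm_num)
  have p3 := pentagonal_pair h0 h1 (k := 3) (by norm_num)
  have p4 := pentagonal_pair h0 h1 (k := 4) (by norm_num)
  have p5 := pentagonal_pair h0 h1 (k := 5) (by norm_num)
  have p0 : (-1) ^ (0 : ℤ) * ρ ^ (10 + 11 * 0 + 3 * (0 * 0) : ℤ) *
      th ((ρ ^ 121) ^ 3) ((ρ ^ 121) ^ 4 * ((ρ ^ 22) ^ (0 : ℤ)) ^ 3) =
      ρ ^ 10 * th ((ρ ^ 121) ^ 3) ((ρ ^ 121) ^ 2) := by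
    have h2 := th_sq_mul_inv (R := (ρ ^ 121) ^ 3) (pow_ne_zero _ (pow_ne_zero _ h0))
      (pow_ne_zero 2 (pow_ne_zero 121 h0))
    rw [← h2]
    have : (ρ ^ 121) ^ 4 * ((ρ ^ 22) ^ (0 : ℤ)) ^ 3 = ((ρ ^ 121) ^ 3) ^ 2 * ((ρ ^ 121) ^ 2)⁻¹ := by
      field_simp
    rw [this]
    norm_num
  rw [p0, p1, p2, p3, p4, p5, pentFactor]
  norm_num
  ring

end

/-- The bilateral Lambert-type series `∑_{n ≠ 0} (-1) ^ n ρ ^ (3 n² + (33 - 6 a) n) / (1 - y ^ n)`,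
where `y = ρ ^ 22`. -/
noncomputable def lambert (ρ : ℂ) (a : ℤ) : ℂ :=
  ∑' n : ℤ, if n = 0 then 0 else
    (-1) ^ n * ρ ^ (3 * (n * n) + (33 - 6 * a) * n) / (1 - (ρ ^ 22) ^ n)

/-- The Lambert series over the multiples of `11` that generates a mock term. -/
noncomputable def mockTerm (ρ : ℂ) (a : ℤ) : ℂ :=
  ∑' n : ℤ, cubeCoeff (ρ ^ 121) ((ρ ^ 121) ^ 6) n / (1 - (ρ ^ 22) ^ a * ((ρ ^ 121) ^ 2) ^ n)

/-- The contribution of the residues `a ± k` to the theta part of `lambert ρ a`. -/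
noncomputable def lambertTheta (ρ : ℂ) (a k : ℤ) : ℂ :=
  if k = a then lam ρ a + lam ρ (2 * a) else
    -thDeriv (ρ ^ 121) 1 * ((-1) ^ (a + k) * thx ρ k * thx ρ (2 * k) /
      (thx ρ (a - k) * thx ρ a * thx ρ (a + k)))

theorem one_sub_norm_le_norm_one_sub_zpow {y : ℂ} (hy0 : y ≠ 0) (hy : ‖y‖ < 1) {n : ℤ}
    (hn : n ≠ 0) : 1 - ‖y‖ ≤ ‖1 - y ^ n‖ := by
  have pos : ∀ m : ℕ, m ≠ 0 → 1 - ‖y‖ ≤ ‖1 - y ^ m‖ := fun m hm => by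
    have h2 := norm_sub_norm_le 1 (y ^ m)
    have h3 := pow_le_of_le_one (norm_nonneg y) hy.le hm
    rw [norm_one, norm_pow] at h2
    linarith
  rcases le_total 0 n with h | h
  · lift n to ℕ using h
    rw [zpow_natCast]
    exact pos n (by exact_mod_cast hn)
  · obtain ⟨m, rfl⟩ : ∃ m : ℕ, n = -m := ⟨(-n).toNat, by omega⟩
    have hm : m ≠ 0 := by rintro rfl; simp at hn
    have hym : y ^ m ≠ 0 := pow_ne_zero _ hy0
    have e : 1 - y ^ (-(m : ℤ)) = -(y ^ m)⁻¹ * (1 - y ^ m) := by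
      rw [zpow_neg, zpow_natCast]; field_simp; ring
    rw [e, norm_mul, norm_neg, norm_inv]
    have h4 : ‖y ^ m‖ ≤ 1 := by rw [norm_pow]; exact pow_le_one₀ (norm_nonneg _) hy.le
    exact (pos m hm).trans (le_mul_of_one_le_left (norm_nonneg _)
      ((one_le_inv₀ (norm_pos_iff.mpr hym)).mpr h4))

section
variable {ρ : ℂ} (h0 : ρ ≠ 0) (h1 : ‖ρ‖ < 1)
include h0 h1

theorem summable_lambert (b : ℤ) : Summable fun n : ℤ => if n = 0 then 0 else
    (-1) ^ n * ρ ^ (3 * (n * n) + b * n) / (1 - (ρ ^ 22) ^ n) := by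
  have hy : ‖ρ ^ 22‖ < 1 := norm_pow_lt_one h1 (by norm_num)
  have hp : 0 < 1 - ‖ρ ^ 22‖ := sub_pos.mpr hy
  have hs := (summable_norm_gauss_quadratic h0 h1 one_ne_zero (a := 3) (by norm_num) b).div_const
    (1 - ‖ρ ^ 22‖)
  refine Summable.of_norm_bounded hs fun n => ?_
  split_ifs with hn
  · rw [norm_zero]; positivity
  · rw [norm_div, norm_mul, norm_neg_one_zpow, one_mul, one_zpow, mul_one]
    exact div_le_div_of_nonneg_left (norm_nonneg _) hp
      (one_sub_norm_le_norm_one_sub_zpow (pow_ne_zero _ h0) hy hn)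

/-- The two sums over `n ≡ a ± k` modulo `11`. -/
theorem lambert_pair {a k : ℤ} {S : ℤ → ℂ} (hd : thDeriv (ρ ^ 121) 1 ≠ 0) (ha : a % 11 ≠ 0)
    (hk : k % 11 ≠ 0) (hak : (a + k) % 11 ≠ 0) (hka : k ≠ a → (a - k) % 11 ≠ 0)
    (hS : ∀ l, S l = ∑' N : ℤ, if 11 * N + (a + l) = 0 then 0 else
      (-1) ^ (a + l) * ρ ^ (3 * (l * l) - 3 * (a * a) + 33 * (a + l)) *
      (cubeCoeff (ρ ^ 121) ((ρ ^ 121) ^ 6 * ((ρ ^ 22) ^ l) ^ 3) N /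
        (1 - (ρ ^ 22) ^ (a + l) * ((ρ ^ 121) ^ 2) ^ N))) :
    S k + S (-k) = (-1) ^ a * ρ ^ (33 * a - 3 * (a * a)) * mockTerm ρ a *
      ((-1) ^ k * thx ρ (2 * k) / thx ρ k) + lambertTheta ρ a k := by
  have hR := pow_ne_zero 121 h0
  have hR1 : ‖ρ ^ 121‖ < 1 := norm_pow_lt_one h1 (by norm_num)
  have hy0 : ρ ^ 22 ≠ 0 := pow_ne_zero _ h0
  have hy : ∀ k : ℤ, (ρ ^ 22) ^ k ≠ 0 := fun k => zpow_ne_zero _ (pow_ne_zero _ h0)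
  have hne : ∀ k : ℤ, k % 11 ≠ 0 → ∀ n : ℤ, (ρ ^ 22) ^ k * ((ρ ^ 121) ^ 2) ^ n ≠ 1 :=
    fun k hk => zpow_mul_sq_zpow_ne_one h0 h1 hk
  have ht : ∀ k : ℤ, k % 11 ≠ 0 → th (ρ ^ 121) ((ρ ^ 22) ^ k) ≠ 0 := fun k hk =>
    th_ne_zero hR hR1 (hy k) (hne k hk)
  obtain ⟨κ, hκ⟩ : ∃ κ, κ * th (ρ ^ 121) ((ρ ^ 22) ^ k) =
      (ρ ^ 22) ^ k * th (ρ ^ 121) (((ρ ^ 22) ^ k) ^ 2) := ⟨_, div_mul_cancel₀ _ (ht k hk)⟩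
  have e2 : ((ρ ^ 22) ^ k) ^ 2 = (ρ ^ 22) ^ (2 * k) := by
    rw [mul_comm, zpow_mul]; norm_cast
  have hmod : ∀ N : ℤ, 11 * N + (a + k) ≠ 0 := fun N h => hak (by omega)
  set c := (-1 : ℂ) ^ (a + k) * ρ ^ (3 * (k * k) - 3 * (a * a) + 33 * (a - k)) with hc
  have hSk : S k = c * (((ρ ^ 22) ^ k) ^ 3 * ∑' N : ℤ, cubeCoeff (ρ ^ 121) ((ρ ^ 121) ^ 6 *
      ((ρ ^ 22) ^ k) ^ 3) N / (1 - (ρ ^ 22) ^ a * (ρ ^ 22) ^ k * ((ρ ^ 121) ^ 2) ^ N)) := by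
    have e : ρ ^ (3 * (k * k) - 3 * (a * a) + 33 * (a + k)) =
        ρ ^ (3 * (k * k) - 3 * (a * a) + 33 * (a - k)) * ((ρ ^ 22) ^ k) ^ 3 := by
      simp only [← zpow_natCast, ← zpow_mul, ← zpow_add₀ h0]
      congr 1; push_cast; ring
    simp only [hS, if_neg (hmod _)]
    rw [tsum_mul_left, e, zpow_add₀ hy0, hc]
    ring
  have hκ2 : c * κ = (-1) ^ a * ρ ^ (33 * a - 3 * (a * a)) *
      ((-1) ^ k * thx ρ (2 * k) / thx ρ k) := by
    have e : ρ ^ (3 * (k * k) - 3 * (a * a) + 33 * (a - k)) * (ρ ^ 22) ^ k * ρ ^ (k * (k - 11)) =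
        ρ ^ (33 * a - 3 * (a * a)) * ρ ^ (2 * k * (2 * k - 11)) := by
      simp only [← zpow_natCast, ← zpow_mul, ← zpow_add₀ h0]
      congr 1; push_cast; ring
    rw [mul_div_assoc', eq_div_iff (thx_ne_zero h0 h1 hk), hc, zpow_add₀ (by norm_num)]
    unfold thx
    rw [← e2]
    linear_combination ((-1) ^ a * (-1) ^ k * ρ ^ (3 * (k * k) - 3 * (a * a) + 33 * (a - k)) *
      ρ ^ (k * (k - 11))) * hκ + ((-1) ^ a * (-1) ^ k * th (ρ ^ 121) (((ρ ^ 22) ^ k) ^ 2)) * e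
  have eInv : ((ρ ^ 22) ^ (-k)) ^ 3 = (((ρ ^ 22) ^ k) ^ 3)⁻¹ := by rw [zpow_neg, inv_pow]
  by_cases h : k = a
  · subst h
    have hSm : S (-k) = c * ∑' N : ℤ, if N = 0 then 0 else cubeCoeff (ρ ^ 121) ((ρ ^ 121) ^ 6 *
        (((ρ ^ 22) ^ k) ^ 3)⁻¹) N / (1 - ((ρ ^ 121) ^ 2) ^ N) := by
      rw [hS, ← tsum_mul_left]
      refine tsum_congr fun N => ?_
      rw [eInv, hc, show k + -k = 0 by ring, add_zero]
      by_cases hN : N = 0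
      · simp [hN]
      · rw [if_neg (by omega), if_neg hN, zpow_zero, one_mul, ← two_mul, zpow_mul]
        norm_num
    have key := appell_sum_eq_limit hR hR1 (hy k) (ht k hk) hd hκ (hne k hk) (by
      rw [← zpow_add₀ hy0]; exact hne _ hak)
    have hc1 : c = 1 := by
      rw [hc, ← two_mul, zpow_mul]; norm_num
    rw [hSk, hSm, lambertTheta, if_pos rfl]
    rw [← zpow_add₀ hy0, ← two_mul] at key
    rw [← zpow_add₀ hy0, ← two_mul]
    unfold lam mockTerm
    linear_combination c * key + (∑' n : ℤ, cubeCoeff (ρ ^ 121) ((ρ ^ 121) ^ 6) n /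
      (1 - (ρ ^ 22) ^ k * ((ρ ^ 121) ^ 2) ^ n)) * hκ2 + (thLog (ρ ^ 121) ((ρ ^ 22) ^ k) +
        thLog (ρ ^ 121) ((ρ ^ 22) ^ (2 * k))) * hc1
  · have hmod' : ∀ N : ℤ, 11 * N + (a + -k) ≠ 0 := fun N h' => hka h (by omega)
    have hSm : S (-k) = c * ∑' N : ℤ, cubeCoeff (ρ ^ 121) ((ρ ^ 121) ^ 6 *
        (((ρ ^ 22) ^ k) ^ 3)⁻¹) N / (1 - (ρ ^ 22) ^ a / (ρ ^ 22) ^ k * ((ρ ^ 121) ^ 2) ^ N) := by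
      simp only [hS, if_neg (hmod' _)]
      rw [tsum_mul_left, eInv, ← sub_eq_add_neg, zpow_sub₀ hy0, hc]
      congr 1
      rw [show a - k = (a + k) + 2 * (-k) by ring, zpow_add₀ (by norm_num), zpow_mul]
      norm_num
    have key := appell_sum_eq hR hR1 (hy k) (hy a) (ht k hk) hκ (hne a ha) (by
      rw [← zpow_sub₀ hy0]; exact hne _ (hka h)) (by rw [← zpow_add₀ hy0]; exact hne _ hak)
    have hth : c * (-thDeriv (ρ ^ 121) 1 * (th (ρ ^ 121) ((ρ ^ 22) ^ k) *
        th (ρ ^ 121) (((ρ ^ 22) ^ k) ^ 2)) / (th (ρ ^ 121) ((ρ ^ 22) ^ a) *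
        th (ρ ^ 121) ((ρ ^ 22) ^ a / (ρ ^ 22) ^ k) *
        th (ρ ^ 121) ((ρ ^ 22) ^ a * (ρ ^ 22) ^ k))) = lambertTheta ρ a k := by
      rw [lambertTheta, if_neg h]
      have e : ρ ^ (3 * (k * k) - 3 * (a * a) + 33 * (a - k)) * (ρ ^ ((a - k) * (a - k - 11)) *
          ρ ^ (a * (a - 11)) * ρ ^ ((a + k) * (a + k - 11))) = ρ ^ (k * (k - 11)) *
          ρ ^ (2 * k * (2 * k - 11)) := by
        simp only [← zpow_add₀ h0]
        congr 1; ring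
      have t1 := ht _ ha
      have t2 := ht _ (hka h)
      have t3 := ht _ hak
      unfold thx
      rw [← zpow_sub₀ hy0, ← zpow_add₀ hy0, mul_div_assoc', mul_div_assoc', div_eq_div_iff
        (mul_ne_zero (mul_ne_zero t1 t2) t3) (mul_ne_zero (mul_ne_zero (mul_ne_zero
        (zpow_ne_zero _ h0) t2) (mul_ne_zero (zpow_ne_zero _ h0) t1)) (mul_ne_zero
        (zpow_ne_zero _ h0) t3)), hc, e2]
      linear_combination ((-1) ^ (a + k) * -thDeriv (ρ ^ 121) 1 * (th (ρ ^ 121) ((ρ ^ 22) ^ k) *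
        th (ρ ^ 121) ((ρ ^ 22) ^ (2 * k))) * (th (ρ ^ 121) ((ρ ^ 22) ^ a) *
        th (ρ ^ 121) ((ρ ^ 22) ^ (a - k)) * th (ρ ^ 121) ((ρ ^ 22) ^ (a + k)))) * e
    rw [hSk, hSm, ← hth]
    unfold mockTerm
    linear_combination c * key + (∑' n : ℤ, cubeCoeff (ρ ^ 121) ((ρ ^ 121) ^ 6) n /
      (1 - (ρ ^ 22) ^ a * ((ρ ^ 121) ^ 2) ^ n)) * hκ2

theorem lambert_dissection {a : ℤ} (hd : thDeriv (ρ ^ 121) 1 ≠ 0) (ha1 : 1 ≤ a) (ha5 : a ≤ 5) :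
    lambert ρ a = (-1) ^ a * ρ ^ (33 * a - 3 * (a * a)) * pentFactor ρ * mockTerm ρ a +
      lambertTheta ρ a 1 + lambertTheta ρ a 2 + lambertTheta ρ a 3 + lambertTheta ρ a 4 +
      lambertTheta ρ a 5 := by
  set S : ℤ → ℂ := fun l => ∑' N : ℤ, if 11 * N + (a + l) = 0 then 0 else
      (-1) ^ (a + l) * ρ ^ (3 * (l * l) - 3 * (a * a) + 33 * (a + l)) *
      (cubeCoeff (ρ ^ 121) ((ρ ^ 121) ^ 6 * ((ρ ^ 22) ^ l) ^ 3) N /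
        (1 - (ρ ^ 22) ^ (a + l) * ((ρ ^ 121) ^ 2) ^ N)) with hS
  have key := tsum_int_eq_sum_pairs (summable_lambert h0 h1 (33 - 6 * a)) (g := S) a fun l => by
    rw [hS]
    refine tsum_congr fun N => ?_
    split_ifs with h
    · rfl
    · exact lambert_term h0 a l N
  have z : S 0 = (-1) ^ a * ρ ^ (33 * a - 3 * (a * a)) * mockTerm ρ a := by
    rw [mockTerm, ← tsum_mul_left, hS]
    refine tsum_congr fun N => ?_
    rw [if_neg (by omega)]
    simp only [add_zero, zpow_zero, one_pow, mul_one, mul_zero, zero_sub, neg_add_eq_sub]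
  have p : ∀ k : ℤ, 1 ≤ k → k ≤ 5 → _ := fun k hk1 hk5 => lambert_pair h0 h1 (a := a) (k := k)
    (S := S) hd (by omega) (by omega) (by omega) (by omega) fun l => rfl
  rw [lambert, key, z, p 1 (by norm_num) (by norm_num), p 2 (by norm_num) (by norm_num),
    p 3 (by norm_num) (by norm_num), p 4 (by norm_num) (by norm_num), p 5 (by norm_num)
    (by norm_num), pentFactor]
  norm_num
  ring

end

/-- The polynomial in the coordinates `u`, `v` of the modular curve `v² + v = u³ - u²` that
represents the discriminant. -/
noncomputable def discPoly (u v : ℂ) : ℂ := u ^ 3 - 3 * u * v - 5 * u ^ 2 + 2 * v + 2 * u + 1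

/-- Nonzero quintuples satisfying the relations between the theta constants of level `11`. -/
structure IsThetaVector (x1 x2 x3 x4 x5 : ℂ) : Prop where
  ne1 : x1 ≠ 0
  ne2 : x2 ≠ 0
  ne3 : x3 ≠ 0
  ne4 : x4 ≠ 0
  ne5 : x5 ≠ 0
  rel_1123 : x1 ^ 2 * x2 * x3 - x3 ^ 2 * x4 * x5 + x2 * x4 * x5 ^ 2 = 0
  rel_1112 : x1 ^ 3 * x2 - x4 ^ 3 * x5 + x3 * x5 ^ 3 = 0
  rel_1455 : x1 * x4 * x5 ^ 2 + x1 * x2 * x3 ^ 2 - x2 * x3 * x4 ^ 2 = 0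
  rel_1115 : x1 ^ 3 * x5 - x2 ^ 3 * x4 + x1 * x3 ^ 3 = 0
  rel_1125 : x1 ^ 2 * x2 * x5 - x2 ^ 2 * x3 * x5 + x1 * x3 * x4 ^ 2 = 0

/-- The first coordinate on the modular curve. -/
noncomputable def curveU (x1 x2 x3 x4 x5 : ℂ) : ℂ := x3 * x4 * x5 / (x1 ^ 2 * x2)

/-- The second coordinate on the modular curve. -/
noncomputable def curveV (x1 x2 x3 _x4 x5 : ℂ) : ℂ := x3 * x5 ^ 3 / (x1 ^ 3 * x2)

namespace IsThetaVector
variable {x1 x2 x3 x4 x5 : ℂ} (hx : IsThetaVector x1 x2 x3 x4 x5)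
include hx

theorem curveU_sub_one :
    curveU x1 x2 x3 x4 x5 - 1 = x4 * x5 ^ 2 / (x1 ^ 2 * x3) := by
  obtain ⟨h1, h2, h3, h4, h5, r1, r2, r3, r4, r5⟩ := hx
  rw [curveU]
  field_simp
  linear_combination -r1

theorem curveV_add_one :
    curveV x1 x2 x3 x4 x5 + 1 = x4 ^ 3 * x5 / (x1 ^ 3 * x2) := by
  obtain ⟨h1, h2, h3, h4, h5, r1, r2, r3, r4, r5⟩ := hx
  rw [curveV]
  field_simp
  linear_combination r2

theorem curveV_add_one_sub_curveU : curveV x1 x2 x3 x4 x5 + 1 - curveU x1 x2 x3 x4 x5 =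
    x4 ^ 2 * x5 ^ 3 / (x1 ^ 2 * x2 ^ 2 * x3) := by
  rw [hx.curveV_add_one]
  obtain ⟨h1, h2, h3, h4, h5, r1, r2, r3, r4, r5⟩ := hx
  rw [curveU]
  field_simp
  linear_combination -r3

theorem curve_eq : curveV x1 x2 x3 x4 x5 ^ 2 + curveV x1 x2 x3 x4 x5 =
    curveU x1 x2 x3 x4 x5 ^ 3 - curveU x1 x2 x3 x4 x5 ^ 2 := by
  have e : curveV x1 x2 x3 x4 x5 * (curveV x1 x2 x3 x4 x5 + 1) =
      curveU x1 x2 x3 x4 x5 ^ 2 * (curveU x1 x2 x3 x4 x5 - 1) := by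
    rw [hx.curveV_add_one, hx.curveU_sub_one]
    obtain ⟨h1, h2, h3, h4, h5, -⟩ := hx
    rw [curveU, curveV]
    field_simp
  linear_combination e

end IsThetaVector

/-- The discriminant of the cubic `4 X³ - 4 b X² - ((1 + c) X - b)²`. -/
theorem cubic_disc {p q r b c : ℂ} (hb : b ≠ 0) (hc : c ≠ 0) (hbc : b ≠ c)
    (h0 : 4 * ((0 - p) * (0 - q) * (0 - r)) = -b ^ 2)
    (h1 : 4 * ((b - p) * (b - q) * (b - r)) = -(c * b) ^ 2)
    (h2 : 4 * ((c - p) * (c - q) * (c - r)) = -(b - c + c ^ 2) ^ 2) :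
    16 * ((p - q) * (q - r) * (r - p)) ^ 2 = b ^ 3 *
      (-(4 * b + (1 + c) ^ 2) ^ 2 - 8 * (1 + c) ^ 3 - 27 * b +
        9 * (4 * b + (1 + c) ^ 2) * (1 + c)) := by
  have e1 : 4 * (p + q + r) = 4 * b + (1 + c) ^ 2 := by
    have h : b * c * (b - c) * (4 * (p + q + r) - (4 * b + (1 + c) ^ 2)) = 0 := by
      linear_combination (c - b) * h0 - c * h1 + b * h2
    exact sub_eq_zero.mp ((mul_eq_zero.mp h).resolve_left
      (mul_ne_zero (mul_ne_zero hb hc) (sub_ne_zero.mpr hbc)))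
  have e2 : 4 * (p * q + q * r + r * p) = 2 * (1 + c) * b := by
    have h : b * (4 * (p * q + q * r + r * p) - 2 * (1 + c) * b) = 0 := by
      linear_combination h1 - h0 + b ^ 2 * e1
    exact sub_eq_zero.mp ((mul_eq_zero.mp h).resolve_left hb)
  have e3 : 4 * (p * q * r) = b ^ 2 := by linear_combination -h0
  have key : 16 * ((p - q) * (q - r) * (r - p)) ^ 2 = ((4 * (p + q + r)) ^ 2 *
      (4 * (p * q + q * r + r * p)) ^ 2 - 16 * (4 * (p * q + q * r + r * p)) ^ 3 -
      4 * (4 * (p + q + r)) ^ 3 * (4 * (p * q * r)) + 72 * (4 * (p + q + r)) *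
      (4 * (p * q + q * r + r * p)) * (4 * (p * q * r)) - 432 * (4 * (p * q * r)) ^ 2) / 16 := by
    ring
  rw [key, e1, e2, e3]
  ring

theorem discPoly_identity {u v : ℂ} (h : v ^ 2 + v = u ^ 3 - u ^ 2) :
    -(4 * (v * u ^ 3 * (u - 1)) * (u + v) ^ 2 + ((u + v) ^ 3 + u ^ 2 * (u - 1) ^ 2) ^ 2) ^ 2 -
      8 * ((u + v) ^ 3 + u ^ 2 * (u - 1) ^ 2) ^ 3 * (u + v) ^ 3 -
      27 * (v * u ^ 3 * (u - 1)) * (u + v) ^ 8 +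
      9 * (4 * (v * u ^ 3 * (u - 1)) * (u + v) ^ 2 + ((u + v) ^ 3 + u ^ 2 * (u - 1) ^ 2) ^ 2) *
        ((u + v) ^ 3 + u ^ 2 * (u - 1) ^ 2) * (u + v) ^ 3 =
    discPoly u v * u ^ 2 * (u - 1) ^ 3 * v ^ 2 * (u + v) ^ 2 := by
  rw [discPoly]
  linear_combination (
    u^13 - 4*u^12 + 17*u^11*v + 9*u^11 + 26*u^10*v^2 - 78*u^10*v - 13*u^10 + 11*u^9*v^3 -
    151*u^9*v^2 + 129*u^9*v + 13*u^9 - 106*u^8*v^3 + 286*u^8*v^2 - 91*u^8*v - 9*u^8 -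
    33*u^7*v^4 + 255*u^7*v^3 - 222*u^7*v^2 + 28*u^7*v + 4*u^7 - 7*u^6*v^5 + 125*u^6*v^4 -
    221*u^6*v^3 + 83*u^6*v^2 - 3*u^6*v - u^6 - u^5*v^6 + 43*u^5*v^5 - 124*u^5*v^4 + 84*u^5*v^3
    - 22*u^5*v^2 - 3*u^5*v + 10*u^4*v^6 - 45*u^4*v^5 + 41*u^4*v^4 - 25*u^4*v^3 - 2*u^4*v^2 +
    u^4*v + u^3*v^7 - 10*u^3*v^6 + 10*u^3*v^5 - 10*u^3*v^4 + u^3*v^3 + 2*u^3*v^2 - u^2*v^7 +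
    u^2*v^6 - u^2*v^5 + u^2*v^4 + u^2*v^3) * h

namespace IsThetaVector
variable {x1 x2 x3 x4 x5 : ℂ} (hx : IsThetaVector x1 x2 x3 x4 x5)
include hx

theorem curveU_add_curveV :
    curveU x1 x2 x3 x4 x5 + curveV x1 x2 x3 x4 x5 = x2 * x4 * x5 ^ 2 / x1 ^ 4 := by
  have e : (curveU x1 x2 x3 x4 x5 + curveV x1 x2 x3 x4 x5) *
      (curveV x1 x2 x3 x4 x5 + 1 - curveU x1 x2 x3 x4 x5) =
      curveU x1 x2 x3 x4 x5 * (curveU x1 x2 x3 x4 x5 - 1) ^ 2 := by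
    linear_combination hx.curve_eq
  rw [hx.curveV_add_one_sub_curveU, hx.curveU_sub_one] at e
  obtain ⟨h1, h2, h3, h4, h5, -⟩ := hx
  have hw : x4 ^ 2 * x5 ^ 3 / (x1 ^ 2 * x2 ^ 2 * x3) ≠ 0 := by positivity
  rw [← mul_left_inj' hw, e, curveU]
  field_simp

theorem disc_eq {p q r : ℂ} (h0 : 4 * ((0 - p) * (0 - q) * (0 - r)) = -(x2 / x1) ^ 2)
    (h1 : 4 * ((x3 * x1 / x2 ^ 2 - p) * (x3 * x1 / x2 ^ 2 - q) * (x3 * x1 / x2 ^ 2 - r)) =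
      -(x4 * x1 ^ 3 / x2 ^ 4) ^ 2)
    (h2 : 4 * ((x4 * x2 / x3 ^ 2 - p) * (x4 * x2 / x3 ^ 2 - q) * (x4 * x2 / x3 ^ 2 - r)) =
      -(x5 * x1 ^ 3 / x3 ^ 4) ^ 2) :
    16 * ((p - q) * (q - r) * (r - p)) ^ 2 * (x2 ^ 2 * x3 ^ 2 * x4 ^ 5 * x5 ^ 6) =
      discPoly (curveU x1 x2 x3 x4 x5) (curveV x1 x2 x3 x4 x5) * x1 ^ 15 := by
  have ht := hx.curveU_add_curveV
  have hm := hx.curveU_sub_one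
  have id := discPoly_identity hx.curve_eq
  obtain ⟨n1, n2, n3, n4, n5, r1, r2, r3, r4, r5⟩ := hx
  set s := x2 ^ 3 / (x1 ^ 2 * x3) with hs
  set b := x3 ^ 3 * x1 ^ 5 / x2 ^ 8 with hb
  set c := x4 * x1 ^ 4 / x2 ^ 5 with hc
  have s0 : s ≠ 0 := by positivity
  have eb : x3 * x1 / x2 ^ 2 = s ^ 2 * b := by rw [hs, hb]; field_simp
  have ec : x4 * x2 / x3 ^ 2 = s ^ 2 * c := by rw [hs, hc]; field_simp
  have hbc : b - c = -(x5 * x1 ^ 7 / x2 ^ 8) := by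
    rw [hb, hc]; field_simp; linear_combination r4
  have ebc : b - c + c ^ 2 = -(x5 * x1 ^ 9 / (x3 * x2 ^ 9)) := by
    rw [hbc, hc]; field_simp; linear_combination r5
  obtain ⟨p, rfl⟩ : ∃ p', p = s ^ 2 * p' := ⟨p / s ^ 2, by field_simp⟩
  obtain ⟨q, rfl⟩ : ∃ p', q = s ^ 2 * p' := ⟨q / s ^ 2, by field_simp⟩
  obtain ⟨r, rfl⟩ : ∃ p', r = s ^ 2 * p' := ⟨r / s ^ 2, by field_simp⟩
  have s6 : s ^ 6 ≠ 0 := pow_ne_zero 6 s0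
  have key := cubic_disc (p := p) (q := q) (r := r) (b := b) (c := c) (by positivity)
    (by positivity) (by
      rw [← sub_ne_zero, hbc]; exact neg_ne_zero.mpr (by positivity))
    (by
      rw [← mul_left_inj' s6]
      have e : b ^ 2 * s ^ 6 = (x2 / x1) ^ 2 := by rw [hb, hs]; field_simp
      linear_combination h0 + e)
    (by
      rw [← mul_left_inj' s6]
      have e : (c * b) ^ 2 * s ^ 6 = (x4 * x1 ^ 3 / x2 ^ 4) ^ 2 := by
        rw [hb, hc, hs]; field_simp
      rw [eb] at h1
      linear_combination h1 + e)
    (by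
      rw [← mul_left_inj' s6, ebc]
      have e : (-(x5 * x1 ^ 9 / (x3 * x2 ^ 9))) ^ 2 * s ^ 6 = (x5 * x1 ^ 3 / x3 ^ 4) ^ 2 := by
        rw [hs]; field_simp
      rw [ec] at h2
      linear_combination h2 + e)
  set u := curveU x1 x2 x3 x4 x5 with hu
  set v := curveV x1 x2 x3 x4 x5 with hv
  have t0 : (u + v) ≠ 0 := by rw [ht]; positivity
  have e1 : b * (u + v) ^ 4 = v * u ^ 3 * (u - 1) := by
    rw [ht, hm, hb, hu, hv, curveU, curveV]; field_simp
  have e2 : c * (u + v) ^ 3 = u ^ 2 * (u - 1) ^ 2 := by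
    rw [ht, hm, hc, hu, curveU]; field_simp
  rw [← e1, ← e2] at id
  have e3 : s ^ 12 * b ^ 3 * (u ^ 2 * (u - 1) ^ 3 * v ^ 2) *
      (x2 ^ 2 * x3 ^ 2 * x4 ^ 5 * x5 ^ 6) = x1 ^ 15 * (u + v) ^ 10 := by
    rw [ht, hm, hs, hb, hu, hv, curveU, curveV]; field_simp
  rw [← mul_left_inj' (pow_ne_zero 12 t0)]
  linear_combination (s ^ 12 * (x2 ^ 2 * x3 ^ 2 * x4 ^ 5 * x5 ^ 6) * (u + v) ^ 12) * key +
    (s ^ 12 * b ^ 3 * (x2 ^ 2 * x3 ^ 2 * x4 ^ 5 * x5 ^ 6)) * id +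
    (discPoly u v * (u + v) ^ 2) * e3

end IsThetaVector

theorem th_half_periods {R : ℂ} (hR0 : R ≠ 0) (hR : ‖R‖ < 1) :
    th R (-1) * th R R * th R (-R) = 2 * qp (R ^ 2) (R ^ 2) ^ 3 := by
  have hJ : qp (R ^ 2) (R ^ 2) ≠ 0 := by
    rw [← th_cube_sq hR0 hR, th_cube_sq hR0 hR]
    have h2 : ‖R ^ 2‖ < 1 := by
      rw [norm_pow]; exact pow_lt_one₀ (norm_nonneg _) hR two_ne_zero
    exact qp_ne_zero_of_norm_lt h2 h2
  have hd : ∀ w : ℂ, w ≠ 0 → DifferentiableAt ℂ (th R) w :=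
    fun w hw => (th_hasDerivAt hR0 hR hw).differentiableAt
  have hG : DifferentiableAt ℂ (fun a => th R (-a) * th R (a * R) * th R (-a * R)) 1 := by
    refine DifferentiableAt.mul (DifferentiableAt.mul ?_ ?_) ?_
    · exact DifferentiableAt.comp (g := th R) 1 (hd _ (by simp)) (by fun_prop)
    · exact DifferentiableAt.comp (g := th R) 1 (hd _ (by simpa using hR0)) (by fun_prop)
    · exact DifferentiableAt.comp (g := th R) 1 (hd _ (by simpa using hR0)) (by fun_prop)
  have h1 := (th_hasDerivAt hR0 hR one_ne_zero).mul hG.hasDerivAt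
  have h2 : HasDerivAt (fun a : ℂ => qp (R ^ 2) (R ^ 2) ^ 3 * th R (a ^ 2))
      (qp (R ^ 2) (R ^ 2) ^ 3 * (thDeriv R 1 * 2)) 1 := by
    refine HasDerivAt.const_mul _ ?_
    have := HasDerivAt.comp (h₂ := th R) (h := fun a : ℂ => a ^ 2) (1 : ℂ)
      (by simpa using th_hasDerivAt hR0 hR one_ne_zero) (hasDerivAt_pow 2 (1 : ℂ))
    simpa [Function.comp_def] using this
  have h3 := h1.unique (h2.congr_of_eventuallyEq ?_)
  · simp only [th_one, inv_one, one_mul, zero_mul, add_zero, neg_mul] at h3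
    have hD : thDeriv R 1 ≠ 0 := by
      rw [thDeriv_one hR0 hR]; exact neg_ne_zero.mpr (pow_ne_zero 3 hJ)
    rw [← mul_right_inj' hD, h3]; ring
  · filter_upwards [isOpen_ne.mem_nhds (one_ne_zero : (1 : ℂ) ≠ 0)] with a ha
    rw [← th_duplication hR0 hR ha]
    simp only [Pi.mul_apply]; ring

section
variable {R : ℂ} (hR0 : R ≠ 0)
include hR0

theorem th_div_self {a : ℂ} (ha : a ≠ 0) : th R (a / R) = -(a / R) * th R (a * R) := by
  have h := th_mul_sq hR0 (w := a / R) (div_ne_zero ha hR0)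
  rw [show R ^ 2 * (a / R) = a * R by field_simp] at h
  rw [h]; field_simp

omit hR0 in
theorem wf_neg_one {a : ℂ} : wf R a (-1) = a⁻¹ * th R (-a) ^ 2 := by
  rw [wf, show a * -1 = -a by ring, show a / -1 = -a by ring]; ring

theorem wf_self {a : ℂ} (ha : a ≠ 0) : wf R a R = -R⁻¹ * th R (a * R) ^ 2 := by
  rw [wf, th_div_self hR0 ha]; field_simp

theorem wf_neg_self {a : ℂ} (ha : a ≠ 0) : wf R a (-R) = R⁻¹ * th R (-a * R) ^ 2 := by
  rw [wf, show a / -R = (-a) / R by field_simp, th_div_self hR0 (neg_ne_zero.mpr ha),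
    show a * -R = -a * R by ring]; field_simp

omit hR0 in
theorem wf_one {a : ℂ} : wf R a 1 = a⁻¹ * th R a ^ 2 := by
  rw [wf, mul_one, div_one, sq]

omit hR0 in
theorem wf_one_left {y : ℂ} (hy : y ≠ 0) : wf R 1 y = -y⁻¹ * th R y ^ 2 := by
  rw [wf, one_mul, one_div, th_inv hy]; ring

end

/-- The ratio playing the role of the Weierstrass function. -/
noncomputable def wfRatio (R y a : ℂ) : ℂ := wf R a y / wf R a 1

theorem wfRatio_sub {R y a c : ℂ} (hR0 : R ≠ 0) (hR : ‖R‖ < 1) (hy : y ≠ 0) (ha : a ≠ 0)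
    (hc : c ≠ 0) (ha' : th R a ≠ 0) (hc' : th R c ≠ 0) :
    wfRatio R y a - wfRatio R y c =
      a * c * wf R a c * (y⁻¹ * th R y ^ 2) / (th R a ^ 2 * th R c ^ 2) := by
  have h := wf_plucker hR0 hR ha hc one_ne_zero hy
  rw [wf_one_left hy, wf_one, wf_one] at h
  rw [wfRatio, wfRatio, wf_one, wf_one]
  generalize wf R a y = A at *
  generalize wf R c y = C at *
  generalize wf R a c = B at *
  field_simp at h ⊢
  linear_combination h

theorem wfRatio_prod {R y a : ℂ} (hR0 : R ≠ 0) (hR : ‖R‖ < 1) (hy : y ≠ 0) (ha : a ≠ 0)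
    (ha' : th R a ≠ 0) :
    4 * ((wfRatio R y a - wfRatio R y (-1)) * (wfRatio R y a - wfRatio R y R) *
      (wfRatio R y a - wfRatio R y (-R))) =
      -(a * th R (a ^ 2) * th R y ^ 3 / th R a ^ 4) ^ 2 / y ^ 3 := by
  have hJ : qp (R ^ 2) (R ^ 2) ≠ 0 := by
    have h2 : ‖R ^ 2‖ < 1 := by
      rw [norm_pow]; exact pow_lt_one₀ (norm_nonneg _) hR two_ne_zero
    exact qp_ne_zero_of_norm_lt h2 h2
  have hp := th_half_periods hR0 hR
  have hd := th_duplication hR0 hR ha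
  have hne : th R (-1) * th R R * th R (-R) ≠ 0 := by
    rw [hp]; exact mul_ne_zero two_ne_zero (pow_ne_zero 3 hJ)
  obtain ⟨⟨n1, n2⟩, n3⟩ : (th R (-1) ≠ 0 ∧ th R R ≠ 0) ∧ th R (-R) ≠ 0 := by
    simpa only [mul_ne_zero_iff] using hne
  rw [wfRatio_sub hR0 hR hy ha (by simp) ha' n1, wfRatio_sub hR0 hR hy ha hR0 ha' n2,
    wfRatio_sub hR0 hR hy ha (by simpa using hR0) ha' n3, wf_neg_one, wf_self hR0 ha,
    wf_neg_self hR0 ha]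
  generalize qp (R ^ 2) (R ^ 2) = J at *
  have e : th R (a ^ 2) = th R a * th R (-a) * th R (a * R) * th R (-a * R) / J ^ 3 := by
    rw [hd]; field_simp
  have e' : th R (-1) = 2 * J ^ 3 / (th R R * th R (-R)) := by
    rw [← hp]; field_simp
  rw [e, e']
  field_simp
  ring

theorem wfRatio_disc {R y : ℂ} (hR0 : R ≠ 0) (hR : ‖R‖ < 1) (hy : y ≠ 0) :
    16 * ((wfRatio R y (-1) - wfRatio R y R) * (wfRatio R y R - wfRatio R y (-R)) *
      (wfRatio R y (-R) - wfRatio R y (-1))) ^ 2 * qp (R ^ 2) (R ^ 2) ^ 12 =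
      R ^ 2 * th R y ^ 12 / y ^ 6 := by
  have hJ : qp (R ^ 2) (R ^ 2) ≠ 0 := by
    have h2 : ‖R ^ 2‖ < 1 := by
      rw [norm_pow]; exact pow_lt_one₀ (norm_nonneg _) hR two_ne_zero
    exact qp_ne_zero_of_norm_lt h2 h2
  have hp := th_half_periods hR0 hR
  have hne : th R (-1) * th R R * th R (-R) ≠ 0 := by
    rw [hp]; exact mul_ne_zero two_ne_zero (pow_ne_zero 3 hJ)
  obtain ⟨⟨n1, n2⟩, n3⟩ : (th R (-1) ≠ 0 ∧ th R R ≠ 0) ∧ th R (-R) ≠ 0 := by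
    simpa only [mul_ne_zero_iff] using hne
  have hm : (-1 : ℂ) ≠ 0 := by simp
  have hR' : -R ≠ 0 := neg_ne_zero.mpr hR0
  have hs : th R (-R * R) = th R (-1) := by
    have := th_mul_sq hR0 hm
    rw [show -R * R = R ^ 2 * -1 by ring, this]; norm_num
  rw [wfRatio_sub hR0 hR hy hm hR0 n1 n2, wfRatio_sub hR0 hR hy hR0 hR' n2 n3,
    wfRatio_sub hR0 hR hy hR' hm n3 n1, wf_neg_one, wf_self hR0 hm,
    wf_neg_self hR0 hR0, hs, neg_neg, neg_one_mul]
  generalize qp (R ^ 2) (R ^ 2) = J at *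
  have e' : th R (-1) = 2 * J ^ 3 / (th R R * th R (-R)) := by
    rw [← hp]; field_simp
  rw [e']
  field_simp
  ring

section
variable {ρ : ℂ} (h0 : ρ ≠ 0) (h1 : ‖ρ‖ < 1)
include h0 h1

theorem isThetaVector_thx :
    IsThetaVector (thx ρ 1) (thx ρ 2) (thx ρ 3) (thx ρ 4) (thx ρ 5) := by
  have e6 : thx ρ 6 = thx ρ 5 := by simpa using thx_eleven_sub h0 5
  have e7 : thx ρ 7 = thx ρ 4 := by simpa using thx_eleven_sub h0 4
  have e8 : thx ρ 8 = thx ρ 3 := by simpa using thx_eleven_sub h0 3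
  have e9 : thx ρ 9 = thx ρ 2 := by simpa using thx_eleven_sub h0 2
  have n1 : thx ρ (-1) = -thx ρ 1 := thx_neg h0 1
  have n2 : thx ρ (-2) = -thx ρ 2 := thx_neg h0 2
  have n3 : thx ρ (-3) = -thx ρ 3 := thx_neg h0 3
  have n4 : thx ρ (-4) = -thx ρ 4 := thx_neg h0 4
  have n5 : thx ρ (-5) = -thx ρ 5 := thx_neg h0 5
  refine ⟨thx_ne_zero h0 h1 (by norm_num), thx_ne_zero h0 h1 (by norm_num),
    thx_ne_zero h0 h1 (by norm_num), thx_ne_zero h0 h1 (by norm_num),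
    thx_ne_zero h0 h1 (by norm_num), ?_, ?_, ?_, ?_, ?_⟩
  · have h := thx_plucker h0 h1 0 1 3 5
    norm_num [e6, e7, e8, e9, n1, n2, n3, n4, n5] at h
    linear_combination h
  · have h := thx_plucker h0 h1 0 1 4 5
    norm_num [e6, e7, e8, e9, n1, n2, n3, n4, n5] at h
    linear_combination h
  · have h := thx_plucker h0 h1 1 2 3 5
    norm_num [e6, e7, e8, e9, n1, n2, n3, n4, n5] at h
    linear_combination h
  · have h := thx_plucker h0 h1 0 1 2 3
    norm_num [e6, e7, e8, e9, n1, n2, n3, n4, n5] at h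
    linear_combination h
  · have h := thx_plucker h0 h1 0 1 2 4
    norm_num [e6, e7, e8, e9, n1, n2, n3, n4, n5] at h
    linear_combination h

theorem sq_mul_wfRatio {k : ℤ} (hk : k % 11 ≠ 0) :
    ρ ^ 2 * wfRatio (ρ ^ 121) (ρ ^ 22) ((ρ ^ 22) ^ k) =
      thx ρ (k + 1) * thx ρ (k - 1) / thx ρ k ^ 2 := by
  have hne := pow_ne_zero 2 (thx_ne_zero h0 h1 hk)
  have e1 := thx_mul_eq_wf h0 k 1
  have e2 := thx_mul_eq_wf h0 k 0
  rw [add_zero, sub_zero, zpow_zero, ← sq, mul_zero, mul_zero, add_zero] at e2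
  rw [zpow_one, mul_one, mul_one, zpow_add₀ h0] at e1
  rw [e2] at hne
  rw [e1, e2, wfRatio]
  have h3 := right_ne_zero_of_mul hne
  have h4 := left_ne_zero_of_mul hne
  norm_cast at *
  field_simp

theorem wfRatio_prod_thx {k : ℤ} (hk : k % 11 ≠ 0) :
    4 * ((thx ρ (k + 1) * thx ρ (k - 1) / thx ρ k ^ 2 -
          ρ ^ 2 * wfRatio (ρ ^ 121) (ρ ^ 22) (-1)) *
        (thx ρ (k + 1) * thx ρ (k - 1) / thx ρ k ^ 2 -
          ρ ^ 2 * wfRatio (ρ ^ 121) (ρ ^ 22) (ρ ^ 121)) *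
        (thx ρ (k + 1) * thx ρ (k - 1) / thx ρ k ^ 2 -
          ρ ^ 2 * wfRatio (ρ ^ 121) (ρ ^ 22) (-ρ ^ 121))) =
      -(thx ρ (2 * k) * thx ρ 1 ^ 3 / thx ρ k ^ 4) ^ 2 := by
  rw [← sq_mul_wfRatio h0 h1 hk]
  have hne := thx_ne_zero h0 h1 hk
  have h := wfRatio_prod (pow_ne_zero 121 h0) (norm_pow_lt_one h1 (by norm_num))
    (pow_ne_zero 22 h0) (zpow_ne_zero k (pow_ne_zero 22 h0)) (right_ne_zero_of_mul hne)
  have e : thx ρ (2 * k) * thx ρ 1 ^ 3 / thx ρ k ^ 4 = (ρ ^ 30)⁻¹ * ((ρ ^ 22) ^ k *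
      th (ρ ^ 121) (((ρ ^ 22) ^ k) ^ 2) * th (ρ ^ 121) (ρ ^ 22) ^ 3 /
      th (ρ ^ 121) ((ρ ^ 22) ^ k) ^ 4) := by
    have hw : ((ρ ^ 22) ^ k) ^ 2 = (ρ ^ 22) ^ (2 * k) := by
      rw [← zpow_natCast, ← zpow_mul, mul_comm]; rfl
    have he : ρ ^ (2 * k * (2 * k - 11)) * ρ ^ (-30 : ℤ) =
        ρ ^ (-30 : ℤ) * (ρ ^ 22) ^ k * (ρ ^ (k * (k - 11))) ^ 4 := by
      simp only [← zpow_natCast, ← zpow_mul, ← zpow_add₀ h0]; congr 1; push_cast; ring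
    have he1 : ρ ^ ((1 : ℤ) * (1 - 11)) = ρ ^ (-10 : ℤ) := by norm_num
    have he2 : ρ ^ (-30 : ℤ) = (ρ ^ 30)⁻¹ := by rw [zpow_neg]; rfl
    have he3 : (ρ ^ (-10 : ℤ)) ^ 3 = ρ ^ (-30 : ℤ) := by rw [← zpow_natCast, ← zpow_mul]; rfl
    unfold thx
    rw [hw, he1, zpow_one, mul_pow, he3, ← he2]
    have hz : th (ρ ^ 121) ((ρ ^ 22) ^ k) ≠ 0 := right_ne_zero_of_mul hne
    have hz' : ρ ^ (k * (k - 11)) ≠ 0 := zpow_ne_zero _ h0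
    generalize th (ρ ^ 121) ((ρ ^ 22) ^ k) = A at *
    generalize th (ρ ^ 121) ((ρ ^ 22) ^ (2 * k)) = B at *
    generalize th (ρ ^ 121) (ρ ^ 22) = C at *
    rw [div_eq_iff (by positivity)]
    rw [show ρ ^ (-30 : ℤ) * ((ρ ^ 22) ^ k * B * C ^ 3 / A ^ 4) * (ρ ^ (k * (k - 11)) * A) ^ 4 =
      (ρ ^ (-30 : ℤ) * (ρ ^ 22) ^ k * (ρ ^ (k * (k - 11))) ^ 4) * (B * C ^ 3) by field_simp, ← he]
    ring
  rw [e, mul_pow]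
  generalize ((ρ ^ 22) ^ k * th (ρ ^ 121) (((ρ ^ 22) ^ k) ^ 2) * th (ρ ^ 121) (ρ ^ 22) ^ 3 /
      th (ρ ^ 121) ((ρ ^ 22) ^ k) ^ 4) = Y at *
  rw [eq_div_iff (by positivity)] at h
  rw [neg_mul_eq_mul_neg, ← h]
  field_simp

theorem discPoly_thx :
    discPoly (curveU (thx ρ 1) (thx ρ 2) (thx ρ 3) (thx ρ 4) (thx ρ 5))
        (curveV (thx ρ 1) (thx ρ 2) (thx ρ 3) (thx ρ 4) (thx ρ 5)) *
        (th ((ρ ^ 121) ^ 3) ((ρ ^ 121) ^ 2) ^ 12 * thx ρ 1 ^ 3) =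
      ρ ^ 242 * (thx ρ 2 ^ 2 * thx ρ 3 ^ 2 * thx ρ 4 ^ 5 * thx ρ 5 ^ 6) := by
  have e6 : thx ρ 6 = thx ρ 5 := by simpa using thx_eleven_sub h0 5
  have z0 : thx ρ 0 = 0 := by simp [thx, th_one]
  have hx := isThetaVector_thx h0 h1
  have p1 := wfRatio_prod_thx h0 h1 (k := 1) (by norm_num)
  have p2 := wfRatio_prod_thx h0 h1 (k := 2) (by norm_num)
  have p3 := wfRatio_prod_thx h0 h1 (k := 3) (by norm_num)
  norm_num [z0, e6] at p1 p2 p3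
  have hd := wfRatio_disc (pow_ne_zero 121 h0) (norm_pow_lt_one h1 (by norm_num))
    (pow_ne_zero 22 h0)
  rw [← th_cube_sq (pow_ne_zero 121 h0) (norm_pow_lt_one h1 (by norm_num))] at hd
  have n1 := hx.ne1
  have h := hx.disc_eq (p := ρ ^ 2 * wfRatio (ρ ^ 121) (ρ ^ 22) (-1))
    (q := ρ ^ 2 * wfRatio (ρ ^ 121) (ρ ^ 22) (ρ ^ 121))
    (r := ρ ^ 2 * wfRatio (ρ ^ 121) (ρ ^ 22) (-ρ ^ 121))
    (by
      rw [show thx ρ 2 / thx ρ 1 = thx ρ 2 * thx ρ 1 ^ 3 / thx ρ 1 ^ 4 by field_simp]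
      linear_combination -p1)
    (by linear_combination p2) (by linear_combination p3)
  have e1 : th (ρ ^ 121) (ρ ^ 22) = ρ ^ 10 * thx ρ 1 := by
    have : ρ ^ ((1 : ℤ) * (1 - 11)) = (ρ ^ 10)⁻¹ := by norm_num [zpow_neg]
    rw [thx, this, zpow_one]; field_simp
  rw [e1, eq_div_iff (by positivity)] at hd
  generalize th ((ρ ^ 121) ^ 3) ((ρ ^ 121) ^ 2) = J at *
  rw [← mul_left_inj' (pow_ne_zero 12 n1)]
  rw [← mul_left_inj' (pow_ne_zero 120 h0)]
  linear_combination (-(J ^ 12 * ρ ^ 120)) * h +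
    (thx ρ 2 ^ 2 * thx ρ 3 ^ 2 * thx ρ 4 ^ 5 * thx ρ 5 ^ 6) * hd

end

/-- Evaluation of a polynomial given by its list of integer coefficients. -/
noncomputable def polyEval (u : ℂ) : List ℤ → ℂ
  | [] => 0
  | a :: p => a + u * polyEval u p

/-- Addition of coefficient lists. -/
def polyAdd : List ℤ → List ℤ → List ℤ
  | [], q => q
  | a :: p, [] => a :: p
  | a :: p, b :: q => (a + b) :: polyAdd p q

/-- Multiplication of a coefficient list by an integer. -/
def polySmul (c : ℤ) : List ℤ → List ℤ
  | [] => []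
  | a :: p => (c * a) :: polySmul c p

/-- Multiplication of coefficient lists. -/
def polyMul : List ℤ → List ℤ → List ℤ
  | [], _ => []
  | a :: p, q => polyAdd (polySmul a q) (0 :: polyMul p q)

/-- Whether all coefficients vanish. -/
def polyIsZero : List ℤ → Bool
  | [] => true
  | a :: p => decide (a = 0) && polyIsZero p

theorem polyEval_add (u : ℂ) (p q : List ℤ) :
    polyEval u (polyAdd p q) = polyEval u p + polyEval u q := by
  induction p generalizing q with
  | nil => simp [polyAdd, polyEval]
  | cons a p ih =>
    cases q with
    | nil => simp [polyAdd, polyEval]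
    | cons b q =>
      simp only [polyAdd, polyEval, ih]
      push_cast
      ring

theorem polyEval_smul (u : ℂ) (c : ℤ) (p : List ℤ) :
    polyEval u (polySmul c p) = c * polyEval u p := by
  induction p with
  | nil => simp [polySmul, polyEval]
  | cons a p ih =>
    simp only [polySmul, polyEval, ih]
    push_cast
    ring

theorem polyEval_mul (u : ℂ) (p q : List ℤ) :
    polyEval u (polyMul p q) = polyEval u p * polyEval u q := by
  induction p with
  | nil => simp [polyMul, polyEval]
  | cons a p ih =>
    simp only [polyMul, polyEval, polyEval_add, polyEval_smul, ih]
    push_cast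
    ring

theorem polyEval_of_isZero (u : ℂ) {p : List ℤ} (h : polyIsZero p = true) : polyEval u p = 0 := by
  induction p with
  | nil => rfl
  | cons a p ih =>
    simp only [polyIsZero, Bool.and_eq_true, decide_eq_true_eq] at h
    simp [polyEval, h.1, ih h.2]

/-- A polynomial function `p(u) + q(u) v` on the curve `v² + v = u³ - u²`. -/
abbrev CurvePoly := List ℤ × List ℤ

/-- Evaluation of a polynomial function on the curve. -/
noncomputable def curveEval (u v : ℂ) (p : CurvePoly) : ℂ := polyEval u p.1 + polyEval u p.2 * v

/-- Addition of polynomial functions on the curve. -/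
def curveAdd (p q : CurvePoly) : CurvePoly := (polyAdd p.1 q.1, polyAdd p.2 q.2)

/-- Multiplication of a polynomial function on the curve by an integer. -/
def curveSmul (c : ℤ) (p : CurvePoly) : CurvePoly := (polySmul c p.1, polySmul c p.2)

/-- Multiplication of polynomial functions on the curve. -/
def curveMul (p q : CurvePoly) : CurvePoly :=
  (polyAdd (polyMul p.1 q.1) (polyMul [0, 0, -1, 1] (polyMul p.2 q.2)),
    polyAdd (polyAdd (polyMul p.1 q.2) (polyMul p.2 q.1)) (polySmul (-1) (polyMul p.2 q.2)))

/-- Powers of a polynomial function on the curve. -/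
def curvePow (p : CurvePoly) : ℕ → CurvePoly
  | 0 => ([1], [])
  | n + 1 => curveMul (curvePow p n) p

theorem curveEval_add (u v : ℂ) (p q : CurvePoly) :
    curveEval u v (curveAdd p q) = curveEval u v p + curveEval u v q := by
  simp only [curveEval, curveAdd, polyEval_add]
  ring

theorem curveEval_smul (u v : ℂ) (c : ℤ) (p : CurvePoly) :
    curveEval u v (curveSmul c p) = c * curveEval u v p := by
  simp only [curveEval, curveSmul, polyEval_smul]
  ring

theorem curveEval_mul {u v : ℂ} (h : v ^ 2 + v = u ^ 3 - u ^ 2) (p q : CurvePoly) :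
    curveEval u v (curveMul p q) = curveEval u v p * curveEval u v q := by
  have e : polyEval u [0, 0, -1, 1] = u ^ 3 - u ^ 2 := by simp [polyEval]; ring
  simp only [curveEval, curveMul, polyEval_add, polyEval_smul, polyEval_mul, e]
  push_cast
  linear_combination (-(polyEval u p.2 * polyEval u q.2)) * h

theorem curveEval_pow {u v : ℂ} (h : v ^ 2 + v = u ^ 3 - u ^ 2) (p : CurvePoly) (n : ℕ) :
    curveEval u v (curvePow p n) = curveEval u v p ^ n := by
  induction n with
  | zero => simp [curvePow, curveEval, polyEval]
  | succ n ih => rw [curvePow, curveEval_mul h, ih, pow_succ]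

/-- Exponent vectors of Laurent monomials in five variables. -/
abbrev Expo := ℤ × ℤ × ℤ × ℤ × ℤ

/-- Laurent monomials in five variables. -/
noncomputable def monom (x1 x2 x3 x4 x5 : ℂ) (e : Expo) : ℂ :=
  x1 ^ e.1 * x2 ^ e.2.1 * x3 ^ e.2.2.1 * x4 ^ e.2.2.2.1 * x5 ^ e.2.2.2.2

/-- Addition of exponent vectors. -/
def expoAdd (e f : Expo) : Expo :=
  (e.1 + f.1, e.2.1 + f.2.1, e.2.2.1 + f.2.2.1, e.2.2.2.1 + f.2.2.2.1, e.2.2.2.2 + f.2.2.2.2)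

/-- The weight of a monomial under the action of eleventh roots of unity. -/
def expoWeight (e : Expo) : ℤ :=
  e.1 + 4 * e.2.1 + 9 * e.2.2.1 + 5 * e.2.2.2.1 + 3 * e.2.2.2.2

/-- The exponent vector of `u ^ i * (u - 1) ^ j * v ^ k * (v + 1 - u) ^ l`. -/
def unitExpo (i j k l : ℤ) : Expo :=
  (-2 * i - 2 * j - 3 * k - 2 * l, -i - k - 2 * l, i - j + k - l, i + j + 2 * l,
    i + 2 * j + 3 * k + 3 * l)

/-- Subtraction of coefficient lists. -/
def polySub : List ℤ → List ℤ → List ℤ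
  | [], q => polySmul (-1) q
  | a :: p, [] => a :: p
  | a :: p, b :: q => (a - b) :: polySub p q

theorem polyEval_sub (u : ℂ) (p q : List ℤ) :
    polyEval u (polySub p q) = polyEval u p - polyEval u q := by
  induction p generalizing q with
  | nil => simp [polySub, polyEval, polyEval_smul]
  | cons a p ih =>
    cases q with
    | nil => simp [polySub, polyEval]
    | cons b q =>
      simp only [polySub, polyEval, ih]
      push_cast
      ring

/-- Multiplication by `u ^ i`. -/
def mulU (p : CurvePoly) : ℕ → CurvePoly
  | 0 => p
  | n + 1 => let q := mulU p n
    (0 :: q.1, 0 :: q.2)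

/-- Multiplication by `(u - 1) ^ j`. -/
def mulUSubOne (p : CurvePoly) : ℕ → CurvePoly
  | 0 => p
  | n + 1 => let q := mulUSubOne p n
    (polySub (0 :: q.1) q.1, polySub (0 :: q.2) q.2)

/-- Multiplication by `v ^ k`. -/
def mulV (p : CurvePoly) : ℕ → CurvePoly
  | 0 => p
  | n + 1 => let q := mulV p n
    (0 :: 0 :: polySub (0 :: q.2) q.2, polySub q.1 q.2)

/-- Multiplication by `(v + 1 - u) ^ l`. -/
def mulVAddOneSubU (p : CurvePoly) : ℕ → CurvePoly
  | 0 => p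
  | n + 1 => let q := mulVAddOneSubU p n
    (polySub q.1 (0 :: polySub q.1 (0 :: polySub (0 :: q.2) q.2)), polySub q.1 (0 :: q.2))

theorem curveEval_mulU (u v : ℂ) (p : CurvePoly) (n : ℕ) :
    curveEval u v (mulU p n) = u ^ n * curveEval u v p := by
  induction n with
  | zero => simp [mulU]
  | succ n ih =>
    rw [pow_succ', mul_assoc, ← ih, mulU]
    simp only [curveEval, polyEval]
    push_cast
    ring

theorem curveEval_mulUSubOne (u v : ℂ) (p : CurvePoly) (n : ℕ) :
    curveEval u v (mulUSubOne p n) = (u - 1) ^ n * curveEval u v p := by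
  induction n with
  | zero => simp [mulUSubOne]
  | succ n ih =>
    rw [pow_succ', mul_assoc, ← ih, mulUSubOne]
    simp only [curveEval, polyEval, polyEval_sub]
    push_cast
    ring

theorem curveEval_mulV {u v : ℂ} (h : v ^ 2 + v = u ^ 3 - u ^ 2) (p : CurvePoly) (n : ℕ) :
    curveEval u v (mulV p n) = v ^ n * curveEval u v p := by
  induction n with
  | zero => simp [mulV]
  | succ n ih =>
    rw [pow_succ', mul_assoc, ← ih, mulV]
    simp only [curveEval, polyEval, polyEval_sub]
    push_cast
    linear_combination -(polyEval u (mulV p n).2 * h)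

theorem curveEval_mulVAddOneSubU {u v : ℂ} (h : v ^ 2 + v = u ^ 3 - u ^ 2) (p : CurvePoly)
    (n : ℕ) : curveEval u v (mulVAddOneSubU p n) = (v + 1 - u) ^ n * curveEval u v p := by
  induction n with
  | zero => simp [mulVAddOneSubU]
  | succ n ih =>
    rw [pow_succ', mul_assoc, ← ih, mulVAddOneSubU]
    simp only [curveEval, polyEval, polyEval_sub]
    push_cast
    linear_combination -(polyEval u (mulVAddOneSubU p n).2 * h)

/-- Multiplication by `u ^ i * (u - 1) ^ j * (v ^ k * (v + 1 - u) ^ l)`. -/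
def unitMul (i j k l : ℕ) (p : CurvePoly) : CurvePoly :=
  mulU (mulUSubOne (mulV (mulVAddOneSubU p l) k) j) i

theorem curveEval_unitMul {u v : ℂ} (h : v ^ 2 + v = u ^ 3 - u ^ 2) (i j k l : ℕ)
    (p : CurvePoly) : curveEval u v (unitMul i j k l p) =
      u ^ i * (u - 1) ^ j * (v ^ k * (v + 1 - u) ^ l) * curveEval u v p := by
  rw [unitMul, curveEval_mulU, curveEval_mulUSubOne, curveEval_mulV h, curveEval_mulVAddOneSubU h]
  ring

/-- Laurent polynomials with coefficients that are polynomial functions on the curve. -/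
abbrev Laurent := List (Expo × CurvePoly)

/-- Evaluation of a Laurent polynomial. -/
noncomputable def laurentEval (x1 x2 x3 x4 x5 : ℂ) : Laurent → ℂ
  | [] => 0
  | t :: L => monom x1 x2 x3 x4 x5 t.1 *
      curveEval (curveU x1 x2 x3 x4 x5) (curveV x1 x2 x3 x4 x5) t.2 + laurentEval x1 x2 x3 x4 x5 L

/-- Product of a term and a Laurent polynomial. -/
def laurentTermMul (t : Expo × CurvePoly) : Laurent → Laurent
  | [] => []
  | s :: L => (expoAdd t.1 s.1, curveMul t.2 s.2) :: laurentTermMul t L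

/-- Product of Laurent polynomials. -/
def laurentMul : Laurent → Laurent → Laurent
  | [], _ => []
  | t :: L, M => laurentTermMul t M ++ laurentMul L M

/-- Multiplication of a Laurent polynomial by an integer. -/
def laurentSmul (c : ℤ) : Laurent → Laurent
  | [] => []
  | t :: L => (t.1, curveSmul c t.2) :: laurentSmul c L

/-- The part of a Laurent polynomial of weight congruent to `g` modulo `11`. -/
def laurentPart (g : ℤ) : Laurent → Laurent
  | [] => []
  | t :: L => if (expoWeight t.1 - g) % 11 = 0 then t :: laurentPart g L
      else laurentPart g L

/-- The exponents of an element of the unit lattice. -/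
def latticeCoords (e : Expo) : ℤ × ℤ × ℤ × ℤ :=
  ((e.1 + 5 * e.2.1 + 8 * e.2.2.1 + 10 * e.2.2.2.1) / 11,
    (-3 * e.1 + 7 * e.2.1 - 2 * e.2.2.1 + 3 * e.2.2.2.1) / 11,
    (-3 * e.1 - 4 * e.2.1 - 2 * e.2.2.1 - 8 * e.2.2.2.1) / 11,
    (e.1 - 6 * e.2.1 - 3 * e.2.2.1 - e.2.2.2.1) / 11)

/-- The difference of two exponent vectors in coordinates of the unit lattice. -/
def relCoords (b e : Expo) : ℤ × ℤ × ℤ × ℤ := latticeCoords (expoAdd e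
  (-b.1, -b.2.1, -b.2.2.1, -b.2.2.2.1, -b.2.2.2.2))

/-- The componentwise minimum of the lattice coordinates of the terms. -/
def minCoords (b : Expo) : Laurent → ℤ × ℤ × ℤ × ℤ
  | [] => (0, 0, 0, 0)
  | t :: L => let c := relCoords b t.1
      let d := minCoords b L
      (min c.1 d.1, min c.2.1 d.2.1, min c.2.2.1 d.2.2.1, min c.2.2.2 d.2.2.2)

/-- The polynomial function obtained by dividing a Laurent polynomial by the monomial `b`,
provided that this is possible. -/
def laurentToCurve (b : Expo) : Laurent → Option CurvePoly
  | [] => some ([], [])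
  | t :: L => match laurentToCurve b L with
    | none => none
    | some p =>
      let c := relCoords b t.1
      if expoAdd b (unitExpo c.1.toNat c.2.1.toNat c.2.2.1.toNat c.2.2.2.toNat) = t.1 then
        some (curveAdd (unitMul c.1.toNat c.2.1.toNat c.2.2.1.toNat c.2.2.2.toNat t.2) p)
      else none

/-- Certificate for the vanishing of a Laurent polynomial of pure weight at theta vectors. -/
def laurentVanishes : Laurent → Bool
  | [] => true
  | t :: L =>
    let d := minCoords t.1 L
    match laurentToCurve (expoAdd t.1 (unitExpo (min 0 d.1) (min 0 d.2.1) (min 0 d.2.2.1)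
      (min 0 d.2.2.2))) (t :: L) with
    | none => false
    | some p => polyIsZero p.1 && polyIsZero p.2

/-- Certificate for the vanishing of a Laurent polynomial at theta vectors. -/
def laurentVanishesAll (L : Laurent) : ℕ → Bool
  | 0 => true
  | n + 1 => laurentVanishes (laurentPart n L) && laurentVanishesAll L n

theorem mul_rearrange (a1 a2 a3 a4 b1 b2 b3 b4 c1 c2 c3 c4 d1 d2 d3 d4 e1 e2 e3 e4 : ℂ) :
    (a1 * a2 * a3 * a4) * (b1 * b2 * b3 * b4) * (c1 * c2 * c3 * c4) * (d1 * d2 * d3 * d4)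
      * (e1 * e2 * e3 * e4) =
    (a1 * b1 * c1 * d1 * e1) * (a2 * b2 * c2 * d2 * e2) * ((a3 * b3 * c3 * d3 * e3) * (a4
      * b4 * c4 * d4 * e4)) := by
  ring

section LaurentEval
variable (x1 x2 x3 x4 x5 : ℂ)

theorem laurentEval_append (L M : Laurent) : laurentEval x1 x2 x3 x4 x5 (L ++ M) =
    laurentEval x1 x2 x3 x4 x5 L + laurentEval x1 x2 x3 x4 x5 M := by
  induction L with
  | nil => simp [laurentEval]
  | cons t L ih => simp only [List.cons_append, laurentEval, ih, add_assoc]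

theorem laurentEval_smul (c : ℤ) (L : Laurent) : laurentEval x1 x2 x3 x4 x5 (laurentSmul c L) =
    c * laurentEval x1 x2 x3 x4 x5 L := by
  induction L with
  | nil => simp [laurentEval, laurentSmul]
  | cons t L ih =>
    simp only [laurentEval, laurentSmul, ih, curveEval_smul]
    ring

variable {x1 x2 x3 x4 x5} (hx : IsThetaVector x1 x2 x3 x4 x5)
include hx

theorem IsThetaVector.monom_expoAdd (e f : Expo) : monom x1 x2 x3 x4 x5 (expoAdd e f) =
    monom x1 x2 x3 x4 x5 e * monom x1 x2 x3 x4 x5 f := by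
  simp only [monom, expoAdd, zpow_add₀ hx.ne1, zpow_add₀ hx.ne2, zpow_add₀ hx.ne3,
    zpow_add₀ hx.ne4, zpow_add₀ hx.ne5]
  ring

theorem IsThetaVector.monom_unitExpo (i j k l : ℕ) : monom x1 x2 x3 x4 x5 (unitExpo i j k l) =
    curveU x1 x2 x3 x4 x5 ^ i * (curveU x1 x2 x3 x4 x5 - 1) ^ j * (curveV x1 x2 x3 x4 x5 ^ k *
      (curveV x1 x2 x3 x4 x5 + 1 - curveU x1 x2 x3 x4 x5) ^ l) := by
  have n1 := hx.ne1
  have n2 := hx.ne2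
  have n3 := hx.ne3
  have e1 : curveU x1 x2 x3 x4 x5 = monom x1 x2 x3 x4 x5 (unitExpo 1 0 0 0) := by
    simp [curveU, monom, unitExpo, zpow_neg]
    field_simp
  have e2 : curveU x1 x2 x3 x4 x5 - 1 = monom x1 x2 x3 x4 x5 (unitExpo 0 1 0 0) := by
    simp [hx.curveU_sub_one, monom, unitExpo, zpow_neg]
    field_simp
  have e3 : curveV x1 x2 x3 x4 x5 = monom x1 x2 x3 x4 x5 (unitExpo 0 0 1 0) := by
    simp [curveV, monom, unitExpo, zpow_neg]
    field_simp
  have e4 : curveV x1 x2 x3 x4 x5 + 1 - curveU x1 x2 x3 x4 x5 =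
      monom x1 x2 x3 x4 x5 (unitExpo 0 0 0 1) := by
    simp [hx.curveV_add_one_sub_curveU, monom, unitExpo, zpow_neg]
    field_simp
  rw [e4, e2, e1, e3]
  simp only [monom, unitExpo, mul_zpow, ← zpow_natCast, ← zpow_mul]
  rw [show -2 * (i : ℤ) - 2 * j - 3 * k - 2 * l = (-2 * (1 : ℤ) - 2 * 0 - 3 * 0 - 2 * 0) * i + (-2
      * (0 : ℤ) - 2 * 1 - 3 * 0 - 2 * 0) * j + (-2 * (0 : ℤ) - 2 * 0 - 3 * 1 - 2 * 0) * k + (-2 *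
      (0 : ℤ) - 2 * 0 - 3 * 0 - 2 * 1) * l by ring,
    show -(i : ℤ) - k - 2 * l = (-(1 : ℤ) - 0 - 2 * 0) * i + (-(0 : ℤ) - 0 - 2 * 0) * j + (-(0 : ℤ)
      - 1 - 2 * 0) * k + (-(0 : ℤ) - 0 - 2 * 1) * l by ring,
    show (i : ℤ) - j + k - l = ((1 : ℤ) - 0 + 0 - 0) * i + ((0 : ℤ) - 1 + 0 - 0) * j + ((0 : ℤ) - 0
      + 1 - 0) * k + ((0 : ℤ) - 0 + 0 - 1) * l by ring,
    show (i : ℤ) + j + 2 * l = ((1 : ℤ) + 0 + 2 * 0) * i + ((0 : ℤ) + 1 + 2 * 0) * j + ((0 : ℤ) + 0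
      + 2 * 0) * k + ((0 : ℤ) + 0 + 2 * 1) * l by ring,
    show (i : ℤ) + 2 * j + 3 * k + 3 * l = ((1 : ℤ) + 2 * 0 + 3 * 0 + 3 * 0) * i + ((0 : ℤ) + 2 * 1
      + 3 * 0 + 3 * 0) * j + ((0 : ℤ) + 2 * 0 + 3 * 1 + 3 * 0) * k + ((0 : ℤ) + 2 * 0 + 3 * 0 + 3 *
      1) * l by ring]
  simp only [zpow_add₀ hx.ne1, zpow_add₀ hx.ne2, zpow_add₀ hx.ne3, zpow_add₀ hx.ne4,
    zpow_add₀ hx.ne5]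
  exact mul_rearrange ..

theorem IsThetaVector.laurentEval_mul (L M : Laurent) :
    laurentEval x1 x2 x3 x4 x5 (laurentMul L M) =
      laurentEval x1 x2 x3 x4 x5 L * laurentEval x1 x2 x3 x4 x5 M := by
  have aux : ∀ (t : Expo × CurvePoly) (M : Laurent),
      laurentEval x1 x2 x3 x4 x5 (laurentTermMul t M) = monom x1 x2 x3 x4 x5 t.1 *
        curveEval (curveU x1 x2 x3 x4 x5) (curveV x1 x2 x3 x4 x5) t.2 *
        laurentEval x1 x2 x3 x4 x5 M := by
    intro t M
    induction M with
    | nil => simp [laurentEval, laurentTermMul]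
    | cons s M ih =>
      simp only [laurentEval, laurentTermMul, ih, hx.monom_expoAdd, curveEval_mul hx.curve_eq]
      ring
  induction L with
  | nil => simp [laurentEval, laurentMul]
  | cons t L ih =>
    simp only [laurentMul, laurentEval_append, ih, aux, laurentEval]
    ring

theorem IsThetaVector.laurentEval_eq_of_toCurve (b : Expo) {L : Laurent} {p : CurvePoly}
    (h : laurentToCurve b L = some p) : laurentEval x1 x2 x3 x4 x5 L = monom x1 x2 x3 x4 x5 b *
      curveEval (curveU x1 x2 x3 x4 x5) (curveV x1 x2 x3 x4 x5) p := by
  induction L generalizing p with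
  | nil =>
    rw [laurentToCurve, Option.some.injEq] at h
    subst h
    simp [laurentEval, curveEval, polyEval]
  | cons t L ih =>
    rw [laurentToCurve] at h
    cases hL : laurentToCurve b L with
    | none => simp [hL] at h
    | some q =>
      simp only [hL] at h
      split_ifs at h with hc
      rw [Option.some.injEq] at h
      subst h
      simp only [laurentEval, curveEval_add, curveEval_unitMul hx.curve_eq, ih hL]
      rw [← hx.monom_unitExpo]
      nth_rw 1 [← hc]
      rw [hx.monom_expoAdd]
      ring

theorem IsThetaVector.laurentEval_eq_zero {L : Laurent} (h : laurentVanishes L = true) :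
    laurentEval x1 x2 x3 x4 x5 L = 0 := by
  cases L with
  | nil => rfl
  | cons t L =>
    rw [laurentVanishes] at h
    split at h
    · simp at h
    · rename_i p hp
      rw [Bool.and_eq_true] at h
      rw [hx.laurentEval_eq_of_toCurve _ hp, curveEval, polyEval_of_isZero _ h.1,
        polyEval_of_isZero _ h.2]
      ring

omit hx in
theorem laurentEval_eq_sum_parts (L : Laurent) : laurentEval x1 x2 x3 x4 x5 L =
    ∑ g ∈ Finset.range 11, laurentEval x1 x2 x3 x4 x5 (laurentPart g L) := by
  induction L with
  | nil => simp [laurentEval, laurentPart]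
  | cons t L ih =>
    have e : ∀ g : ℤ, laurentEval x1 x2 x3 x4 x5 (laurentPart g (t :: L)) =
        (if (expoWeight t.1 - g) % 11 = 0 then monom x1 x2 x3 x4 x5 t.1 *
          curveEval (curveU x1 x2 x3 x4 x5) (curveV x1 x2 x3 x4 x5) t.2 else 0) +
        laurentEval x1 x2 x3 x4 x5 (laurentPart g L) := by
      intro g
      rw [laurentPart]
      split_ifs <;> simp [laurentEval]
    simp only [e, Finset.sum_add_distrib, ← ih, laurentEval]
    congr 1
    have h0 := Int.emod_nonneg (expoWeight t.1) (by norm_num : (11 : ℤ) ≠ 0)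
    have h1 := Int.emod_lt_of_pos (expoWeight t.1) (by norm_num : (0 : ℤ) < 11)
    rw [Finset.sum_eq_single_of_mem (expoWeight t.1 % 11).toNat (Finset.mem_range.mpr (by omega)),
      if_pos (by omega)]
    intro b hb hne
    rw [Finset.mem_range] at hb
    rw [if_neg (by omega)]

theorem IsThetaVector.laurentEval_eq_zero_of_all {L : Laurent}
    (h : laurentVanishesAll L 11 = true) : laurentEval x1 x2 x3 x4 x5 L = 0 := by
  rw [laurentEval_eq_sum_parts]
  have aux : ∀ n, laurentVanishesAll L n = true → ∀ g ∈ Finset.range n,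
      laurentEval x1 x2 x3 x4 x5 (laurentPart g L) = 0 := by
    intro n
    induction n with
    | zero => simp
    | succ n ih =>
      intro hn g hg
      rw [laurentVanishesAll, Bool.and_eq_true] at hn
      rw [Finset.mem_range, Nat.lt_succ_iff_lt_or_eq] at hg
      rcases hg with hg | rfl
      · exact ih hn.2 g (Finset.mem_range.mpr hg)
      · exact hx.laurentEval_eq_zero hn.1
  exact Finset.sum_eq_zero (aux 11 h)

end LaurentEval

/-- The discriminant as a polynomial function on the curve. -/
def discCurve : CurvePoly := ([1, 2, -5, 1], [2, -3])

/-- The coefficients of the eleven-dissection of the pentagonal number series. -/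
def pentList : Laurent :=
  [((0, 0, 0, 0, 0), ([1], [])),
   ((-1, 1, 0, 0, 0), ([-1], [])),
   ((0, -1, 0, 1, 0), ([1], [])),
   ((0, 0, -1, 0, 1), ([-1], [])),
   ((0, 0, 1, -1, 0), ([1], [])),
   ((1, 0, 0, 0, -1), ([-1], []))]

/-- The eleven-dissection of the inverse of the pentagonal number series, up to a power of the
discriminant. -/
def pentInvList : Laurent :=
  [((-11, 2, -2, 5, 6), ([11, -165, 781, -1672, 2090, -1705, 1012, -176, -385, 209, 11], [0,
     -242, 968, -1452, 1089, -484, 484, -484, 121])),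
   ((-10, 3, -3, 4, 6), ([1, -43, 372, -984, 1311, -979, 665, -456, 232, -222, 145], [1, -38,
     449, -1141, 1399, -1146, 1069, -691, 95, 15])),
   ((-9, 3, -2, 3, 5), ([7, -147, 679, -1520, 1642, -352, -1395, 1835, -708, -212, 146, 22], [7,
     -145, 745, -1761, 2137, -1400, 102, 850, -677, 138])),
   ((-10, 3, -2, 3, 6), ([-42, 288, -939, 1310, -194, -2167, 3431, -2375, 849, -323, 147], [-42,
     287, -1016, 1579, -843, -906, 1720, -876, 47, 30])),
   ((-10, 3, -2, 4, 5), ([5, -116, 650, -1543, 1891, -1012, 80, -487, 1094, -681, 120], [5,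
     -146, 628, -1393, 2188, -2243, 1297, -485, 123, 42])),
   ((-11, 3, -2, 4, 6), ([-30, 267, -875, 1503, -720, -1430, 2215, -1137, 377, -204, 39], [-30,
     282, -820, 1450, -1314, 269, 413, -412, 208, 1])),
   ((-9, 2, -3, 5, 5), ([0, -3, 106, -482, 1305, -2197, 2487, -2080, 1485, -785, 185, 1], [7,
     88, -167, -286, 1106, -1333, 1123, -755, 180, 61])),
   ((-10, 3, -1, 4, 4), ([22, -248, 1125, -2306, 2368, -1270, 431, -222, 297, -360, 161, 2],
     [25, -176, 942, -2409, 3367, -2941, 1509, -58, -333, 67])),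
   ((-9, 2, -2, 4, 5), ([-2, 77, -525, 1413, -2282, 2440, -1327, -620, 1538, -910, 188, 3], [-3,
     21, -420, 1468, -2307, 1780, -507, -102, -24, 87])),
   ((-10, 2, -2, 4, 6), ([15, -205, 795, -1571, 1526, -385, -728, 618, 114, -305, 96], [15,
     -163, 762, -1770, 1911, -976, 382, -421, 226, 5])),
   ((-10, 2, -2, 5, 5), ([-1, 65, -416, 1512, -2939, 3047, -1545, 291, 76, -207, 119], [21, 115,
     -625, 1229, -1146, 101, 922, -772, 147, 7]))]

/-- A monomial as a Laurent polynomial. -/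
def monomList (c : ℤ) (e : Expo) : Laurent := [(e, [c], [])]

/-- A monomial times a power of the discriminant as a Laurent polynomial. -/
def discMonomList (c : ℤ) (n : ℕ) (e : Expo) : Laurent := [(e, curveSmul c (curvePow discCurve n))]

theorem pentList_mul_pentInvList_certificate :
    laurentVanishesAll (laurentMul pentList pentInvList ++ discMonomList (-1) 5 (0, 0, 0, 0, 0)) 11 =
      true := by
  decide +kernel

/-- The theta part of the combination with positive weights on the rank classes 0, 2, 4. -/
def thetaPart024 : Laurent :=
  [((-3, 3, -1, 0, 0), ([-6], [])),
   ((1, -2, -1, 1, 0), ([5], [])),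
   ((2, -1, -2, -1, 1), ([7], [])),
   ((2, 0, 0, -2, -1), ([1], [])),
   ((3, 0, 0, -1, -3), ([-3], [])),
   ((-2, 1, -1, 1, 0), ([7], [])),
   ((-1, -1, 1, -1, 1), ([-7], [])),
   ((-1, 0, 0, 1, -1), ([7], [])),
   ((0, 0, 0, -1, 0), ([-7], [])),
   ((0, 0, -1, 0, 0), ([4], [])),
   ((-1, -1, 1, 0, 0), ([-4], [])),
   ((0, -2, 1, 1, -1), ([4], [])),
   ((1, -1, -1, -1, 1), ([-4], [])),
   ((1, 0, -1, -1, 0), ([4], [])),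
   ((-1, 1, -1, 1, -1), ([-4], [])),
   ((-1, 0, 0, 0, 0), ([4], [])),
   ((1, -1, -2, 0, 1), ([-4], [])),
   ((1, 1, -1, -1, -1), ([-2], [])),
   ((0, 0, 0, 0, -1), ([2], [])),
   ((-1, 0, 1, -2, 1), ([-2], [])),
   ((0, -1, 0, -1, 1), ([2], [])),
   ((1, 1, 0, -1, -2), ([-6], [])),
   ((0, 1, -1, 0, -1), ([6], [])),
   ((0, -1, 0, 0, 0), ([-6], [])),
   ((-1, -1, 1, 1, -1), ([6], []))]

theorem thetaPart024_certificate :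
    laurentVanishesAll (laurentPart 1 (laurentMul thetaPart024 pentInvList) ++
      (discMonomList (-1) 5 (0, -1, -1, 0, 1) ++ discMonomList (-11) 4 (-4, -2, -1, 2, 4))) 11 = true := by
  decide +kernel

/-- The theta part of the combination with positive weights on the rank classes 0, 1, 3. -/
def thetaPart013 : Laurent :=
  [((-3, 3, -1, 0, 0), ([11], [])),
   ((1, -2, -1, 1, 0), ([-16], [])),
   ((2, -1, -2, -1, 1), ([-23], [])),
   ((2, 0, 0, -2, -1), ([-13], [])),
   ((3, 0, 0, -1, -3), ([2], [])),
   ((-2, 1, -1, 1, 0), ([-10], [])),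
   ((-1, -1, 1, -1, 1), ([10], [])),
   ((-1, 0, 0, 1, -1), ([-10], [])),
   ((0, 0, 0, -1, 0), ([10], [])),
   ((0, 0, -1, 0, 0), ([-1], [])),
   ((-1, -1, 1, 0, 0), ([1], [])),
   ((0, -2, 1, 1, -1), ([-1], [])),
   ((1, -1, -1, -1, 1), ([1], [])),
   ((1, 0, -1, -1, 0), ([-12], [])),
   ((-1, 1, -1, 1, -1), ([12], [])),
   ((-1, 0, 0, 0, 0), ([-12], [])),
   ((1, -1, -2, 0, 1), ([12], [])),
   ((1, 1, -1, -1, -1), ([6], [])),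
   ((0, 0, 0, 0, -1), ([-6], [])),
   ((-1, 0, 1, -2, 1), ([6], [])),
   ((0, -1, 0, -1, 1), ([-6], [])),
   ((1, 1, 0, -1, -2), ([7], [])),
   ((0, 1, -1, 0, -1), ([-7], [])),
   ((0, -1, 0, 0, 0), ([7], [])),
   ((-1, -1, 1, 1, -1), ([-7], []))]

theorem thetaPart013_certificate :
    laurentVanishesAll (laurentPart 1 (laurentMul thetaPart013 pentInvList) ++
      (discMonomList (-1) 5 (0, -1, -1, 0, 1) ++ discMonomList (-11) 4 (-4, -3, -3, 3, 6))) 11 = true := by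
  decide +kernel

/-- The theta part of the combination with positive weights on the rank classes 1, 4. -/
def thetaPart14 : Laurent :=
  [((-3, 3, -1, 0, 0), ([-2], [])),
   ((1, -2, -1, 1, 0), ([7], [])),
   ((2, -1, -2, -1, 1), ([10], [])),
   ((2, 0, 0, -2, -1), ([12], [])),
   ((3, 0, 0, -1, -3), ([2], [])),
   ((-2, 1, -1, 1, 0), ([2], [])),
   ((-1, -1, 1, -1, 1), ([-2], [])),
   ((-1, 0, 0, 1, -1), ([2], [])),
   ((0, 0, 0, -1, 0), ([-2], [])),
   ((0, 0, -1, 0, 0), ([-2], [])),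
   ((-1, -1, 1, 0, 0), ([2], [])),
   ((0, -2, 1, 1, -1), ([-2], [])),
   ((1, -1, -1, -1, 1), ([2], [])),
   ((1, 0, -1, -1, 0), ([9], [])),
   ((-1, 1, -1, 1, -1), ([-9], [])),
   ((-1, 0, 0, 0, 0), ([9], [])),
   ((1, -1, -2, 0, 1), ([-9], [])),
   ((1, 1, -1, -1, -1), ([-10], [])),
   ((0, 0, 0, 0, -1), ([10], [])),
   ((-1, 0, 1, -2, 1), ([-10], [])),
   ((0, -1, 0, -1, 1), ([10], [])),
   ((1, 1, 0, -1, -2), ([3], [])),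
   ((0, 1, -1, 0, -1), ([-3], [])),
   ((0, -1, 0, 0, 0), ([3], [])),
   ((-1, -1, 1, 1, -1), ([-3], []))]

theorem thetaPart14_certificate :
    laurentVanishesAll (laurentPart 1 (laurentMul thetaPart14 pentInvList) ++
      (discMonomList (0) 5 (0, -1, -1, 0, 1) ++ discMonomList (-11) 4 (-4, -1, -3, 2, 5))) 11 = true := by
  decide +kernel

/-- The theta part of the combination with positive weights on the rank classes 1, 2, 5. -/
def thetaPart125 : Laurent :=
  [((-3, 3, -1, 0, 0), ([-4], [])),
   ((1, -2, -1, 1, 0), ([8], [])),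
   ((2, -1, -2, -1, 1), ([10], [])),
   ((2, 0, 0, -2, -1), ([4], [])),
   ((3, 0, 0, -1, -3), ([2], [])),
   ((-2, 1, -1, 1, 0), ([3], [])),
   ((-1, -1, 1, -1, 1), ([-3], [])),
   ((-1, 0, 0, 1, -1), ([3], [])),
   ((0, 0, 0, -1, 0), ([-3], [])),
   ((0, 0, -1, 0, 0), ([-3], [])),
   ((-1, -1, 1, 0, 0), ([3], [])),
   ((0, -2, 1, 1, -1), ([-3], [])),
   ((1, -1, -1, -1, 1), ([3], [])),
   ((1, 0, -1, -1, 0), ([-3], [])),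
   ((-1, 1, -1, 1, -1), ([3], [])),
   ((-1, 0, 0, 0, 0), ([-3], [])),
   ((1, -1, -2, 0, 1), ([3], [])),
   ((1, 1, -1, -1, -1), ([7], [])),
   ((0, 0, 0, 0, -1), ([-7], [])),
   ((-1, 0, 1, -2, 1), ([7], [])),
   ((0, -1, 0, -1, 1), ([-7], [])),
   ((1, 1, 0, -1, -2), ([-1], [])),
   ((0, 1, -1, 0, -1), ([1], [])),
   ((0, -1, 0, 0, 0), ([-1], [])),
   ((-1, -1, 1, 1, -1), ([1], []))]

theorem thetaPart125_certificate :
    laurentVanishesAll (laurentPart 1 (laurentMul thetaPart125 pentInvList) ++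
      (discMonomList (1) 5 (0, -1, -1, 0, 1) ++ discMonomList (-11) 4 (-4, 0, -1, 1, 3))) 11 = true := by
  decide +kernel

/-- The theta part of the combination with positive weights on the rank classes 2, 3, 4. -/
def thetaPart234 : Laurent :=
  [((-3, 3, -1, 0, 0), ([-2], [])),
   ((1, -2, -1, 1, 0), ([1], [])),
   ((2, 0, 0, -2, -1), ([3], [])),
   ((-2, 1, -1, 1, 0), ([1], [])),
   ((-1, -1, 1, -1, 1), ([-1], [])),
   ((-1, 0, 0, 1, -1), ([1], [])),
   ((0, 0, 0, -1, 0), ([-1], [])),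
   ((0, 0, -1, 0, 0), ([-1], [])),
   ((-1, -1, 1, 0, 0), ([1], [])),
   ((0, -2, 1, 1, -1), ([-1], [])),
   ((1, -1, -1, -1, 1), ([1], [])),
   ((1, 0, -1, -1, 0), ([-1], [])),
   ((-1, 1, -1, 1, -1), ([1], [])),
   ((-1, 0, 0, 0, 0), ([-1], [])),
   ((1, -1, -2, 0, 1), ([1], [])),
   ((1, 1, -1, -1, -1), ([-5], [])),
   ((0, 0, 0, 0, -1), ([5], [])),
   ((-1, 0, 1, -2, 1), ([-5], [])),
   ((0, -1, 0, -1, 1), ([5], [])),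
   ((1, 1, 0, -1, -2), ([-4], [])),
   ((0, 1, -1, 0, -1), ([4], [])),
   ((0, -1, 0, 0, 0), ([-4], [])),
   ((-1, -1, 1, 1, -1), ([4], []))]

theorem thetaPart234_certificate :
    laurentVanishesAll (laurentPart 1 (laurentMul thetaPart234 pentInvList) ++
      (discMonomList (1) 5 (0, -1, -1, 0, 1) ++ discMonomList (-11) 4 (-5, -1, 0, 3, 2))) 11 = true := by
  decide +kernel

/-- Polynomials in an eleventh root of unity with Laurent polynomial coefficients. -/
abbrev RootLaurent := List (ℕ × Laurent)

/-- Evaluation of a polynomial in a root of unity. -/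
noncomputable def rootEval (z x1 x2 x3 x4 x5 : ℂ) : RootLaurent → ℂ
  | [] => 0
  | t :: L => z ^ t.1 * laurentEval x1 x2 x3 x4 x5 t.2 + rootEval z x1 x2 x3 x4 x5 L

/-- Product of a term and a polynomial in a root of unity. -/
def rootTermMul (t : ℕ × Laurent) : RootLaurent → RootLaurent
  | [] => []
  | s :: L => (t.1 + s.1, laurentMul t.2 s.2) :: rootTermMul t L

/-- Product of polynomials in a root of unity. -/
def rootMul : RootLaurent → RootLaurent → RootLaurent
  | [], _ => []
  | t :: L, M => rootTermMul t M ++ rootMul L M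

/-- The coefficient of a power of the root of unity. -/
def rootPart (k : ℕ) : RootLaurent → Laurent
  | [] => []
  | t :: L => if t.1 % 11 = k then t.2 ++ rootPart k L else rootPart k L

/-- Certificate for the vanishing of a polynomial in a primitive eleventh root of unity. -/
def rootVanishes (L : RootLaurent) : ℕ → Bool
  | 0 => true
  | n + 1 => laurentVanishesAll (rootPart n L ++ laurentSmul (-1) (rootPart 10 L)) 11 &&
      rootVanishes L n

section RootEval
variable {z x1 x2 x3 x4 x5 : ℂ}

theorem rootEval_append (L M : RootLaurent) : rootEval z x1 x2 x3 x4 x5 (L ++ M) =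
    rootEval z x1 x2 x3 x4 x5 L + rootEval z x1 x2 x3 x4 x5 M := by
  induction L with
  | nil => simp [rootEval]
  | cons t L ih => simp only [List.cons_append, rootEval, ih, add_assoc]

theorem rootEval_mul (hx : IsThetaVector x1 x2 x3 x4 x5) (L M : RootLaurent) :
    rootEval z x1 x2 x3 x4 x5 (rootMul L M) =
      rootEval z x1 x2 x3 x4 x5 L * rootEval z x1 x2 x3 x4 x5 M := by
  have aux : ∀ (t : ℕ × Laurent) (M : RootLaurent),
      rootEval z x1 x2 x3 x4 x5 (rootTermMul t M) = z ^ t.1 *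
        laurentEval x1 x2 x3 x4 x5 t.2 * rootEval z x1 x2 x3 x4 x5 M := by
    intro t M
    induction M with
    | nil => simp [rootEval, rootTermMul]
    | cons s M ih =>
      simp only [rootEval, rootTermMul, ih, hx.laurentEval_mul, pow_add]
      ring
  induction L with
  | nil => simp [rootEval, rootMul]
  | cons t L ih =>
    simp only [rootMul, rootEval_append, ih, aux, rootEval]
    ring

theorem rootEval_eq_sum (hz : z ^ 11 = 1) (L : RootLaurent) : rootEval z x1 x2 x3 x4 x5 L =
    ∑ k ∈ Finset.range 11, z ^ k * laurentEval x1 x2 x3 x4 x5 (rootPart k L) := by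
  induction L with
  | nil => simp [rootEval, rootPart, laurentEval]
  | cons t L ih =>
    have e : ∀ k : ℕ, z ^ k * laurentEval x1 x2 x3 x4 x5 (rootPart k (t :: L)) =
        (if t.1 % 11 = k then z ^ k * laurentEval x1 x2 x3 x4 x5 t.2 else 0) +
        z ^ k * laurentEval x1 x2 x3 x4 x5 (rootPart k L) := by
      intro k
      rw [rootPart]
      split_ifs <;> simp [laurentEval_append, mul_add]
    simp only [e, Finset.sum_add_distrib, ← ih, rootEval]
    rw [Finset.sum_ite_eq, if_pos (Finset.mem_range.mpr (Nat.mod_lt _ (by norm_num))),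
      ← pow_eq_pow_mod _ hz]

theorem sum_pow_eq_zero_of_pow_eq_one (hz : z ^ 11 = 1) (h1 : z ≠ 1) :
    ∑ k ∈ Finset.range 11, z ^ k = 0 := by
  rw [geom_sum_eq h1, hz]
  simp

theorem rootEval_eq_zero (hx : IsThetaVector x1 x2 x3 x4 x5) (hz : z ^ 11 = 1) (h1 : z ≠ 1)
    {L : RootLaurent} (h : rootVanishes L 11 = true) : rootEval z x1 x2 x3 x4 x5 L = 0 := by
  have aux : ∀ n, rootVanishes L n = true → ∀ k < n, laurentEval x1 x2 x3 x4 x5 (rootPart k L) =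
      laurentEval x1 x2 x3 x4 x5 (rootPart 10 L) := by
    intro n
    induction n with
    | zero => simp
    | succ n ih =>
      intro hn k hk
      rw [rootVanishes, Bool.and_eq_true] at hn
      rw [Nat.lt_succ_iff_lt_or_eq] at hk
      rcases hk with hk | rfl
      · exact ih hn.2 k hk
      · have := hx.laurentEval_eq_zero_of_all hn.1
        rw [laurentEval_append, laurentEval_smul] at this
        push_cast at this
        linear_combination this
  rw [rootEval_eq_sum hz, Finset.sum_congr rfl fun k hk => by
    rw [aux 11 h k (Finset.mem_range.mp hk)], ← Finset.sum_mul,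
    sum_pow_eq_zero_of_pow_eq_one hz h1, zero_mul]

end RootEval

/-- The eleven-dissection of the theta function in the crank generating function. -/
def crankThetaList : RootLaurent :=
  [(0, monomList 1 (0, 0, 0, 0, 1)), (10, monomList (-1) (0, 0, 0, 0, 1)),
   (9, monomList 1 (0, 0, 0, 1, 0)), (8, monomList (-1) (0, 0, 1, 0, 0)),
   (7, monomList 1 (0, 1, 0, 0, 0)), (6, monomList (-1) (1, 0, 0, 0, 0)),
   (4, monomList 1 (1, 0, 0, 0, 0)), (3, monomList (-1) (0, 1, 0, 0, 0)),
   (2, monomList 1 (0, 0, 1, 0, 0)), (1, monomList (-1) (0, 0, 0, 1, 0))]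

/-- The coefficients of the eleven-dissection of the crank generating function. -/
def crankCoeff : ℕ → Laurent
  | 0 => monomList (-1) (0, -1, -1, 0, 1) ++ (monomList 1 (-1, 1, -1, 0, 0) ++
      (monomList 1 (0, -1, 0, 0, 0) ++ (monomList (-1) (0, 0, 0, -1, 0) ++
        monomList 1 (-1, 0, 0, 0, 0))))
  | 1 => monomList 1 (0, -1, -1, 0, 1) ++ (monomList 1 (0, 0, -1, 0, 0) ++
      monomList 1 (1, 0, 0, -1, -1))
  | 2 => monomList 1 (-1, 0, 1, -1, 0) ++ (monomList 1 (0, -1, 0, 0, 0) ++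
      monomList (-1) (0, -1, 0, 1, -1))
  | 3 => monomList 1 (-1, 1, -1, 0, 0) ++ (monomList 1 (1, 0, 0, -1, -1) ++
      monomList (-1) (0, 0, 0, 0, -1))
  | 4 => monomList 1 (0, -1, 0, 0, 0) ++ (monomList (-1) (0, -1, 0, 1, -1) ++
      (monomList 1 (0, 0, -1, 0, 0) ++ (monomList 1 (1, 0, 0, -1, -1) ++
        monomList (-1) (0, 0, 0, -1, 0))))
  | _ => []

/-- The eleven-dissection of the crank generating function. -/
def crankList : RootLaurent :=
  [(0, crankCoeff 0), (1, crankCoeff 1), (10, crankCoeff 1), (2, crankCoeff 2), (9, crankCoeff 2),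
   (3, crankCoeff 3), (8, crankCoeff 3), (4, crankCoeff 4), (7, crankCoeff 4)]

theorem crank_certificate :
    rootVanishes (rootMul [(0, monomList 1 (0, 0, 0, 0, 0)), (10, monomList (-1) (0, 0, 0, 0, 0))]
      [(0, laurentMul pentList pentList)] ++ rootMul crankThetaList
        (rootMul [(0, monomList (-1) (0, 0, 0, 0, 0))] crankList)) 11 = true := by
  decide +kernel

/-- Monomials in the theta constants. -/
noncomputable def thxMonom (ρ : ℂ) (e : Expo) : ℂ :=
  monom (thx ρ 1) (thx ρ 2) (thx ρ 3) (thx ρ 4) (thx ρ 5) e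

/-- Laurent polynomials in the theta constants. -/
noncomputable def thxEval (ρ : ℂ) (L : Laurent) : ℂ :=
  laurentEval (thx ρ 1) (thx ρ 2) (thx ρ 3) (thx ρ 4) (thx ρ 5) L

section ThetaParts
variable {ρ : ℂ} (h0 : ρ ≠ 0) (h1 : ‖ρ‖ < 1)
include h0

theorem thx_reductions : thx ρ 6 = thx ρ 5 ∧ thx ρ 7 = thx ρ 4 ∧ thx ρ 8 = thx ρ 3 ∧
    thx ρ 9 = thx ρ 2 ∧ thx ρ 10 = thx ρ 1 ∧ thx ρ (-1) = -thx ρ 1 ∧ thx ρ (-2) = -thx ρ 2 ∧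
    thx ρ (-3) = -thx ρ 3 ∧ thx ρ (-4) = -thx ρ 4 := by
  have h := thx_eleven_sub h0
  have h' := thx_neg h0
  exact ⟨h 5, h 4, h 3, h 2, h 1, h' 1, h' 2, h' 3, h' 4⟩

include h1

theorem lam_square_relation {a c : ℤ} (ha : a % 11 ≠ 0) (h₁ : (a + c) % 11 ≠ 0)
    (h₂ : (a - c) % 11 ≠ 0) : 2 * lam ρ a - lam ρ (a + c) - lam ρ (a - c) =
      -thDeriv (ρ ^ 121) 1 * (thx ρ (2 * a) * thx ρ c ^ 2 /
        (thx ρ a ^ 2 * (thx ρ (a + c) * thx ρ (a - c)))) := by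
  have h := lam_parallelogram h0 h1 (A := a) (C := c) (D := 0) (by simpa using ha)
    (by simpa using ha) h₁ h₂
  have n1 := thx_ne_zero h0 h1 ha
  have n2 := thx_ne_zero h0 h1 h₁
  have n3 := thx_ne_zero h0 h1 h₂
  simp only [add_zero, sub_zero] at h
  field_simp
  linear_combination h

theorem lam_relations :
    2 * lam ρ 1 - lam ρ 3 - (1 - lam ρ 1) = -thDeriv (ρ ^ 121) 1 * -(thxMonom ρ (-3, 3, -1, 0, 0)) ∧
    2 * lam ρ 2 - lam ρ 3 - lam ρ 1 = -thDeriv (ρ ^ 121) 1 * (thxMonom ρ (1, -2, -1, 1, 0)) ∧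
    2 * lam ρ 3 - lam ρ 4 - lam ρ 2 = -thDeriv (ρ ^ 121) 1 * (thxMonom ρ (2, -1, -2, -1, 1)) ∧
    2 * lam ρ 4 - lam ρ 5 - lam ρ 3 = -thDeriv (ρ ^ 121) 1 * (thxMonom ρ (2, 0, 0, -2, -1)) ∧
    2 * lam ρ 5 - (-lam ρ 5) - lam ρ 4 = -thDeriv (ρ ^ 121) 1 * (thxMonom ρ (3, 0, 0, -1, -3)) := by
  obtain ⟨e6, e7, e8, e9, e10, -⟩ := thx_reductions h0
  have n1 := thx_ne_zero h0 h1 (k := 1) (by norm_num)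
  have n2 := thx_ne_zero h0 h1 (k := 2) (by norm_num)
  have n3 := thx_ne_zero h0 h1 (k := 3) (by norm_num)
  have n4 := thx_ne_zero h0 h1 (k := 4) (by norm_num)
  have n5 := thx_ne_zero h0 h1 (k := 5) (by norm_num)
  have l1 : lam ρ (-1) = 1 - lam ρ 1 := lam_neg h0 h1 (k := 1) (by norm_num)
  have l6 : lam ρ 6 = -lam ρ 5 := by
    rw [show (6 : ℤ) = -5 + 11 by norm_num, lam_add_eleven h0 h1 (k := -5) (by norm_num),
      lam_neg h0 h1 (k := 5) (by norm_num)]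
    ring
  have x1 : thx ρ (-1) = -thx ρ 1 := thx_neg h0 1
  refine ⟨?_, ?_, ?_, ?_, ?_⟩
  · have h := lam_square_relation h0 h1 (a := 1) (c := 2) (by norm_num) (by norm_num) (by norm_num)
    norm_num [e6, e7, e8, e9, e10, l1, l6, x1] at h
    simp only [h, thxMonom, monom, zpow_neg, zpow_ofNat]
    norm_num
    field_simp
  · have h := lam_square_relation h0 h1 (a := 2) (c := 1) (by norm_num) (by norm_num) (by norm_num)
    norm_num [e6, e7, e8, e9, e10, l1, l6, x1] at h
    simp only [h, thxMonom, monom, zpow_neg, zpow_ofNat]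
    norm_num
    field_simp
    exact Or.inl trivial
  · have h := lam_square_relation h0 h1 (a := 3) (c := 1) (by norm_num) (by norm_num) (by norm_num)
    norm_num [e6, e7, e8, e9, e10, l1, l6, x1] at h
    simp only [h, thxMonom, monom, zpow_neg, zpow_ofNat]
    norm_num
    field_simp
    exact Or.inl trivial
  · have h := lam_square_relation h0 h1 (a := 4) (c := 1) (by norm_num) (by norm_num) (by norm_num)
    norm_num [e6, e7, e8, e9, e10, l1, l6, x1] at h
    simp only [h, thxMonom, monom, zpow_neg, zpow_ofNat]
    norm_num
    field_simp
    exact Or.inl trivial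
  · have h := lam_square_relation h0 h1 (a := 5) (c := 1) (by norm_num) (by norm_num) (by norm_num)
    norm_num [e6, e7, e8, e9, e10, l1, l6, x1] at h
    simp only [thxMonom, monom, zpow_neg, zpow_ofNat]
    norm_num
    field_simp at h ⊢
    linear_combination h

theorem lambertTheta_one :
    lambertTheta ρ 1 1 = lam ρ 1 + lam ρ 2 ∧
    lambertTheta ρ 1 2 = -thDeriv (ρ ^ 121) 1 * (thxMonom ρ (-2, 1, -1, 1, 0)) ∧
    lambertTheta ρ 1 3 = -thDeriv (ρ ^ 121) 1 * -(thxMonom ρ (-1, -1, 1, -1, 1)) ∧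
    lambertTheta ρ 1 4 = -thDeriv (ρ ^ 121) 1 * (thxMonom ρ (-1, 0, 0, 1, -1)) ∧
    lambertTheta ρ 1 5 = -thDeriv (ρ ^ 121) 1 * -(thxMonom ρ (0, 0, 0, -1, 0)) := by
  obtain ⟨e6, e7, e8, e9, e10, m1, m2, m3, m4⟩ := thx_reductions h0
  have n1 := thx_ne_zero h0 h1 (k := 1) (by norm_num)
  have n2 := thx_ne_zero h0 h1 (k := 2) (by norm_num)
  have n3 := thx_ne_zero h0 h1 (k := 3) (by norm_num)
  have n4 := thx_ne_zero h0 h1 (k := 4) (by norm_num)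
  have n5 := thx_ne_zero h0 h1 (k := 5) (by norm_num)
  refine ⟨?_, ?_, ?_, ?_, ?_⟩
  · norm_num [lambertTheta]
  · rw [lambertTheta, if_neg (by norm_num)]
    congr 1
    norm_num [e6, e7, e8, e9, e10, m1, m2, m3, m4, thxMonom, monom, zpow_neg, zpow_ofNat]
    field_simp
  · rw [lambertTheta, if_neg (by norm_num)]
    congr 1
    norm_num [e6, e7, e8, e9, e10, m1, m2, m3, m4, thxMonom, monom, zpow_neg, zpow_ofNat]
    field_simp
  · rw [lambertTheta, if_neg (by norm_num)]
    congr 1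
    norm_num [e6, e7, e8, e9, e10, m1, m2, m3, m4, thxMonom, monom, zpow_neg, zpow_ofNat]
    field_simp
  · rw [lambertTheta, if_neg (by norm_num)]
    congr 1
    norm_num [e6, e7, e8, e9, e10, m1, m2, m3, m4, thxMonom, monom, zpow_neg, zpow_ofNat]
    field_simp

theorem lambertTheta_two :
    lambertTheta ρ 2 1 = -thDeriv (ρ ^ 121) 1 * -(thxMonom ρ (0, 0, -1, 0, 0)) ∧
    lambertTheta ρ 2 2 = lam ρ 2 + lam ρ 4 ∧
    lambertTheta ρ 2 3 = -thDeriv (ρ ^ 121) 1 * (thxMonom ρ (-1, -1, 1, 0, 0)) ∧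
    lambertTheta ρ 2 4 = -thDeriv (ρ ^ 121) 1 * -(thxMonom ρ (0, -2, 1, 1, -1)) ∧
    lambertTheta ρ 2 5 = -thDeriv (ρ ^ 121) 1 * (thxMonom ρ (1, -1, -1, -1, 1)) := by
  obtain ⟨e6, e7, e8, e9, e10, m1, m2, m3, m4⟩ := thx_reductions h0
  have n1 := thx_ne_zero h0 h1 (k := 1) (by norm_num)
  have n2 := thx_ne_zero h0 h1 (k := 2) (by norm_num)
  have n3 := thx_ne_zero h0 h1 (k := 3) (by norm_num)
  have n4 := thx_ne_zero h0 h1 (k := 4) (by norm_num)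
  have n5 := thx_ne_zero h0 h1 (k := 5) (by norm_num)
  refine ⟨?_, ?_, ?_, ?_, ?_⟩
  · rw [lambertTheta, if_neg (by norm_num)]
    congr 1
    norm_num [e6, e7, e8, e9, e10, m1, m2, m3, m4, thxMonom, monom, zpow_neg, zpow_ofNat]
    field_simp
  · norm_num [lambertTheta]
  · rw [lambertTheta, if_neg (by norm_num)]
    congr 1
    norm_num [e6, e7, e8, e9, e10, m1, m2, m3, m4, thxMonom, monom, zpow_neg, zpow_ofNat]
    field_simp
  · rw [lambertTheta, if_neg (by norm_num)]
    congr 1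
    norm_num [e6, e7, e8, e9, e10, m1, m2, m3, m4, thxMonom, monom, zpow_neg, zpow_ofNat]
    field_simp
  · rw [lambertTheta, if_neg (by norm_num)]
    congr 1
    norm_num [e6, e7, e8, e9, e10, m1, m2, m3, m4, thxMonom, monom, zpow_neg, zpow_ofNat]
    field_simp

theorem lambertTheta_three :
    lambertTheta ρ 3 1 = -thDeriv (ρ ^ 121) 1 * (thxMonom ρ (1, 0, -1, -1, 0)) ∧
    lambertTheta ρ 3 2 = -thDeriv (ρ ^ 121) 1 * -(thxMonom ρ (-1, 1, -1, 1, -1)) ∧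
    lambertTheta ρ 3 3 = lam ρ 3 + -lam ρ 5 ∧
    lambertTheta ρ 3 4 = -thDeriv (ρ ^ 121) 1 * (thxMonom ρ (-1, 0, 0, 0, 0)) ∧
    lambertTheta ρ 3 5 = -thDeriv (ρ ^ 121) 1 * -(thxMonom ρ (1, -1, -2, 0, 1)) := by
  obtain ⟨e6, e7, e8, e9, e10, m1, m2, m3, m4⟩ := thx_reductions h0
  have n1 := thx_ne_zero h0 h1 (k := 1) (by norm_num)
  have n2 := thx_ne_zero h0 h1 (k := 2) (by norm_num)
  have n3 := thx_ne_zero h0 h1 (k := 3) (by norm_num)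
  have n4 := thx_ne_zero h0 h1 (k := 4) (by norm_num)
  have n5 := thx_ne_zero h0 h1 (k := 5) (by norm_num)
  refine ⟨?_, ?_, ?_, ?_, ?_⟩
  · rw [lambertTheta, if_neg (by norm_num)]
    congr 1
    norm_num [e6, e7, e8, e9, e10, m1, m2, m3, m4, thxMonom, monom, zpow_neg, zpow_ofNat]
    field_simp
  · rw [lambertTheta, if_neg (by norm_num)]
    congr 1
    norm_num [e6, e7, e8, e9, e10, m1, m2, m3, m4, thxMonom, monom, zpow_neg, zpow_ofNat]
    field_simp
  · rw [lambertTheta, if_pos rfl, show (2 * 3 : ℤ) = -5 + 11 by norm_num,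
      lam_add_eleven h0 h1 (by norm_num), lam_neg h0 h1 (by norm_num)]
    ring
  · rw [lambertTheta, if_neg (by norm_num)]
    congr 1
    norm_num [e6, e7, e8, e9, e10, m1, m2, m3, m4, thxMonom, monom, zpow_neg, zpow_ofNat]
    field_simp
  · rw [lambertTheta, if_neg (by norm_num)]
    congr 1
    norm_num [e6, e7, e8, e9, e10, m1, m2, m3, m4, thxMonom, monom, zpow_neg, zpow_ofNat]
    field_simp

theorem lambertTheta_four :
    lambertTheta ρ 4 1 = -thDeriv (ρ ^ 121) 1 * -(thxMonom ρ (1, 1, -1, -1, -1)) ∧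
    lambertTheta ρ 4 2 = -thDeriv (ρ ^ 121) 1 * (thxMonom ρ (0, 0, 0, 0, -1)) ∧
    lambertTheta ρ 4 3 = -thDeriv (ρ ^ 121) 1 * -(thxMonom ρ (-1, 0, 1, -2, 1)) ∧
    lambertTheta ρ 4 4 = lam ρ 4 + -lam ρ 3 ∧
    lambertTheta ρ 4 5 = -thDeriv (ρ ^ 121) 1 * (thxMonom ρ (0, -1, 0, -1, 1)) := by
  obtain ⟨e6, e7, e8, e9, e10, m1, m2, m3, m4⟩ := thx_reductions h0
  have n1 := thx_ne_zero h0 h1 (k := 1) (by norm_num)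
  have n2 := thx_ne_zero h0 h1 (k := 2) (by norm_num)
  have n3 := thx_ne_zero h0 h1 (k := 3) (by norm_num)
  have n4 := thx_ne_zero h0 h1 (k := 4) (by norm_num)
  have n5 := thx_ne_zero h0 h1 (k := 5) (by norm_num)
  refine ⟨?_, ?_, ?_, ?_, ?_⟩
  · rw [lambertTheta, if_neg (by norm_num)]
    congr 1
    norm_num [e6, e7, e8, e9, e10, m1, m2, m3, m4, thxMonom, monom, zpow_neg, zpow_ofNat]
    field_simp
  · rw [lambertTheta, if_neg (by norm_num)]
    congr 1
    norm_num [e6, e7, e8, e9, e10, m1, m2, m3, m4, thxMonom, monom, zpow_neg, zpow_ofNat]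
    field_simp
  · rw [lambertTheta, if_neg (by norm_num)]
    congr 1
    norm_num [e6, e7, e8, e9, e10, m1, m2, m3, m4, thxMonom, monom, zpow_neg, zpow_ofNat]
    field_simp
  · rw [lambertTheta, if_pos rfl, show (2 * 4 : ℤ) = -3 + 11 by norm_num,
      lam_add_eleven h0 h1 (by norm_num), lam_neg h0 h1 (by norm_num)]
    ring
  · rw [lambertTheta, if_neg (by norm_num)]
    congr 1
    norm_num [e6, e7, e8, e9, e10, m1, m2, m3, m4, thxMonom, monom, zpow_neg, zpow_ofNat]
    field_simp

theorem lambertTheta_five :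
    lambertTheta ρ 5 1 = -thDeriv (ρ ^ 121) 1 * (thxMonom ρ (1, 1, 0, -1, -2)) ∧
    lambertTheta ρ 5 2 = -thDeriv (ρ ^ 121) 1 * -(thxMonom ρ (0, 1, -1, 0, -1)) ∧
    lambertTheta ρ 5 3 = -thDeriv (ρ ^ 121) 1 * (thxMonom ρ (0, -1, 0, 0, 0)) ∧
    lambertTheta ρ 5 4 = -thDeriv (ρ ^ 121) 1 * -(thxMonom ρ (-1, -1, 1, 1, -1)) ∧
    lambertTheta ρ 5 5 = lam ρ 5 + -lam ρ 1 := by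
  obtain ⟨e6, e7, e8, e9, e10, m1, m2, m3, m4⟩ := thx_reductions h0
  have n1 := thx_ne_zero h0 h1 (k := 1) (by norm_num)
  have n2 := thx_ne_zero h0 h1 (k := 2) (by norm_num)
  have n3 := thx_ne_zero h0 h1 (k := 3) (by norm_num)
  have n4 := thx_ne_zero h0 h1 (k := 4) (by norm_num)
  have n5 := thx_ne_zero h0 h1 (k := 5) (by norm_num)
  refine ⟨?_, ?_, ?_, ?_, ?_⟩
  · rw [lambertTheta, if_neg (by norm_num)]
    congr 1
    norm_num [e6, e7, e8, e9, e10, m1, m2, m3, m4, thxMonom, monom, zpow_neg, zpow_ofNat]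
    field_simp
  · rw [lambertTheta, if_neg (by norm_num)]
    congr 1
    norm_num [e6, e7, e8, e9, e10, m1, m2, m3, m4, thxMonom, monom, zpow_neg, zpow_ofNat]
    field_simp
  · rw [lambertTheta, if_neg (by norm_num)]
    congr 1
    norm_num [e6, e7, e8, e9, e10, m1, m2, m3, m4, thxMonom, monom, zpow_neg, zpow_ofNat]
    field_simp
  · rw [lambertTheta, if_neg (by norm_num)]
    congr 1
    norm_num [e6, e7, e8, e9, e10, m1, m2, m3, m4, thxMonom, monom, zpow_neg, zpow_ofNat]
    field_simp
  · rw [lambertTheta, if_pos rfl, show (2 * 5 : ℤ) = -1 + 11 by norm_num,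
      lam_add_eleven h0 h1 (by norm_num), lam_neg h0 h1 (by norm_num)]
    ring

theorem lambert_sum_024 (hd : thDeriv (ρ ^ 121) 1 ≠ 0) :
    7 * lambert ρ 1 + (-4) * lambert ρ 2 + 4 * lambert ρ 3 + 2 * lambert ρ 4 + (-6) * lambert ρ 5 + (-6) =
    pentFactor ρ * ((-7) * (ρ ^ 30 * mockTerm ρ 1) + (-4) * (ρ ^ 54 * mockTerm ρ 2) + (-4) * (ρ ^
      72 * mockTerm ρ 3) + 2 * (ρ ^ 84 * mockTerm ρ 4) + 6 * (ρ ^ 90 * mockTerm ρ 5)) -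
      thDeriv (ρ ^ 121) 1 * thxEval ρ thetaPart024 := by
  obtain ⟨h11, h12, h13, h14, h15⟩ := lambertTheta_one h0 h1
  obtain ⟨h21, h22, h23, h24, h25⟩ := lambertTheta_two h0 h1
  obtain ⟨h31, h32, h33, h34, h35⟩ := lambertTheta_three h0 h1
  obtain ⟨h41, h42, h43, h44, h45⟩ := lambertTheta_four h0 h1
  obtain ⟨h51, h52, h53, h54, h55⟩ := lambertTheta_five h0 h1
  obtain ⟨r1, r2, r3, r4, r5⟩ := lam_relations h0 h1
  rw [lambert_dissection h0 h1 hd (a := 1) (by norm_num) (by norm_num), h11, h12, h13, h14, h15]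
  rw [lambert_dissection h0 h1 hd (a := 2) (by norm_num) (by norm_num), h21, h22, h23, h24, h25]
  rw [lambert_dissection h0 h1 hd (a := 3) (by norm_num) (by norm_num), h31, h32, h33, h34, h35]
  rw [lambert_dissection h0 h1 hd (a := 4) (by norm_num) (by norm_num), h41, h42, h43, h44, h45]
  rw [lambert_dissection h0 h1 hd (a := 5) (by norm_num) (by norm_num), h51, h52, h53, h54, h55]
  simp only [thxMonom] at *
  simp only [thxEval, thetaPart024, laurentEval, curveEval, polyEval]
  norm_num
  linear_combination 6 * r1 + 5 * r2 + 7 * r3 + 1 * r4 + (-3) * r5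

theorem lambert_sum_013 (hd : thDeriv (ρ ^ 121) 1 ≠ 0) :
    (-10) * lambert ρ 1 + 1 * lambert ρ 2 + (-12) * lambert ρ 3 + (-6) * lambert ρ 4 + 7 * lambert ρ 5 + 11 =
    pentFactor ρ * (10 * (ρ ^ 30 * mockTerm ρ 1) + 1 * (ρ ^ 54 * mockTerm ρ 2) + 12 * (ρ ^ 72 *
      mockTerm ρ 3) + (-6) * (ρ ^ 84 * mockTerm ρ 4) + (-7) * (ρ ^ 90 * mockTerm ρ 5)) -
      thDeriv (ρ ^ 121) 1 * thxEval ρ thetaPart013 := by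
  obtain ⟨h11, h12, h13, h14, h15⟩ := lambertTheta_one h0 h1
  obtain ⟨h21, h22, h23, h24, h25⟩ := lambertTheta_two h0 h1
  obtain ⟨h31, h32, h33, h34, h35⟩ := lambertTheta_three h0 h1
  obtain ⟨h41, h42, h43, h44, h45⟩ := lambertTheta_four h0 h1
  obtain ⟨h51, h52, h53, h54, h55⟩ := lambertTheta_five h0 h1
  obtain ⟨r1, r2, r3, r4, r5⟩ := lam_relations h0 h1
  rw [lambert_dissection h0 h1 hd (a := 1) (by norm_num) (by norm_num), h11, h12, h13, h14, h15]
  rw [lambert_dissection h0 h1 hd (a := 2) (by norm_num) (by norm_num), h21, h22, h23, h24, h25]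
  rw [lambert_dissection h0 h1 hd (a := 3) (by norm_num) (by norm_num), h31, h32, h33, h34, h35]
  rw [lambert_dissection h0 h1 hd (a := 4) (by norm_num) (by norm_num), h41, h42, h43, h44, h45]
  rw [lambert_dissection h0 h1 hd (a := 5) (by norm_num) (by norm_num), h51, h52, h53, h54, h55]
  simp only [thxMonom] at *
  simp only [thxEval, thetaPart013, laurentEval, curveEval, polyEval]
  norm_num
  linear_combination (-11) * r1 + (-16) * r2 + (-23) * r3 + (-13) * r4 + 2 * r5

theorem lambert_sum_14 (hd : thDeriv (ρ ^ 121) 1 ≠ 0) :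
    2 * lambert ρ 1 + 2 * lambert ρ 2 + 9 * lambert ρ 3 + 10 * lambert ρ 4 + 3 * lambert ρ 5 + (-2) =
    pentFactor ρ * ((-2) * (ρ ^ 30 * mockTerm ρ 1) + 2 * (ρ ^ 54 * mockTerm ρ 2) + (-9) * (ρ ^ 72 *
      mockTerm ρ 3) + 10 * (ρ ^ 84 * mockTerm ρ 4) + (-3) * (ρ ^ 90 * mockTerm ρ 5)) -
      thDeriv (ρ ^ 121) 1 * thxEval ρ thetaPart14 := by
  obtain ⟨h11, h12, h13, h14, h15⟩ := lambertTheta_one h0 h1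
  obtain ⟨h21, h22, h23, h24, h25⟩ := lambertTheta_two h0 h1
  obtain ⟨h31, h32, h33, h34, h35⟩ := lambertTheta_three h0 h1
  obtain ⟨h41, h42, h43, h44, h45⟩ := lambertTheta_four h0 h1
  obtain ⟨h51, h52, h53, h54, h55⟩ := lambertTheta_five h0 h1
  obtain ⟨r1, r2, r3, r4, r5⟩ := lam_relations h0 h1
  rw [lambert_dissection h0 h1 hd (a := 1) (by norm_num) (by norm_num), h11, h12, h13, h14, h15]
  rw [lambert_dissection h0 h1 hd (a := 2) (by norm_num) (by norm_num), h21, h22, h23, h24, h25]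
  rw [lambert_dissection h0 h1 hd (a := 3) (by norm_num) (by norm_num), h31, h32, h33, h34, h35]
  rw [lambert_dissection h0 h1 hd (a := 4) (by norm_num) (by norm_num), h41, h42, h43, h44, h45]
  rw [lambert_dissection h0 h1 hd (a := 5) (by norm_num) (by norm_num), h51, h52, h53, h54, h55]
  simp only [thxMonom] at *
  simp only [thxEval, thetaPart14, laurentEval, curveEval, polyEval]
  norm_num
  linear_combination 2 * r1 + 7 * r2 + 10 * r3 + 12 * r4 + 2 * r5

theorem lambert_sum_125 (hd : thDeriv (ρ ^ 121) 1 ≠ 0) :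
    3 * lambert ρ 1 + 3 * lambert ρ 2 + (-3) * lambert ρ 3 + (-7) * lambert ρ 4 + (-1) * lambert ρ 5 + (-4) =
    pentFactor ρ * ((-3) * (ρ ^ 30 * mockTerm ρ 1) + 3 * (ρ ^ 54 * mockTerm ρ 2) + 3 * (ρ ^ 72 *
      mockTerm ρ 3) + (-7) * (ρ ^ 84 * mockTerm ρ 4) + 1 * (ρ ^ 90 * mockTerm ρ 5)) -
      thDeriv (ρ ^ 121) 1 * thxEval ρ thetaPart125 := by
  obtain ⟨h11, h12, h13, h14, h15⟩ := lambertTheta_one h0 h1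
  obtain ⟨h21, h22, h23, h24, h25⟩ := lambertTheta_two h0 h1
  obtain ⟨h31, h32, h33, h34, h35⟩ := lambertTheta_three h0 h1
  obtain ⟨h41, h42, h43, h44, h45⟩ := lambertTheta_four h0 h1
  obtain ⟨h51, h52, h53, h54, h55⟩ := lambertTheta_five h0 h1
  obtain ⟨r1, r2, r3, r4, r5⟩ := lam_relations h0 h1
  rw [lambert_dissection h0 h1 hd (a := 1) (by norm_num) (by norm_num), h11, h12, h13, h14, h15]
  rw [lambert_dissection h0 h1 hd (a := 2) (by norm_num) (by norm_num), h21, h22, h23, h24, h25]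
  rw [lambert_dissection h0 h1 hd (a := 3) (by norm_num) (by norm_num), h31, h32, h33, h34, h35]
  rw [lambert_dissection h0 h1 hd (a := 4) (by norm_num) (by norm_num), h41, h42, h43, h44, h45]
  rw [lambert_dissection h0 h1 hd (a := 5) (by norm_num) (by norm_num), h51, h52, h53, h54, h55]
  simp only [thxMonom] at *
  simp only [thxEval, thetaPart125, laurentEval, curveEval, polyEval]
  norm_num
  linear_combination 4 * r1 + 8 * r2 + 10 * r3 + 4 * r4 + 2 * r5

theorem lambert_sum_234 (hd : thDeriv (ρ ^ 121) 1 ≠ 0) :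
    1 * lambert ρ 1 + 1 * lambert ρ 2 + (-1) * lambert ρ 3 + 5 * lambert ρ 4 + (-4) * lambert ρ 5 + (-2) =
    pentFactor ρ * ((-1) * (ρ ^ 30 * mockTerm ρ 1) + 1 * (ρ ^ 54 * mockTerm ρ 2) + 1 * (ρ ^ 72 *
      mockTerm ρ 3) + 5 * (ρ ^ 84 * mockTerm ρ 4) + 4 * (ρ ^ 90 * mockTerm ρ 5)) -
      thDeriv (ρ ^ 121) 1 * thxEval ρ thetaPart234 := by
  obtain ⟨h11, h12, h13, h14, h15⟩ := lambertTheta_one h0 h1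
  obtain ⟨h21, h22, h23, h24, h25⟩ := lambertTheta_two h0 h1
  obtain ⟨h31, h32, h33, h34, h35⟩ := lambertTheta_three h0 h1
  obtain ⟨h41, h42, h43, h44, h45⟩ := lambertTheta_four h0 h1
  obtain ⟨h51, h52, h53, h54, h55⟩ := lambertTheta_five h0 h1
  obtain ⟨r1, r2, r3, r4, r5⟩ := lam_relations h0 h1
  rw [lambert_dissection h0 h1 hd (a := 1) (by norm_num) (by norm_num), h11, h12, h13, h14, h15]
  rw [lambert_dissection h0 h1 hd (a := 2) (by norm_num) (by norm_num), h21, h22, h23, h24, h25]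
  rw [lambert_dissection h0 h1 hd (a := 3) (by norm_num) (by norm_num), h31, h32, h33, h34, h35]
  rw [lambert_dissection h0 h1 hd (a := 4) (by norm_num) (by norm_num), h41, h42, h43, h44, h45]
  rw [lambert_dissection h0 h1 hd (a := 5) (by norm_num) (by norm_num), h51, h52, h53, h54, h55]
  simp only [thxMonom] at *
  simp only [thxEval, thetaPart234, laurentEval, curveEval, polyEval]
  norm_num
  linear_combination 2 * r1 + 1 * r2 + 0 * r3 + 3 * r4 + 0 * r5

end ThetaParts

/-- Functions that are multiplied by `η ^ g` when the argument is multiplied by an eleventh root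
of unity `η`. -/
def IsHom (g : ℤ) (F : ℂ → ℂ) : Prop :=
  ∀ ρ η : ℂ, ρ ≠ 0 → η ^ 11 = 1 → F (η * ρ) = η ^ g * F ρ

theorem ne_zero_of_pow_eleven {η : ℂ} (h : η ^ 11 = 1) : η ≠ 0 := by
  rintro rfl
  norm_num at h

theorem zpow_mul_eleven {η : ℂ} (h : η ^ 11 = 1) (k : ℤ) : η ^ (11 * k) = 1 := by
  rw [zpow_mul, show η ^ (11 : ℤ) = η ^ 11 by norm_cast, h, one_zpow]

theorem zpow_add_mul_eleven {η : ℂ} (h : η ^ 11 = 1) (a k : ℤ) : η ^ (a + 11 * k) = η ^ a := by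
  rw [zpow_add₀ (ne_zero_of_pow_eleven h), zpow_mul_eleven h, mul_one]

namespace IsHom
variable {F G : ℂ → ℂ} {f g : ℤ}

theorem congr (hF : IsHom f F) (k : ℤ) (h : f = g + 11 * k) : IsHom g F := fun ρ η h0 hη => by
  rw [hF ρ η h0 hη, h, zpow_add_mul_eleven hη]

theorem mul (hF : IsHom f F) (hG : IsHom g G) : IsHom (f + g) fun ρ => F ρ * G ρ :=
  fun ρ η h0 hη => by
    simp only [hF ρ η h0 hη, hG ρ η h0 hη, zpow_add₀ (ne_zero_of_pow_eleven hη)]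
    ring

theorem zpow (hF : IsHom f F) (n : ℤ) : IsHom (f * n) fun ρ => F ρ ^ n := fun ρ η h0 hη => by
  simp only [hF ρ η h0 hη, mul_zpow, zpow_mul]

theorem add (hF : IsHom f F) (hG : IsHom f G) : IsHom f fun ρ => F ρ + G ρ := fun ρ η h0 hη => by
  simp only [hF ρ η h0 hη, hG ρ η h0 hη]
  ring

end IsHom

theorem isHom_pow_mul (F : ℂ → ℂ) (n : ℕ) : IsHom 0 fun ρ => F (ρ ^ (11 * n)) :=
  fun ρ η _ hη => by
    simp only [mul_pow, pow_mul η, hη, one_pow, one_mul, zpow_zero]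

theorem isHom_zpow (n : ℤ) : IsHom n fun ρ => ρ ^ n := fun ρ η _ _ => mul_zpow η ρ n

theorem isHom_pow (n : ℕ) : IsHom n fun ρ => ρ ^ n := fun ρ η _ _ => by
  simp only [mul_pow, zpow_natCast]

theorem isHom_thx (k : ℤ) : IsHom (k * k) fun ρ => thx ρ k := fun ρ η h0 hη => by
  simp only [thx]
  rw [mul_pow η ρ 121, mul_pow η ρ 22, show η ^ 121 = (η ^ 11) ^ 11 by ring,
    show η ^ 22 = (η ^ 11) ^ 2 by ring, hη, mul_zpow,
    show k * (k - 11) = k * k + 11 * (-k) by ring, zpow_add_mul_eleven hη]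
  simp only [one_pow, one_mul, mul_assoc]

theorem isHom_thxMonom (e : Expo) : IsHom (expoWeight e) fun ρ => thxMonom ρ e := by
  unfold thxMonom monom
  refine (((((isHom_thx 1).zpow e.1).mul ((isHom_thx 2).zpow e.2.1)).mul
    ((isHom_thx 3).zpow e.2.2.1)).mul ((isHom_thx 4).zpow e.2.2.2.1)).mul
    ((isHom_thx 5).zpow e.2.2.2.2) |>.congr (e.2.2.2.1 + 2 * e.2.2.2.2) ?_
  simp only [expoWeight]
  ring

theorem isHom_curveEval (p : CurvePoly) : IsHom 0 fun ρ =>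
    curveEval (curveU (thx ρ 1) (thx ρ 2) (thx ρ 3) (thx ρ 4) (thx ρ 5))
      (curveV (thx ρ 1) (thx ρ 2) (thx ρ 3) (thx ρ 4) (thx ρ 5)) p := fun ρ η h0 hη => by
  have hη0 := ne_zero_of_pow_eleven hη
  simp only [isHom_thx 1 ρ η h0 hη, isHom_thx 2 ρ η h0 hη, isHom_thx 3 ρ η h0 hη,
    isHom_thx 4 ρ η h0 hη, isHom_thx 5 ρ η h0 hη]
  have e1 : curveU (η ^ (1 * 1 : ℤ) * thx ρ 1) (η ^ (2 * 2 : ℤ) * thx ρ 2)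
      (η ^ (3 * 3 : ℤ) * thx ρ 3) (η ^ (4 * 4 : ℤ) * thx ρ 4) (η ^ (5 * 5 : ℤ) * thx ρ 5) =
      curveU (thx ρ 1) (thx ρ 2) (thx ρ 3) (thx ρ 4) (thx ρ 5) := by
    simp only [curveU]
    norm_num
    norm_cast
    rw [show η ^ 9 * thx ρ 3 * (η ^ 16 * thx ρ 4) * (η ^ 25 * thx ρ 5) =
      (η ^ 11) ^ 4 * (η ^ 6 * (thx ρ 3 * thx ρ 4 * thx ρ 5)) by ring, hη,
      show (η * thx ρ 1) ^ 2 * (η ^ 4 * thx ρ 2) = η ^ 6 * (thx ρ 1 ^ 2 * thx ρ 2) by ring,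
      one_pow, one_mul, mul_div_mul_left _ _ (pow_ne_zero 6 hη0)]
  have e2 : curveV (η ^ (1 * 1 : ℤ) * thx ρ 1) (η ^ (2 * 2 : ℤ) * thx ρ 2)
      (η ^ (3 * 3 : ℤ) * thx ρ 3) (η ^ (4 * 4 : ℤ) * thx ρ 4) (η ^ (5 * 5 : ℤ) * thx ρ 5) =
      curveV (thx ρ 1) (thx ρ 2) (thx ρ 3) (thx ρ 4) (thx ρ 5) := by
    simp only [curveV]
    norm_num
    norm_cast
    rw [show η ^ 9 * thx ρ 3 * (η ^ 25 * thx ρ 5) ^ 3 =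
      (η ^ 11) ^ 7 * (η ^ 7 * (thx ρ 3 * thx ρ 5 ^ 3)) by ring, hη,
      show (η * thx ρ 1) ^ 3 * (η ^ 4 * thx ρ 2) = η ^ 7 * (thx ρ 1 ^ 3 * thx ρ 2) by ring,
      one_pow, one_mul, mul_div_mul_left _ _ (pow_ne_zero 7 hη0)]
  rw [e1, e2, zpow_zero, one_mul]

theorem isHom_thxEval_part (g : ℤ) (L : Laurent) : IsHom g fun ρ => thxEval ρ (laurentPart g L) := by
  induction L with
  | nil => intro ρ η _ _; simp [thxEval, laurentPart, laurentEval]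
  | cons t L ih =>
    simp only [laurentPart]
    split_ifs with h
    · have h2 := ((isHom_thxMonom t.1).mul (isHom_curveEval t.2)).congr (g := g)
        ((expoWeight t.1 - g) / 11) (by omega)
      exact h2.add ih
    · exact ih

/-- The projection to the part of weight two. -/
noncomputable def weightTwo (η : ℂ) (F : ℂ → ℂ) (ρ : ℂ) : ℂ :=
  ∑ j ∈ Finset.range 11, (η ^ j) ^ (-2 : ℤ) * F (η ^ j * ρ)

theorem sum_zpow_range {η : ℂ} (hη : IsPrimitiveRoot η 11) (m : ℤ) :
    ∑ j ∈ Finset.range 11, (η ^ j) ^ m = if m % 11 = 0 then 11 else 0 := by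
  have h1 : (η ^ m) ^ 11 = 1 := by
    rw [← zpow_natCast, ← zpow_mul, mul_comm]
    exact zpow_mul_eleven hη.pow_eq_one m
  have e : ∀ j : ℕ, (η ^ j) ^ m = (η ^ m) ^ j := fun j => by
    rw [← zpow_natCast, ← zpow_natCast, ← zpow_mul, ← zpow_mul, mul_comm]
  simp only [e]
  split_ifs with h
  · rw [(hη.zpow_eq_one_iff_dvd m).mpr (Int.dvd_of_emod_eq_zero h)]
    simp
  · exact sum_pow_eq_zero_of_pow_eq_one h1 fun h2 => h
      (Int.emod_eq_zero_of_dvd (by exact_mod_cast (hη.zpow_eq_one_iff_dvd m).mp h2))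

section WeightTwo
variable {η : ℂ} (hη : IsPrimitiveRoot η 11) {ρ : ℂ}
include hη

theorem pow_pow_eleven (j : ℕ) : (η ^ j) ^ 11 = 1 := by
  rw [← pow_mul, mul_comm, pow_mul, hη.pow_eq_one, one_pow]

theorem weightTwo_of_isHom (h0 : ρ ≠ 0) {F : ℂ → ℂ} {g : ℤ} (hF : IsHom g F) :
    weightTwo η F ρ = (if (g - 2) % 11 = 0 then 11 else 0) * F ρ := by
  rw [weightTwo, ← sum_zpow_range hη, Finset.sum_mul]
  refine Finset.sum_congr rfl fun j _ => ?_
  have h := pow_pow_eleven hη j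
  rw [hF ρ _ h0 h, ← mul_assoc, ← zpow_add₀ (ne_zero_of_pow_eleven h),
    show -2 + g = g - 2 by ring]

omit hη in
theorem weightTwo_add (F G : ℂ → ℂ) :
    weightTwo η (fun ρ => F ρ + G ρ) ρ = weightTwo η F ρ + weightTwo η G ρ := by
  simp only [weightTwo, mul_add, Finset.sum_add_distrib]

omit hη in
theorem weightTwo_sum (s : Finset ℕ) (F : ℕ → ℂ → ℂ) :
    weightTwo η (fun ρ => ∑ g ∈ s, F g ρ) ρ = ∑ g ∈ s, weightTwo η (F g) ρ := by
  simp only [weightTwo, Finset.mul_sum]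
  exact Finset.sum_comm

/-- Extraction of the coefficients of a power series in `ρ ^ 2` along an arithmetic progression. -/
theorem hasSum_weightTwo {f : ℕ → ℂ} {F : ℂ → ℂ}
    (hF : ∀ j : ℕ, HasSum (fun n => f n * ((η ^ j * ρ) ^ 2) ^ n) (F (η ^ j * ρ))) :
    HasSum (fun n => 11 * ρ ^ 2 * (f (11 * n + 1) * (ρ ^ 22) ^ n)) (weightTwo η F ρ) := by
  have h := hasSum_sum fun j (_ : j ∈ Finset.range 11) => (hF j).mul_left ((η ^ j) ^ (-2 : ℤ))
  have e : ∀ n, ∑ j ∈ Finset.range 11, (η ^ j) ^ (-2 : ℤ) * (f n * ((η ^ j * ρ) ^ 2) ^ n) =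
      (if (2 * (n : ℤ) - 2) % 11 = 0 then 11 else 0) * (f n * (ρ ^ 2) ^ n) := fun n => by
    rw [← sum_zpow_range hη, Finset.sum_mul]
    refine Finset.sum_congr rfl fun j _ => ?_
    rw [sub_eq_add_neg, zpow_add₀ (ne_zero_of_pow_eleven (pow_pow_eleven hη j)), mul_pow, mul_pow,
      zpow_mul, zpow_natCast, zpow_ofNat]
    ring
  simp only [e] at h
  have hinj : Function.Injective fun n : ℕ => 11 * n + 1 := fun a b hab => by
    simp only at hab; omega
  rw [← hinj.hasSum_iff] at h
  · refine (congrArg (fun f => HasSum f _) (funext fun n => ?_)).mpr h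
    simp only [Function.comp]
    rw [if_pos (by push_cast; omega)]
    ring
  · intro n hn
    rw [if_neg, zero_mul]
    intro h2
    exact hn ⟨n / 11, by simp only; omega⟩

end WeightTwo

/-- The Euler product at `ρ ^ 242`. -/
noncomputable def eulerJ (ρ : ℂ) : ℂ := th ((ρ ^ 121) ^ 3) ((ρ ^ 121) ^ 2)

/-- The discriminant at the theta constants. -/
noncomputable def thxDisc (ρ : ℂ) : ℂ := curveEval
  (curveU (thx ρ 1) (thx ρ 2) (thx ρ 3) (thx ρ 4) (thx ρ 5))
  (curveV (thx ρ 1) (thx ρ 2) (thx ρ 3) (thx ρ 4) (thx ρ 5)) discCurve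

theorem isHom_eulerJ : IsHom 0 eulerJ :=
  isHom_pow_mul (fun x => th (x ^ 3) (x ^ 2)) 11

theorem isHom_thxDisc : IsHom 0 thxDisc := isHom_curveEval discCurve

theorem isHom_mockTerm (a : ℤ) : IsHom 0 fun ρ => mockTerm ρ a := fun ρ η _ hη => by
  simp only [mockTerm]
  rw [mul_pow η ρ 121, mul_pow η ρ 22, show η ^ 121 = (η ^ 11) ^ 11 by ring,
    show η ^ 22 = (η ^ 11) ^ 2 by ring, hη]
  simp only [one_pow, one_mul, zpow_zero]

section
variable {ρ : ℂ} (h0 : ρ ≠ 0) (h1 : ‖ρ‖ < 1)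
include h0 h1

theorem eulerJ_eq : eulerJ ρ = qp ((ρ ^ 121) ^ 2) ((ρ ^ 121) ^ 2) :=
  th_cube_sq (pow_ne_zero _ h0) (norm_pow_lt_one h1 (by norm_num))

theorem eulerJ_ne_zero : eulerJ ρ ≠ 0 := by
  rw [eulerJ_eq h0 h1]
  have h := norm_sq_lt_one (norm_pow_lt_one h1 (n := 121) (by norm_num))
  exact qp_ne_zero_of_norm_lt h h

theorem thDeriv_eq_eulerJ : thDeriv (ρ ^ 121) 1 = -eulerJ ρ ^ 3 := by
  rw [eulerJ_eq h0 h1, thDeriv_one (pow_ne_zero _ h0) (norm_pow_lt_one h1 (by norm_num))]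

theorem thDeriv_ne_zero : thDeriv (ρ ^ 121) 1 ≠ 0 := by
  rw [thDeriv_eq_eulerJ h0 h1]
  exact neg_ne_zero.mpr (pow_ne_zero _ (eulerJ_ne_zero h0 h1))

omit h0 h1 in
theorem thxDisc_eq : thxDisc ρ = discPoly
    (curveU (thx ρ 1) (thx ρ 2) (thx ρ 3) (thx ρ 4) (thx ρ 5))
    (curveV (thx ρ 1) (thx ρ 2) (thx ρ 3) (thx ρ 4) (thx ρ 5)) := by
  simp only [thxDisc, discCurve, curveEval, polyEval, discPoly]
  push_cast
  ring

theorem thxDisc_mul : thxDisc ρ * (eulerJ ρ ^ 12 * thx ρ 1 ^ 3) =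
    ρ ^ 242 * (thx ρ 2 ^ 2 * thx ρ 3 ^ 2 * thx ρ 4 ^ 5 * thx ρ 5 ^ 6) := by
  rw [thxDisc_eq]
  exact discPoly_thx h0 h1

theorem thxDisc_ne_zero : thxDisc ρ ≠ 0 := by
  intro h
  have h2 := thxDisc_mul h0 h1
  rw [h, zero_mul] at h2
  have n2 := thx_ne_zero h0 h1 (k := 2) (by norm_num)
  have n3 := thx_ne_zero h0 h1 (k := 3) (by norm_num)
  have n4 := thx_ne_zero h0 h1 (k := 4) (by norm_num)
  have n5 := thx_ne_zero h0 h1 (k := 5) (by norm_num)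
  exact mul_ne_zero (pow_ne_zero _ h0) (mul_ne_zero (mul_ne_zero (mul_ne_zero (pow_ne_zero 2 n2)
    (pow_ne_zero 2 n3)) (pow_ne_zero 5 n4)) (pow_ne_zero 6 n5)) h2.symm

theorem thxEval_discMonomList (c : ℤ) (n : ℕ) (e : Expo) :
    thxEval ρ (discMonomList c n e) = c * thxDisc ρ ^ n * thxMonom ρ e := by
  have hc := (isThetaVector_thx h0 h1).curve_eq
  simp only [thxEval, discMonomList, laurentEval, curveEval_smul, curveEval_pow hc, thxDisc,
    thxMonom]
  ring

theorem pentFactor_eq : pentFactor ρ = thxEval ρ pentList := by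
  obtain ⟨e6, e7, e8, e9, e10, -⟩ := thx_reductions h0
  have n1 := thx_ne_zero h0 h1 (k := 1) (by norm_num)
  have n2 := thx_ne_zero h0 h1 (k := 2) (by norm_num)
  have n3 := thx_ne_zero h0 h1 (k := 3) (by norm_num)
  have n4 := thx_ne_zero h0 h1 (k := 4) (by norm_num)
  have n5 := thx_ne_zero h0 h1 (k := 5) (by norm_num)
  simp only [pentFactor, thxEval, pentList, laurentEval, curveEval, polyEval, monom, e6, e8, e10,
    zpow_zero, zpow_one, zpow_neg]
  push_cast
  field_simp
  ring

theorem pentFactor_mul_inv : pentFactor ρ * thxEval ρ pentInvList = thxDisc ρ ^ 5 := by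
  have hx := isThetaVector_thx h0 h1
  have h := hx.laurentEval_eq_zero_of_all pentList_mul_pentInvList_certificate
  rw [laurentEval_append, hx.laurentEval_mul] at h
  have h2 := thxEval_discMonomList h0 h1 (-1) 5 (0, 0, 0, 0, 0)
  have h3 : thxMonom ρ (0, 0, 0, 0, 0) = 1 := by simp [thxMonom, monom]
  rw [h3] at h2
  rw [pentFactor_eq h0 h1]
  simp only [thxEval] at h2 ⊢
  rw [h2] at h
  push_cast at h
  linear_combination h

theorem pentFactor_ne_zero : pentFactor ρ ≠ 0 := by
  intro h
  have h2 := pentFactor_mul_inv h0 h1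
  rw [h, zero_mul] at h2
  exact pow_ne_zero 5 (thxDisc_ne_zero h0 h1) h2.symm

omit h1 in
theorem weightTwo_mul_thxEval {η : ℂ} (hη : IsPrimitiveRoot η 11) {P : ℂ → ℂ} (hP : IsHom (-10) P)
    (L : Laurent) : weightTwo η (fun ρ => P ρ * thxEval ρ L) ρ =
      11 * (P ρ * thxEval ρ (laurentPart 1 L)) := by
  have e : ∀ ρ, thxEval ρ L = ∑ g ∈ Finset.range 11, thxEval ρ (laurentPart g L) := fun ρ =>
    laurentEval_eq_sum_parts L
  simp only [e, Finset.mul_sum]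
  rw [weightTwo_sum, Finset.sum_eq_single 1]
  · rw [weightTwo_of_isHom hη h0 (hP.mul (isHom_thxEval_part (1 : ℕ) L))]
    norm_num
  · intro g hg hg1
    rw [weightTwo_of_isHom hη h0 (hP.mul (isHom_thxEval_part g L)), if_neg, zero_mul]
    have := Finset.mem_range.mp hg
    omega
  · simp

omit h1 in
theorem weightTwo_mock {η : ℂ} (hη : IsPrimitiveRoot η 11) (n : ℕ) (a : ℤ) (c : ℂ)
    (hn : (n - 12 : ℤ) % 11 ≠ 0) :
    weightTwo η (fun ρ => c * (ρ ^ n * mockTerm ρ a) * ρ ^ (-10 : ℤ) * eulerJ ρ ^ (-1 : ℤ)) ρ = 0 := by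
  have hc : IsHom 0 fun _ => c := fun ρ η _ _ => by simp
  rw [weightTwo_of_isHom hη h0 (((hc.mul ((isHom_pow n).mul (isHom_mockTerm a))).mul
    (isHom_zpow (-10))).mul (isHom_eulerJ.zpow (-1))), if_neg (by omega), zero_mul]

omit h1 in
theorem weightTwo_const {η : ℂ} (hη : IsPrimitiveRoot η 11) (c : ℂ) :
    weightTwo η (fun ρ => c * ρ ^ (-2 : ℤ)) ρ = 0 := by
  have hc : IsHom 0 fun _ => c := fun ρ η _ _ => by simp
  rw [weightTwo_of_isHom hη h0 (hc.mul (isHom_zpow (-2))), if_neg (by norm_num), zero_mul]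

/-- The part of weight two of a combination of rank generating functions. -/
theorem weightTwo_rank {η : ℂ} (hη : IsPrimitiveRoot η 11) {τ : Laurent} {m1 m2 m3 m4 m5 d : ℂ}
    {F : ℂ → ℂ} (hF : ∀ ρ' : ℂ, ρ' ≠ 0 → ‖ρ'‖ = ‖ρ‖ → th (ρ' ^ 3) (ρ' ^ 2) * F ρ' =
      pentFactor ρ' * (m1 * (ρ' ^ 30 * mockTerm ρ' 1) + m2 * (ρ' ^ 54 * mockTerm ρ' 2) +
        m3 * (ρ' ^ 72 * mockTerm ρ' 3) + m4 * (ρ' ^ 84 * mockTerm ρ' 4) +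
        m5 * (ρ' ^ 90 * mockTerm ρ' 5)) - thDeriv (ρ' ^ 121) 1 * thxEval ρ' τ -
      d * ρ' ^ (-2 : ℤ) * th (ρ' ^ 3) (ρ' ^ 2)) :
    weightTwo η F ρ = 11 * (ρ ^ (-10 : ℤ) * eulerJ ρ ^ (2 : ℤ) * thxDisc ρ ^ (-5 : ℤ) *
      thxEval ρ (laurentPart 1 (laurentMul τ pentInvList))) := by
  have e : weightTwo η F ρ = weightTwo η (fun ρ =>
      (m1 * (ρ ^ 30 * mockTerm ρ 1) * ρ ^ (-10 : ℤ) * eulerJ ρ ^ (-1 : ℤ) +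
      (m2 * (ρ ^ 54 * mockTerm ρ 2) * ρ ^ (-10 : ℤ) * eulerJ ρ ^ (-1 : ℤ) +
      (m3 * (ρ ^ 72 * mockTerm ρ 3) * ρ ^ (-10 : ℤ) * eulerJ ρ ^ (-1 : ℤ) +
      (m4 * (ρ ^ 84 * mockTerm ρ 4) * ρ ^ (-10 : ℤ) * eulerJ ρ ^ (-1 : ℤ) +
      (m5 * (ρ ^ 90 * mockTerm ρ 5) * ρ ^ (-10 : ℤ) * eulerJ ρ ^ (-1 : ℤ) +
      ((-d) * ρ ^ (-2 : ℤ) + ρ ^ (-10 : ℤ) * eulerJ ρ ^ (2 : ℤ) * thxDisc ρ ^ (-5 : ℤ) *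
        thxEval ρ (laurentMul τ pentInvList)))))))) ρ := by
    refine Finset.sum_congr rfl fun j _ => ?_
    have hj : ‖η ^ j‖ = 1 := by
      rw [norm_pow, hη.norm'_eq_one (by norm_num), one_pow]
    have k0 : η ^ j * ρ ≠ 0 := mul_ne_zero (ne_zero_of_pow_eleven (pow_pow_eleven hη j)) h0
    have kn : ‖η ^ j * ρ‖ = ‖ρ‖ := by rw [norm_mul, hj, one_mul]
    have k1 : ‖η ^ j * ρ‖ < 1 := kn.trans_lt h1
    have h := hF _ k0 kn
    have hx := isThetaVector_thx k0 k1
    generalize η ^ j * ρ = r at *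
    have hm : thxEval r (laurentMul τ pentInvList) = thxEval r τ * thxEval r pentInvList :=
      hx.laurentEval_mul _ _
    have hA := pentFactor_mul_inv k0 k1
    have hA0 := pentFactor_ne_zero k0 k1
    have hJ0 := eulerJ_ne_zero k0 k1
    have hD0 := thxDisc_ne_zero k0 k1
    rw [pentagonal_dissection k0 k1, thDeriv_eq_eulerJ k0 k1,
      show th ((r ^ 121) ^ 3) ((r ^ 121) ^ 2) = eulerJ r from rfl] at h
    have hp : thxEval r pentInvList = thxDisc r ^ 5 / pentFactor r := by
      rw [← hA]; field_simp
    dsimp only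
    rw [hm, hp]
    congr 1
    generalize mockTerm r 1 = M1 at *
    generalize mockTerm r 2 = M2 at *
    generalize mockTerm r 3 = M3 at *
    generalize mockTerm r 4 = M4 at *
    generalize mockTerm r 5 = M5 at *
    generalize pentFactor r = A at *
    generalize eulerJ r = J at *
    generalize thxDisc r = D at *
    generalize thxEval r τ = T at *
    have hE : r ^ 10 * J * A ≠ 0 := by positivity
    apply mul_left_cancel₀ hE
    rw [h]
    simp only [zpow_neg, zpow_ofNat]
    field_simp
    ring
  rw [e]
  simp only [weightTwo_add]
  rw [weightTwo_mock h0 hη _ _ _ (by norm_num), weightTwo_mock h0 hη _ _ _ (by norm_num),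
    weightTwo_mock h0 hη _ _ _ (by norm_num), weightTwo_mock h0 hη _ _ _ (by norm_num),
    weightTwo_mock h0 hη _ _ _ (by norm_num), weightTwo_const h0 hη,
    weightTwo_mul_thxEval h0 hη ((((isHom_zpow (-10)).mul (isHom_eulerJ.zpow 2)).mul
      (isHom_thxDisc.zpow (-5))).congr 0 (by norm_num))]
  ring

end

section
variable {ρ : ℂ} (h0 : ρ ≠ 0) (h1 : ‖ρ‖ < 1)
include h0 h1

theorem th_dissection_root {z : ℂ} (hz : z ^ 11 = 1) : th ρ z⁻¹ =
    ρ ^ 30 * rootEval z (thx ρ 1) (thx ρ 2) (thx ρ 3) (thx ρ 4) (thx ρ 5) crankThetaList := by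
  have hz0 := ne_zero_of_pow_eleven hz
  have hs := (summable_norm_th h0 h1 (inv_ne_zero hz0)).of_norm
  have key : ∀ i : ℤ, ∑' N : ℤ, (-1 : ℂ) ^ (11 * N + (i + 0)) * ρ ^ ((11 * N + (i + 0)) *
      (11 * N + (i + 0) - 1)) * z⁻¹ ^ (11 * N + (i + 0)) =
      (-1) ^ i * z⁻¹ ^ i * (ρ ^ 30 * thx ρ (i + 5)) := by
    intro i
    have e : ∀ N : ℤ, (-1 : ℂ) ^ (11 * N + (i + 0)) * ρ ^ ((11 * N + (i + 0)) *
        (11 * N + (i + 0) - 1)) * z⁻¹ ^ (11 * N + (i + 0)) =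
        (-1) ^ i * z⁻¹ ^ i * (ρ ^ 30 * ρ ^ ((i + 5) * (i + 5 - 11))) *
        ((-1) ^ N * (ρ ^ 121) ^ (N * (N - 1)) * ((ρ ^ 22) ^ (i + 5)) ^ N) := by
      intro N
      have hi : z⁻¹ ^ 11 = 1 := by rw [inv_pow, hz, inv_one]
      rw [show 11 * N + (i + 0) = i + 11 * N by ring, zpow_add_mul_eleven hi,
        add_comm i (11 * N), neg_one_zpow_eleven_mul_add]
      have e2 : ρ ^ ((11 * N + i) * (11 * N + i - 1)) = ρ ^ 30 * ρ ^ ((i + 5) * (i + 5 - 11)) *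
          ((ρ ^ 121) ^ (N * (N - 1)) * ((ρ ^ 22) ^ (i + 5)) ^ N) := by
        simp only [← zpow_natCast, ← zpow_mul, ← zpow_add₀ h0]
        congr 1; push_cast; ring
      rw [e2]
      ring
    simp only [e]
    rw [tsum_mul_left]
    simp only [thx, th]
    ring
  rw [th, tsum_int_eq_sum_residues hs 0, Finset.sum_congr rfl fun (i : ℕ) _ => key i]
  have hp : ∀ a : ℕ, a ≤ 11 → z⁻¹ ^ (a : ℤ) = z ^ (11 - a) := by
    intro a ha
    rw [inv_zpow', zpow_neg, zpow_natCast, eq_comm]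
    refine eq_inv_of_mul_eq_one_left ?_
    rw [← pow_add, Nat.sub_add_cancel ha, hz]
  obtain ⟨e6, e7, e8, e9, e10, -⟩ := thx_reductions h0
  have f : ∀ k, thx ρ (k + 11) = -thx ρ k := thx_add_eleven h0
  have f11 : thx ρ 11 = 0 := by
    have := thx_eleven_sub h0 0
    rw [sub_zero] at this
    rw [this]
    simp [thx, th_one]
  have f12 : thx ρ 12 = -thx ρ 1 := f 1
  have f13 : thx ρ 13 = -thx ρ 2 := f 2
  have f14 : thx ρ 14 = -thx ρ 3 := f 3
  have f15 : thx ρ 15 = -thx ρ 4 := f 4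
  rw [Finset.sum_congr rfl fun (i : ℕ) hi => by
    rw [hp i (Finset.mem_range.mp hi).le]]
  simp only [Finset.sum_range_succ, Finset.sum_range_zero]
  norm_num [e6, e7, e8, e9, e10, f11, f12, f13, f14, f15, rootEval, crankThetaList, monomList,
    laurentEval, curveEval, polyEval, monom, hz]
  ring

/-- The dissection of the crank generating function at roots of unity. -/
theorem crank_dissection {z c : ℂ} (hz : z ^ 11 = 1) (hz1 : z ≠ 1)
    (hc : c * th ρ z⁻¹ = (1 - z⁻¹) * th (ρ ^ 3) (ρ ^ 2) ^ 2) :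
    c = ρ ^ (-10 : ℤ) * eulerJ ρ ^ (2 : ℤ) *
      rootEval z (thx ρ 1) (thx ρ 2) (thx ρ 3) (thx ρ 4) (thx ρ 5) crankList := by
  have hx := isThetaVector_thx h0 h1
  have hz0 := ne_zero_of_pow_eleven hz
  have h := rootEval_eq_zero hx hz hz1 crank_certificate
  simp only [rootEval_append, rootEval_mul hx] at h
  have e1 : rootEval z (thx ρ 1) (thx ρ 2) (thx ρ 3) (thx ρ 4) (thx ρ 5)
      [(0, monomList 1 (0, 0, 0, 0, 0)), (10, monomList (-1) (0, 0, 0, 0, 0))] = 1 - z⁻¹ := by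
    have : z⁻¹ = z ^ 10 := (eq_inv_of_mul_eq_one_left (by rw [← pow_succ, hz])).symm
    simp [rootEval, monomList, laurentEval, curveEval, polyEval, monom, this]
    ring
  have e2 : rootEval z (thx ρ 1) (thx ρ 2) (thx ρ 3) (thx ρ 4) (thx ρ 5)
      [(0, monomList (-1) (0, 0, 0, 0, 0))] = -1 := by
    simp [rootEval, monomList, laurentEval, curveEval, polyEval, monom]
  have e3 : rootEval z (thx ρ 1) (thx ρ 2) (thx ρ 3) (thx ρ 4) (thx ρ 5)
      [(0, laurentMul pentList pentList)] = pentFactor ρ ^ 2 := by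
    rw [pentFactor_eq h0 h1, thxEval, sq, ← hx.laurentEval_mul]
    simp [rootEval]
  rw [e1, e2, e3] at h
  rw [th_dissection_root h0 h1 hz, pentagonal_dissection h0 h1,
    show th ((ρ ^ 121) ^ 3) ((ρ ^ 121) ^ 2) = eulerJ ρ from rfl] at hc
  have hA0 := pentFactor_ne_zero h0 h1
  generalize rootEval z (thx ρ 1) (thx ρ 2) (thx ρ 3) (thx ρ 4) (thx ρ 5) crankThetaList = T at *
  generalize rootEval z (thx ρ 1) (thx ρ 2) (thx ρ 3) (thx ρ 4) (thx ρ 5) crankList = W at *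
  have hT : T ≠ 0 := by
    rintro rfl
    rw [zero_mul, add_zero, mul_eq_zero] at h
    rcases h with h | h
    · exact hz1 (inv_eq_one.mp (sub_eq_zero.mp h).symm)
    · exact pow_ne_zero 2 hA0 h
  have h30 : ρ ^ 30 * T ≠ 0 := mul_ne_zero (pow_ne_zero _ h0) hT
  apply mul_right_cancel₀ h30
  rw [hc, zpow_neg, zpow_ofNat, zpow_ofNat]
  field_simp
  field_simp at h
  linear_combination eulerJ ρ ^ 2 * h

/-- The part of weight two of the crank generating function at a root of unity. -/
theorem weightTwo_crank {η z : ℂ} (hη : IsPrimitiveRoot η 11) (hz : z ^ 11 = 1) (hz1 : z ≠ 1)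
    {C : ℂ → ℂ} (hC : ∀ ρ' : ℂ, ρ' ≠ 0 → ‖ρ'‖ = ‖ρ‖ →
      C ρ' * th ρ' z⁻¹ = (1 - z⁻¹) * th (ρ' ^ 3) (ρ' ^ 2) ^ 2) :
    weightTwo η C ρ = 11 * (ρ ^ (-10 : ℤ) * eulerJ ρ ^ (2 : ℤ) *
      thxMonom ρ (0, -1, -1, 0, 1)) * (-1 + z + z ^ 10) := by
  have e : weightTwo η C ρ = weightTwo η (fun ρ => ∑ k ∈ Finset.range 11,
      (ρ ^ (-10 : ℤ) * eulerJ ρ ^ (2 : ℤ) * z ^ k) * thxEval ρ (rootPart k crankList)) ρ := by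
    refine Finset.sum_congr rfl fun j _ => ?_
    have hj : ‖η ^ j‖ = 1 := by
      rw [norm_pow, hη.norm'_eq_one (by norm_num), one_pow]
    have k0 : η ^ j * ρ ≠ 0 := mul_ne_zero (ne_zero_of_pow_eleven (pow_pow_eleven hη j)) h0
    have kn : ‖η ^ j * ρ‖ = ‖ρ‖ := by rw [norm_mul, hj, one_mul]
    dsimp only
    rw [crank_dissection k0 (kn.trans_lt h1) hz hz1 (hC _ k0 kn), rootEval_eq_sum hz]
    simp only [Finset.mul_sum, thxEval, mul_assoc]
  have hP : ∀ k : ℕ, IsHom (-10) fun ρ => ρ ^ (-10 : ℤ) * eulerJ ρ ^ (2 : ℤ) * z ^ k := fun k => by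
    have hc : IsHom 0 fun _ => z ^ k := fun ρ η _ _ => by simp
    exact ((isHom_zpow (-10)).mul (isHom_eulerJ.zpow 2)).mul hc
  have part : ∀ k < 11, thxEval ρ (laurentPart 1 (rootPart k crankList)) =
      (if k = 0 then -1 else if k = 1 ∨ k = 10 then 1 else 0) * thxMonom ρ (0, -1, -1, 0, 1) := by
    intro k hk
    have e0 : laurentPart 1 (rootPart 0 crankList) = monomList (-1) (0, -1, -1, 0, 1) := by decide
    have e1 : laurentPart 1 (rootPart 1 crankList) = monomList 1 (0, -1, -1, 0, 1) := by decide
    have e10 : laurentPart 1 (rootPart 10 crankList) = monomList 1 (0, -1, -1, 0, 1) := by decide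
    have em : ∀ k ∈ [2, 3, 4, 5, 6, 7, 8, 9], laurentPart 1 (rootPart k crankList) = [] := by
      decide
    have ev : ∀ c, thxEval ρ (monomList c (0, -1, -1, 0, 1)) = c * thxMonom ρ (0, -1, -1, 0, 1) := by
      intro c
      simp only [thxEval, monomList, laurentEval, curveEval, polyEval, thxMonom]
      ring
    by_cases h0 : k = 0
    · subst h0; rw [e0, ev, if_pos rfl]; push_cast; ring
    by_cases h1 : k = 1
    · subst h1; rw [e1, ev]; simp
    by_cases h10 : k = 10
    · subst h10; rw [e10, ev]; simp
    rw [em k (by simp; omega), if_neg h0, if_neg (by omega), zero_mul]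
    rfl
  rw [e, weightTwo_sum, Finset.sum_congr rfl fun k hk => by
    rw [weightTwo_mul_thxEval h0 hη (hP k), part k (Finset.mem_range.mp hk)]]
  simp only [Finset.sum_range_succ, Finset.sum_range_zero]
  norm_num
  ring

end

theorem sum_inverse_dft {η : ℂ} (hη : IsPrimitiveRoot η 11) (c w : ℕ → ℂ) :
    ∑ j ∈ Finset.range 11, (∑ k ∈ Finset.range 11, w k * (η ^ j) ^ (-k : ℤ)) *
      ∑ l ∈ Finset.range 11, c l * (η ^ j) ^ l = 11 * ∑ k ∈ Finset.range 11, w k * c k := by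
  have e : ∀ j, (∑ k ∈ Finset.range 11, w k * (η ^ j) ^ (-k : ℤ)) *
      ∑ l ∈ Finset.range 11, c l * (η ^ j) ^ l = ∑ k ∈ Finset.range 11, ∑ l ∈ Finset.range 11,
      w k * c l * (η ^ j) ^ ((l : ℤ) - k) := by
    intro j
    rw [Finset.sum_mul_sum]
    refine Finset.sum_congr rfl fun k _ => Finset.sum_congr rfl fun l _ => ?_
    rw [sub_eq_add_neg, zpow_add₀ (ne_zero_of_pow_eleven (pow_pow_eleven hη j)), zpow_natCast]
    ring
  simp only [e]
  rw [Finset.sum_comm, Finset.mul_sum]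
  refine Finset.sum_congr rfl fun k hk => ?_
  rw [Finset.sum_comm, Finset.sum_eq_single k]
  · simp
  · intro l hl hlk
    rw [← Finset.mul_sum, sum_zpow_range hη, if_neg, mul_zero]
    have := Finset.mem_range.mp hk
    have := Finset.mem_range.mp hl
    omega
  · exact fun h => absurd hk h

/-- Recovering coefficient combinations of total weight zero from the values at nontrivial
roots of unity. -/
theorem hasSum_of_roots {η : ℂ} (hη : IsPrimitiveRoot η 11) {c : ℕ → ℕ → ℂ} {d : ℕ → ℂ}
    {w : ℕ → ℂ} (hw : ∑ k ∈ Finset.range 11, w k = 0)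
    (h : ∀ z : ℂ, z ^ 11 = 1 → z ≠ 1 → HasSum (fun n => ∑ k ∈ Finset.range 11, c k n * z ^ k)
      (∑ k ∈ Finset.range 11, d k * z ^ k)) :
    HasSum (fun n => ∑ k ∈ Finset.range 11, w k * c k n) (∑ k ∈ Finset.range 11, w k * d k) := by
  have h2 : ∀ j ∈ Finset.range 11, HasSum (fun n =>
      (∑ k ∈ Finset.range 11, w k * (η ^ j) ^ (-k : ℤ)) * ∑ l ∈ Finset.range 11, c l n * (η ^ j) ^ l)
      ((∑ k ∈ Finset.range 11, w k * (η ^ j) ^ (-k : ℤ)) *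
        ∑ l ∈ Finset.range 11, d l * (η ^ j) ^ l) := by
    intro j hj
    by_cases hj0 : η ^ j = 1
    · simp only [hj0, one_zpow, mul_one, hw, zero_mul]
      exact hasSum_zero
    · exact (h _ (pow_pow_eleven hη j) hj0).mul_left _
  have h3 := (hasSum_sum h2).mul_left (1 / 11)
  simp only [sum_inverse_dft hη] at h3
  simpa using h3

/-- Partitions of `N`, viewed as multisets of positive integers. -/
def ptn (N : ℕ) : Finset (Multiset ℕ) :=
  (Finset.univ : Finset (Nat.Partition N)).image (·.parts)

theorem mem_ptn {N : ℕ} {s : Multiset ℕ} : s ∈ ptn N ↔ (∀ i ∈ s, 0 < i) ∧ s.sum = N := by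
  simp only [ptn, Finset.mem_image, Finset.mem_univ, true_and]
  constructor
  · rintro ⟨π, rfl⟩
    exact ⟨fun i hi => π.parts_pos hi, π.parts_sum⟩
  · rintro ⟨h, hs⟩
    exact ⟨⟨s, fun {i} hi => h i hi, hs⟩, rfl⟩

theorem sum_ptn {M : Type*} [AddCommMonoid M] (N : ℕ) (g : Multiset ℕ → M) :
    ∑ s ∈ ptn N, g s = ∑ π : Nat.Partition N, g π.parts := by
  rw [ptn, Finset.sum_image]
  intro π _ π' _ h
  exact Nat.Partition.ext h

theorem card_ptn_le (N : ℕ) : (ptn N).card ≤ 2 ^ N := by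
  calc (ptn N).card ≤ (Finset.univ : Finset (Nat.Partition N)).card := Finset.card_image_le
    _ = Fintype.card (Nat.Partition N) := rfl
    _ ≤ Fintype.card (Composition N) :=
      Fintype.card_le_of_surjective _ Nat.Partition.ofComposition_surj
    _ = 2 ^ (N - 1) := composition_card N
    _ ≤ 2 ^ N := Nat.pow_le_pow_right (by norm_num) (Nat.sub_le N 1)

theorem ptn_zero : ptn 0 = {0} := by
  ext s
  rw [mem_ptn, Finset.mem_singleton]
  constructor
  · rintro ⟨h, hs⟩
    rw [Multiset.sum_eq_zero_iff] at hs
    exact Multiset.eq_zero_of_forall_notMem fun i hi => (h i hi).ne' (hs i hi)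
  · rintro rfl; simp

/-- Number of partitions of `N`, each part `p` being weighted by `t p`. -/
def ptnWeight (t : ℕ → ℂ) (N : ℕ) : ℂ := ∑ s ∈ ptn N, (s.map t).prod

theorem norm_sum_ptn_le {N : ℕ} {g : Multiset ℕ → ℂ} (hg : ∀ s ∈ ptn N, ‖g s‖ ≤ 1) :
    ‖∑ s ∈ ptn N, g s‖ ≤ 2 ^ N := by
  calc ‖∑ s ∈ ptn N, g s‖ ≤ ∑ s ∈ ptn N, (1 : ℝ) := norm_sum_le_of_le _ hg
    _ = ((ptn N).card : ℝ) := by simp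
    _ ≤ 2 ^ N := by exact_mod_cast card_ptn_le N

theorem norm_prod_map_le {t : ℕ → ℂ} (ht : ∀ p, ‖t p‖ ≤ 1) (s : Multiset ℕ) :
    ‖(s.map t).prod‖ ≤ 1 := by
  induction s using Multiset.induction_on with
  | empty => simp
  | cons a s ih =>
    rw [Multiset.map_cons, Multiset.prod_cons, norm_mul]
    exact mul_le_one₀ (ht a) (norm_nonneg _) ih

theorem norm_ptnWeight_le {t : ℕ → ℂ} (ht : ∀ p, ‖t p‖ ≤ 1) (N : ℕ) :
    ‖ptnWeight t N‖ ≤ 2 ^ N :=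
  norm_sum_ptn_le fun s _ => norm_prod_map_le ht s

theorem ptnWeight_congr {t t' : ℕ → ℂ} {N : ℕ} (h : ∀ p, 0 < p → p ≤ N → t p = t' p) :
    ptnWeight t N = ptnWeight t' N := by
  refine Finset.sum_congr rfl fun s hs => ?_
  rw [mem_ptn] at hs
  rw [Multiset.map_congr rfl fun p hp => h p (hs.1 p hp) (hs.2 ▸ Multiset.le_sum_of_mem hp)]

/-- Summing over the partitions that contain the part `a` amounts to removing it. -/
theorem sum_ptn_mem {M : Type*} [AddCommMonoid M] {a : ℕ} (ha : 0 < a) (N : ℕ)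
    (g : Multiset ℕ → M) :
    ∑ s ∈ (ptn N).filter (a ∈ ·), g s =
      if a ≤ N then ∑ s ∈ ptn (N - a), g (a ::ₘ s) else 0 := by
  split_ifs with hN
  · refine Finset.sum_nbij' (fun s => s.erase a) (fun s => a ::ₘ s) ?_ ?_ ?_ ?_ ?_
    · intro s hs
      rw [Finset.mem_filter, mem_ptn] at hs
      obtain ⟨⟨h, hsum⟩, hm⟩ := hs
      rw [mem_ptn]
      refine ⟨fun i hi => h i (Multiset.mem_of_mem_erase hi), ?_⟩
      have := congrArg Multiset.sum (Multiset.cons_erase hm)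
      rw [Multiset.sum_cons] at this
      omega
    · intro s hs
      rw [mem_ptn] at hs
      rw [Finset.mem_filter, mem_ptn]
      refine ⟨⟨?_, ?_⟩, Multiset.mem_cons_self a s⟩
      · intro i hi
        rcases Multiset.mem_cons.1 hi with rfl | hi
        · exact ha
        · exact hs.1 i hi
      · rw [Multiset.sum_cons, hs.2]; omega
    · intro s hs
      rw [Finset.mem_filter] at hs
      exact Multiset.cons_erase hs.2
    · intro s _
      exact Multiset.erase_cons_head a s
    · intro s hs
      rw [Finset.mem_filter] at hs
      rw [Multiset.cons_erase hs.2]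
  · refine Finset.sum_eq_zero fun s hs => ?_
    rw [Finset.mem_filter, mem_ptn] at hs
    exact absurd (hs.1.2 ▸ Multiset.le_sum_of_mem hs.2) hN

theorem ptnWeight_update {a : ℕ} (ha : 0 < a) (t : ℕ → ℂ) (N : ℕ) :
    ptnWeight t N = ptnWeight (Function.update t a 0) N +
      if a ≤ N then t a * ptnWeight t (N - a) else 0 := by
  rw [ptnWeight, ← Finset.sum_filter_add_sum_filter_not _ (a ∈ ·), sum_ptn_mem ha, add_comm]
  congr 1
  · rw [ptnWeight, ← Finset.sum_filter_add_sum_filter_not (ptn N) (a ∈ ·)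
      (fun s => (s.map (Function.update t a 0)).prod)]
    have hz : ∑ s ∈ (ptn N).filter (a ∈ ·), (s.map (Function.update t a 0)).prod = 0 := by
      refine Finset.sum_eq_zero fun s hs => ?_
      rw [Finset.mem_filter] at hs
      exact Multiset.prod_eq_zero (Multiset.mem_map.2 ⟨a, hs.2, by simp⟩)
    rw [hz, zero_add]
    · refine Finset.sum_congr rfl fun s hs => ?_
      rw [Finset.mem_filter] at hs
      refine congrArg _ (Multiset.map_congr rfl fun p hp => ?_)
      rw [Function.update_of_ne]
      rintro rfl
      exact hs.2 hp
  · split_ifs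
    · rw [ptnWeight, Finset.mul_sum]
      refine Finset.sum_congr rfl fun s _ => ?_
      rw [Multiset.map_cons, Multiset.prod_cons]
    · rfl

theorem ptnWeight_zero_of_pos {N : ℕ} (hN : 0 < N) : ptnWeight (fun _ => 0) N = 0 := by
  refine Finset.sum_eq_zero fun s hs => ?_
  rw [mem_ptn] at hs
  obtain ⟨i, hi⟩ := Multiset.exists_mem_of_ne_zero (s := s) (by
    rintro rfl
    simp at hs; omega)
  exact Multiset.prod_eq_zero (Multiset.mem_map.2 ⟨i, hi, rfl⟩)

theorem ptnWeight_apply_zero (t : ℕ → ℂ) : ptnWeight t 0 = 1 := by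
  simp [ptnWeight, ptn_zero]

theorem hasSum_shift {f : ℕ → ℂ} {z S : ℂ} (a : ℕ) (h : HasSum (fun N => f N * z ^ N) S) :
    HasSum (fun N => (if a ≤ N then f (N - a) else 0) * z ^ N) (z ^ a * S) := by
  have h1 := h.mul_left (z ^ a)
  rw [← (add_left_injective a).hasSum_iff]
  · refine (congrArg (fun f => HasSum f _) (funext fun m => ?_)).mpr h1
    simp only [Function.comp_apply, Nat.le_add_left, if_true, Nat.add_sub_cancel, pow_add]
    ring
  · intro N hN
    rw [if_neg, zero_mul]
    intro h
    exact hN ⟨N - a, Nat.sub_add_cancel h⟩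

theorem summable_two_pow_bound {z : ℂ} (hz : ‖z‖ < 1 / 2) : Summable fun N : ℕ => (2 * ‖z‖) ^ N :=
  summable_geometric_of_lt_one (by positivity) (by linarith)

theorem norm_mul_pow_le {c z : ℂ} {N : ℕ} (hc : ‖c‖ ≤ 2 ^ N) : ‖c * z ^ N‖ ≤ (2 * ‖z‖) ^ N := by
  rw [norm_mul, norm_pow, mul_pow]
  exact mul_le_mul_of_nonneg_right hc (by positivity)

theorem summable_of_two_pow {f : ℕ → ℂ} {z : ℂ} (hz : ‖z‖ < 1 / 2) (hf : ∀ N, ‖f N‖ ≤ 2 ^ N) :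
    Summable fun N => f N * z ^ N :=
  Summable.of_norm_bounded (summable_two_pow_bound hz) fun N => norm_mul_pow_le (hf N)

section
variable {t : ℕ → ℂ} (ht : ∀ p, ‖t p‖ ≤ 1) {z : ℂ} (hz : ‖z‖ < 1 / 2)
include ht hz

theorem hasSum_ptnWeight_truncated (M : ℕ) :
    HasSum (fun N => ptnWeight (fun p => if p ≤ M then t p else 0) N * z ^ N)
      (∏ i ∈ Finset.range M, (1 - t (i + 1) * z ^ (i + 1)))⁻¹ := by
  have hb : ∀ M p, ‖(if p ≤ M then t p else 0 : ℂ)‖ ≤ 1 := by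
    intro M p
    split_ifs
    · exact ht p
    · simp
  induction M with
  | zero =>
    simp only [Finset.range_zero, Finset.prod_empty, inv_one]
    convert hasSum_ite_eq 0 (1 : ℂ) using 2 with N
    rcases Nat.eq_zero_or_pos N with rfl | hN
    · simp [ptnWeight_apply_zero]
    · rw [if_neg hN.ne', ptnWeight_congr (t' := fun _ => 0), ptnWeight_zero_of_pos hN, zero_mul]
      intro p hp _
      rw [if_neg (by omega)]
  | succ M ih =>
    set tt : ℕ → ℂ := fun p => if p ≤ M + 1 then t p else 0 with htt
    have hs := (summable_of_two_pow hz (norm_ptnWeight_le (hb (M + 1)))).hasSum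
    set S := ∑' N, ptnWeight tt N * z ^ N with hS
    have h2 := ih.add ((hasSum_shift (M + 1) hs).mul_left (t (M + 1)))
    have h3 := hs.unique ((congrArg (fun f => HasSum f _) (funext fun N => ?_)).mpr h2)
    · have hne : 1 - t (M + 1) * z ^ (M + 1) ≠ 0 := by
        intro h
        have : ‖t (M + 1) * z ^ (M + 1)‖ = 1 := by rw [← sub_eq_zero.1 h, norm_one]
        rw [norm_mul, norm_pow] at this
        have h5 : ‖z‖ ^ (M + 1) < 1 := pow_lt_one₀ (norm_nonneg _) (by linarith) (by omega)
        nlinarith [ht (M + 1), norm_nonneg (t (M + 1)), pow_nonneg (norm_nonneg z) (M + 1)]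
      rw [Finset.prod_range_succ, mul_inv]
      have h4 : S = (∏ i ∈ Finset.range M, (1 - t (i + 1) * z ^ (i + 1)))⁻¹ *
          (1 - t (M + 1) * z ^ (M + 1))⁻¹ := by
        rw [eq_mul_inv_iff_mul_eq₀ hne]
        linear_combination h3
      rw [← h4]
      exact hs
    · rw [ptnWeight_update (Nat.succ_pos M) tt N]
      have e1 : ptnWeight (Function.update tt (M + 1) 0) N =
          ptnWeight (fun p => if p ≤ M then t p else 0) N := by
        refine ptnWeight_congr fun p _ _ => ?_
        rcases eq_or_ne p (M + 1) with rfl | hp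
        · simp
        · rw [Function.update_of_ne hp, htt]
          dsimp only
          congr 1
          simp only [eq_iff_iff]; omega
      rw [Nat.succ_eq_add_one, e1]
      have e2 : tt (M + 1) = t (M + 1) := by simp [htt]
      rw [e2]
      split_ifs <;> ring

/-- The generating function of weighted partitions as an infinite product. -/
theorem hasSum_ptnWeight {φ : ℕ → ℕ} (hφ : Tendsto φ atTop atTop) {P : ℂ} (hP : P ≠ 0)
    (h : Tendsto (fun m => ∏ i ∈ Finset.range (φ m), (1 - t (i + 1) * z ^ (i + 1))) atTop (𝓝 P)) :
    HasSum (fun N => ptnWeight t N * z ^ N) P⁻¹ := by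
  have hs := summable_of_two_pow hz (norm_ptnWeight_le ht)
  have h1 : Tendsto (fun m => ∑' N, ptnWeight (fun p => if p ≤ φ m then t p else 0) N * z ^ N)
      atTop (𝓝 (∑' N, ptnWeight t N * z ^ N)) := by
    refine tendsto_tsum_of_dominated_convergence (summable_two_pow_bound hz) ?_ ?_
    · intro N
      refine tendsto_const_nhds.congr' ?_
      filter_upwards [hφ.eventually_ge_atTop N] with m hm
      rw [ptnWeight_congr fun p _ hp => (if_pos (hp.trans hm)).symm]
    · refine Eventually.of_forall fun m N => norm_mul_pow_le (norm_ptnWeight_le ?_ N)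
      intro p
      split_ifs
      · exact ht p
      · simp
  have h2 : (fun m => ∑' N, ptnWeight (fun p => if p ≤ φ m then t p else 0) N * z ^ N) =
      fun m => (∏ i ∈ Finset.range (φ m), (1 - t (i + 1) * z ^ (i + 1)))⁻¹ :=
    funext fun m => (hasSum_ptnWeight_truncated ht hz (φ m)).tsum_eq
  rw [h2] at h1
  rw [← tendsto_nhds_unique h1 (h.inv₀ hP)]
  exact hs.hasSum

end

theorem hasSum_card_ptn {z : ℂ} (hz : ‖z‖ < 1 / 2) :
    HasSum (fun N => ((ptn N).card : ℂ) * z ^ N) (qp z z)⁻¹ := by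
  have hz1 : ‖z‖ < 1 := by linarith
  have h := hasSum_ptnWeight (t := fun _ => 1) (by simp) hz tendsto_id
    (qp_ne_zero_of_norm_lt hz1 hz1) (by
      refine (qp_tendsto hz1 z).congr fun n => ?_
      refine Finset.prod_congr rfl fun i _ => ?_
      rw [pow_succ]; ring)
  simpa [ptnWeight] using h

/-- Summation of a double series along antidiagonals. -/
theorem hasSum_antidiagonal {f : ℕ → ℕ → ℂ} (hf : Summable fun p : ℕ × ℕ => f p.1 p.2)
    {g : ℕ → ℂ} (hg : ∀ n, HasSum (f n) (g n)) :
    HasSum (fun N => ∑ p ∈ Finset.HasAntidiagonal.antidiagonal N, f p.1 p.2) (∑' n, g n) := by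
  have h1 : ∑' p : ℕ × ℕ, f p.1 p.2 = ∑' n, g n := by
    rw [hf.tsum_prod' fun n => (hg n).summable]
    exact tsum_congr fun n => (hg n).tsum_eq
  have h2 : HasSum (fun p : ℕ × ℕ => f p.1 p.2) (∑' n, g n) := h1 ▸ hf.hasSum
  have h3 := (Finset.HasAntidiagonal.sigmaAntidiagonalEquivProd (A := ℕ)).hasSum_iff.mpr h2
  have h4 := h3.sigma (g := fun N => ∑ p ∈ Finset.HasAntidiagonal.antidiagonal N, f p.1 p.2) (fun N => by
    rw [← Finset.sum_coe_sort]
    exact hasSum_fintype _)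
  exact h4

section
variable {Q : ℂ} (hQ : ‖Q‖ < 1)
include hQ

theorem qp_eq_prod_mul (a : ℂ) (n : ℕ) :
    qp Q a = (∏ i ∈ Finset.range n, (1 - a * Q ^ i)) * qp Q (a * Q ^ n) := by
  induction n with
  | zero => simp
  | succ n ih =>
    rw [ih, Finset.prod_range_succ, qp_eq hQ (a * Q ^ n), pow_succ]
    ring_nf

theorem exists_norm_prod_le (a : ℂ) : ∃ C, ∀ n : ℕ, ‖∏ i ∈ Finset.range n, (1 - a * Q ^ i)‖ ≤ C := by
  obtain ⟨C, hC⟩ := (qp_tendsto hQ a).norm.bddAbove_range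
  exact ⟨C, fun n => hC ⟨n, rfl⟩⟩

theorem prod_one_sub_ne_zero (n : ℕ) : ∏ i ∈ Finset.range n, (1 - Q * Q ^ i) ≠ 0 :=
  Finset.prod_ne_zero_iff.mpr fun i _ => one_sub_mul_pow_ne_zero hQ i

theorem exists_norm_coeff_le (a : ℂ) : ∃ C, ∀ n : ℕ, ‖(∏ i ∈ Finset.range n, (1 - a * Q ^ i)) *
    (∏ i ∈ Finset.range n, (1 - Q * Q ^ i))⁻¹‖ ≤ C := by
  obtain ⟨C, hC⟩ := exists_norm_prod_le hQ a
  obtain ⟨D, hD⟩ := invPoch_bounded hQ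
  have hC0 : 0 ≤ C := (norm_nonneg _).trans (hC 0)
  refine ⟨C * D, fun n => ?_⟩
  rw [norm_mul]
  refine mul_le_mul (hC n) ?_ (norm_nonneg _) hC0
  have h := hD n
  rw [invPoch, if_neg (by omega), Int.toNat_natCast] at h
  exact h

/-- The `q`-binomial theorem. -/
theorem hasSum_qbinomial (a : ℂ) {w : ℂ} (hw : ‖w‖ < 1) :
    HasSum (fun n : ℕ => (∏ i ∈ Finset.range n, (1 - a * Q ^ i)) *
      (∏ i ∈ Finset.range n, (1 - Q * Q ^ i))⁻¹ * w ^ n) (qp Q (a * w) * (qp Q w)⁻¹) := by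
  set A : ℕ → ℂ := fun n => (∏ i ∈ Finset.range n, (1 - a * Q ^ i)) *
      (∏ i ∈ Finset.range n, (1 - Q * Q ^ i))⁻¹ with hA
  obtain ⟨C, hC⟩ := exists_norm_coeff_le hQ a
  have hC0 : 0 ≤ C := (norm_nonneg _).trans (hC 0)
  have hbound : ∀ {x : ℂ} (n : ℕ), ‖A n * x ^ n‖ ≤ C * ‖x‖ ^ n := by
    intro x n
    rw [norm_mul, norm_pow]
    exact mul_le_mul_of_nonneg_right (hC n) (by positivity)
  have hs : ∀ {x : ℂ}, ‖x‖ < 1 → Summable fun n => A n * x ^ n := fun {x} hx =>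
    Summable.of_norm_bounded ((summable_geometric_of_lt_one (norm_nonneg x) hx).mul_left C)
      fun n => hbound n
  set F : ℂ → ℂ := fun x => ∑' n, A n * x ^ n with hF
  have hAs : ∀ n, A (n + 1) * (1 - Q ^ (n + 1)) = A n * (1 - a * Q ^ n) := by
    intro n
    simp only [hA, Finset.prod_range_succ]
    have h1 := one_sub_mul_pow_ne_zero hQ n
    have h2 := prod_one_sub_ne_zero hQ n
    rw [pow_succ' Q n]
    generalize Q * Q ^ n = x at *
    field_simp
  have hstep : ∀ x : ℂ, ‖x‖ < 1 → (1 - x) * F x = (1 - a * x) * F (x * Q) := by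
    intro x hx
    have hxQ : ‖x * Q‖ < 1 := by
      rw [norm_mul]; nlinarith [norm_nonneg x, norm_nonneg Q]
    have h1 := (hs hx).hasSum.sub (hs hxQ).hasSum
    have h2 : ∑' n, (A n * x ^ n - A n * (x * Q) ^ n) = F x - F (x * Q) := h1.tsum_eq
    rw [h1.summable.tsum_eq_zero_add] at h2
    have h3 := ((hs hx).hasSum.mul_left x).sub ((hs hxQ).hasSum.mul_left (a * x))
    have h4 : ∑' n, (x * (A n * x ^ n) - a * x * (A n * (x * Q) ^ n)) =
      x * F x - a * x * F (x * Q) := h3.tsum_eq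
    have h5 : ∀ n, A (n + 1) * x ^ (n + 1) - A (n + 1) * (x * Q) ^ (n + 1) =
        x * (A n * x ^ n) - a * x * (A n * (x * Q) ^ n) := by
      intro n
      rw [mul_pow, mul_pow, pow_succ x]
      linear_combination x ^ n * x * hAs n
    rw [tsum_congr h5, h4] at h2
    simp only [pow_zero, sub_self, zero_add] at h2
    linear_combination -h2
  have hnw : ∀ m : ℕ, ‖w * Q ^ m‖ ≤ ‖w‖ := by
    intro m
    rw [norm_mul, norm_pow]
    exact mul_le_of_le_one_right (norm_nonneg _) (pow_le_one₀ (norm_nonneg _) hQ.le)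
  have hiter : ∀ m : ℕ, (∏ i ∈ Finset.range m, (1 - w * Q ^ i)) * F w =
      (∏ i ∈ Finset.range m, (1 - a * w * Q ^ i)) * F (w * Q ^ m) := by
    intro m
    induction m with
    | zero => simp
    | succ m ih =>
      rw [Finset.prod_range_succ, Finset.prod_range_succ, pow_succ]
      have := hstep (w * Q ^ m) ((hnw m).trans_lt hw)
      rw [← mul_assoc w (Q ^ m) Q]
      linear_combination (1 - w * Q ^ m) * ih +
        (∏ i ∈ Finset.range m, (1 - a * w * Q ^ i)) * this
  have hlim : Tendsto (fun m : ℕ => F (w * Q ^ m)) atTop (𝓝 (∑' n, A n * 0 ^ n)) := by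
    refine tendsto_tsum_of_dominated_convergence
      ((summable_geometric_of_lt_one (norm_nonneg w) hw).mul_left C) ?_ ?_
    · intro n
      refine Tendsto.const_mul _ (Tendsto.pow ?_ n)
      simpa using (tendsto_pow_atTop_nhds_zero_of_norm_lt_one hQ).const_mul w
    · refine Eventually.of_forall fun m n => (hbound n).trans ?_
      exact mul_le_mul_of_nonneg_left (pow_le_pow_left₀ (norm_nonneg _) (hnw m) n) hC0
  have h0 : ∑' n, A n * 0 ^ n = 1 := by
    rw [tsum_eq_single 0 fun n hn => by rw [zero_pow hn, mul_zero]]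
    simp [hA]
  rw [h0] at hlim
  have h1 := (qp_tendsto hQ w).mul_const (F w)
  have h2 := (qp_tendsto hQ (a * w)).mul hlim
  have h3 := tendsto_nhds_unique (h1.congr hiter) h2
  have hne := qp_ne_zero_of_norm_lt hQ hw
  have h4 : F w = qp Q (a * w) * (qp Q w)⁻¹ := by
    rw [eq_mul_inv_iff_mul_eq₀ hne]
    linear_combination h3
  rw [← h4]
  exact (hs hw).hasSum

theorem hasSum_qbinomial_inv {a w : ℂ} (hw : ‖w‖ < 1) (ha : ∀ i : ℕ, a * Q ^ i ≠ 1) :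
    HasSum (fun n : ℕ => w ^ n * ((∏ i ∈ Finset.range n, (1 - Q * Q ^ i))⁻¹ *
      (qp Q (a * Q ^ n))⁻¹)) (qp Q (a * w) * (qp Q w * qp Q a)⁻¹) := by
  have h := (hasSum_qbinomial hQ a hw).mul_right (qp Q a)⁻¹
  rw [mul_inv, ← mul_assoc]
  refine (congrArg (fun f => HasSum f _) (funext fun n => ?_)).mpr h
  have h1 := qp_eq_prod_mul hQ a n
  have h2 : qp Q a ≠ 0 := qp_ne_zero hQ ha
  rw [h1] at h2
  have h3 := (mul_ne_zero_iff.1 h2).1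
  have h4 := (mul_ne_zero_iff.1 h2).2
  rw [h1]
  field_simp

/-- Euler's expansion of the reciprocal of an infinite product. -/
theorem hasSum_euler {w : ℂ} (hw : ‖w‖ < 1) :
    HasSum (fun n : ℕ => w ^ n * (∏ i ∈ Finset.range n, (1 - Q * Q ^ i))⁻¹) (qp Q w)⁻¹ := by
  have h := hasSum_qbinomial hQ 0 hw
  have e : qp Q (0 * w) = 1 := by simp [qp]
  rw [e, one_mul] at h
  refine (congrArg (fun f => HasSum f _) (funext fun n => ?_)).mpr h
  simp [mul_comm]

end

/-- The rank of a multiset of positive integers, viewed as a partition. -/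
def rk (s : Multiset ℕ) : ℤ := (s.sup : ℤ) - (Multiset.card s : ℤ)

theorem sup_mem {s : Multiset ℕ} (hs : s ≠ 0) : s.sup ∈ s := by
  induction s using Multiset.induction_on with
  | empty => exact absurd rfl hs
  | cons a s ih =>
    rw [Multiset.sup_cons]
    rcases eq_or_ne s 0 with rfl | h
    · simp
    · rcases max_choice a s.sup with h1 | h1
      · rw [h1]; exact Multiset.mem_cons_self a s
      · rw [h1]; exact Multiset.mem_cons_of_mem (ih h)

theorem sum_map_pred {s : Multiset ℕ} (hs : ∀ i ∈ s, 0 < i) :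
    (s.map Nat.pred).sum + Multiset.card s = s.sum := by
  induction s using Multiset.induction_on with
  | empty => simp
  | cons a s ih =>
    have h1 := ih fun i hi => hs i (Multiset.mem_cons_of_mem hi)
    have h2 := hs a (Multiset.mem_cons_self a s)
    simp only [Multiset.map_cons, Multiset.sum_cons, Multiset.card_cons, Nat.pred_eq_sub_one] at *
    omega

theorem sum_map_succ (s : Multiset ℕ) : (s.map Nat.succ).sum = s.sum + Multiset.card s := by
  induction s using Multiset.induction_on with
  | empty => simp
  | cons a s ih =>
    simp only [Multiset.map_cons, Multiset.sum_cons, Multiset.card_cons, ih]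
    omega

theorem sum_filter_ne_zero (s : Multiset ℕ) : (s.filter (· ≠ 0)).sum = s.sum := by
  induction s using Multiset.induction_on with
  | empty => simp
  | cons a s ih =>
    by_cases h : a = 0
    · simp [h, ih]
    · simp only [ne_eq] at ih
      simp [h, ih]

theorem sup_filter_ne_zero (s : Multiset ℕ) : (s.filter (· ≠ 0)).sup = s.sup := by
  induction s using Multiset.induction_on with
  | empty => simp
  | cons a s ih =>
    by_cases h : a = 0
    · simp [h, ih]
    · simp only [ne_eq] at ih
      simp [h, ih]

theorem filter_ne_zero_add_replicate (s : Multiset ℕ) : s.filter (· ≠ 0) +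
    Multiset.replicate (Multiset.card s - Multiset.card (s.filter (· ≠ 0))) 0 = s := by
  have h := Multiset.filter_add_not (· ≠ 0) s
  have h2 : s.filter (fun a => ¬ a ≠ 0) = Multiset.replicate (s.count 0) 0 := by
    simp only [ne_eq, not_not]
    exact Multiset.filter_eq' s 0
  rw [h2] at h
  have h3 := congrArg Multiset.card h
  rw [Multiset.card_add, Multiset.card_replicate] at h3
  rw [← h3, Nat.add_sub_cancel_left]
  exact h

/-- Dyson's adjoint map on partitions. -/
def dyson (m : ℤ) (s : Multiset ℕ) : Multiset ℕ :=
  (((Multiset.card s : ℤ) + m + 1).toNat ::ₘ s.map Nat.pred).filter (· ≠ 0)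

/-- The inverse of Dyson's adjoint map. -/
def dysonInv (m : ℤ) (s : Multiset ℕ) : Multiset ℕ :=
  (s.erase s.sup + Multiset.replicate
    (((s.sup : ℤ) - m - 1).toNat - Multiset.card (s.erase s.sup)) 0).map Nat.succ

section
variable {m : ℤ} (hm : 0 ≤ m ∨ m ≤ -3) {N N' : ℕ} (hN : (N' : ℤ) = N + m + 1)
include hm

theorem card_add_nonneg {s : Multiset ℕ} (hs : s ∈ ptn N) (hr : rk s ≤ m + 2) :
    0 ≤ (Multiset.card s : ℤ) + m + 1 := by
  rcases hm with hm | hm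
  · positivity
  · have h0 : s ≠ 0 := by
      rintro rfl
      simp only [rk, Multiset.sup_zero, Multiset.card_zero, Nat.bot_eq_zero] at hr
      omega
    have h1 := (mem_ptn.1 hs).1 _ (sup_mem h0)
    rw [rk] at hr
    omega

theorem pred_le_of_rk_le {s : Multiset ℕ} (hs : s ∈ ptn N) (hr : rk s ≤ m + 2) :
    (s.map Nat.pred).sup ≤ ((Multiset.card s : ℤ) + m + 1).toNat := by
  have h := card_add_nonneg hm hs hr
  rw [Multiset.sup_le]
  intro b hb
  obtain ⟨a, ha, rfl⟩ := Multiset.mem_map.1 hb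
  have h1 := Multiset.le_sup ha
  rw [rk] at hr
  rw [Nat.pred_eq_sub_one]
  omega

include hN

theorem dyson_mem {s : Multiset ℕ} (hs : s ∈ ptn N) (hr : rk s ≤ m + 2) :
    dyson m s ∈ ptn N' ∧ m ≤ rk (dyson m s) := by
  have h1 := card_add_nonneg hm hs hr
  have h2 := pred_le_of_rk_le hm hs hr
  rw [mem_ptn] at hs
  refine ⟨mem_ptn.2 ⟨fun i hi => ?_, ?_⟩, ?_⟩
  · exact Nat.pos_of_ne_zero (Multiset.mem_filter.1 hi).2
  · rw [dyson, sum_filter_ne_zero, Multiset.sum_cons]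
    have h3 := sum_map_pred hs.1
    rw [hs.2] at h3
    omega
  · have h4 : (dyson m s).sup = ((Multiset.card s : ℤ) + m + 1).toNat := by
      rw [dyson, sup_filter_ne_zero, Multiset.sup_cons, sup_eq_left]
      exact h2
    rw [rk, h4]
    have h5 : Multiset.card (dyson m s) ≤ Multiset.card s + 1 := by
      rw [dyson]
      refine (Multiset.card_le_card (Multiset.filter_le _ _)).trans ?_
      simp
    omega

omit hm in
theorem dysonInv_card {s : Multiset ℕ} (hs : s ∈ ptn N') (hr : m ≤ rk s) :
    0 ≤ (s.sup : ℤ) - m - 1 ∧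
      (Multiset.card (s.erase s.sup) : ℤ) ≤ (s.sup : ℤ) - m - 1 := by
  rcases eq_or_ne s 0 with rfl | h0
  · have h2 := (mem_ptn.1 hs).2
    simp only [Multiset.sum_zero] at h2
    simp only [Multiset.sup_zero, Nat.bot_eq_zero, Multiset.erase_zero, Multiset.card_zero]
    omega
  · have h1 := Multiset.card_erase_add_one (sup_mem h0)
    rw [rk] at hr
    omega

omit hm in
theorem dysonInv_mem {s : Multiset ℕ} (hs : s ∈ ptn N') (hr : m ≤ rk s) :
    dysonInv m s ∈ ptn N ∧ rk (dysonInv m s) ≤ m + 2 ∧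
      (Multiset.card (dysonInv m s) : ℤ) = (s.sup : ℤ) - m - 1 := by
  obtain ⟨h1, h2⟩ := dysonInv_card hN hs hr
  rw [mem_ptn] at hs
  have hc : (Multiset.card (dysonInv m s) : ℤ) = (s.sup : ℤ) - m - 1 := by
    rw [dysonInv, Multiset.card_map, Multiset.card_add, Multiset.card_replicate]
    omega
  refine ⟨mem_ptn.2 ⟨fun i hi => ?_, ?_⟩, ?_, hc⟩
  · obtain ⟨a, _, rfl⟩ := Multiset.mem_map.1 hi
    exact Nat.succ_pos a
  · have h3 : (s.erase s.sup).sum + s.sup = N' := by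
      rcases eq_or_ne s 0 with rfl | h0
      · simpa using hs.2
      · have := congrArg Multiset.sum (Multiset.cons_erase (sup_mem h0))
        rw [Multiset.sum_cons, hs.2] at this
        omega
    have h4 : (dysonInv m s).sum = (s.erase s.sup).sum + Multiset.card (dysonInv m s) := by
      rw [dysonInv, sum_map_succ, Multiset.sum_add, Multiset.sum_replicate, smul_zero, add_zero,
        Multiset.card_map]
    omega
  · have h5 : (dysonInv m s).sup ≤ s.sup + 1 := by
      rw [Multiset.sup_le]
      intro b hb
      obtain ⟨a, ha, rfl⟩ := Multiset.mem_map.1 hb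
      rcases Multiset.mem_add.1 ha with ha | ha
      · exact Nat.succ_le_succ (Multiset.le_sup (Multiset.mem_of_mem_erase ha))
      · rw [Multiset.eq_of_mem_replicate ha]; omega
    rw [rk]
    omega

omit hN in
theorem dysonInv_dyson {s : Multiset ℕ} (hs : s ∈ ptn N) (hr : rk s ≤ m + 2) :
    dysonInv m (dyson m s) = s := by
  have h1 := card_add_nonneg hm hs hr
  have h2 := pred_le_of_rk_le hm hs hr
  have h4 : (dyson m s).sup = ((Multiset.card s : ℤ) + m + 1).toNat := by
    rw [dyson, sup_filter_ne_zero, Multiset.sup_cons, sup_eq_left]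
    exact h2
  have h5 : (dyson m s).erase (dyson m s).sup = (s.map Nat.pred).filter (· ≠ 0) := by
    rw [h4, dyson]
    generalize ((Multiset.card s : ℤ) + m + 1).toNat = L at *
    rcases eq_or_ne L 0 with rfl | hL
    · rw [Multiset.filter_cons_of_neg _ (by simp), Multiset.erase_of_notMem]
      simp
    · rw [Multiset.filter_cons_of_pos (p := (· ≠ 0)) _ hL, Multiset.erase_cons_head]
  rw [dysonInv, h5, h4]
  have h6 : ((((Multiset.card s : ℤ) + m + 1).toNat : ℤ) - m - 1).toNat =
      Multiset.card (s.map Nat.pred) := by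
    rw [Multiset.card_map]; omega
  rw [h6, filter_ne_zero_add_replicate, Multiset.map_map]
  conv_rhs => rw [← Multiset.map_id s]
  refine Multiset.map_congr rfl fun i hi => ?_
  have := (mem_ptn.1 hs).1 i hi
  simp only [Function.comp_apply, Nat.pred_eq_sub_one, id_eq]
  omega

omit hm in
theorem dyson_dysonInv {s : Multiset ℕ} (hs : s ∈ ptn N') (hr : m ≤ rk s) :
    dyson m (dysonInv m s) = s := by
  obtain ⟨h1, h2⟩ := dysonInv_card hN hs hr
  obtain ⟨_, _, hc⟩ := dysonInv_mem hN hs hr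
  rw [dyson, hc]
  have e : ((s.sup : ℤ) - m - 1 + m + 1).toNat = s.sup := by omega
  rw [e, dysonInv, Multiset.map_map]
  have e2 : (Nat.pred ∘ Nat.succ) = id := by ext; simp
  rw [e2, Multiset.map_id]
  have hp := (mem_ptn.1 hs).1
  rcases eq_or_ne s 0 with rfl | h0
  · simp [Multiset.filter_eq_nil, Multiset.mem_replicate]
  · rw [← Multiset.cons_add, Multiset.cons_erase (sup_mem h0), Multiset.filter_add,
      Multiset.filter_eq_self.2 fun i hi => (hp i hi).ne', Multiset.filter_eq_nil.2, add_zero]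
    intro a ha
    simp [Multiset.eq_of_mem_replicate ha]

/-- Dyson's symmetry between partitions of bounded rank. -/
theorem dyson_card : ((ptn N).filter (rk · ≤ m + 2)).card = ((ptn N').filter (m ≤ rk ·)).card := by
  refine Finset.card_nbij' (dyson m) (dysonInv m) ?_ ?_ ?_ ?_
  · intro s hs
    have hs := Finset.mem_filter.1 hs
    exact Finset.mem_filter.2 (dyson_mem hm hN hs.1 hs.2)
  · intro s hs
    have hs := Finset.mem_filter.1 hs
    have h := dysonInv_mem hN hs.1 hs.2
    exact Finset.mem_filter.2 ⟨h.1, h.2.1⟩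
  · intro s hs
    have hs := Finset.mem_filter.1 hs
    exact dysonInv_dyson hm hs.1 hs.2
  · intro s hs
    have hs := Finset.mem_filter.1 hs
    exact dyson_dysonInv hN hs.1 hs.2

end

/-- The number of partitions of `N` for which the statistic `r` is at least `j`. -/
def countGe (r : Multiset ℕ → ℤ) (j N : ℕ) : ℕ := ((ptn N).filter fun s => (j : ℤ) ≤ r s).card

/-- The recurrence satisfied by the distribution of the rank and of its negative. -/
def IsDysonStat (r : Multiset ℕ → ℤ) : Prop := ∀ j : ℕ, 0 < j → ∀ N : ℕ, (countGe r j N : ℂ) =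
  if j + 1 ≤ N then ((ptn (N - (j + 1))).card : ℂ) - (countGe r (j + 3) (N - (j + 1)) : ℂ) else 0

theorem isDysonStat_rk : IsDysonStat rk := by
  intro j hj N
  split_ifs with h
  · have h1 := dyson_card (m := j) (N := N - (j + 1)) (N' := N) (Or.inl (by positivity)) (by omega)
    have h2 := Finset.card_filter_add_card_filter_not (s := ptn (N - (j + 1)))
      (fun s => rk s ≤ (j : ℤ) + 2)
    have h3 : countGe rk (j + 3) (N - (j + 1)) =
        ((ptn (N - (j + 1))).filter fun s => ¬ rk s ≤ (j : ℤ) + 2).card := by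
      refine congrArg Finset.card (Finset.filter_congr fun s _ => ?_)
      push_cast; omega
    rw [eq_sub_iff_add_eq, h3, ← h2, h1, countGe]
    push_cast; ring
  · rw [Nat.cast_eq_zero, countGe, Finset.card_eq_zero, Finset.filter_eq_empty_iff]
    intro s hs hr
    rcases eq_or_ne s 0 with rfl | h0
    · simp only [rk, Multiset.sup_zero, Multiset.card_zero, Nat.bot_eq_zero] at hr
      omega
    · have h1 := Multiset.le_sum_of_mem (sup_mem h0)
      have h2 := Multiset.card_pos.2 h0
      rw [(mem_ptn.1 hs).2] at h1
      rw [rk] at hr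
      omega

theorem card_le_of_mem_ptn {N : ℕ} {s : Multiset ℕ} (hs : s ∈ ptn N) : Multiset.card s ≤ N := by
  have h := sum_map_pred (mem_ptn.1 hs).1
  rw [(mem_ptn.1 hs).2] at h
  omega

theorem isDysonStat_neg_rk : IsDysonStat fun s => -rk s := by
  intro j hj N
  split_ifs with h
  · have h1 := dyson_card (m := -(j : ℤ) - 2) (N := N) (N' := N - (j + 1)) (Or.inr (by omega))
      (by omega)
    have h2 := Finset.card_filter_add_card_filter_not (s := ptn (N - (j + 1)))
      (fun s => -(j : ℤ) - 2 ≤ rk s)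
    have h3 : countGe (fun s => -rk s) (j + 3) (N - (j + 1)) =
        ((ptn (N - (j + 1))).filter fun s => ¬ -(j : ℤ) - 2 ≤ rk s).card := by
      refine congrArg Finset.card (Finset.filter_congr fun s _ => ?_)
      push_cast; omega
    have h4 : countGe (fun s => -rk s) j N =
        ((ptn N).filter fun s => rk s ≤ -(j : ℤ) - 2 + 2).card := by
      refine congrArg Finset.card (Finset.filter_congr fun s _ => ?_)
      change (j : ℤ) ≤ -rk s ↔ _
      omega
    rw [eq_sub_iff_add_eq, h3, ← h2, h4, h1]
    push_cast; ring
  · rw [Nat.cast_eq_zero, countGe, Finset.card_eq_zero, Finset.filter_eq_empty_iff]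
    intro s hs hr
    have hc := card_le_of_mem_ptn hs
    rcases eq_or_ne s 0 with rfl | h0
    · simp only [rk, Multiset.sup_zero, Multiset.card_zero, Nat.bot_eq_zero] at hr
      omega
    · have h1 := (mem_ptn.1 hs).1 _ (sup_mem h0)
      rw [rk] at hr
      omega

/-- The series giving, up to the partition generating function, the partitions of rank at
least `j`. -/
noncomputable def rankTail (ρ : ℂ) (j : ℕ) : ℂ :=
  ∑' n : ℕ, (-1) ^ n * ρ ^ ((n + 1) * (3 * n + 2)) * (ρ ^ 2) ^ (j * (n + 1))

section
variable {ρ : ℂ} (h1 : ‖ρ‖ < 1)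
include h1

theorem norm_rankTail_term_le (j n : ℕ) :
    ‖(-1) ^ n * ρ ^ ((n + 1) * (3 * n + 2)) * (ρ ^ 2) ^ (j * (n + 1))‖ ≤
      ‖ρ‖ ^ n * ‖ρ‖ ^ j := by
  rw [← pow_mul, norm_mul, norm_mul, norm_pow, norm_neg, norm_one, one_pow, one_mul, norm_pow,
    norm_pow]
  refine mul_le_mul ?_ ?_ (by positivity) (by positivity)
  · exact pow_le_pow_of_le_one (norm_nonneg _) h1.le (by nlinarith)
  · exact pow_le_pow_of_le_one (norm_nonneg _) h1.le (by nlinarith)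

theorem summable_rankTail (j : ℕ) :
    Summable fun n : ℕ => (-1) ^ n * ρ ^ ((n + 1) * (3 * n + 2)) * (ρ ^ 2) ^ (j * (n + 1)) :=
  Summable.of_norm_bounded ((summable_geometric_of_lt_one (norm_nonneg ρ) h1).mul_right (‖ρ‖ ^ j))
    (norm_rankTail_term_le h1 j)

theorem norm_rankTail_le (j : ℕ) : ‖rankTail ρ j‖ ≤ (1 - ‖ρ‖)⁻¹ := by
  refine tsum_of_norm_bounded (hasSum_geometric_of_lt_one (norm_nonneg ρ) h1) fun n => ?_
  refine (norm_rankTail_term_le h1 j n).trans ?_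
  exact mul_le_of_le_one_right (by positivity) (pow_le_one₀ (norm_nonneg _) h1.le)

theorem rankTail_eq (j : ℕ) :
    rankTail ρ j = (ρ ^ 2) ^ (j + 1) * (1 - rankTail ρ (j + 3)) := by
  rw [rankTail, (summable_rankTail h1 j).tsum_eq_zero_add, rankTail, mul_sub, ← tsum_mul_left,
    sub_eq_add_neg, ← tsum_neg]
  congr 1
  · simp only [← pow_mul]; norm_num; ring
  · refine tsum_congr fun n => ?_
    simp only [← pow_mul]
    rw [pow_succ (-1 : ℂ) n]
    have e : ρ ^ ((n + 1 + 1) * (3 * (n + 1) + 2)) * ρ ^ (2 * (j * (n + 1 + 1))) =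
      ρ ^ (2 * (j + 1)) * (ρ ^ ((n + 1) * (3 * n + 2)) * ρ ^ (2 * ((j + 3) * (n + 1)))) := by
      simp only [← pow_add]
      congr 1; ring
    linear_combination (-(-1 : ℂ) ^ n) * e

theorem eq_mul_rankTail {X : ℕ → ℂ} {P : ℂ} {C : ℝ} (hC : ∀ j, ‖X j‖ ≤ C)
    (hX : ∀ j, 0 < j → X j = (ρ ^ 2) ^ (j + 1) * (P - X (j + 3))) {j : ℕ} (hj : 0 < j) :
    X j = P * rankTail ρ j := by
  set K := C + ‖P‖ * (1 - ‖ρ‖)⁻¹ with hK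
  have hD : ∀ j, ‖X j - P * rankTail ρ j‖ ≤ K := by
    intro j
    refine (norm_sub_le _ _).trans (add_le_add (hC j) ?_)
    rw [norm_mul]
    exact mul_le_mul_of_nonneg_left (norm_rankTail_le h1 j) (norm_nonneg _)
  have hrec : ∀ j, 0 < j → X j - P * rankTail ρ j =
      -((ρ ^ 2) ^ (j + 1) * (X (j + 3) - P * rankTail ρ (j + 3))) := by
    intro j hj
    linear_combination hX j hj - P * rankTail_eq h1 j
  have hb : ∀ k j, 0 < j → ‖X j - P * rankTail ρ j‖ ≤ ‖ρ‖ ^ k * K := by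
    intro k
    induction k with
    | zero => intro j _; simpa using hD j
    | succ k ih =>
      intro j hj
      rw [hrec j hj, norm_neg, norm_mul, ← pow_mul, norm_pow, pow_succ' _ k, mul_assoc]
      refine mul_le_mul ?_ (ih _ (by omega)) (norm_nonneg _) (norm_nonneg _)
      exact pow_le_of_le_one (norm_nonneg _) h1.le (by omega)
  have hlim : Tendsto (fun k : ℕ => ‖ρ‖ ^ k * K) atTop (𝓝 0) := by
    simpa using (tendsto_pow_atTop_nhds_zero_of_lt_one (norm_nonneg ρ) h1).mul_const K
  have h2 := ge_of_tendsto' hlim fun k => hb k j hj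
  exact sub_eq_zero.1 (norm_le_zero_iff.1 h2)

end

theorem norm_countGe_le (r : Multiset ℕ → ℤ) (j N : ℕ) : ‖(countGe r j N : ℂ)‖ ≤ 2 ^ N := by
  rw [Complex.norm_natCast]
  exact_mod_cast (Finset.card_filter_le _ _).trans (card_ptn_le N)

section
variable {r : Multiset ℕ → ℤ} (hr : IsDysonStat r) {ρ : ℂ} (hρ : ‖ρ ^ 2‖ < 1 / 2)
include hr hρ

omit hr in
theorem norm_lt_one_of_sq : ‖ρ‖ < 1 := by
  rw [norm_pow] at hρ
  nlinarith [norm_nonneg ρ]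

theorem hasSum_countGe {j : ℕ} (hj : 0 < j) :
    HasSum (fun N => (countGe r j N : ℂ) * (ρ ^ 2) ^ N)
      ((qp (ρ ^ 2) (ρ ^ 2))⁻¹ * rankTail ρ j) := by
  have hs : ∀ j, HasSum (fun N => (countGe r j N : ℂ) * (ρ ^ 2) ^ N)
      (∑' N, (countGe r j N : ℂ) * (ρ ^ 2) ^ N) := fun j =>
    (summable_of_two_pow hρ (norm_countGe_le r j)).hasSum
  have hX := eq_mul_rankTail (norm_lt_one_of_sq hρ)
    (X := fun j => ∑' N, (countGe r j N : ℂ) * (ρ ^ 2) ^ N) (P := (qp (ρ ^ 2) (ρ ^ 2))⁻¹)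
    (C := ∑' N, (2 * ‖ρ ^ 2‖) ^ N)
    (fun j => tsum_of_norm_bounded (summable_two_pow_bound hρ).hasSum fun N =>
      norm_mul_pow_le (norm_countGe_le r j N)) ?_ hj
  · rw [← hX]
    exact hs j
  · intro j hj
    have h0 : HasSum (fun N => (((ptn N).card : ℂ) - (countGe r (j + 3) N : ℂ)) * (ρ ^ 2) ^ N)
        ((qp (ρ ^ 2) (ρ ^ 2))⁻¹ - ∑' N, (countGe r (j + 3) N : ℂ) * (ρ ^ 2) ^ N) :=
      (congrArg (fun f => HasSum f _) (funext fun N => by ring)).mpr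
        ((hasSum_card_ptn hρ).sub (hs (j + 3)))
    have h2 := hasSum_shift (j + 1) h0
    rw [← h2.tsum_eq]
    exact tsum_congr fun N => by rw [hr j hj N]

end

/-- The number of `t` with `k + 11 * t ≤ m`. -/
def stepCount (k : ℕ) (m : ℤ) : ℕ := ((m - k + 11) / 11).toNat

theorem hasSum_stepCount (k : ℕ) (m : ℤ) :
    HasSum (fun t : ℕ => if ((k + 11 * t : ℕ) : ℤ) ≤ m then (1 : ℂ) else 0) (stepCount k m : ℂ) := by
  have h := hasSum_sum_of_ne_finset_zero (s := Finset.range (stepCount k m))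
    (L := SummationFilter.unconditional ℕ)
    (f := fun t : ℕ => if ((k + 11 * t : ℕ) : ℤ) ≤ m then (1 : ℂ) else 0) (fun t ht => by
      rw [Finset.mem_range, stepCount] at ht
      rw [if_neg]
      push_cast
      omega)
  have e : ∑ t ∈ Finset.range (stepCount k m), (if ((k + 11 * t : ℕ) : ℤ) ≤ m then (1 : ℂ) else 0) =
      (stepCount k m : ℂ) := by
    rw [Finset.sum_congr rfl (g := fun _ => (1 : ℂ)), Finset.sum_const, Finset.card_range,
      nsmul_eq_mul, mul_one]
    intro t ht
    rw [Finset.mem_range, stepCount] at ht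
    rw [if_pos]
    push_cast
    omega
  rw [← e]
  exact h

/-- The sum of the series `rankTail` over an arithmetic progression modulo 11. -/
noncomputable def rankStep (ρ : ℂ) (k : ℕ) : ℂ :=
  ∑' n : ℕ, (-1) ^ n * ρ ^ ((n + 1) * (3 * n + 2)) * (ρ ^ 2) ^ (k * (n + 1)) /
    (1 - (ρ ^ 22) ^ (n + 1))

theorem tsum_rankTail {ρ : ℂ} (h1 : ‖ρ‖ < 1) (k : ℕ) :
    ∑' t : ℕ, rankTail ρ (k + 11 * t) = rankStep ρ k := by
  have hs : Summable fun p : ℕ × ℕ => (-1) ^ p.2 * ρ ^ ((p.2 + 1) * (3 * p.2 + 2)) *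
      (ρ ^ 2) ^ ((k + 11 * p.1) * (p.2 + 1)) := by
    have hg := summable_geometric_of_lt_one (norm_nonneg ρ) h1
    refine Summable.of_norm_bounded (hg.mul_of_nonneg hg (fun n => by positivity)
      (fun n => by positivity)) fun p => ?_
    refine (norm_rankTail_term_le h1 _ _).trans ?_
    rw [mul_comm]
    refine mul_le_mul_of_nonneg_right ?_ (by positivity)
    exact pow_le_pow_of_le_one (norm_nonneg _) h1.le (by omega)
  have h2 := hs.tsum_comm (f := fun t n : ℕ => (-1) ^ n * ρ ^ ((n + 1) * (3 * n + 2)) *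
      (ρ ^ 2) ^ ((k + 11 * t) * (n + 1)))
  unfold rankTail rankStep
  rw [← h2]
  refine tsum_congr fun n => ?_
  have hy : ‖(ρ ^ 22) ^ (n + 1)‖ < 1 := by
    rw [← pow_mul, norm_pow]
    exact pow_lt_one₀ (norm_nonneg _) h1 (by omega)
  have h3 := (hasSum_geometric_of_norm_lt_one hy).mul_left
    ((-1) ^ n * ρ ^ ((n + 1) * (3 * n + 2)) * (ρ ^ 2) ^ (k * (n + 1)))
  rw [div_eq_mul_inv, ← h3.tsum_eq]
  refine tsum_congr fun t => ?_
  rw [mul_assoc _ ((ρ ^ 2) ^ (k * (n + 1)))]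
  congr 1
  simp only [← pow_mul, ← pow_add]
  congr 1; ring

section
variable {r : Multiset ℕ → ℤ} (hr : IsDysonStat r) {ρ : ℂ} (hρ : ‖ρ ^ 2‖ < 1 / 2)
include hr hρ

omit hρ in
theorem countGe_eq_zero {j N : ℕ} (hj : 0 < j) (h : N < j + 1) : countGe r j N = 0 := by
  have := hr j hj N
  rw [if_neg (by omega)] at this
  exact_mod_cast this

theorem summable_countGe {k : ℕ} (hk : 0 < k) :
    Summable fun p : ℕ × ℕ => (countGe r (k + 11 * p.2) p.1 : ℂ) * (ρ ^ 2) ^ p.1 := by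
  set x := Real.sqrt (2 * ‖ρ ^ 2‖) with hx
  have hx0 : 0 ≤ x := Real.sqrt_nonneg _
  have hx2 : x * x = 2 * ‖ρ ^ 2‖ := Real.mul_self_sqrt (by positivity)
  have hx1 : x < 1 := by nlinarith
  have hg := summable_geometric_of_lt_one hx0 hx1
  refine Summable.of_norm_bounded (hg.mul_of_nonneg hg (fun n => by positivity)
      (fun n => by positivity)) fun p => ?_
  rcases lt_or_ge p.1 (k + 11 * p.2 + 1) with h | h
  · rw [countGe_eq_zero hr (by omega) h]
    simp only [Nat.cast_zero, zero_mul, norm_zero]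
    positivity
  · refine (norm_mul_pow_le (norm_countGe_le _ _ _)).trans ?_
    rw [← hx2, mul_pow]
    exact mul_le_mul_of_nonneg_left (pow_le_pow_of_le_one hx0 hx1.le (by omega)) (by positivity)

theorem hasSum_sum_stepCount {k : ℕ} (hk : 0 < k) :
    HasSum (fun N => (∑ s ∈ ptn N, (stepCount k (r s) : ℂ)) * (ρ ^ 2) ^ N)
      ((qp (ρ ^ 2) (ρ ^ 2))⁻¹ * rankStep ρ k) := by
  have hs := summable_countGe hr hρ hk
  have hfib : ∀ N, HasSum (fun t : ℕ => (countGe r (k + 11 * t) N : ℂ) * (ρ ^ 2) ^ N)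
      ((∑ s ∈ ptn N, (stepCount k (r s) : ℂ)) * (ρ ^ 2) ^ N) := fun N => by
    refine HasSum.mul_right _ ?_
    have h := hasSum_sum (s := ptn N) fun s _ => hasSum_stepCount k (r s)
    refine (congrArg (fun f => HasSum f _) (funext fun t => ?_)).mpr h
    rw [countGe, Finset.card_filter]
    push_cast
    rfl
  have h1 := hs.hasSum.prod_fiberwise hfib
  have h2 := hs.prod_symm.tsum_prod' (fun t => hs.prod_symm.prod_factor t)
  rw [← (Equiv.prodComm ℕ ℕ).tsum_eq, Equiv.coe_prodComm, h2] at h1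
  have h3 : ∀ t : ℕ, ∑' N : ℕ, (countGe r (k + 11 * t) N : ℂ) * (ρ ^ 2) ^ N =
      (qp (ρ ^ 2) (ρ ^ 2))⁻¹ * rankTail ρ (k + 11 * t) := fun t =>
    (hasSum_countGe hr hρ (by omega)).tsum_eq
  simp only [Prod.swap, h3] at h1
  rw [tsum_mul_left, tsum_rankTail (norm_lt_one_of_sq hρ)] at h1
  exact h1

end

/-- The number of partitions of `N` whose rank is congruent to `k` modulo 11. -/
def rankClass (k N : ℕ) : ℕ := ((ptn N).filter fun s => rk s % 11 = (k : ℤ)).card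

theorem rankClass_eq (k N : ℕ) (hk : 0 < k) (hk' : k < 11) : (rankClass k N : ℂ) =
    ∑ s ∈ ptn N, (stepCount k (rk s) : ℂ) - ∑ s ∈ ptn N, (stepCount (k + 1) (rk s) : ℂ) +
    ∑ s ∈ ptn N, (stepCount (11 - k) (-rk s) : ℂ) - ∑ s ∈ ptn N, (stepCount (12 - k) (-rk s) : ℂ) := by
  rw [rankClass, Finset.card_filter, ← Finset.sum_sub_distrib, ← Finset.sum_add_distrib,
    ← Finset.sum_sub_distrib]
  push_cast
  refine Finset.sum_congr rfl fun s _ => ?_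
  generalize rk s = m
  have h : ((if m % 11 = (k : ℤ) then 1 else 0 : ℤ)) = (stepCount k m : ℤ) - stepCount (k + 1) m +
      stepCount (11 - k) (-m) - stepCount (12 - k) (-m) := by
    simp only [stepCount]
    split_ifs <;> push_cast [hk'.le, show k ≤ 12 by omega] <;> omega
  exact_mod_cast congrArg (Int.cast : ℤ → ℂ) h

theorem rankClass_zero_eq (N : ℕ) : (rankClass 0 N : ℂ) =
    ((ptn N).card : ℂ) - ∑ s ∈ ptn N, (stepCount 1 (rk s) : ℂ) +
    ∑ s ∈ ptn N, (stepCount 11 (rk s) : ℂ) -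
    ∑ s ∈ ptn N, (stepCount 1 (-rk s) : ℂ) + ∑ s ∈ ptn N, (stepCount 11 (-rk s) : ℂ) := by
  rw [rankClass, Finset.card_filter, Finset.card_eq_sum_ones]
  push_cast
  rw [← Finset.sum_sub_distrib, ← Finset.sum_add_distrib,
    ← Finset.sum_sub_distrib, ← Finset.sum_add_distrib]
  refine Finset.sum_congr rfl fun s _ => ?_
  generalize rk s = m
  have h : ((if m % 11 = ((0 : ℕ) : ℤ) then 1 else 0 : ℤ)) = 1 - (stepCount 1 m : ℤ) +
      stepCount 11 m - stepCount 1 (-m) + stepCount 11 (-m) := by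
    simp only [stepCount]
    split_ifs <;> push_cast <;> omega
  exact_mod_cast congrArg (Int.cast : ℤ → ℂ) h

section
variable {ρ : ℂ} (hρ : ‖ρ ^ 2‖ < 1 / 2)
include hρ

theorem hasSum_rankClass {k : ℕ} (hk : 0 < k) (hk' : k < 11) :
    HasSum (fun N => (rankClass k N : ℂ) * (ρ ^ 2) ^ N) ((qp (ρ ^ 2) (ρ ^ 2))⁻¹ *
      (rankStep ρ k - rankStep ρ (k + 1) + rankStep ρ (11 - k) - rankStep ρ (12 - k))) := by
  have h1 := hasSum_sum_stepCount isDysonStat_rk hρ hk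
  have h2 := hasSum_sum_stepCount isDysonStat_rk hρ (Nat.succ_pos k)
  have h3 := hasSum_sum_stepCount isDysonStat_neg_rk hρ (k := 11 - k) (by omega)
  have h4 := hasSum_sum_stepCount isDysonStat_neg_rk hρ (k := 12 - k) (by omega)
  have h := ((h1.sub h2).add h3).sub h4
  rw [← mul_sub, ← mul_add, ← mul_sub] at h
  refine (congrArg (fun f => HasSum f _) (funext fun N => ?_)).mpr h
  rw [rankClass_eq k N hk hk']
  ring

theorem hasSum_rankClass_zero :
    HasSum (fun N => (rankClass 0 N : ℂ) * (ρ ^ 2) ^ N) ((qp (ρ ^ 2) (ρ ^ 2))⁻¹ *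
      (1 - 2 * rankStep ρ 1 + 2 * rankStep ρ 11)) := by
  have h0 := hasSum_card_ptn hρ
  have h1 := hasSum_sum_stepCount isDysonStat_rk hρ (k := 1) (by norm_num)
  have h2 := hasSum_sum_stepCount isDysonStat_rk hρ (k := 11) (by norm_num)
  have h3 := hasSum_sum_stepCount isDysonStat_neg_rk hρ (k := 1) (by norm_num)
  have h4 := hasSum_sum_stepCount isDysonStat_neg_rk hρ (k := 11) (by norm_num)
  have h := (((h0.sub h1).add h2).sub h3).add h4
  have e : (qp (ρ ^ 2) (ρ ^ 2))⁻¹ * (1 - 2 * rankStep ρ 1 + 2 * rankStep ρ 11) =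
    (qp (ρ ^ 2) (ρ ^ 2))⁻¹ - (qp (ρ ^ 2) (ρ ^ 2))⁻¹ * rankStep ρ 1 +
    (qp (ρ ^ 2) (ρ ^ 2))⁻¹ * rankStep ρ 11 - (qp (ρ ^ 2) (ρ ^ 2))⁻¹ * rankStep ρ 1 +
    (qp (ρ ^ 2) (ρ ^ 2))⁻¹ * rankStep ρ 11 := by ring
  rw [e]
  refine (congrArg (fun f => HasSum f _) (funext fun N => ?_)).mpr h
  rw [rankClass_zero_eq N]
  ring

end

section
variable {ρ : ℂ} (h0 : ρ ≠ 0) (h1 : ‖ρ‖ < 1)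
include h0 h1

omit h0 in
theorem one_sub_pow_succ_ne_zero (n : ℕ) : 1 - (ρ ^ 22) ^ (n + 1) ≠ 0 := by
  intro h
  have : ‖(ρ ^ 22) ^ (n + 1)‖ < 1 := by
    rw [← pow_mul, norm_pow]
    exact pow_lt_one₀ (norm_nonneg _) h1 (by omega)
  rw [← sub_eq_zero.1 h, norm_one] at this
  exact lt_irrefl _ this

omit h1 in
theorem lambert_term_pos {b : ℤ} {j : ℕ} (hb : b = 2 * j - 1) (n : ℕ) :
    (-1) ^ ((n + 1 : ℕ) : ℤ) * ρ ^ (3 * (((n + 1 : ℕ) : ℤ) * ((n + 1 : ℕ) : ℤ)) +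
      b * ((n + 1 : ℕ) : ℤ)) / (1 - (ρ ^ 22) ^ ((n + 1 : ℕ) : ℤ)) =
    -((-1) ^ n * ρ ^ ((n + 1) * (3 * n + 2)) * (ρ ^ 2) ^ (j * (n + 1)) /
      (1 - (ρ ^ 22) ^ (n + 1))) := by
  have e : ρ ^ (3 * (((n + 1 : ℕ) : ℤ) * ((n + 1 : ℕ) : ℤ)) + b * ((n + 1 : ℕ) : ℤ)) =
      ρ ^ ((n + 1) * (3 * n + 2)) * (ρ ^ 2) ^ (j * (n + 1)) := by
    simp only [← zpow_natCast, ← zpow_mul, ← zpow_add₀ h0]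
    congr 1
    rw [hb]
    push_cast; ring
  rw [zpow_natCast, zpow_natCast, e, pow_succ (-1 : ℂ)]
  ring

theorem lambert_term_neg {b : ℤ} {j : ℕ} (hb : b = 2 * j - 1) (hj : j ≤ 12) (n : ℕ) :
    (-1) ^ (-((n + 1 : ℕ) : ℤ)) * ρ ^ (3 * (-((n + 1 : ℕ) : ℤ) * -((n + 1 : ℕ) : ℤ)) +
      b * -((n + 1 : ℕ) : ℤ)) / (1 - (ρ ^ 22) ^ (-((n + 1 : ℕ) : ℤ))) =
    (-1) ^ n * ρ ^ ((n + 1) * (3 * n + 2)) * (ρ ^ 2) ^ ((12 - j) * (n + 1)) /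
      (1 - (ρ ^ 22) ^ (n + 1)) := by
  have hy' := one_sub_pow_succ_ne_zero h1 n
  have hyn : (ρ ^ 22) ^ (n + 1) ≠ 0 := pow_ne_zero _ (pow_ne_zero _ h0)
  have e : ρ ^ (3 * (-((n + 1 : ℕ) : ℤ) * -((n + 1 : ℕ) : ℤ)) + b * -((n + 1 : ℕ) : ℤ)) *
      (ρ ^ 22) ^ (n + 1) =
      ρ ^ ((n + 1) * (3 * n + 2)) * (ρ ^ 2) ^ ((12 - j) * (n + 1)) := by
    simp only [← zpow_natCast, ← zpow_mul, ← zpow_add₀ h0]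
    congr 1
    rw [hb]
    push_cast [hj]; ring
  rw [mul_assoc ((-1) ^ n) (ρ ^ ((n + 1) * (3 * n + 2))), ← e, neg_one_zpow_neg,
    zpow_neg (ρ ^ 22), zpow_natCast, zpow_natCast, pow_succ (-1 : ℂ)]
  have hy2 : 1 - ((ρ ^ 22) ^ (n + 1))⁻¹ ≠ 0 := by
    intro h
    apply hy'
    rw [sub_eq_zero] at h ⊢
    exact (inv_eq_one.1 h.symm).symm
  generalize (ρ ^ 22) ^ (n + 1) = y at *
  generalize ρ ^ (3 * (-((n + 1 : ℕ) : ℤ) * -((n + 1 : ℕ) : ℤ)) + b * -((n + 1 : ℕ) : ℤ)) = x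
  have e3 : (1 - y⁻¹) * y = -(1 - y) := by field_simp; ring
  rw [div_eq_div_iff hy2 hy']
  linear_combination (-(-1) ^ n * x) * e3

omit h0 h1 in
theorem tsum_int_eq_of_zero {f : ℤ → ℂ} (hs : Summable f) (hz : f 0 = 0) :
    ∑' n, f n = ∑' n : ℕ, f ((n + 1 : ℕ) : ℤ) + ∑' n : ℕ, f (-((n + 1 : ℕ) : ℤ)) := by
  have hn : Summable fun n : ℕ => f n := hs.comp_injective Nat.cast_injective
  have hneg : Summable fun n : ℕ => f (-((n : ℤ) + 1)) := hs.comp_injective fun a b h => by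
    simpa using h
  rw [(hn.hasSum.of_nat_of_neg_add_one hneg.hasSum).tsum_eq, hn.tsum_eq_zero_add, Nat.cast_zero,
    hz, zero_add]
  rfl

theorem tsum_lambert_eq {b : ℤ} {j : ℕ} (hb : b = 2 * j - 1) (hj : j ≤ 12) :
    (∑' n : ℤ, if n = 0 then 0 else (-1) ^ n * ρ ^ (3 * (n * n) + b * n) / (1 - (ρ ^ 22) ^ n)) =
      rankStep ρ (12 - j) - rankStep ρ j := by
  rw [tsum_int_eq_of_zero (summable_lambert h0 h1 b) (if_pos rfl), rankStep, rankStep, add_comm,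
    sub_eq_add_neg, ← tsum_neg]
  congr 1
  · refine tsum_congr fun n => ?_
    rw [if_neg (by omega)]
    exact lambert_term_neg h0 h1 hb hj n
  · refine tsum_congr fun n => ?_
    rw [if_neg (by omega)]
    exact lambert_term_pos h0 hb n

theorem lambert_two_eq : lambert ρ 2 = rankStep ρ 1 - rankStep ρ 11 := by
  rw [lambert]
  exact tsum_lambert_eq h0 h1 (j := 11) (by norm_num) (by norm_num)

theorem lambert_three_eq : lambert ρ 3 = rankStep ρ 4 - rankStep ρ 8 := by
  rw [lambert]
  exact tsum_lambert_eq h0 h1 (j := 8) (by norm_num) (by norm_num)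

theorem lambert_four_eq : lambert ρ 4 = rankStep ρ 7 - rankStep ρ 5 := by
  rw [lambert]
  exact tsum_lambert_eq h0 h1 (j := 5) (by norm_num) (by norm_num)

theorem lambert_five_eq : lambert ρ 5 = rankStep ρ 10 - rankStep ρ 2 := by
  rw [lambert]
  exact tsum_lambert_eq h0 h1 (j := 2) (by norm_num) (by norm_num)

theorem lambert_one_eq : lambert ρ 1 =
    rankStep ρ 9 - rankStep ρ 3 + 1 + ρ ^ (-2 : ℤ) * th (ρ ^ 3) (ρ ^ 2) := by
  rw [← tsum_lambert_eq h0 h1 (b := 5) (j := 3) (by norm_num) (by norm_num), lambert]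
  have hs1 := summable_lambert h0 h1 (33 - 6 * 1)
  have hs2 := summable_lambert h0 h1 5
  have h3 : ‖ρ ^ 3‖ < 1 := norm_pow_lt_one h1 (by norm_num)
  have e8 : ρ ^ 8 = (ρ ^ 3) ^ 2 * ρ ^ 2 := by ring
  have hth : th (ρ ^ 3) (ρ ^ 8) = -ρ ^ (-2 : ℤ) * th (ρ ^ 3) (ρ ^ 2) := by
    rw [e8, th_mul_sq (pow_ne_zero 3 h0) (pow_ne_zero 2 h0)]
    rfl
  have hs3 := (summable_norm_th (pow_ne_zero 3 h0) h3 (pow_ne_zero 8 h0)).of_norm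
  have hd := (hs1.hasSum.sub hs2.hasSum).add hs3.hasSum
  have h4 := hd.unique ((congrArg (fun f => HasSum f _) (funext fun n => ?_)).mpr
    (hasSum_ite_eq (0 : ℤ) (1 : ℂ)))
  · change _ + th (ρ ^ 3) (ρ ^ 8) = 1 at h4
    rw [hth] at h4
    linear_combination h4
  · split_ifs with hn
    · subst hn; simp
    · have hy : (1 - (ρ ^ 22) ^ n) ≠ 0 := by
        intro h
        have hz := one_sub_norm_le_norm_one_sub_zpow (pow_ne_zero 22 h0)
          (norm_pow_lt_one h1 (n := 22) (by norm_num)) hn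
        rw [h, norm_zero] at hz
        have := norm_pow_lt_one h1 (n := 22) (by norm_num)
        linarith
      have e1 : ρ ^ (3 * (n * n) + (33 - 6 * 1) * n) = ρ ^ (3 * (n * n) + 5 * n) * (ρ ^ 22) ^ n := by
        simp only [← zpow_natCast, ← zpow_mul, ← zpow_add₀ h0]
        congr 1; push_cast; ring
      have e2 : (ρ ^ 3) ^ (n * (n - 1)) * (ρ ^ 8) ^ n = ρ ^ (3 * (n * n) + 5 * n) := by
        simp only [← zpow_natCast, ← zpow_mul, ← zpow_add₀ h0]
        congr 1; push_cast; ring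
      rw [e1, mul_assoc _ ((ρ ^ 3) ^ _), e2]
      generalize (ρ ^ 22) ^ n = y at *
      field_simp
      ring

/-- The rank generating functions in terms of Lambert series. -/
theorem hasSum_rank_combination (hρ : ‖ρ ^ 2‖ < 1 / 2) (c0 c1 c2 c3 c4 c5 : ℂ) :
    ∃ S, HasSum (fun N => (c0 * rankClass 0 N + c1 * rankClass 1 N + c2 * rankClass 2 N +
      c3 * rankClass 3 N + c4 * rankClass 4 N + c5 * rankClass 5 N) * (ρ ^ 2) ^ N) S ∧
      th (ρ ^ 3) (ρ ^ 2) * S = (c2 - c3) * lambert ρ 1 + (c1 - 2 * c0) * lambert ρ 2 +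
        (c4 - c3) * lambert ρ 3 + (c4 - c5) * lambert ρ 4 + (c1 - c2) * lambert ρ 5 +
        (c0 - (c2 - c3)) - (c2 - c3) * ρ ^ (-2 : ℤ) * th (ρ ^ 3) (ρ ^ 2) := by
  have s0 := (hasSum_rankClass_zero hρ).mul_left c0
  have s1 := (hasSum_rankClass hρ (k := 1) (by norm_num) (by norm_num)).mul_left c1
  have s2 := (hasSum_rankClass hρ (k := 2) (by norm_num) (by norm_num)).mul_left c2
  have s3 := (hasSum_rankClass hρ (k := 3) (by norm_num) (by norm_num)).mul_left c3
  have s4 := (hasSum_rankClass hρ (k := 4) (by norm_num) (by norm_num)).mul_left c4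
  have s5 := (hasSum_rankClass hρ (k := 5) (by norm_num) (by norm_num)).mul_left c5
  refine ⟨_, (congrArg (fun f => HasSum f _) (funext fun N => ?_)).mpr
    (((((s0.add s1).add s2).add s3).add s4).add s5), ?_⟩
  · ring
  · rw [lambert_one_eq h0 h1, lambert_two_eq h0 h1, lambert_three_eq h0 h1, lambert_four_eq h0 h1,
      lambert_five_eq h0 h1, th_cube_sq h0 h1]
    have hE := qp_ne_zero_of_norm_lt (norm_sq_lt_one h1) (norm_sq_lt_one h1)
    norm_num only
    generalize qp (ρ ^ 2) (ρ ^ 2) = E at *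
    field_simp
    ring

end

/-- The crank of a multiset of positive integers, viewed as a partition. -/
def ck (s : Multiset ℕ) : ℤ :=
  if s.count 1 = 0 then (s.sup : ℤ)
  else (Multiset.card (s.filter fun x => s.count 1 < x) : ℤ) - (s.count 1 : ℤ)

/-- The weight of a part in a partition with `n` ones. -/
def onesWeight (ζ : ℂ) (n p : ℕ) : ℂ := if p = 1 then 0 else if n < p then ζ else 1

/-- The weight of a part other than the largest one, in a partition without ones. -/
def maxWeight (K p : ℕ) : ℂ := if 2 ≤ p ∧ p ≤ K then 1 else 0

theorem count_one_le {N : ℕ} {s : Multiset ℕ} (hs : s ∈ ptn N) : s.count 1 ≤ N :=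
  (Multiset.count_le_card 1 s).trans (card_le_of_mem_ptn hs)

theorem prod_onesWeight (ζ : ℂ) (n : ℕ) {s : Multiset ℕ} (hs : 1 ∉ s) :
    (s.map (onesWeight ζ n)).prod = ζ ^ Multiset.card (s.filter (n < ·)) := by
  induction s using Multiset.induction_on with
  | empty => simp
  | cons a s ih =>
    rw [Multiset.mem_cons, not_or] at hs
    rw [Multiset.map_cons, Multiset.prod_cons, ih hs.2, onesWeight, if_neg (Ne.symm hs.1)]
    split_ifs with h
    · rw [Multiset.filter_cons_of_pos (p := (n < ·)) _ h, Multiset.card_cons, pow_succ']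
    · rw [Multiset.filter_cons_of_neg (p := (n < ·)) _ h, one_mul]

theorem prod_maxWeight (K : ℕ) (s : Multiset ℕ) :
    (s.map (maxWeight K)).prod = if ∀ p ∈ s, 2 ≤ p ∧ p ≤ K then 1 else 0 := by
  induction s using Multiset.induction_on with
  | empty => simp
  | cons a s ih =>
    rw [Multiset.map_cons, Multiset.prod_cons, ih, maxWeight]
    simp only [Multiset.forall_mem_cons]
    split_ifs <;> simp_all

theorem sum_ones (ζ : ℂ) (hζ : ζ ≠ 0) {N n : ℕ} (hn : 0 < n) (hnN : n ≤ N) :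
    ∑ s ∈ (ptn N).filter (fun s => s.count 1 = n), ζ ^ ck s =
      ζ⁻¹ ^ n * ptnWeight (onesWeight ζ n) (N - n) := by
  have h1 : ptnWeight (onesWeight ζ n) (N - n) =
      ∑ s ∈ (ptn (N - n)).filter (1 ∉ ·), (s.map (onesWeight ζ n)).prod := by
    rw [ptnWeight, ← Finset.sum_filter_add_sum_filter_not _ (1 ∉ ·)]
    rw [add_eq_left]
    refine Finset.sum_eq_zero fun s hs => ?_
    rw [Finset.mem_filter, not_not] at hs
    exact Multiset.prod_eq_zero (Multiset.mem_map.2 ⟨1, hs.2, by simp [onesWeight]⟩)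
  rw [h1, Finset.mul_sum]
  have hsplit : ∀ s : Multiset ℕ, s.filter (· ≠ 1) + Multiset.replicate (s.count 1) 1 = s := by
    intro s
    have h := Multiset.filter_add_not (· ≠ 1) s
    have h2 : s.filter (fun a => ¬ a ≠ 1) = Multiset.replicate (s.count 1) 1 := by
      simp only [ne_eq, not_not]
      exact Multiset.filter_eq' s 1
    rwa [h2] at h
  refine Finset.sum_nbij' (fun s => s.filter (· ≠ 1)) (fun s => s + Multiset.replicate n 1)
    ?_ ?_ ?_ ?_ ?_
  · intro s hs
    obtain ⟨hs, hc⟩ := Finset.mem_filter.1 hs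
    obtain ⟨hp, hsum⟩ := mem_ptn.1 hs
    refine Finset.mem_filter.2 ⟨mem_ptn.2 ⟨fun i hi => hp i (Multiset.mem_filter.1 hi).1, ?_⟩, ?_⟩
    · have := congrArg Multiset.sum (hsplit s)
      rw [Multiset.sum_add, Multiset.sum_replicate, hsum, hc] at this
      simp only [smul_eq_mul, mul_one] at this
      omega
    · simp
  · intro s hs
    obtain ⟨hs, hc⟩ := Finset.mem_filter.1 hs
    obtain ⟨hp, hsum⟩ := mem_ptn.1 hs
    refine Finset.mem_filter.2 ⟨mem_ptn.2 ⟨fun i hi => ?_, ?_⟩, ?_⟩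
    · rcases Multiset.mem_add.1 hi with hi | hi
      · exact hp i hi
      · rw [Multiset.eq_of_mem_replicate hi]; norm_num
    · rw [Multiset.sum_add, Multiset.sum_replicate, hsum]
      simp only [smul_eq_mul, mul_one]
      omega
    · rw [Multiset.count_add, Multiset.count_eq_zero.2 hc, Multiset.count_replicate_self, zero_add]
  · intro s hs
    obtain ⟨hs, hc⟩ := Finset.mem_filter.1 hs
    have := hsplit s
    rwa [hc] at this
  · intro s hs
    obtain ⟨hs, hc⟩ := Finset.mem_filter.1 hs
    rw [Multiset.filter_add, Multiset.filter_eq_self.2, Multiset.filter_eq_nil.2, add_zero]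
    · intro a ha
      simp [Multiset.eq_of_mem_replicate ha]
    · rintro a ha rfl
      exact hc ha
  · intro s hs
    obtain ⟨hs, hc⟩ := Finset.mem_filter.1 hs
    rw [prod_onesWeight ζ n (by simp), ck, hc, if_neg hn.ne', zpow_sub₀ hζ, zpow_natCast,
      zpow_natCast, Multiset.filter_filter, div_eq_mul_inv, inv_pow, mul_comm]
    congr 4
    ext a
    constructor
    · intro h; exact ⟨h, by omega⟩
    · exact fun h => h.1

theorem sum_max (ζ : ℂ) {N K : ℕ} (hK : 2 ≤ K) (hKN : K ≤ N) :
    ∑ s ∈ ((ptn N).filter fun s => s.count 1 = 0).filter (fun s => s.sup = K), ζ ^ ck s =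
      ζ ^ K * ptnWeight (maxWeight K) (N - K) := by
  have h := sum_ptn_mem (by omega : 0 < K) N
    (fun s => ζ ^ K * if ∀ p ∈ s, 2 ≤ p ∧ p ≤ K then (1 : ℂ) else 0)
  rw [if_pos hKN] at h
  rw [ptnWeight, Finset.mul_sum]
  have h2 : ∑ s ∈ ptn (N - K), ζ ^ K * (s.map (maxWeight K)).prod = ∑ s ∈ ptn (N - K),
      ζ ^ K * if ∀ p ∈ K ::ₘ s, 2 ≤ p ∧ p ≤ K then (1 : ℂ) else 0 := by
    refine Finset.sum_congr rfl fun s _ => ?_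
    rw [prod_maxWeight]
    simp [hK]
  rw [h2, ← h]
  simp only [mul_ite, mul_one, mul_zero]
  rw [← Finset.sum_filter]
  refine Finset.sum_congr ?_ fun s hs => ?_
  · ext s
    simp only [Finset.mem_filter]
    constructor
    · rintro ⟨⟨hs, hc⟩, hsup⟩
      have h0 : s ≠ 0 := by
        rintro rfl
        simp at hsup
        omega
      refine ⟨⟨hs, hsup ▸ sup_mem h0⟩, fun p hp => ⟨?_, hsup ▸ Multiset.le_sup hp⟩⟩
      have h3 := (mem_ptn.1 hs).1 p hp
      have h4 : p ≠ 1 := by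
        rintro rfl
        exact Multiset.count_eq_zero.1 hc hp
      omega
    · rintro ⟨⟨hs, hm⟩, hall⟩
      refine ⟨⟨hs, Multiset.count_eq_zero.2 fun h1 => ?_⟩, le_antisymm ?_ (Multiset.le_sup hm)⟩
      · have := (hall 1 h1).1; omega
      · exact Multiset.sup_le.2 fun b hb => (hall b hb).2
  · simp only [Finset.mem_filter] at hs
    obtain ⟨⟨hs, hm⟩, hall⟩ := hs
    have hc : s.count 1 = 0 := Multiset.count_eq_zero.2 fun h1 => by
      have := (hall 1 h1).1; omega
    have hsup : s.sup = K := le_antisymm (Multiset.sup_le.2 fun b hb => (hall b hb).2)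
      (Multiset.le_sup hm)
    rw [ck, if_pos hc, hsup, zpow_natCast]

theorem sum_no_ones (ζ : ℂ) (N : ℕ) :
    ∑ s ∈ (ptn N).filter (fun s => s.count 1 = 0), ζ ^ ck s = (if N = 0 then 1 else 0) +
      ∑ K ∈ Finset.range (N + 1), if K < 2 then 0 else ζ ^ K * ptnWeight (maxWeight K) (N - K) := by
  rcases Nat.eq_zero_or_pos N with rfl | hN
  · simp [ptn_zero, ck, Finset.filter_singleton]
  rw [if_neg hN.ne', zero_add, ← Finset.sum_fiberwise_of_maps_to (s := (ptn N).filter _)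
    (t := Finset.range (N + 1)) (g := fun s => s.sup)]
  · refine Finset.sum_congr rfl fun K hK => ?_
    rw [Finset.mem_range] at hK
    split_ifs with h
    · refine Finset.sum_eq_zero fun s hs => ?_
      simp only [Finset.mem_filter] at hs
      obtain ⟨⟨hs, hc⟩, hsup⟩ := hs
      exfalso
      have h0 : s ≠ 0 := by
        rintro rfl
        have := (mem_ptn.1 hs).2
        simp at this
        omega
      have h1 := sup_mem h0
      have h2 := (mem_ptn.1 hs).1 _ h1
      have h3 : s.sup = 1 := by omega
      rw [h3] at h1
      exact Multiset.count_eq_zero.1 hc h1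
    · exact sum_max ζ (by omega) (by omega)
  · intro s hs
    have hs := (Finset.mem_filter.1 hs).1
    rw [Finset.mem_range, Nat.lt_succ_iff, Multiset.sup_le]
    intro b hb
    exact (mem_ptn.1 hs).2 ▸ Multiset.le_sum_of_mem hb

/-- The crank distribution, split according to the number of ones and the largest part. -/
theorem sum_zpow_ck (ζ : ℂ) (hζ : ζ ≠ 0) (N : ℕ) : ∑ s ∈ ptn N, ζ ^ ck s =
    (if N = 0 then 1 else 0) + ∑ n ∈ Finset.range (N + 1),
      ((if n = 0 then 0 else ζ⁻¹ ^ n * ptnWeight (onesWeight ζ n) (N - n)) +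
      if n < 2 then 0 else ζ ^ n * ptnWeight (maxWeight n) (N - n)) := by
  have h1 : ∑ s ∈ ptn N, ζ ^ ck s = ∑ n ∈ Finset.range (N + 1),
      ∑ s ∈ (ptn N).filter (fun s => s.count 1 = n), ζ ^ ck s :=
    (Finset.sum_fiberwise_of_maps_to
      (fun s hs => Finset.mem_range.2 (Nat.lt_succ_of_le (count_one_le hs))) _).symm
  have h2 : ∀ n ∈ Finset.range (N + 1),
      ∑ s ∈ (ptn N).filter (fun s => s.count 1 = n), ζ ^ ck s =
      (if n = 0 then ∑ s ∈ (ptn N).filter (fun s => s.count 1 = 0), ζ ^ ck s else 0) +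
      (if n = 0 then 0 else ζ⁻¹ ^ n * ptnWeight (onesWeight ζ n) (N - n)) := by
    intro n hn
    rw [Finset.mem_range] at hn
    rcases Nat.eq_zero_or_pos n with rfl | h
    · rw [if_pos rfl, if_pos rfl, add_zero]
    · rw [if_neg h.ne', if_neg h.ne', zero_add, sum_ones ζ hζ h (by omega)]
  rw [h1, Finset.sum_congr rfl h2, Finset.sum_add_distrib, Finset.sum_add_distrib,
    Finset.sum_ite_eq', if_pos (Finset.mem_range.2 N.succ_pos), sum_no_ones]
  ring

theorem norm_onesWeight_le {ζ : ℂ} (hζ : ‖ζ‖ = 1) (n p : ℕ) : ‖onesWeight ζ n p‖ ≤ 1 := by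
  unfold onesWeight
  split_ifs <;> simp [hζ]

theorem norm_maxWeight_le (K p : ℕ) : ‖maxWeight K p‖ ≤ 1 := by
  unfold maxWeight
  split_ifs <;> simp

section
variable {q : ℂ} (hq : ‖q‖ < 1 / 2)
include hq

theorem prod_range_skip_one {n : ℕ} (hn : 0 < n) :
    ∏ i ∈ Finset.range n, (if i = 0 then 1 else 1 - q * q ^ i) =
      (∏ i ∈ Finset.range n, (1 - q * q ^ i)) * (1 - q)⁻¹ := by
  have h1 : 1 - q ≠ 0 := by simpa using one_sub_mul_pow_ne_zero (by linarith : ‖q‖ < 1) 0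
  obtain ⟨m, rfl⟩ := Nat.exists_eq_succ_of_ne_zero hn.ne'
  rw [Finset.prod_range_succ', Finset.prod_range_succ' _ m]
  simp only [if_true, Nat.add_eq_zero_iff, one_ne_zero, and_false, if_false, pow_zero, mul_one]
  rw [mul_assoc, mul_inv_cancel₀ h1, mul_one]

theorem hasSum_onesWeight {ζ : ℂ} (hζ : ‖ζ‖ = 1) {n : ℕ} (hn : 0 < n) :
    HasSum (fun M => ptnWeight (onesWeight ζ n) M * q ^ M)
      ((1 - q) * ((∏ i ∈ Finset.range n, (1 - q * q ^ i))⁻¹ * (qp q (ζ * q * q ^ n))⁻¹)) := by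
  have hq1 : ‖q‖ < 1 := by linarith
  have h1 : 1 - q ≠ 0 := by simpa using one_sub_mul_pow_ne_zero hq1 0
  have hx : ‖ζ * q * q ^ n‖ < 1 := by
    rw [norm_mul, norm_mul, hζ, one_mul, norm_pow]
    exact mul_lt_one_of_nonneg_of_lt_one_left (norm_nonneg _) hq1
      (pow_le_one₀ (norm_nonneg _) hq1.le)
  have hp := prod_one_sub_ne_zero hq1 n
  have hP : (∏ i ∈ Finset.range n, (1 - q * q ^ i)) * (1 - q)⁻¹ * qp q (ζ * q * q ^ n) ≠ 0 :=
    mul_ne_zero (mul_ne_zero hp (inv_ne_zero h1)) (qp_ne_zero_of_norm_lt hq1 hx)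
  have h := hasSum_ptnWeight (norm_onesWeight_le hζ n) hq
    (tendsto_atTop_mono (fun m => Nat.le_add_left m n) tendsto_id) hP ?_
  · convert h using 1
    rw [mul_inv, mul_inv, inv_inv]
    ring
  · refine ((qp_tendsto hq1 (ζ * q * q ^ n)).const_mul _).congr fun m => ?_
    rw [Finset.prod_range_add, ← prod_range_skip_one hq hn]
    congr 1
    · refine Finset.prod_congr rfl fun i hi => ?_
      rw [Finset.mem_range] at hi
      rcases Nat.eq_zero_or_pos i with rfl | h0
      · simp [onesWeight]
      · rw [if_neg h0.ne', onesWeight, if_neg (by omega), if_neg (by omega), one_mul, pow_succ']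
    · refine Finset.prod_congr rfl fun i hi => ?_
      rw [onesWeight, if_neg (by omega), if_pos (by omega)]
      ring

theorem hasSum_maxWeight {K : ℕ} (hK : 0 < K) :
    HasSum (fun M => ptnWeight (maxWeight K) M * q ^ M)
      ((1 - q) * (∏ i ∈ Finset.range K, (1 - q * q ^ i))⁻¹) := by
  have hq1 : ‖q‖ < 1 := by linarith
  have h1 : 1 - q ≠ 0 := by simpa using one_sub_mul_pow_ne_zero hq1 0
  have hP : (∏ i ∈ Finset.range K, (1 - q * q ^ i)) * (1 - q)⁻¹ ≠ 0 :=
    mul_ne_zero (prod_one_sub_ne_zero hq1 K) (inv_ne_zero h1)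
  have h := hasSum_ptnWeight (norm_maxWeight_le K) hq
    (tendsto_atTop_mono (fun m => Nat.le_add_left m K) tendsto_id) hP ?_
  · convert h using 1
    rw [mul_inv, inv_inv, mul_comm]
  · refine tendsto_const_nhds.congr fun m => ?_
    rw [Finset.prod_range_add, ← prod_range_skip_one hq hK]
    rw [Finset.prod_eq_one (s := Finset.range m), mul_one]
    · refine Finset.prod_congr rfl fun i hi => ?_
      rw [Finset.mem_range] at hi
      rcases Nat.eq_zero_or_pos i with rfl | h0
      · simp [maxWeight]
      · rw [if_neg h0.ne', maxWeight, if_pos (by omega), one_mul, pow_succ']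
    · intro i hi
      rw [maxWeight, if_neg (by omega)]
      ring

/-- The crank generating function, before the correction at `1`. -/
theorem hasSum_zpow_ck {ζ : ℂ} (hζ : ‖ζ‖ = 1) :
    HasSum (fun N => (∑ s ∈ ptn N, ζ ^ ck s) * q ^ N)
      (qp q q * (qp q (q / ζ) * qp q (ζ * q))⁻¹ + q - ζ * q) := by
  have hq1 : ‖q‖ < 1 := by linarith
  have hζ0 : ζ ≠ 0 := norm_ne_zero_iff.1 (by rw [hζ]; exact one_ne_zero)
  have h1 : 1 - q ≠ 0 := by simpa using one_sub_mul_pow_ne_zero hq1 0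
  have hw : ‖q / ζ‖ < 1 := by rwa [norm_div, hζ, div_one]
  have ha : ‖ζ * q‖ < 1 := by rwa [norm_mul, hζ, one_mul]
  set A : ℕ → ℂ := fun n => (∏ i ∈ Finset.range n, (1 - q * q ^ i))⁻¹ with hA
  set f : ℕ → ℕ → ℂ := fun n M =>
    ((if n = 0 then 0 else ζ⁻¹ ^ n * ptnWeight (onesWeight ζ n) M) +
      if n < 2 then 0 else ζ ^ n * ptnWeight (maxWeight n) M) * q ^ (n + M) with hf
  set g : ℕ → ℂ := fun n =>
    (if n = 0 then 0 else (q / ζ) ^ n * ((1 - q) * (A n * (qp q (ζ * q * q ^ n))⁻¹))) +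
      if n < 2 then 0 else (ζ * q) ^ n * ((1 - q) * A n) with hg
  have hfg : ∀ n, HasSum (f n) (g n) := by
    intro n
    have e1 : HasSum (fun M => (if n = 0 then 0 else
        ζ⁻¹ ^ n * ptnWeight (onesWeight ζ n) M) * q ^ (n + M))
        (if n = 0 then 0 else (q / ζ) ^ n * ((1 - q) * (A n * (qp q (ζ * q * q ^ n))⁻¹))) := by
      split_ifs with h0
      · simp
      · have h := (hasSum_onesWeight hq hζ (Nat.pos_of_ne_zero h0)).mul_left ((q / ζ) ^ n)
        refine (congrArg (fun f => HasSum f _) (funext fun M => ?_)).mpr h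
        rw [div_eq_mul_inv, mul_pow, pow_add]
        ring
    have e2 : HasSum (fun M => (if n < 2 then 0 else
        ζ ^ n * ptnWeight (maxWeight n) M) * q ^ (n + M))
        (if n < 2 then 0 else (ζ * q) ^ n * ((1 - q) * A n)) := by
      split_ifs with h0
      · simp
      · have h := (hasSum_maxWeight hq (by omega : 0 < n)).mul_left ((ζ * q) ^ n)
        refine (congrArg (fun f => HasSum f _) (funext fun M => ?_)).mpr h
        rw [mul_pow, pow_add]
        ring
    refine (congrArg (fun f => HasSum f _) (funext fun M => ?_)).mpr (e1.add e2)
    exact add_mul _ _ _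
  have hsum : Summable fun p : ℕ × ℕ => f p.1 p.2 := by
    have hb : Summable fun p : ℕ × ℕ => 2 * ((2 * ‖q‖) ^ p.1 * (2 * ‖q‖) ^ p.2) :=
      ((summable_two_pow_bound hq).mul_of_nonneg (summable_two_pow_bound hq)
        (fun _ => by positivity) (fun _ => by positivity)).mul_left 2
    refine Summable.of_norm_bounded hb ?_
    rintro ⟨n, M⟩
    simp only [hf]
    rw [norm_mul, norm_pow, ← pow_add, mul_pow, ← mul_assoc]
    refine mul_le_mul_of_nonneg_right ?_ (by positivity)
    have t1 : ‖(if n = 0 then 0 else ζ⁻¹ ^ n * ptnWeight (onesWeight ζ n) M : ℂ)‖ ≤ 2 ^ M := by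
      split_ifs
      · rw [norm_zero]; positivity
      · rw [norm_mul, norm_pow, norm_inv, hζ, inv_one, one_pow, one_mul]
        exact norm_ptnWeight_le (norm_onesWeight_le hζ n) M
    have t2 : ‖(if n < 2 then 0 else ζ ^ n * ptnWeight (maxWeight n) M : ℂ)‖ ≤ 2 ^ M := by
      split_ifs
      · rw [norm_zero]; positivity
      · rw [norm_mul, norm_pow, hζ, one_pow, one_mul]
        exact norm_ptnWeight_le (norm_maxWeight_le n) M
    refine (norm_add_le _ _).trans ((add_le_add t1 t2).trans ?_)
    rw [← two_mul]
    exact mul_le_mul_of_nonneg_left (pow_le_pow_right₀ (by norm_num) (Nat.le_add_left _ _))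
      (by norm_num)
  have hanti := hasSum_antidiagonal hsum hfg
  have hgs : HasSum g ((1 - q) * (qp q (ζ * q * (q / ζ)) * (qp q (q / ζ) * qp q (ζ * q))⁻¹) -
      (1 - q) - ζ * q) := by
    have b1 := (hasSum_qbinomial_inv hq1 hw (a := ζ * q) (fun i h => by
      have : ‖ζ * q * q ^ i‖ < 1 := by
        rw [norm_mul, norm_pow]
        exact mul_lt_one_of_nonneg_of_lt_one_left (norm_nonneg _) ha
          (pow_le_one₀ (norm_nonneg _) hq1.le)
      rw [h, norm_one] at this
      exact lt_irrefl _ this)).mul_left (1 - q)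
    have b2 := (hasSum_euler hq1 ha).mul_left (1 - q)
    have b3 := hasSum_ite_eq (0 : ℕ) ((1 - q) * ((qp q (ζ * q))⁻¹ + 1))
    have b4 := hasSum_ite_eq (1 : ℕ) (ζ * q)
    have b := ((b1.add b2).sub b3).sub b4
    have e : (1 - q) * (qp q (ζ * q * (q / ζ)) * (qp q (q / ζ) * qp q (ζ * q))⁻¹) -
      (1 - q) - ζ * q = (1 - q) * (qp q (ζ * q * (q / ζ)) * (qp q (q / ζ) * qp q (ζ * q))⁻¹) +
      (1 - q) * (qp q (ζ * q))⁻¹ - (1 - q) * ((qp q (ζ * q))⁻¹ + 1) - ζ * q := by ring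
    rw [e]
    refine (congrArg (fun f => HasSum f _) (funext fun n => ?_)).mpr b
    simp only [hg, hA]
    match n with
    | 0 =>
      simp
      ring
    | 1 =>
      simp only [one_ne_zero, if_false, if_true, pow_one, Finset.prod_range_one, pow_zero, mul_one,
        show (1 : ℕ) < 2 by norm_num]
      field_simp
      ring
    | n + 2 =>
      rw [if_neg (by omega), if_neg (by omega), if_neg (by omega), if_neg (by omega)]
      ring
  rw [hgs.tsum_eq] at hanti
  have hfin := hanti.add (hasSum_ite_eq (0 : ℕ) (1 : ℂ))
  have e : qp q q * (qp q (q / ζ) * qp q (ζ * q))⁻¹ + q - ζ * q =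
      (1 - q) * (qp q (ζ * q * (q / ζ)) * (qp q (q / ζ) * qp q (ζ * q))⁻¹) -
      (1 - q) - ζ * q + 1 := by
    rw [qp_eq hq1 q, show ζ * q * (q / ζ) = q * q by field_simp]
    ring
  rw [e]
  refine (congrArg (fun f => HasSum f _) (funext fun N => ?_)).mpr hfin
  have e2 : ∀ p ∈ Finset.HasAntidiagonal.antidiagonal N, f p.1 p.2 =
      ((if p.1 = 0 then 0 else ζ⁻¹ ^ p.1 * ptnWeight (onesWeight ζ p.1) p.2) +
      if p.1 < 2 then 0 else ζ ^ p.1 * ptnWeight (maxWeight p.1) p.2) * q ^ N := by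
    intro p hp
    have hp : p.1 + p.2 = N := Finset.HasAntidiagonal.mem_antidiagonal.1 hp
    simp only [hf]
    rw [hp]
  rw [Finset.sum_congr rfl e2, ← Finset.sum_mul, sum_zpow_ck ζ hζ0 N,
    Finset.Nat.sum_antidiagonal_eq_sum_range_succ (fun n M =>
      (if n = 0 then 0 else ζ⁻¹ ^ n * ptnWeight (onesWeight ζ n) M) +
      if n < 2 then 0 else ζ ^ n * ptnWeight (maxWeight n) M), add_mul, add_comm]
  congr 1
  split_ifs with h0
  · rw [h0, pow_zero, mul_one]
  · rw [zero_mul]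

end

/-- The number of partitions of `N` with crank congruent to `k` modulo `11`, with the standard
convention at `N = 1`. -/
def crankClass (k N : ℕ) : ℤ :=
  if N = 1 then (if k = 0 then -1 else if k = 1 ∨ k = 10 then 1 else 0)
  else (((ptn N).filter fun s => ck s % 11 = (k : ℤ)).card : ℤ)

theorem sum_zpow_eq_sum_classes {z : ℂ} (hz : z ^ 11 = 1) (A : Finset (Multiset ℕ))
    (c : Multiset ℕ → ℤ) : ∑ s ∈ A, z ^ c s =
      ∑ k ∈ Finset.range 11, ((A.filter fun s => c s % 11 = (k : ℤ)).card : ℂ) * z ^ k := by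
  have hz0 := ne_zero_of_pow_eleven hz
  rw [← Finset.sum_fiberwise_of_maps_to (t := Finset.range 11) (g := fun s => (c s % 11).toNat)
    (fun s _ => Finset.mem_range.2 (by omega))]
  refine Finset.sum_congr rfl fun k hk => ?_
  rw [← nsmul_eq_mul, ← Finset.sum_const]
  refine Finset.sum_congr ?_ fun s hs => ?_
  · ext s
    simp only [Finset.mem_filter]
    refine and_congr_right fun _ => ?_
    omega
  · have h := (Finset.mem_filter.1 hs).2
    have e : c s = 11 * (c s / 11) + (k : ℤ) := by omega
    rw [e, zpow_add₀ hz0, zpow_mul, zpow_natCast]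
    have : z ^ (11 : ℤ) = 1 := by exact_mod_cast hz
    rw [this, one_zpow, one_mul]

theorem ptn_one : ptn 1 = {{1}} := by
  ext s
  rw [mem_ptn, Finset.mem_singleton]
  constructor
  · rintro ⟨h1, h2⟩
    have h0 : s ≠ 0 := by rintro rfl; simp at h2
    obtain ⟨a, ha⟩ := Multiset.exists_mem_of_ne_zero h0
    obtain ⟨t, rfl⟩ := Multiset.exists_cons_of_mem ha
    rw [Multiset.sum_cons] at h2
    have h3 := h1 a ha
    have h4 : t.sum = 0 := by omega
    have h5 : t = 0 := by
      refine Multiset.eq_zero_of_forall_notMem fun b hb => ?_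
      have h6 := Multiset.le_sum_of_mem hb
      have h7 := h1 b (Multiset.mem_cons_of_mem hb)
      omega
    have h6 : a = 1 := by omega
    rw [h5, h6]; rfl
  · rintro rfl
    simp

theorem sum_crankClass {z : ℂ} (hz : z ^ 11 = 1) (N : ℕ) :
    ∑ k ∈ Finset.range 11, (crankClass k N : ℂ) * z ^ k =
      (∑ s ∈ ptn N, z ^ ck s) + if N = 1 then z - 1 else 0 := by
  split_ifs with h
  · subst h
    have h2 : z ^ (-1 : ℤ) = z ^ 10 := by
      rw [zpow_neg_one, inv_eq_iff_eq_inv]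
      exact eq_inv_of_mul_eq_one_left (by rw [← hz]; ring)
    have h3 : ck {1} = -1 := by
      have h : Multiset.filter (fun x => 1 < x) {1} = 0 := rfl
      simp [ck, h]
    rw [ptn_one, Finset.sum_singleton, h3, h2]
    simp [crankClass, Finset.sum_range_succ]
    ring
  · rw [sum_zpow_eq_sum_classes hz, add_zero]
    simp [crankClass, h]

section
variable {ρ : ℂ} (h0 : ρ ≠ 0) (hρ : ‖ρ ^ 2‖ < 1 / 2)
include h0 hρ

/-- The generating function of the residue classes of the crank in the progression `11 n + 1`. -/
theorem hasSum_crank_combination {η : ℂ} (hη : IsPrimitiveRoot η 11) {w : ℕ → ℂ}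
    (hw : ∑ k ∈ Finset.range 11, w k = 0) :
    HasSum (fun n => ∑ k ∈ Finset.range 11, w k *
      (11 * ρ ^ 2 * ((crankClass k (11 * n + 1) : ℂ) * (ρ ^ 22) ^ n)))
      (11 * (ρ ^ (-10 : ℤ) * eulerJ ρ ^ (2 : ℤ) * thxMonom ρ (0, -1, -1, 0, 1)) *
        (w 1 + w 10 - w 0)) := by
  have h1 := norm_lt_one_of_sq hρ
  set K := 11 * (ρ ^ (-10 : ℤ) * eulerJ ρ ^ (2 : ℤ) * thxMonom ρ (0, -1, -1, 0, 1)) with hK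
  have h := hasSum_of_roots hη (c := fun k n =>
    11 * ρ ^ 2 * ((crankClass k (11 * n + 1) : ℂ) * (ρ ^ 22) ^ n))
    (d := fun k => K * if k = 0 then -1 else if k = 1 ∨ k = 10 then 1 else 0) hw ?_
  · convert h using 1
    simp [Finset.sum_range_succ]
    ring
  intro z hz hz1
  have hz0 := ne_zero_of_pow_eleven hz
  have hzn : ‖z‖ = 1 := by
    have := congrArg norm hz
    rw [norm_pow, norm_one] at this
    exact (pow_eq_one_iff_of_nonneg (norm_nonneg _) (by norm_num)).1 this
  set C : ℂ → ℂ := fun ρ' =>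
    qp (ρ' ^ 2) (ρ' ^ 2) * (qp (ρ' ^ 2) (ρ' ^ 2 / z) * qp (ρ' ^ 2) (z * ρ' ^ 2))⁻¹ with hC
  have hs : ∀ j : ℕ, HasSum (fun n => (∑ k ∈ Finset.range 11, (crankClass k n : ℂ) * z ^ k) *
      ((η ^ j * ρ) ^ 2) ^ n) (C (η ^ j * ρ)) := by
    intro j
    have hj : ‖η ^ j‖ = 1 := by
      rw [norm_pow, hη.norm'_eq_one (by norm_num), one_pow]
    have hq : ‖(η ^ j * ρ) ^ 2‖ < 1 / 2 := by
      rwa [mul_pow, norm_mul, norm_pow, hj, one_pow, one_mul]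
    have b := (hasSum_zpow_ck hq hzn).add (hasSum_ite_eq (1 : ℕ) ((z - 1) * (η ^ j * ρ) ^ 2))
    have e : C (η ^ j * ρ) = qp ((η ^ j * ρ) ^ 2) ((η ^ j * ρ) ^ 2) *
      (qp ((η ^ j * ρ) ^ 2) ((η ^ j * ρ) ^ 2 / z) * qp ((η ^ j * ρ) ^ 2) (z * (η ^ j * ρ) ^ 2))⁻¹ +
      (η ^ j * ρ) ^ 2 - z * (η ^ j * ρ) ^ 2 + (z - 1) * (η ^ j * ρ) ^ 2 := by
      simp only [hC]; ring
    rw [e]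
    refine (congrArg (fun f => HasSum f _) (funext fun N => ?_)).mpr b
    rw [sum_crankClass hz, add_mul]
    congr 1
    split_ifs with hN
    · rw [hN, pow_one]
    · rw [zero_mul]
  have h2 := hasSum_weightTwo hη hs
  rw [weightTwo_crank h0 h1 hη hz hz1] at h2
  · have e : ∑ k ∈ Finset.range 11, (K * if k = 0 then -1 else if k = 1 ∨ k = 10 then 1 else 0) *
        z ^ k = K * (-1 + z + z ^ 10) := by
      simp [Finset.sum_range_succ]
      ring
    rw [e]
    refine (congrArg (fun f => HasSum f _) (funext fun n => ?_)).mpr h2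
    rw [Finset.sum_mul, Finset.mul_sum]
    refine Finset.sum_congr rfl fun k _ => ?_
    ring
  · intro ρ' hρ0 hρ1
    have h1' : ‖ρ'‖ < 1 := hρ1 ▸ h1
    have hq := norm_sq_lt_one h1'
    rw [th_eq_prod hρ0 h1' (inv_ne_zero hz0), th_cube_sq hρ0 h1', qp_eq hq z⁻¹]
    have n1 := qp_ne_zero_of_norm_lt hq (x := ρ' ^ 2 / z) (by rwa [norm_div, hzn, div_one])
    have n2 := qp_ne_zero_of_norm_lt hq (x := z * ρ' ^ 2) (by rwa [norm_mul, hzn, one_mul])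
    simp only [hC]
    rw [show ρ' ^ 2 / z⁻¹ = z * ρ' ^ 2 by field_simp,
      show z⁻¹ * ρ' ^ 2 = ρ' ^ 2 / z by field_simp]
    generalize qp (ρ' ^ 2) (z * ρ' ^ 2) = x at *
    field_simp

end

section
variable {ρ : ℂ} (h0 : ρ ≠ 0) (hρ : ‖ρ ^ 2‖ < 1 / 2)
include h0 hρ

/-- A combination of rank and crank residue classes whose theta part satisfies a certificate is
given by a single theta quotient. -/
theorem hasSum_rank_crank_combination {η : ℂ} (hη : IsPrimitiveRoot η 11) {τ : Laurent}
    {rhs : Expo} {c0 c1 c2 c3 c4 c5 m1 m2 m3 m4 m5 : ℂ} {cr : ℤ} {w : ℕ → ℂ}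
    (hw : ∑ k ∈ Finset.range 11, w k = 0) (hcr : w 1 + w 10 - w 0 = cr)
    (hcert : laurentVanishesAll (laurentPart 1 (laurentMul τ pentInvList) ++
      (discMonomList cr 5 (0, -1, -1, 0, 1) ++ discMonomList (-11) 4 rhs)) 11 = true)
    (hL : ∀ ρ : ℂ, ρ ≠ 0 → ‖ρ‖ < 1 → (c2 - c3) * lambert ρ 1 + (c1 - 2 * c0) * lambert ρ 2 +
        (c4 - c3) * lambert ρ 3 + (c4 - c5) * lambert ρ 4 + (c1 - c2) * lambert ρ 5 +
        (c0 - (c2 - c3)) =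
      pentFactor ρ * (m1 * (ρ ^ 30 * mockTerm ρ 1) + m2 * (ρ ^ 54 * mockTerm ρ 2) +
        m3 * (ρ ^ 72 * mockTerm ρ 3) + m4 * (ρ ^ 84 * mockTerm ρ 4) +
        m5 * (ρ ^ 90 * mockTerm ρ 5)) - thDeriv (ρ ^ 121) 1 * thxEval ρ τ) :
    HasSum (fun n => (c0 * rankClass 0 (11 * n + 1) + c1 * rankClass 1 (11 * n + 1) +
      c2 * rankClass 2 (11 * n + 1) + c3 * rankClass 3 (11 * n + 1) +
      c4 * rankClass 4 (11 * n + 1) + c5 * rankClass 5 (11 * n + 1) +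
      ∑ k ∈ Finset.range 11, w k * crankClass k (11 * n + 1)) * (ρ ^ 22) ^ n)
      (11 * (ρ ^ (-12 : ℤ) * eulerJ ρ ^ (2 : ℤ) * (thxDisc ρ)⁻¹ * thxMonom ρ rhs)) := by
  have h1 := norm_lt_one_of_sq hρ
  set f : ℕ → ℂ := fun N => c0 * rankClass 0 N + c1 * rankClass 1 N + c2 * rankClass 2 N +
      c3 * rankClass 3 N + c4 * rankClass 4 N + c5 * rankClass 5 N with hf
  set F : ℂ → ℂ := fun ρ => ∑' N, f N * (ρ ^ 2) ^ N with hF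
  have hS : ∀ ρ : ℂ, ρ ≠ 0 → ‖ρ ^ 2‖ < 1 / 2 → HasSum (fun N => f N * (ρ ^ 2) ^ N) (F ρ) ∧
      th (ρ ^ 3) (ρ ^ 2) * F ρ = (c2 - c3) * lambert ρ 1 + (c1 - 2 * c0) * lambert ρ 2 +
        (c4 - c3) * lambert ρ 3 + (c4 - c5) * lambert ρ 4 + (c1 - c2) * lambert ρ 5 +
        (c0 - (c2 - c3)) - (c2 - c3) * ρ ^ (-2 : ℤ) * th (ρ ^ 3) (ρ ^ 2) := by
    intro ρ h0 hρ
    obtain ⟨S, hS, e⟩ := hasSum_rank_combination h0 (norm_lt_one_of_sq hρ) hρ c0 c1 c2 c3 c4 c5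
    have hFS : F ρ = S := hS.tsum_eq
    rw [hFS]
    exact ⟨hS, e⟩
  have hs : ∀ j : ℕ, HasSum (fun N => f N * ((η ^ j * ρ) ^ 2) ^ N) (F (η ^ j * ρ)) := by
    intro j
    have hj : ‖η ^ j‖ = 1 := by
      rw [norm_pow, hη.norm'_eq_one (by norm_num), one_pow]
    have hj0 : η ^ j ≠ 0 := norm_ne_zero_iff.1 (by rw [hj]; exact one_ne_zero)
    refine (hS _ (mul_ne_zero hj0 h0) ?_).1
    rwa [mul_pow, norm_mul, norm_pow, hj, one_pow, one_mul]
  have hr := hasSum_weightTwo hη hs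
  rw [weightTwo_rank h0 h1 hη (τ := τ) (m1 := m1) (m2 := m2) (m3 := m3) (m4 := m4) (m5 := m5)
    (d := c2 - c3)] at hr
  · have hc := hasSum_crank_combination h0 hρ hη hw
    have hx := isThetaVector_thx h0 h1
    have hv := hx.laurentEval_eq_zero_of_all hcert
    rw [laurentEval_append, laurentEval_append] at hv
    have d1 := thxEval_discMonomList h0 h1 cr 5 (0, -1, -1, 0, 1)
    have d2 := thxEval_discMonomList h0 h1 (-11) 4 rhs
    rw [← thxEval, ← thxEval, ← thxEval, d1, d2] at hv
    have hD := thxDisc_ne_zero h0 h1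
    have hsum := (hr.add hc).mul_left (11 * ρ ^ 2)⁻¹
    have e : (11 * ρ ^ 2)⁻¹ * (11 * (ρ ^ (-10 : ℤ) * eulerJ ρ ^ (2 : ℤ) * thxDisc ρ ^ (-5 : ℤ) *
        thxEval ρ (laurentPart 1 (laurentMul τ pentInvList))) +
        11 * (ρ ^ (-10 : ℤ) * eulerJ ρ ^ (2 : ℤ) * thxMonom ρ (0, -1, -1, 0, 1)) *
        (w 1 + w 10 - w 0)) =
        11 * (ρ ^ (-12 : ℤ) * eulerJ ρ ^ (2 : ℤ) * (thxDisc ρ)⁻¹ * thxMonom ρ rhs) := by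
      rw [hcr]
      generalize thxEval ρ (laurentPart 1 (laurentMul τ pentInvList)) = E at *
      generalize thxDisc ρ = D at *
      generalize thxMonom ρ (0, -1, -1, 0, 1) = x at *
      generalize thxMonom ρ rhs = x' at *
      generalize eulerJ ρ ^ (2 : ℤ) = J
      have hE : E = 11 * D ^ 4 * x' - cr * D ^ 5 * x := by
        push_cast at hv
        linear_combination hv
      have z5 : D ^ (-5 : ℤ) = (D ^ 5)⁻¹ := by rw [zpow_neg]; norm_cast
      have z10 : ρ ^ (-10 : ℤ) = ρ ^ 2 * ρ ^ (-12 : ℤ) := by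
        rw [← zpow_natCast, ← zpow_add₀ h0]; norm_num
      rw [hE, z5, z10]
      generalize ρ ^ (-12 : ℤ) = r
      field_simp
      ring
    rw [e] at hsum
    refine (congrArg (fun f => HasSum f _) (funext fun n => ?_)).mpr hsum
    have e2 : ∀ k, w k * (11 * ρ ^ 2 * ((crankClass k (11 * n + 1) : ℂ) * (ρ ^ 22) ^ n)) =
        11 * ρ ^ 2 * ((w k * crankClass k (11 * n + 1)) * (ρ ^ 22) ^ n) := fun k => by ring
    simp only [e2]
    rw [← Finset.mul_sum, ← Finset.sum_mul]
    simp only [hf]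
    generalize (ρ ^ 22) ^ n = y
    generalize (∑ k ∈ Finset.range 11, w k * (crankClass k (11 * n + 1) : ℂ)) = s
    field_simp
  · intro ρ' k0 k1
    have h1' : ‖ρ'‖ < 1 := k1 ▸ h1
    rw [(hS ρ' k0 (by rwa [norm_pow, k1, ← norm_pow])).2, hL ρ' k0 h1']

omit hρ in
/-- The theta quotient of the closed form as an infinite product in `ρ ^ 22`. -/
theorem thetaQuotient_eq (h1 : ‖ρ‖ < 1) {e1 e2 e3 e4 e5 i : ℕ}
    (he : e1 + e2 + e3 + e4 + e5 = 13)
    (hi : 10 * e1 + 18 * e2 + 24 * e3 + 28 * e4 + 30 * e5 = 254 + 22 * i) :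
    ρ ^ (-12 : ℤ) * eulerJ ρ ^ (2 : ℤ) * (thxDisc ρ)⁻¹ *
      thxMonom ρ (-3 - e1, 2 - e2, 2 - e3, 5 - e4, 6 - e5) =
    (ρ ^ 22) ^ i * (eulerJ ρ * (((th (ρ ^ 121) ((ρ ^ 22) ^ 1) / eulerJ ρ)⁻¹) ^ e1 *
      ((th (ρ ^ 121) ((ρ ^ 22) ^ 2) / eulerJ ρ)⁻¹) ^ e2 *
      ((th (ρ ^ 121) ((ρ ^ 22) ^ 3) / eulerJ ρ)⁻¹) ^ e3 *
      ((th (ρ ^ 121) ((ρ ^ 22) ^ 4) / eulerJ ρ)⁻¹) ^ e4 *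
      ((th (ρ ^ 121) ((ρ ^ 22) ^ 5) / eulerJ ρ)⁻¹) ^ e5)) := by
  have hJ := eulerJ_ne_zero h0 h1
  have hD := thxDisc_ne_zero h0 h1
  have hm := thxDisc_mul h0 h1
  have n1 := thx_ne_zero h0 h1 (k := 1) (by norm_num)
  have n2 := thx_ne_zero h0 h1 (k := 2) (by norm_num)
  have n3 := thx_ne_zero h0 h1 (k := 3) (by norm_num)
  have n4 := thx_ne_zero h0 h1 (k := 4) (by norm_num)
  have n5 := thx_ne_zero h0 h1 (k := 5) (by norm_num)
  have q : ∀ k d : ℕ, (k : ℤ) * (k - 11) = -d → thx ρ k ≠ 0 → ∀ e : ℕ, (thx ρ k ^ e)⁻¹ =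
      ρ ^ (d * e) * (((th (ρ ^ 121) ((ρ ^ 22) ^ k) / eulerJ ρ)⁻¹) ^ e * (eulerJ ρ ^ e)⁻¹) := by
    intro k d hd hk e
    have h : thx ρ k = (ρ ^ d)⁻¹ * th (ρ ^ 121) ((ρ ^ 22) ^ k) := by
      rw [thx, hd, zpow_neg]
      norm_cast
    have hT : th (ρ ^ 121) ((ρ ^ 22) ^ k) ≠ 0 := by
      intro hT
      rw [h, hT, mul_zero] at hk
      exact hk rfl
    have h2 : (thx ρ k)⁻¹ =
        ρ ^ d * ((th (ρ ^ 121) ((ρ ^ 22) ^ k) / eulerJ ρ)⁻¹ * (eulerJ ρ)⁻¹) := by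
      rw [h]
      field_simp
    rw [← inv_pow, h2, mul_pow, mul_pow, pow_mul, inv_pow (eulerJ ρ)]
  have q1 := q 1 10 (by norm_num) (by simpa using n1) e1
  have q2 := q 2 18 (by norm_num) (by simpa using n2) e2
  have q3 := q 3 24 (by norm_num) (by simpa using n3) e3
  have q4 := q 4 28 (by norm_num) (by simpa using n4) e4
  have q5 := q 5 30 (by norm_num) (by simpa using n5) e5
  simp only [Nat.cast_one, Nat.cast_ofNat] at q1 q2 q3 q4 q5
  have r1 : thx ρ 1 ^ (-3 - e1 : ℤ) = (thx ρ 1 ^ 3)⁻¹ * (thx ρ 1 ^ e1)⁻¹ := by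
    rw [zpow_sub₀ n1, zpow_neg, zpow_natCast, div_eq_mul_inv]
    norm_cast
  have r : ∀ (x : ℂ) (m e : ℕ), x ≠ 0 → x ^ (m - e : ℤ) = x ^ m * (x ^ e)⁻¹ := by
    intro x m e hx
    rw [zpow_sub₀ hx, zpow_natCast, zpow_natCast, div_eq_mul_inv]
  have r2 := r (thx ρ 2) 2 e2 n2
  have r3 := r (thx ρ 3) 2 e3 n3
  have r4 := r (thx ρ 4) 5 e4 n4
  have r5 := r (thx ρ 5) 6 e5 n5
  simp only [Nat.cast_ofNat] at r2 r3 r4 r5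
  simp only [thxMonom, monom]
  rw [r1, r2, r3, r4, r5, q1, q2, q3, q4, q5]
  have ej : eulerJ ρ ^ e1 * eulerJ ρ ^ e2 * eulerJ ρ ^ e3 * eulerJ ρ ^ e4 * eulerJ ρ ^ e5 =
      eulerJ ρ ^ 13 := by
    rw [← pow_add, ← pow_add, ← pow_add, ← pow_add, he]
  have er : ρ ^ (10 * e1) * ρ ^ (18 * e2) * ρ ^ (24 * e3) * ρ ^ (28 * e4) * ρ ^ (30 * e5) =
      ρ ^ 254 * (ρ ^ 22) ^ i := by
    rw [← pow_add, ← pow_add, ← pow_add, ← pow_add, hi, pow_add, pow_mul]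
  have z12 : ρ ^ (-12 : ℤ) = (ρ ^ 12)⁻¹ := by rw [zpow_neg]; norm_cast
  have zj : eulerJ ρ ^ (2 : ℤ) = eulerJ ρ ^ 2 := by norm_cast
  rw [z12, zj]
  generalize (th (ρ ^ 121) ((ρ ^ 22) ^ 1) / eulerJ ρ)⁻¹ ^ e1 = t1
  generalize (th (ρ ^ 121) ((ρ ^ 22) ^ 2) / eulerJ ρ)⁻¹ ^ e2 = t2
  generalize (th (ρ ^ 121) ((ρ ^ 22) ^ 3) / eulerJ ρ)⁻¹ ^ e3 = t3
  generalize (th (ρ ^ 121) ((ρ ^ 22) ^ 4) / eulerJ ρ)⁻¹ ^ e4 = t4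
  generalize (th (ρ ^ 121) ((ρ ^ 22) ^ 5) / eulerJ ρ)⁻¹ ^ e5 = t5
  generalize thx ρ 1 = x1 at *
  generalize thx ρ 2 = x2 at *
  generalize thx ρ 3 = x3 at *
  generalize thx ρ 4 = x4 at *
  generalize thx ρ 5 = x5 at *
  generalize thxDisc ρ = D at *
  generalize (ρ ^ 22) ^ i = yi at *
  generalize eulerJ ρ = J at *
  have hD2 : D⁻¹ = J ^ 12 * x1 ^ 3 * (ρ ^ 242 * (x2 ^ 2 * x3 ^ 2 * x4 ^ 5 * x5 ^ 6))⁻¹ := by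
    rw [← hm]
    field_simp
  have hJ13 : (J ^ e1)⁻¹ * (J ^ e2)⁻¹ * (J ^ e3)⁻¹ * (J ^ e4)⁻¹ * (J ^ e5)⁻¹ = (J ^ 13)⁻¹ := by
    rw [← ej]
    simp only [mul_inv]
  rw [hD2]
  calc _ = (ρ ^ (10 * e1) * ρ ^ (18 * e2) * ρ ^ (24 * e3) * ρ ^ (28 * e4) * ρ ^ (30 * e5)) *
      ((J ^ e1)⁻¹ * (J ^ e2)⁻¹ * (J ^ e3)⁻¹ * (J ^ e4)⁻¹ * (J ^ e5)⁻¹) *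
      ((ρ ^ 12)⁻¹ * J ^ 2 * (J ^ 12 * x1 ^ 3 *
      (ρ ^ 242 * (x2 ^ 2 * x3 ^ 2 * x4 ^ 5 * x5 ^ 6))⁻¹) * ((x1 ^ 3)⁻¹ * x2 ^ 2 * x3 ^ 2 *
      x4 ^ 5 * x5 ^ 6)) * (t1 * t2 * t3 * t4 * t5) := by ring
    _ = _ := by
      rw [er, hJ13]
      generalize t1 * t2 * t3 * t4 * t5 = t
      field_simp
end

theorem coeff_zero_of_hasSum_zero {r : ℝ} (hr : 0 < r) {a : ℕ → ℂ}
    (h : ∀ y : ℂ, y ≠ 0 → ‖y‖ < r → HasSum (fun n => a n * y ^ n) 0) : a 0 = 0 := by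
  set y0 : ℂ := ((r / 2 : ℝ) : ℂ) with hy0
  have hn0 : ‖y0‖ = r / 2 := by
    rw [hy0, Complex.norm_real, Real.norm_of_nonneg (by positivity)]
  have hne : y0 ≠ 0 := norm_ne_zero_iff.1 (by rw [hn0]; positivity)
  have hb : Summable fun n => ‖a n * y0 ^ n‖ := (h y0 hne (by rw [hn0]; linarith)).summable.norm
  have ht : Tendsto (fun m : ℕ => ∑' n, a n * (y0 * (((m : ℝ) + 1)⁻¹ : ℝ)) ^ n) atTop
      (𝓝 (∑' n, if n = 0 then a 0 else 0)) := by
    have hm : ∀ m : ℕ, ‖((((m : ℝ) + 1)⁻¹ : ℝ) : ℂ)‖ ≤ 1 := by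
      intro m
      rw [Complex.norm_real, Real.norm_of_nonneg (by positivity)]
      exact inv_le_one_of_one_le₀ (by linarith [(Nat.cast_nonneg m : (0 : ℝ) ≤ m)])
    refine tendsto_tsum_of_dominated_convergence hb ?_ (Eventually.of_forall fun m n => ?_)
    · intro n
      split_ifs with hn
      · simp [hn]
      · have h1 : Tendsto (fun m : ℕ => (((m : ℝ) + 1)⁻¹ : ℝ)) atTop (𝓝 0) :=
          tendsto_one_div_add_atTop_nhds_zero_nat.congr fun m => one_div _
        have h2 : Tendsto (fun m : ℕ => ((((m : ℝ) + 1)⁻¹ : ℝ) : ℂ)) atTop (𝓝 ((0 : ℝ) : ℂ)) :=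
          (Complex.continuous_ofReal.tendsto 0).comp h1
        have h3 := ((h2.const_mul y0).pow n).const_mul (a n)
        simpa [hn] using h3
    · rw [mul_pow, ← mul_assoc, norm_mul]
      refine mul_le_of_le_one_right (norm_nonneg _) ?_
      rw [norm_pow]
      exact pow_le_one₀ (norm_nonneg _) (hm m)
  rw [tsum_ite_eq] at ht
  refine tendsto_nhds_unique ht (tendsto_const_nhds.congr fun m => ?_)
  have hp : (0 : ℝ) < ((m : ℝ) + 1)⁻¹ := by positivity
  refine (h _ (mul_ne_zero hne (Complex.ofReal_ne_zero.2 hp.ne')) ?_).tsum_eq.symm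
  rw [norm_mul, hn0, Complex.norm_real, Real.norm_of_nonneg hp.le]
  have : ((m : ℝ) + 1)⁻¹ ≤ 1 :=
    inv_le_one_of_one_le₀ (by linarith [(Nat.cast_nonneg m : (0 : ℝ) ≤ m)])
  nlinarith

theorem coeff_eq_zero_of_hasSum_zero {r : ℝ} (hr : 0 < r) (n : ℕ) {a : ℕ → ℂ}
    (h : ∀ y : ℂ, y ≠ 0 → ‖y‖ < r → HasSum (fun n => a n * y ^ n) 0) : a n = 0 := by
  induction n generalizing a with
  | zero => exact coeff_zero_of_hasSum_zero hr h
  | succ n ih =>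
    refine ih (a := fun n => a (n + 1)) fun y hy hyr => ?_
    have h1 := (hasSum_nat_add_iff' 1).2 (h y hy hyr)
    rw [Finset.sum_range_one, coeff_zero_of_hasSum_zero hr h, zero_mul, sub_zero] at h1
    have h2 := h1.mul_left y⁻¹
    rw [mul_zero] at h2
    refine (congrArg (fun f => HasSum f _) (funext fun m => ?_)).mpr h2
    rw [pow_succ]
    field_simp

/-- Functions on a punctured disc which are power series with natural coefficients. -/
def HasNatSeries (r : ℝ) (g : ℂ → ℂ) : Prop :=
  ∃ c : ℕ → ℕ, ∀ y : ℂ, y ≠ 0 → ‖y‖ < r → HasSum (fun n => (c n : ℂ) * y ^ n) (g y)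

namespace HasNatSeries
variable {r : ℝ} {f g : ℂ → ℂ}

theorem mul (hf : HasNatSeries r f) (hg : HasNatSeries r g) : HasNatSeries r fun y => f y * g y := by
  obtain ⟨c, hc⟩ := hf
  obtain ⟨d, hd⟩ := hg
  refine ⟨fun N => ∑ p ∈ Finset.HasAntidiagonal.antidiagonal N, c p.1 * d p.2, fun y hy hyr => ?_⟩
  have h1 : HasSum (fun n => (c n : ℂ) * y ^ n) (f y) := hc y hy hyr
  have h2 : HasSum (fun n => (d n : ℂ) * y ^ n) (g y) := hd y hy hyr
  have hn1 : Summable fun n => ‖(c n : ℂ) * y ^ n‖ := h1.summable.norm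
  have hn2 : Summable fun n => ‖(d n : ℂ) * y ^ n‖ := h2.summable.norm
  have h3 : HasSum (fun N => ∑ p ∈ Finset.HasAntidiagonal.antidiagonal N,
      ((c p.1 : ℂ) * y ^ p.1) * ((d p.2 : ℂ) * y ^ p.2)) (f y * g y) := by
    have hs := (summable_norm_sum_mul_antidiagonal_of_summable_norm hn1 hn2).of_norm.hasSum
    rwa [← tsum_mul_tsum_eq_tsum_sum_antidiagonal_of_summable_norm hn1 hn2, h1.tsum_eq,
      h2.tsum_eq] at hs
  refine (congrArg (fun f => HasSum f _) (funext fun N => ?_)).mpr h3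
  push_cast
  rw [Finset.sum_mul]
  refine Finset.sum_congr rfl fun p hp => ?_
  have hp : p.1 + p.2 = N := Finset.HasAntidiagonal.mem_antidiagonal.1 hp
  rw [← hp, pow_add]
  ring

theorem const (m : ℕ) : HasNatSeries r fun _ => (m : ℂ) := by
  refine ⟨fun n => if n = 0 then m else 0, fun y _ _ => ?_⟩
  refine (congrArg (fun f => HasSum f _) (funext fun n => ?_)).mpr (hasSum_ite_eq (0 : ℕ) (m : ℂ))
  by_cases h : n = 0 <;> simp [h]

theorem pow_id (i : ℕ) : HasNatSeries r fun y => y ^ i := by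
  refine ⟨fun n => if n = i then 1 else 0, fun y _ _ => ?_⟩
  refine (congrArg (fun f => HasSum f _) (funext fun n => ?_)).mpr (hasSum_ite_eq i (y ^ i))
  by_cases h : n = i <;> simp [h]

theorem pow (hf : HasNatSeries r f) (n : ℕ) : HasNatSeries r fun y => f y ^ n := by
  induction n with
  | zero => simpa using const (r := r) 1
  | succ n ih => simpa only [pow_succ] using ih.mul hf

theorem coeff_nonneg (hr : 0 < r) (hf : HasNatSeries r f) {a : ℕ → ℤ}
    (h : ∀ y : ℂ, y ≠ 0 → ‖y‖ < r → HasSum (fun n => (a n : ℂ) * y ^ n) (f y)) (n : ℕ) :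
    0 ≤ a n := by
  obtain ⟨c, hc⟩ := hf
  have h1 := coeff_eq_zero_of_hasSum_zero hr n (a := fun n => (a n : ℂ) - c n) fun y hy hyr => by
    have := (h y hy hyr).sub (hc y hy hyr)
    rw [sub_self] at this
    refine (congrArg (fun f => HasSum f _) (funext fun m => ?_)).mpr this
    ring
  have h2 : (a n : ℂ) = ((c n : ℤ) : ℂ) := by
    rw [sub_eq_zero.1 h1]; norm_cast
  rw [Int.cast_injective h2]
  exact Int.natCast_nonneg _

end HasNatSeries

/-- The number of partitions of `N` with all parts satisfying `P`. -/
def partsCount (P : ℕ → Prop) [DecidablePred P] (N : ℕ) : ℕ :=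
  ((ptn N).filter fun s => ∀ p ∈ s, P p).card

theorem ptnWeight_indicator (P : ℕ → Prop) [DecidablePred P] (N : ℕ) :
    ptnWeight (fun p => if P p then 1 else 0) N = (partsCount P N : ℂ) := by
  have h : ∀ s : Multiset ℕ, (s.map fun p => if P p then (1 : ℂ) else 0).prod =
      if ∀ p ∈ s, P p then 1 else 0 := by
    intro s
    induction s using Multiset.induction_on with
    | empty => simp
    | cons a s ih =>
      rw [Multiset.map_cons, Multiset.prod_cons, ih]
      simp only [Multiset.forall_mem_cons]
      split_ifs <;> simp_all
  simp only [ptnWeight, h, partsCount, Finset.sum_boole]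

theorem prod_range_mul_eleven (F : ℕ → ℂ) (m : ℕ) : ∏ i ∈ Finset.range (11 * m), F i =
    ∏ j ∈ Finset.range m, ∏ r ∈ Finset.range 11, F (11 * j + r) := by
  induction m with
  | zero => simp
  | succ m ih => rw [Nat.mul_succ, Finset.prod_range_add, ih, Finset.prod_range_succ _ m]

theorem tendsto_mul_eleven : Tendsto (fun m : ℕ => 11 * m) atTop atTop :=
  tendsto_atTop_mono (fun m => by simp only [id]; omega) tendsto_id

theorem norm_indicator_le (P : ℕ → Prop) [DecidablePred P] (p : ℕ) :
    ‖(if P p then 1 else 0 : ℂ)‖ ≤ 1 := by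
  split_ifs <;> simp

section
variable {y : ℂ} (hy : ‖y‖ < 1 / 2)
include hy

theorem hasSum_partsCount_residues {k : ℕ} (h1 : 0 < k) (h5 : k ≤ 5) :
    HasSum (fun n => (partsCount (fun p => p % 11 = k ∨ p % 11 = 11 - k) n : ℂ) * y ^ n)
      (qp (y ^ 11) (y ^ k) * qp (y ^ 11) (y ^ (11 - k)))⁻¹ := by
  have hy1 : ‖y‖ < 1 := by linarith
  have hQ : ‖y ^ 11‖ < 1 := norm_pow_lt_one hy1 (by norm_num)
  have hne := mul_ne_zero (qp_ne_zero_of_norm_lt hQ (norm_pow_lt_one hy1 h1.ne'))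
    (qp_ne_zero_of_norm_lt hQ (x := y ^ (11 - k)) (norm_pow_lt_one hy1 (by omega)))
  have h := hasSum_ptnWeight (norm_indicator_le fun p => p % 11 = k ∨ p % 11 = 11 - k) hy
    tendsto_mul_eleven hne ?_
  · simpa only [ptnWeight_indicator] using h
  · refine ((qp_tendsto hQ (y ^ k)).mul (qp_tendsto hQ (y ^ (11 - k)))).congr fun m => ?_
    rw [prod_range_mul_eleven, ← Finset.prod_mul_distrib]
    refine Finset.prod_congr rfl fun j _ => ?_
    have e : ∀ r < 11, (11 * j + r + 1) % 11 = (r + 1) % 11 := fun r _ => by omega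
    simp only [Finset.prod_range_succ, Finset.prod_range_zero, one_mul]
    rw [e 0 (by norm_num), e 1 (by norm_num), e 2 (by norm_num), e 3 (by norm_num),
      e 4 (by norm_num), e 5 (by norm_num), e 6 (by norm_num), e 7 (by norm_num),
      e 8 (by norm_num), e 9 (by norm_num), e 10 (by norm_num)]
    interval_cases k <;> norm_num <;> ring

theorem hasSum_partsCount_top (n : ℕ) :
    HasSum (fun M => (partsCount (fun p => (p % 11 = 0 ∧ p ≤ 11 * n) ∨
      (p % 11 = 10 ∧ 11 * n < p)) M : ℂ) * y ^ M)
      ((∏ i ∈ Finset.range n, (1 - y ^ 11 * (y ^ 11) ^ i))⁻¹ *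
        (qp (y ^ 11) (y ^ 10 * (y ^ 11) ^ n))⁻¹) := by
  have hy1 : ‖y‖ < 1 := by linarith
  have hQ : ‖y ^ 11‖ < 1 := norm_pow_lt_one hy1 (by norm_num)
  have hx : ‖y ^ 10 * (y ^ 11) ^ n‖ < 1 := by
    rw [norm_mul, norm_pow (y ^ 11)]
    exact mul_lt_one_of_nonneg_of_lt_one_left (norm_nonneg _) (norm_pow_lt_one hy1 (by norm_num))
      (pow_le_one₀ (norm_nonneg _) hQ.le)
  have hne := mul_ne_zero (prod_one_sub_ne_zero hQ n) (qp_ne_zero_of_norm_lt hQ hx)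
  have h := hasSum_ptnWeight (norm_indicator_le fun p => (p % 11 = 0 ∧ p ≤ 11 * n) ∨
      (p % 11 = 10 ∧ 11 * n < p)) hy
    (tendsto_mul_eleven.comp (tendsto_atTop_mono (fun m => Nat.le_add_left m n) tendsto_id)) hne ?_
  · rw [← mul_inv]
    simpa only [ptnWeight_indicator] using h
  · refine ((qp_tendsto hQ (y ^ 10 * (y ^ 11) ^ n)).const_mul _).congr fun m => ?_
    have e0 : ∀ j r, r < 9 → (11 * j + r + 1) % 11 ≠ 0 ∧ (11 * j + r + 1) % 11 ≠ 10 :=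
      fun j r _ => by omega
    have e : ∀ j, (∏ r ∈ Finset.range 11, (1 - (if ((11 * j + r + 1) % 11 = 0 ∧
        11 * j + r + 1 ≤ 11 * n) ∨ ((11 * j + r + 1) % 11 = 10 ∧ 11 * n < 11 * j + r + 1) then 1
        else 0) * y ^ (11 * j + r + 1))) =
        if j < n then 1 - y ^ 11 * (y ^ 11) ^ j else 1 - y ^ 10 * (y ^ 11) ^ j := by
      intro j
      rw [Finset.prod_range_succ, Finset.prod_range_succ, Finset.prod_eq_one fun r hr => ?_]
      · split_ifs <;> first | omega | ring
      · rw [Finset.mem_range] at hr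
        rw [if_neg (by have := e0 j r hr; omega), zero_mul, sub_zero]
    rw [Function.comp_apply, prod_range_mul_eleven, Finset.prod_congr rfl fun j _ => e j,
      Finset.prod_range_add]
    congr 1
    · refine Finset.prod_congr rfl fun j hj => ?_
      rw [if_pos (Finset.mem_range.1 hj)]
    · refine Finset.prod_congr rfl fun j _ => ?_
      rw [if_neg (by omega), pow_add]
      ring

end

theorem hasNatSeries_residues {r : ℝ} (hr : r ≤ 1 / 2) {k : ℕ} (h1 : 0 < k) (h5 : k ≤ 5) :
    HasNatSeries r fun y => (qp (y ^ 11) (y ^ k) * qp (y ^ 11) (y ^ (11 - k)))⁻¹ :=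
  ⟨_, fun _ _ hy => hasSum_partsCount_residues (hy.trans_le hr) h1 h5⟩

theorem hasNatSeries_euler_residues {r : ℝ} (hr : r ≤ 1 / 2) :
    HasNatSeries r fun y => qp (y ^ 11) (y ^ 11) * (qp (y ^ 11) (y ^ 1) * qp (y ^ 11) (y ^ 10))⁻¹ := by
  refine ⟨fun N => ∑ p ∈ Finset.HasAntidiagonal.antidiagonal N,
    partsCount (fun q => (q % 11 = 0 ∧ q ≤ 11 * p.1) ∨ (q % 11 = 10 ∧ 11 * p.1 < q)) p.2,
    fun y hy0 hyr => ?_⟩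
  have hy : ‖y‖ < 1 / 2 := hyr.trans_le hr
  have hy1 : ‖y‖ < 1 := by linarith
  have hQ : ‖y ^ 11‖ < 1 := norm_pow_lt_one hy1 (by norm_num)
  set f : ℕ → ℕ → ℂ := fun n M => (partsCount (fun q => (q % 11 = 0 ∧ q ≤ 11 * n) ∨
    (q % 11 = 10 ∧ 11 * n < q)) M : ℂ) * y ^ (n + M) with hf
  have hfg : ∀ n, HasSum (f n) (y ^ n * ((∏ i ∈ Finset.range n, (1 - y ^ 11 * (y ^ 11) ^ i))⁻¹ *
        (qp (y ^ 11) (y ^ 10 * (y ^ 11) ^ n))⁻¹)) := by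
    intro n
    refine (congrArg (fun f => HasSum f _) (funext fun M => ?_)).mpr
      ((hasSum_partsCount_top hy n).mul_left (y ^ n))
    simp only [hf]
    rw [pow_add]
    ring
  have hs : Summable fun p : ℕ × ℕ => f p.1 p.2 := by
    have hb : Summable fun p : ℕ × ℕ => (2 * ‖y‖) ^ p.1 * (2 * ‖y‖) ^ p.2 :=
      (summable_two_pow_bound hy).mul_of_nonneg (summable_two_pow_bound hy)
        (fun _ => by positivity) (fun _ => by positivity)
    refine Summable.of_norm_bounded hb ?_
    rintro ⟨n, M⟩
    simp only [hf]
    rw [← pow_add]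
    refine norm_mul_pow_le ?_
    rw [← ptnWeight_indicator]
    refine (norm_ptnWeight_le (norm_indicator_le _) M).trans ?_
    exact pow_le_pow_right₀ (by norm_num) (Nat.le_add_left _ _)
  have h := hasSum_antidiagonal hs hfg
  have hb := hasSum_qbinomial_inv hQ (w := y) (a := y ^ 10) hy1 (fun i h => by
    have h2 : ‖y ^ 10 * (y ^ 11) ^ i‖ < 1 := by
      rw [norm_mul, norm_pow (y ^ 11)]
      exact mul_lt_one_of_nonneg_of_lt_one_left (norm_nonneg _)
        (norm_pow_lt_one hy1 (by norm_num)) (pow_le_one₀ (norm_nonneg _) hQ.le)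
    rw [h, norm_one] at h2
    exact lt_irrefl _ h2)
  rw [hb.tsum_eq, ← pow_succ] at h
  simp only [pow_one]
  refine (congrArg (fun f => HasSum f _) (funext fun N => ?_)).mpr h
  push_cast
  rw [Finset.sum_mul]
  refine Finset.sum_congr rfl fun p hp => ?_
  have hp : p.1 + p.2 = N := Finset.HasAntidiagonal.mem_antidiagonal.1 hp
  simp only [hf]
  rw [hp]

/-- The infinite products appearing in the closed forms have natural coefficients. -/
theorem hasNatSeries_product {r : ℝ} (hr : r ≤ 1 / 2) (i d e2 e3 e4 e5 : ℕ) :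
    HasNatSeries r fun y => 11 * (y ^ i * (qp (y ^ 11) (y ^ 11) *
      ((qp (y ^ 11) (y ^ 1) * qp (y ^ 11) (y ^ 10))⁻¹ ^ (d + 1) *
      (qp (y ^ 11) (y ^ 2) * qp (y ^ 11) (y ^ 9))⁻¹ ^ e2 *
      (qp (y ^ 11) (y ^ 3) * qp (y ^ 11) (y ^ 8))⁻¹ ^ e3 *
      (qp (y ^ 11) (y ^ 4) * qp (y ^ 11) (y ^ 7))⁻¹ ^ e4 *
      (qp (y ^ 11) (y ^ 5) * qp (y ^ 11) (y ^ 6))⁻¹ ^ e5))) := by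
  have h1 := (hasNatSeries_residues hr (k := 1) (by norm_num) (by norm_num)).pow d
  have h2 := (hasNatSeries_residues hr (k := 2) (by norm_num) (by norm_num)).pow e2
  have h3 := (hasNatSeries_residues hr (k := 3) (by norm_num) (by norm_num)).pow e3
  have h4 := (hasNatSeries_residues hr (k := 4) (by norm_num) (by norm_num)).pow e4
  have h5 := (hasNatSeries_residues hr (k := 5) (by norm_num) (by norm_num)).pow e5
  have h := (HasNatSeries.const (r := r) 11).mul ((HasNatSeries.pow_id (r := r) i).mul
    (((((hasNatSeries_euler_residues hr).mul h1).mul h2).mul h3).mul h4 |>.mul h5))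
  refine (congrArg (HasNatSeries r) (funext fun y => ?_)).mpr h
  norm_num only [Nat.cast_ofNat]
  ring

theorem th_div_eulerJ {ρ : ℂ} (h0 : ρ ≠ 0) (h1 : ‖ρ‖ < 1) {k : ℕ} (hk : k ≤ 11) :
    th (ρ ^ 121) ((ρ ^ 22) ^ k) / eulerJ ρ =
      qp ((ρ ^ 22) ^ 11) ((ρ ^ 22) ^ k) * qp ((ρ ^ 22) ^ 11) ((ρ ^ 22) ^ (11 - k)) := by
  have hJ := eulerJ_ne_zero h0 h1
  have e : (ρ ^ 121) ^ 2 = (ρ ^ 22) ^ 11 := by ring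
  have hq : (ρ ^ 22) ^ 11 / (ρ ^ 22) ^ k = (ρ ^ 22) ^ (11 - k) := by
    rw [div_eq_iff (pow_ne_zero _ (pow_ne_zero _ h0)), ← pow_add, Nat.sub_add_cancel hk]
  rw [div_eq_iff hJ, th_eq_prod (pow_ne_zero _ h0) (norm_pow_lt_one h1 (by norm_num))
    (pow_ne_zero _ (pow_ne_zero _ h0)), eulerJ_eq h0 h1, e, hq, mul_comm]

/-- A combination of rank and crank classes with a closed form is nonnegative. -/
theorem combination_nonneg {τ : Laurent} {rhs : Expo} (c0 c1 c2 c3 c4 c5 : ℤ)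
    {m1 m2 m3 m4 m5 : ℂ} {cr : ℤ} (w : ℕ → ℤ) {i d e2 e3 e4 e5 : ℕ}
    (hw : ∑ k ∈ Finset.range 11, w k = 0) (hcr : w 1 + w 10 - w 0 = cr)
    (he : d + 1 + e2 + e3 + e4 + e5 = 13)
    (hi : 10 * (d + 1) + 18 * e2 + 24 * e3 + 28 * e4 + 30 * e5 = 254 + 22 * i)
    (hrhs : rhs = (-3 - ((d + 1 : ℕ) : ℤ), 2 - (e2 : ℤ), 2 - (e3 : ℤ), 5 - (e4 : ℤ), 6 - (e5 : ℤ)))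
    (hcert : laurentVanishesAll (laurentPart 1 (laurentMul τ pentInvList) ++
      (discMonomList cr 5 (0, -1, -1, 0, 1) ++ discMonomList (-11) 4 rhs)) 11 = true)
    (hL : ∀ ρ : ℂ, ρ ≠ 0 → ‖ρ‖ < 1 → ((c2 : ℂ) - c3) * lambert ρ 1 +
        ((c1 : ℂ) - 2 * c0) * lambert ρ 2 + ((c4 : ℂ) - c3) * lambert ρ 3 +
        ((c4 : ℂ) - c5) * lambert ρ 4 + ((c1 : ℂ) - c2) * lambert ρ 5 + ((c0 : ℂ) - (c2 - c3)) =
      pentFactor ρ * (m1 * (ρ ^ 30 * mockTerm ρ 1) + m2 * (ρ ^ 54 * mockTerm ρ 2) +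
        m3 * (ρ ^ 72 * mockTerm ρ 3) + m4 * (ρ ^ 84 * mockTerm ρ 4) +
        m5 * (ρ ^ 90 * mockTerm ρ 5)) - thDeriv (ρ ^ 121) 1 * thxEval ρ τ) (n : ℕ) :
    0 ≤ c0 * rankClass 0 (11 * n + 1) + c1 * rankClass 1 (11 * n + 1) +
      c2 * rankClass 2 (11 * n + 1) + c3 * rankClass 3 (11 * n + 1) +
      c4 * rankClass 4 (11 * n + 1) + c5 * rankClass 5 (11 * n + 1) +
      ∑ k ∈ Finset.range 11, w k * crankClass k (11 * n + 1) := by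
  have hr : (0 : ℝ) < (1 / 2) ^ 11 := by positivity
  refine (hasNatSeries_product (r := (1 / 2) ^ 11) (by norm_num) i d e2 e3 e4 e5).coeff_nonneg hr
    (a := fun n => c0 * rankClass 0 (11 * n + 1) + c1 * rankClass 1 (11 * n + 1) +
      c2 * rankClass 2 (11 * n + 1) + c3 * rankClass 3 (11 * n + 1) +
      c4 * rankClass 4 (11 * n + 1) + c5 * rankClass 5 (11 * n + 1) +
      ∑ k ∈ Finset.range 11, w k * crankClass k (11 * n + 1)) (fun y hy hyr => ?_) n
  obtain ⟨ρ, rfl⟩ := IsAlgClosed.exists_pow_nat_eq y (n := 22) (by norm_num)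
  have h0 : ρ ≠ 0 := fun h => hy (by rw [h, zero_pow (by norm_num)])
  have hρ : ‖ρ ^ 2‖ < 1 / 2 := by
    refine lt_of_pow_lt_pow_left₀ 11 (by norm_num) ?_
    rwa [← norm_pow, ← pow_mul]
  have h1 := norm_lt_one_of_sq hρ
  have h := hasSum_rank_crank_combination h0 hρ (Complex.isPrimitiveRoot_exp 11 (by norm_num))
    (c0 := c0) (c1 := c1) (c2 := c2) (c3 := c3) (c4 := c4) (c5 := c5) (w := fun k => (w k : ℂ))
    (cr := cr) (by exact_mod_cast hw) (by exact_mod_cast hcr) hcert hL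
  rw [hrhs, thetaQuotient_eq h0 h1 he hi, th_div_eulerJ h0 h1 (by norm_num),
    th_div_eulerJ h0 h1 (by norm_num), th_div_eulerJ h0 h1 (by norm_num),
    th_div_eulerJ h0 h1 (by norm_num), th_div_eulerJ h0 h1 (by norm_num), eulerJ_eq h0 h1,
    show (ρ ^ 121) ^ 2 = (ρ ^ 22) ^ 11 by ring] at h
  refine (congrArg (fun f => HasSum f _) (funext fun m => ?_)).mpr h
  push_cast
  ring

/-- The weights `a, b, c` on the classes `0, 1, 2`. -/
def smallWeight (a b c : ℤ) (k : ℕ) : ℤ := if k = 0 then a else if k = 1 then b else if k = 2 then c else 0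

theorem sum_smallWeight (a b c : ℤ) (g : ℕ → ℤ) :
    ∑ k ∈ Finset.range 11, smallWeight a b c k * g k = a * g 0 + b * g 1 + c * g 2 := by
  simp [Finset.sum_range_succ, smallWeight]

theorem rank_024_combination_nonneg (n : ℕ) : (0 : ℤ) ≤ 1 * rankClass 0 (11 * n + 1) + (-2) *
    rankClass 1 (11 * n + 1) + 4 * rankClass 2 (11 * n + 1) + (-3) * rankClass 3 (11 * n + 1) + 1 *
    rankClass 4 (11 * n + 1) + (-1) * rankClass 5 (11 * n + 1) +
    (1 * crankClass 0 (11 * n + 1) + 0 * crankClass 1 (11 * n + 1) + (-1) * crankClass 2 (11 * n + 1)) := by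
  rw [← sum_smallWeight _ _ _ fun k => crankClass k (11 * n + 1)]
  refine combination_nonneg 1 (-2) 4 (-3) 1 (-1) (smallWeight 1 0 (-1)) (cr := -1) (i := 2)
    (d := 0) (e2 := 4) (e3 := 3) (e4 := 3) (e5 := 2) rfl rfl rfl rfl rfl
    thetaPart024_certificate
    (fun ρ h0 h1 => Eq.trans ?_ (lambert_sum_024 h0 h1 (thDeriv_ne_zero h0 h1))) n
  push_cast
  ring

theorem rank_013_combination_nonneg (n : ℕ) : (0 : ℤ) ≤ 1 * rankClass 0 (11 * n + 1) + 3 *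
    rankClass 1 (11 * n + 1) + (-4) * rankClass 2 (11 * n + 1) + 6 * rankClass 3 (11 * n + 1) +
    (-6) * rankClass 4 (11 * n + 1) + 0 * rankClass 5 (11 * n + 1) +
    (1 * crankClass 0 (11 * n + 1) + 0 * crankClass 1 (11 * n + 1) + (-1) * crankClass 2 (11 * n + 1)) := by
  rw [← sum_smallWeight _ _ _ fun k => crankClass k (11 * n + 1)]
  refine combination_nonneg 1 3 (-4) 6 (-6) 0 (smallWeight 1 0 (-1)) (cr := -1) (i := 1)
    (d := 0) (e2 := 5) (e3 := 5) (e4 := 2) (e5 := 0) rfl rfl rfl rfl rfl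
    thetaPart013_certificate
    (fun ρ h0 h1 => Eq.trans ?_ (lambert_sum_013 h0 h1 (thDeriv_ne_zero h0 h1))) n
  push_cast
  ring

theorem rank_14_combination_nonneg (n : ℕ) : (0 : ℤ) ≤ 0 * rankClass 0 (11 * n + 1) + 2 * rankClass
    1 (11 * n + 1) + (-1) * rankClass 2 (11 * n + 1) + (-3) * rankClass 3 (11 * n + 1) + 6 *
    rankClass 4 (11 * n + 1) + (-4) * rankClass 5 (11 * n + 1) +
    (0 * crankClass 0 (11 * n + 1) + 0 * crankClass 1 (11 * n + 1) + 0 * crankClass 2 (11 * n + 1)) := by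
  rw [← sum_smallWeight _ _ _ fun k => crankClass k (11 * n + 1)]
  refine combination_nonneg 0 2 (-1) (-3) 6 (-4) (smallWeight 0 0 0) (cr := 0) (i := 2)
    (d := 0) (e2 := 3) (e3 := 5) (e4 := 3) (e5 := 1) rfl rfl rfl rfl rfl
    thetaPart14_certificate
    (fun ρ h0 h1 => Eq.trans ?_ (lambert_sum_14 h0 h1 (thDeriv_ne_zero h0 h1))) n
  push_cast
  ring

theorem rank_125_combination_nonneg (n : ℕ) : (0 : ℤ) ≤ (-1) * rankClass 0 (11 * n + 1) + 1 *
    rankClass 1 (11 * n + 1) + 2 * rankClass 2 (11 * n + 1) + (-1) * rankClass 3 (11 * n + 1) +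
    (-4) * rankClass 4 (11 * n + 1) + 3 * rankClass 5 (11 * n + 1) +
    ((-2) * crankClass 0 (11 * n + 1) + (-1) * crankClass 1 (11 * n + 1) + 3 * crankClass 2 (11 * n + 1)) := by
  rw [← sum_smallWeight _ _ _ fun k => crankClass k (11 * n + 1)]
  refine combination_nonneg (-1) 1 2 (-1) (-4) 3 (smallWeight (-2) (-1) 3) (cr := 1) (i := 3)
    (d := 0) (e2 := 2) (e3 := 3) (e4 := 4) (e5 := 3) rfl rfl rfl rfl rfl
    thetaPart125_certificate
    (fun ρ h0 h1 => Eq.trans ?_ (lambert_sum_125 h0 h1 (thDeriv_ne_zero h0 h1))) n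
  push_cast
  ring

theorem rank_234_combination_nonneg (n : ℕ) : (0 : ℤ) ≤ (-1) * rankClass 0 (11 * n + 1) + (-1) *
    rankClass 1 (11 * n + 1) + 3 * rankClass 2 (11 * n + 1) + 2 * rankClass 3 (11 * n + 1) + 1 *
    rankClass 4 (11 * n + 1) + (-4) * rankClass 5 (11 * n + 1) +
    ((-2) * crankClass 0 (11 * n + 1) + (-1) * crankClass 1 (11 * n + 1) + 3 * crankClass 2 (11 * n + 1)) := by
  rw [← sum_smallWeight _ _ _ fun k => crankClass k (11 * n + 1)]
  refine combination_nonneg (-1) (-1) 3 2 1 (-4) (smallWeight (-2) (-1) 3) (cr := 1) (i := 2)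
    (d := 1) (e2 := 3) (e3 := 2) (e4 := 2) (e5 := 4) rfl rfl rfl rfl rfl
    thetaPart234_certificate
    (fun ρ h0 h1 => Eq.trans ?_ (lambert_sum_234 h0 h1 (thDeriv_ne_zero h0 h1))) n
  push_cast
  ring

end RankCrank

theorem rankCount_eq_rankClass (k N : ℕ) (hk : k < 11) :
    rankCount k 11 N = RankCrank.rankClass k N := by
  rw [rankCount, RankCrank.rankClass, Finset.card_filter, Finset.card_filter, RankCrank.sum_ptn,
    Int.emod_eq_of_lt (Int.natCast_nonneg k) (by exact_mod_cast hk)]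
  rfl

theorem crankCount_eq_crankClass (k N : ℕ) (hk : k < 11) :
    crankCount k N = RankCrank.crankClass k N := by
  rw [crankCount, RankCrank.crankClass, Finset.card_filter, Finset.card_filter, RankCrank.sum_ptn,
    Int.emod_eq_of_lt (Int.natCast_nonneg k) (by exact_mod_cast hk)]
  norm_cast

/-- Rank-crank inequalities for the residue 1 modulo 11. -/
theorem rank_crank_inequalities_residue_one (n : ℕ) :
    ((rankCount 0 11 (11  *  n  +  1) : ℤ)  +  4 * (rankCount 2 11 (11  *  n  +  1) : ℤ)  +  (rankCount 4 11 (11  *  n  +  1) : ℤ)  +  crankCount 0 (11  *  n  +  1) ≥ 2 * (rankCount 1 11 (11  *  n  +  1) : ℤ)  +  3 * (rankCount 3 11 (11  *  n  +  1) : ℤ)  +  (rankCount 5 11 (11  *  n  +  1) : ℤ)  +  crankCount 2 (11  *  n  +  1))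
    ∧ ((rankCount 0 11 (11  *  n  +  1) : ℤ)  +  3 * (rankCount 1 11 (11  *  n  +  1) : ℤ)  +  6 * (rankCount 3 11 (11  *  n  +  1) : ℤ)  +  crankCount 0 (11  *  n  +  1) ≥ 4 * (rankCount 2 11 (11  *  n  +  1) : ℤ)  +  6 * (rankCount 4 11 (11  *  n  +  1) : ℤ)  +  crankCount 2 (11  *  n  +  1))
    ∧ (2 * (rankCount 1 11 (11  *  n  +  1) : ℤ)  +  6 * (rankCount 4 11 (11  *  n  +  1) : ℤ) ≥ (rankCount 2 11 (11  *  n  +  1) : ℤ)  +  3 * (rankCount 3 11 (11  *  n  +  1) : ℤ)  +  4 * (rankCount 5 11 (11  *  n  +  1) : ℤ))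
    ∧ ((rankCount 1 11 (11  *  n  +  1) : ℤ)  +  2 * (rankCount 2 11 (11  *  n  +  1) : ℤ)  +  3 * (rankCount 5 11 (11  *  n  +  1) : ℤ)  +  3 * crankCount 2 (11  *  n  +  1) ≥ (rankCount 0 11 (11  *  n  +  1) : ℤ)  +  (rankCount 3 11 (11  *  n  +  1) : ℤ)  +  4 * (rankCount 4 11 (11  *  n  +  1) : ℤ)  +  2 * crankCount 0 (11  *  n  +  1)  +  crankCount 1 (11  *  n  +  1))
    ∧ (3 * (rankCount 2 11 (11  *  n  +  1) : ℤ)  +  2 * (rankCount 3 11 (11  *  n  +  1) : ℤ)  +  (rankCount 4 11 (11  *  n  +  1) : ℤ)  +  3 * crankCount 2 (11  *  n  +  1) ≥ (rankCount 0 11 (11  *  n  +  1) : ℤ)  +  (rankCount 1 11 (11  *  n  +  1) : ℤ)  +  4 * (rankCount 5 11 (11  *  n  +  1) : ℤ)  +  2 * crankCount 0 (11  *  n  +  1)  +  crankCount 1 (11  *  n  +  1)) := by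
  have r0 := rankCount_eq_rankClass 0 (11 * n + 1) (by norm_num)
  have r1 := rankCount_eq_rankClass 1 (11 * n + 1) (by norm_num)
  have r2 := rankCount_eq_rankClass 2 (11 * n + 1) (by norm_num)
  have r3 := rankCount_eq_rankClass 3 (11 * n + 1) (by norm_num)
  have r4 := rankCount_eq_rankClass 4 (11 * n + 1) (by norm_num)
  have r5 := rankCount_eq_rankClass 5 (11 * n + 1) (by norm_num)
  have m0 := crankCount_eq_crankClass 0 (11 * n + 1) (by norm_num)
  have m1 := crankCount_eq_crankClass 1 (11 * n + 1) (by norm_num)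
  have m2 := crankCount_eq_crankClass 2 (11 * n + 1) (by norm_num)
  norm_num only [Nat.cast_ofNat, Nat.cast_zero, Nat.cast_one] at r0 r1 r2 r3 r4 r5 m0 m1 m2
  rw [r0, r1, r2, r3, r4, r5, m0, m1, m2]
  exact ⟨by linarith [RankCrank.rank_024_combination_nonneg n],
    by linarith [RankCrank.rank_013_combination_nonneg n],
    by linarith [RankCrank.rank_14_combination_nonneg n],
    by linarith [RankCrank.rank_125_combination_nonneg n],
    by linarith [RankCrank.rank_234_combination_nonneg n]⟩
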